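/- (Weak comparison principle with nondecreasing nonlinearity and inhomogeneous Dirichlet data.) Let 1 < p < ∞ and let Ω ⊂ ℝ^N be a bounded domain with smooth boundary. Let β : Ω × ℝ → ℝ be continuous, with u ↦ β(x,u) locally Lipschitz on ℝ \ {0} uniformly in x ∈ Ω, nondecreasing in u, and with β(x,0) ≥ 0 for all x ∈ Ω. Assume the following uniqueness/existence hypothesis: for every bounded measurable h ≥ 0 on Ω and every continuous h' ≥ 0 on ∂Ω, there is exactly one nonnegative bounded weak solution w, continuous on the closure of Ω, of −Δ_p w = β(x,w) + h in Ω with w = h' on ∂Ω. Let f, g be bounded measurable functions on Ω with 0 ≤ g ≤ f in Ω, and let f', g' be continuous functions on ∂Ω with 0 ≤ g' ≤ f' on ∂Ω. If u and v are nonnegative bounded weak solutions, continuous on the closure of Ω, of −Δ_p u = β(x,u) + f in Ω with u = f' on ∂Ω, and of −Δ_p v = β(x,v) + g in Ω with v = g' on ∂Ω respectively, then v ≤ u throughout Ω. -/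

import Mathlib

open MeasureTheory RealInnerProductSpace Metric Set

noncomputable section

/-- Smooth test functions compactly supported in `U` (the class `C_c^∞(U)`). -/
def IsTestFun {N : ℕ} (U : Set (EuclideanSpace ℝ (Fin N)))
    (φ : EuclideanSpace ℝ (Fin N) → ℝ) : Prop :=
  ContDiff ℝ (⊤ : ℕ∞) φ ∧ HasCompactSupport φ ∧ tsupport φ ⊆ U

/-- `u` is a weak solution of `-Δ_p u = h` in `U`:
`∫_U |∇u|^{p-2} ⟨∇u, ∇φ⟩ = ∫_U h φ` for all test functions `φ`. -/
def IsWeakSolution (p : ℝ) {N : ℕ} (U : Set (EuclideanSpace ℝ (Fin N)))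
    (u h : EuclideanSpace ℝ (Fin N) → ℝ) : Prop :=
  ∀ φ : EuclideanSpace ℝ (Fin N) → ℝ, IsTestFun U φ →
    (∫ x in U, ‖gradient u x‖ ^ (p - 2) * ⟪gradient u x, gradient φ x⟫)
      = ∫ x in U, h x * φ x

/-- The `p`-torsional rigidity of `U`:
`E(U) = (p/(p-1)) ⬝ sup { ∫_U φ - (1/p) ∫_U |∇φ|^p : φ ∈ C_c^∞(U) }`. -/
def pTorsionalRigidity (p : ℝ) {N : ℕ} (U : Set (EuclideanSpace ℝ (Fin N))) : ℝ :=
  (p / (p - 1)) *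
    sSup { r : ℝ | ∃ φ, IsTestFun U φ ∧
      r = (∫ x in U, φ x) - (1 / p) * ∫ x in U, ‖gradient φ x‖ ^ p }

/-- The first Dirichlet eigenvalue of the `p`-Laplacian on `U`:
`λ₁(U) = inf { (∫_U |∇φ|^p)/(∫_U |φ|^p) : φ ∈ C_c^∞(U), φ ≢ 0 }`. -/
def pLambda1 (p : ℝ) {N : ℕ} (U : Set (EuclideanSpace ℝ (Fin N))) : ℝ :=
  sInf { r : ℝ | ∃ φ, IsTestFun U φ ∧ φ ≠ 0 ∧
    r = (∫ x in U, ‖gradient φ x‖ ^ p) / (∫ x in U, |φ x| ^ p) }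

/-- `f` is `C^1` on the closure of `U` (i.e. `C^1` on an open neighbourhood of it). -/
def C1OnClosure {N : ℕ} (U : Set (EuclideanSpace ℝ (Fin N)))
    (f : EuclideanSpace ℝ (Fin N) → ℝ) : Prop :=
  ∃ W, IsOpen W ∧ closure U ⊆ W ∧ ContDiffOn ℝ 1 f W

/-- `Ω` has a smooth boundary: it is the sublevel set of a smooth function whose
differential does not vanish on the boundary. -/
def HasSmoothBoundary {N : ℕ} (Ω : Set (EuclideanSpace ℝ (Fin N))) : Prop :=
  ∃ f : EuclideanSpace ℝ (Fin N) → ℝ, ContDiff ℝ (⊤ : ℕ∞) f ∧ Ω = f ⁻¹' Set.Iio 0 ∧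
    ∀ x ∈ frontier Ω, fderiv ℝ f x ≠ 0

/-- The index of the first coordinate. -/
def firstIdx (N : ℕ) (hN : 2 ≤ N) : Fin N := ⟨0, by omega⟩

/-- The first standard basis vector `e₁`. -/
def e1v {N : ℕ} (hN : 2 ≤ N) : EuclideanSpace ℝ (Fin N) :=
  EuclideanSpace.single (firstIdx N hN) 1

/-- The domain `Ω(s) = B(0,r1) \ closure B(s e₁, r0)`. -/
def annulus {N : ℕ} (hN : 2 ≤ N) (r0 r1 s : ℝ) : Set (EuclideanSpace ℝ (Fin N)) :=
  Metric.ball (0 : EuclideanSpace ℝ (Fin N)) r1 \ closure (Metric.ball (s • e1v hN) r0)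

/-- Reflection across the hyperplane `{x₁ = s}`: `x ↦ (2s - x₁, x₂, …, x_N)`. -/
def reflectH {N : ℕ} (hN : 2 ≤ N) (s : ℝ) (x : EuclideanSpace ℝ (Fin N)) :
    EuclideanSpace ℝ (Fin N) :=
  x + (2 * (s - x (firstIdx N hN))) • e1v hN

/-- The divergence of a vector field, as the trace of its Jacobian. -/
def divergence {N : ℕ} (V : EuclideanSpace ℝ (Fin N) → EuclideanSpace ℝ (Fin N))
    (x : EuclideanSpace ℝ (Fin N)) : ℝ :=
  LinearMap.trace ℝ _ (fderiv ℝ V x : EuclideanSpace ℝ (Fin N) →ₗ[ℝ] EuclideanSpace ℝ (Fin N))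

/-- The classical `p`-Laplacian `Δ_p b = div(|∇b|^{p-2} ∇b)` at a point. -/
def pLapAt (p : ℝ) {N : ℕ} (b : EuclideanSpace ℝ (Fin N) → ℝ)
    (x : EuclideanSpace ℝ (Fin N)) : ℝ :=
  divergence (fun z => ‖gradient b z‖ ^ (p - 2) • gradient b z) x

/-- The torsion function of `U`: `C^1` up to the boundary, vanishing on the boundary,
positive inside, weak solution of `-Δ_p y = 1`. -/
def IsTorsionFn (p : ℝ) {N : ℕ} (U : Set (EuclideanSpace ℝ (Fin N)))
    (y : EuclideanSpace ℝ (Fin N) → ℝ) : Prop :=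
  C1OnClosure U y ∧ (∀ x ∈ frontier U, y x = 0) ∧ (∀ x ∈ U, 0 < y x) ∧
    IsWeakSolution p U y (fun _ => 1)

/-- A first eigenfunction of the Dirichlet `p`-Laplacian on `U`: `C^1` up to the boundary,
positive inside, vanishing on the boundary, `L^p`-normalized, weak solution of
`-Δ_p u = λ₁(U) u^{p-1}`. -/
def IsFirstEigenfun (p : ℝ) {N : ℕ} (U : Set (EuclideanSpace ℝ (Fin N)))
    (y : EuclideanSpace ℝ (Fin N) → ℝ) : Prop :=
  C1OnClosure U y ∧ (∀ x ∈ U, 0 < y x) ∧ (∀ x ∈ frontier U, y x = 0) ∧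
    (∫ x in U, y x ^ p) = 1 ∧
    IsWeakSolution p U y (fun x => pLambda1 p U * y x ^ (p - 1))

/-- The matrix `DA(x) = |x|^{p-2} I + (p-2)|x|^{p-4} x xᵀ`,
the derivative of `A(x) = |x|^{p-2} x`. -/
def DA (p : ℝ) {N : ℕ} (x : EuclideanSpace ℝ (Fin N)) :
    EuclideanSpace ℝ (Fin N) →L[ℝ] EuclideanSpace ℝ (Fin N) :=
  ‖x‖ ^ (p - 2) • ContinuousLinearMap.id ℝ (EuclideanSpace ℝ (Fin N)) +
    ((p - 2) * ‖x‖ ^ (p - 4)) • (innerSL ℝ x).smulRight x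

/-- `w` is a nonnegative bounded weak solution, continuous on the closure of `Ω` and `C^1`
inside, of `-Δ_p w = F(x, w)` in `Ω` with boundary value `bdry` on `∂Ω`. -/
def SolClass (p : ℝ) {N : ℕ} (Ω : Set (EuclideanSpace ℝ (Fin N)))
    (F : EuclideanSpace ℝ (Fin N) → ℝ → ℝ)
    (bdry w : EuclideanSpace ℝ (Fin N) → ℝ) : Prop :=
  ContinuousOn w (closure Ω) ∧ ContDiffOn ℝ 1 w Ω ∧
    (∀ x ∈ closure Ω, 0 ≤ w x) ∧ (∃ M, ∀ x ∈ closure Ω, |w x| ≤ M) ∧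
    IsWeakSolution p Ω w (fun x => F x (w x)) ∧ (∀ x ∈ frontier Ω, w x = bdry x)

section

open Filter Real Gradient

abbrev Eu (N : ℕ) := EuclideanSpace ℝ (Fin N)

variable {N : ℕ}
variable {f g k k' s u v w w' φ ψ : Eu N → ℝ}
variable {A C C' Ca K K' L Lam Lk Lψ M R R' S d h lam m p r t δ ε η κ κ₀ μ ν ρ τ : ℝ}
variable {a b c e x y z ζ ξ : Eu N}
variable {U U' V Z Ω : Set (Eu N)}
variable {F : Eu N → Eu N}

def IsLip (v : Eu N → ℝ) : Prop := ∃ C : NNReal, LipschitzWith C v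

lemma norm_gradient (v : Eu N → ℝ) (x : Eu N) : ‖∇ v x‖ = ‖fderiv ℝ v x‖ := by
  simp [gradient]

lemma LipschitzWith.norm_gradient_le {C : NNReal} (hv : LipschitzWith C v)
    (x : Eu N) : ‖∇ v x‖ ≤ C := by
  rw [norm_gradient]; exact norm_fderiv_le_of_lipschitz ℝ hv

lemma measurable_gradient (v : Eu N → ℝ) : Measurable (∇ v) := by
  unfold gradient
  exact (InnerProductSpace.toDual ℝ (Eu N)).symm.continuous.measurable.comp (measurable_fderiv ℝ v)

lemma IsLip.continuous (hv : IsLip v) : Continuous v := hv.choose_spec.continuous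

lemma IsLip.ae_differentiableAt (hv : IsLip v) :
    ∀ᵐ x, DifferentiableAt ℝ v x := hv.choose_spec.ae_differentiableAt

lemma IsLip.exists_norm_gradient_le (hv : IsLip v) :
    ∃ C : ℝ, 0 ≤ C ∧ ∀ x, ‖∇ v x‖ ≤ C :=
  ⟨hv.choose, NNReal.coe_nonneg _, hv.choose_spec.norm_gradient_le⟩

lemma ae_comp_add_smul {p : Eu N → Prop} (hm : MeasurableSet {x | p x}) (h : ∀ᵐ x, p x)
    (y : Eu N) : ∀ᵐ x : Eu N, ∀ᵐ t : ℝ, p (x + t • y) := by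
  have hmeas : MeasurableSet {q : Eu N × ℝ | p (q.1 + q.2 • y)} :=
    (by fun_prop : Measurable fun q : Eu N × ℝ => q.1 + q.2 • y) hm
  rw [Measure.ae_ae_comm hmeas]
  refine .of_forall fun t => ?_
  exact (measurePreserving_add_right volume (t • y)).quasiMeasurePreserving.ae h

lemma IsLip.ae_enorm_sub_le (hv : IsLip v) (y : Eu N) :
    ∀ᵐ x : Eu N, ‖v (x + y) - v x‖ₑ ≤ ∫⁻ t in Icc (0 : ℝ) 1, ‖⟪∇ v (x + t • y), y⟫‖ₑ := by
  obtain ⟨C, hC⟩ := hv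
  filter_upwards [ae_comp_add_smul (measurableSet_of_differentiableAt ℝ v)
    hC.ae_differentiableAt y] with x hx
  set g : ℝ → ℝ := fun t => v (x + t • y) with hg
  have hlip : LipschitzWith (C * ‖y‖₊) g := by
    refine hC.comp (LipschitzWith.of_dist_le_mul fun s t => ?_)
    rw [dist_add_left, dist_eq_norm, ← sub_smul, norm_smul, mul_comm, dist_eq_norm]; rfl
  have hac : AbsolutelyContinuousOnInterval g 0 1 :=
    hlip.lipschitzOnWith.absolutelyContinuousOnInterval
  have h1 : v (x + y) - v x = ∫ t in (0 : ℝ)..1, deriv g t := by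
    rw [hac.integral_deriv_eq_sub]; simp [hg]
  rw [h1, intervalIntegral.integral_of_le zero_le_one]
  refine (enorm_integral_le_lintegral_enorm _).trans ?_
  refine (lintegral_mono_set Ioc_subset_Icc_self).trans (le_of_eq ?_)
  refine lintegral_congr_ae (ae_restrict_of_ae ?_)
  filter_upwards [hx] with t ht
  have h2 : HasDerivAt g (fderiv ℝ v (x + t • y) y) t := by
    have h3 : HasDerivAt (fun t : ℝ => x + t • y) y t := by
      simpa using ((hasDerivAt_id t).smul_const y).const_add x
    exact ht.hasFDerivAt.comp_hasDerivAt t h3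
  rw [h2.deriv, inner_gradient_left]

lemma IsLip.lintegral_enorm_sub_le (hv : IsLip v) (y : Eu N) {A B : Set (Eu N)}
    (hA : MeasurableSet A) (hB : MeasurableSet B)
    (hAB : ∀ x ∈ A, ∀ t ∈ Icc (0 : ℝ) 1, x + t • y ∈ B) :
    ∫⁻ x in A, ‖v (x + y) - v x‖ₑ ≤ ‖y‖ₑ * ∫⁻ x in B, ‖∇ v x‖ₑ := by
  have hm := measurable_gradient v
  calc ∫⁻ x in A, ‖v (x + y) - v x‖ₑ
      ≤ ∫⁻ x in A, ∫⁻ t in Icc (0 : ℝ) 1, ‖⟪∇ v (x + t • y), y⟫‖ₑ :=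
        lintegral_mono_ae (ae_restrict_of_ae (hv.ae_enorm_sub_le y))
    _ = ∫⁻ t in Icc (0 : ℝ) 1, ∫⁻ x in A, ‖⟪∇ v (x + t • y), y⟫‖ₑ := by
        apply lintegral_lintegral_swap
        apply Measurable.aemeasurable
        unfold Function.uncurry
        exact ((hm.comp (by fun_prop)).inner measurable_const).enorm
    _ ≤ ∫⁻ t in Icc (0 : ℝ) 1, ‖y‖ₑ * ∫⁻ x in B, ‖∇ v x‖ₑ := by
        refine setLIntegral_mono measurable_const fun t ht => ?_
        calc ∫⁻ x in A, ‖⟪∇ v (x + t • y), y⟫‖ₑ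
            ≤ ∫⁻ x in A, B.indicator (fun z => ‖y‖ₑ * ‖∇ v z‖ₑ) (x + t • y) := by
              refine setLIntegral_mono' hA fun x hx => ?_
              rw [indicator_of_mem (hAB x hx t ht), mul_comm, ← enorm_norm y,
                ← enorm_norm (∇ v _), ← enorm_mul]
              refine enorm_le_iff_norm_le.2 ?_
              rw [norm_mul, norm_norm, norm_norm]
              exact norm_inner_le_norm _ _
          _ ≤ ∫⁻ x, B.indicator (fun z => ‖y‖ₑ * ‖∇ v z‖ₑ) (x + t • y) :=
              setLIntegral_le_lintegral _ _
          _ = ‖y‖ₑ * ∫⁻ x in B, ‖∇ v x‖ₑ := by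
              rw [lintegral_add_right_eq_self (fun z => B.indicator
                (fun z => ‖y‖ₑ * ‖∇ v z‖ₑ) z), lintegral_indicator hB,
                lintegral_const_mul _ hm.enorm]
    _ = ‖y‖ₑ * ∫⁻ x in B, ‖∇ v x‖ₑ := by simp

lemma IsLip.lintegral_le_of_volume_support_le (hv : IsLip v) (hr : 0 < r)
    (hs : volume {x | v x ≠ 0} ≤ volume (ball (0 : Eu N) r) / 2) :
    ∫⁻ x, ‖v x‖ₑ ≤ 2 * ENNReal.ofReal r * ∫⁻ x, ‖∇ v x‖ₑ := by
  set b := ball (0 : Eu N) r with hb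
  set G := ∫⁻ x, ‖∇ v x‖ₑ with hG
  have hb0 : volume b ≠ 0 := (measure_ball_pos volume _ hr).ne'
  have hbt : volume b ≠ ⊤ := measure_ball_lt_top.ne
  have hc := hv.continuous
  have h1 : ∫⁻ y in b, ∫⁻ x, ‖v (x + y) - v x‖ₑ ≤ ENNReal.ofReal r * G * volume b := by
    rw [← setLIntegral_const]
    refine setLIntegral_mono measurable_const fun y hy => ?_
    have := hv.lintegral_enorm_sub_le y MeasurableSet.univ MeasurableSet.univ (by simp)
    simp only [Measure.restrict_univ] at this
    refine this.trans (mul_le_mul_left ?_ _)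
    rw [← ofReal_norm]
    exact ENNReal.ofReal_le_ofReal (mem_ball_zero_iff.1 hy).le
  have h2 : (volume b / 2) * ∫⁻ x, ‖v x‖ₑ ≤ ∫⁻ y in b, ∫⁻ x, ‖v (x + y) - v x‖ₑ := by
    rw [lintegral_lintegral_swap (by
      apply Measurable.aemeasurable; unfold Function.uncurry; fun_prop),
      ← lintegral_const_mul _ (by fun_prop)]
    refine lintegral_mono fun x => ?_
    have hms : MeasurableSet {y | v (x + y) ≠ 0} :=
      (isOpen_ne_fun (by fun_prop) continuous_const).measurableSet
    have h3 : volume {y | v (x + y) ≠ 0} ≤ volume b / 2 := by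
      refine le_trans (le_of_eq ?_) hs
      exact measure_preimage_add volume x {z | v z ≠ 0}
    have h4 : volume b / 2 ≤ volume (b \ {y | v (x + y) ≠ 0}) := by
      refine le_trans ?_ le_measure_sdiff
      rw [ENNReal.le_sub_iff_add_le_right (h3.trans_lt (ENNReal.div_lt_top hbt (by simp))).ne
        (h3.trans ENNReal.half_le_self)]
      exact (add_le_add le_rfl h3).trans (ENNReal.add_halves _).le
    calc volume b / 2 * ‖v x‖ₑ ≤ ‖v x‖ₑ * volume (b \ {y | v (x + y) ≠ 0}) := by
          rw [mul_comm]; exact mul_le_mul_right h4 _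
      _ = ∫⁻ y in b \ {y | v (x + y) ≠ 0}, ‖v x‖ₑ := (setLIntegral_const _ _).symm
      _ = ∫⁻ y in b \ {y | v (x + y) ≠ 0}, ‖v (x + y) - v x‖ₑ := by
          refine setLIntegral_congr_fun (measurableSet_ball.diff hms) fun y hy => ?_
          have : v (x + y) = 0 := by simpa using hy.2
          simp [this]
      _ ≤ ∫⁻ y in b, ‖v (x + y) - v x‖ₑ := lintegral_mono_set sdiff_subset
  have h5 := h2.trans h1
  rw [ENNReal.div_eq_inv_mul, mul_assoc, ENNReal.inv_mul_le_iff (by simp) (by simp)] at h5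
  rw [← ENNReal.mul_le_mul_iff_right hb0 hbt]
  refine h5.trans (le_of_eq (by ring))

lemma IsLip.volume_mul_lintegral_le (hv : IsLip v)
    (hZm : MeasurableSet Z) (hZ : Z ⊆ ball c R) (hvZ : ∀ x ∈ Z, v x = 0) :
    volume Z * ∫⁻ x in ball c R, ‖v x‖ₑ ≤
      ENNReal.ofReal (2 * R) * volume (ball (0 : Eu N) (2 * R)) *
        ∫⁻ x in ball c R, ‖∇ v x‖ₑ := by
  set B := ball c R with hB
  set b := ball (0 : Eu N) (2 * R) with hb
  set G := ∫⁻ x in B, ‖∇ v x‖ₑ with hG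
  have hc := hv.continuous
  have hBm : MeasurableSet B := measurableSet_ball
  have hbm : MeasurableSet b := measurableSet_ball
  have hBc : Convex ℝ B := convex_ball c R
  have hb1 : ∀ y ∈ b, ‖y‖ ≤ 2 * R := fun y hy => (mem_ball_zero_iff.1 hy).le
  have hb2 : ∀ x y, x ∈ B → x + y ∈ B → y ∈ b := by
    intro x y hx hxy
    simp only [hB, mem_ball, dist_eq_norm] at hx hxy
    simp only [hb, mem_ball_zero_iff]
    have := norm_sub_le (x + y - c) (x - c)
    rw [sub_sub_sub_cancel_right, add_sub_cancel_left] at this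
    linarith
  clear_value B b
  set k : Eu N → Eu N → ENNReal := fun x z => B.indicator (fun _ => B.indicator
    (fun z => ‖v z - v x‖ₑ) z) x with hk
  have hkm : Measurable (Function.uncurry k) := by
    have : Function.uncurry k = (B ×ˢ B).indicator (fun q : Eu N × Eu N => ‖v q.2 - v q.1‖ₑ) := by
      ext ⟨x, z⟩
      by_cases hx : x ∈ B <;> by_cases hz : z ∈ B <;> simp [Function.uncurry, hk, hx, hz]
    rw [this]
    exact Measurable.indicator (by fun_prop) (hBm.prod hBm)
  have h1 : volume Z * ∫⁻ x in B, ‖v x‖ₑ ≤ ∫⁻ x, ∫⁻ z, k x z := by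
    rw [← lintegral_const_mul _ (by fun_prop), ← lintegral_indicator hBm]
    refine lintegral_mono fun x => ?_
    by_cases hx : x ∈ B
    · rw [indicator_of_mem hx]
      calc volume Z * ‖v x‖ₑ = ∫⁻ z in Z, ‖v x‖ₑ := by rw [setLIntegral_const, mul_comm]
        _ = ∫⁻ z in Z, k x z := by
            refine setLIntegral_congr_fun hZm fun z hz => ?_
            simp [hk, hx, hZ hz, hvZ z hz]
        _ ≤ _ := setLIntegral_le_lintegral _ _
    · rw [indicator_of_notMem hx]; exact zero_le
  have h2 : ∫⁻ x, ∫⁻ z, k x z = ∫⁻ y, ∫⁻ x, k x (x + y) := by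
    rw [lintegral_lintegral_swap (f := fun y x => k x (x + y)) (by
      apply Measurable.aemeasurable
      exact hkm.comp (by fun_prop : Measurable fun q : Eu N × Eu N => (q.2, q.2 + q.1)))]
    refine lintegral_congr fun x => ?_
    exact (lintegral_add_left_eq_self (fun z => k x z) x).symm
  have h3 : ∫⁻ y, ∫⁻ x, k x (x + y) ≤ ∫⁻ y, b.indicator (fun _ => ENNReal.ofReal (2 * R) * G) y := by
    refine lintegral_mono fun y => ?_
    have h4 : ∫⁻ x, k x (x + y) = ∫⁻ x in B ∩ (fun x => x + y) ⁻¹' B, ‖v (x + y) - v x‖ₑ := by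
      rw [← lintegral_indicator (hBm.inter
        ((measurable_add_const y) hBm))]
      refine lintegral_congr fun x => ?_
      by_cases hx : x ∈ B <;> by_cases hz : x + y ∈ B <;> simp [hk, hx, hz]
    by_cases hy : y ∈ b
    · rw [indicator_of_mem hy]
      simp only
      rw [h4]
      refine (hv.lintegral_enorm_sub_le y (hBm.inter
        ((measurable_add_const y) hBm)) hBm ?_).trans
        (mul_le_mul_left (b := ‖y‖ₑ) (c := ENNReal.ofReal (2 * R)) ?_ _)
      · rintro x ⟨hx, hxy⟩ t ht
        exact hBc.add_smul_mem hx hxy ht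
      · rw [← ofReal_norm]
        exact ENNReal.ofReal_le_ofReal (hb1 y hy)
    · rw [indicator_of_notMem hy, h4]
      have : B ∩ (fun x => x + y) ⁻¹' B = ∅ := by
        ext x
        simp only [mem_inter_iff, mem_preimage, mem_empty_iff_false, iff_false, not_and]
        exact fun hx hxy => hy (hb2 x y hx hxy)
      rw [this]; simp
  rw [lintegral_indicator hbm, setLIntegral_const] at h3
  refine (h1.trans (h2.le.trans h3)).trans (le_of_eq (by ring))

lemma isLip_of_le (h : ∀ x y, |v x - v y| ≤ C * ‖x - y‖) : IsLip v := by
  refine ⟨C.toNNReal, LipschitzWith.of_dist_le_mul fun x y => ?_⟩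
  rw [dist_eq, dist_eq_norm]
  exact (h x y).trans (mul_le_mul_of_nonneg_right (le_coe_toNNReal C) (norm_nonneg _))

lemma IsLip.exists_le (h : IsLip v) :
    ∃ C : ℝ, 0 ≤ C ∧ ∀ x y, |v x - v y| ≤ C * ‖x - y‖ := by
  obtain ⟨C, hC⟩ := h
  refine ⟨C, C.2, fun x y => ?_⟩
  simpa [dist_eq, dist_eq_norm] using hC.dist_le_mul x y

lemma isLip_const (c : ℝ) : IsLip (fun _ : Eu N => c) := ⟨0, LipschitzWith.const c⟩

lemma isLip_inner (e : Eu N) : IsLip (fun x : Eu N => ⟪e, x⟫) :=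
  isLip_of_le (C := ‖e‖) fun x y => by
    rw [← inner_sub_right]; exact abs_real_inner_le_norm _ _

lemma IsLip.add (hu : IsLip u) (hv : IsLip v) : IsLip (fun x => u x + v x) :=
  ⟨_, hu.choose_spec.add hv.choose_spec⟩

lemma IsLip.neg (hu : IsLip u) : IsLip (fun x => - u x) := by
  obtain ⟨C, -, h⟩ := hu.exists_le
  exact isLip_of_le (C := C) fun x y => by
    rw [neg_sub_neg, abs_sub_comm]; exact h x y

lemma IsLip.sub (hu : IsLip u) (hv : IsLip v) : IsLip (fun x => u x - v x) := by
  simpa [sub_eq_add_neg] using hu.add hv.neg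

lemma IsLip.const_mul (hu : IsLip u) (c : ℝ) : IsLip (fun x => c * u x) := by
  obtain ⟨C, -, h⟩ := hu.exists_le
  exact isLip_of_le (C := |c| * C) fun x y => by
    rw [← mul_sub, abs_mul, mul_assoc]; exact mul_le_mul_of_nonneg_left (h x y) (abs_nonneg _)

lemma IsLip.max (hu : IsLip u) (hv : IsLip v) :
    IsLip (fun x => max (u x) (v x)) :=
  ⟨_, hu.choose_spec.max hv.choose_spec⟩

lemma IsLip.min (hu : IsLip u) (hv : IsLip v) :
    IsLip (fun x => min (u x) (v x)) :=
  ⟨_, hu.choose_spec.min hv.choose_spec⟩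

lemma isLip_norm : IsLip (fun x : Eu N => ‖x‖) := ⟨1, lipschitzWith_one_norm⟩

lemma IsLip.comp_affine (hu : IsLip u) (c : Eu N) (r : ℝ) :
    IsLip (fun x => u (c + r • x)) := by
  obtain ⟨C, -, h⟩ := hu.exists_le
  exact isLip_of_le (C := C * |r|) fun x y => by
    refine (h _ _).trans (le_of_eq ?_)
    rw [add_sub_add_left_eq_sub, ← smul_sub, norm_smul, norm_eq_abs, mul_assoc]

lemma IsLip.comp_add (hu : IsLip u) (c : Eu N) :
    IsLip (fun x => u (x + c)) := by
  have := hu.comp_affine c 1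
  simpa [add_comm] using this

lemma IsLip.mul_of_hasCompactSupport {η : Eu N → ℝ} (hη : IsLip η) (hc : HasCompactSupport η)
    (hv : IsLip v) : IsLip (fun x => η x * v x) := by
  obtain ⟨C, hC, h1⟩ := hη.exists_le
  obtain ⟨D, hD, h2⟩ := hv.exists_le
  obtain ⟨M, hM⟩ := hc.isCompact.exists_bound_of_continuousOn hv.continuous.continuousOn
  obtain ⟨A, hA⟩ := hc.exists_bound_of_continuous hη.continuous
  have hA0 : 0 ≤ A := (norm_nonneg _).trans (hA 0)
  have hM' : ∀ x ∈ tsupport η, |v x| ≤ |M| := fun x hx => (hM x hx).trans (le_abs_self M)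
  have key : ∀ x ∈ tsupport η, ∀ y, |η x * v x - η y * v y| ≤ (C * |M| + A * D) * ‖x - y‖ := by
    intro x hx y
    have e : η x * v x - η y * v y = (η x - η y) * v x + η y * (v x - v y) := by ring
    rw [e]
    refine (abs_add_le _ _).trans ?_
    rw [abs_mul, abs_mul, add_mul]
    have h3 := mul_le_mul (h1 x y) (hM' x hx) (abs_nonneg _) (by positivity)
    have h4 := mul_le_mul (hA y) (h2 x y) (abs_nonneg _) hA0
    rw [norm_eq_abs] at h4
    calc _ ≤ _ := add_le_add h3 h4
      _ = _ := by ring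
  refine isLip_of_le (C := C * |M| + A * D) fun x y => ?_
  by_cases hx : x ∈ tsupport η
  · exact key x hx y
  by_cases hy : y ∈ tsupport η
  · rw [abs_sub_comm, norm_sub_rev]; exact key y hy x
  rw [image_eq_zero_of_notMem_tsupport hx, image_eq_zero_of_notMem_tsupport hy]
  simp; positivity

lemma IsLip.hasGradientAt_ae (hv : IsLip v) :
    ∀ᵐ x, HasGradientAt v (∇ v x) x := by
  filter_upwards [hv.ae_differentiableAt] with x hx using hx.hasGradientAt

lemma HasGradientAt.add' (hu : HasGradientAt u a x)
    (hv : HasGradientAt v b x) : HasGradientAt (fun x => u x + v x) (a + b) x := by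
  rw [hasGradientAt_iff_hasFDerivAt] at *
  rw [map_add]; exact HasFDerivAt.add hu hv

lemma HasGradientAt.const_mul' (hu : HasGradientAt u a x)
    (c : ℝ) : HasGradientAt (fun x => c * u x) (c • a) x := by
  rw [hasGradientAt_iff_hasFDerivAt] at *
  refine (hu.const_mul c).congr_fderiv ?_
  ext y; simp

lemma HasGradientAt.sub' (hu : HasGradientAt u a x)
    (hv : HasGradientAt v b x) : HasGradientAt (fun x => u x - v x) (a - b) x := by
  rw [hasGradientAt_iff_hasFDerivAt] at *
  rw [map_sub]; exact HasFDerivAt.sub hu hv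

lemma HasGradientAt.mul' (hu : HasGradientAt u a x)
    (hv : HasGradientAt v b x) : HasGradientAt (fun x => u x * v x) (u x • b + v x • a) x := by
  rw [hasGradientAt_iff_hasFDerivAt] at *
  refine (HasFDerivAt.mul hu hv).congr_fderiv ?_
  ext y; simp

lemma HasGradientAt.comp_affine (hu : HasGradientAt u a (c + r • x)) :
    HasGradientAt (fun x => u (c + r • x)) (r • a) x := by
  rw [hasGradientAt_iff_hasFDerivAt] at *
  have h : HasFDerivAt (fun x : Eu N => c + r • x) (r • ContinuousLinearMap.id ℝ (Eu N)) x :=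
    ((hasFDerivAt_id x).const_smul r).const_add c
  refine (hu.comp x h).congr_fderiv ?_
  ext y; simp

lemma hasGradientAt_inner (e x : Eu N) : HasGradientAt (fun x : Eu N => ⟪e, x⟫) e x := by
  rw [hasGradientAt_iff_hasFDerivAt]
  exact (innerSL ℝ e).hasFDerivAt

lemma gradient_comp_affine (u : Eu N → ℝ) (c x : Eu N) (hr : r ≠ 0) :
    ∇ (fun x => u (c + r • x)) x = r • ∇ u (c + r • x) := by
  by_cases h : DifferentiableAt ℝ u (c + r • x)
  · exact h.hasGradientAt.comp_affine.gradient
  · rw [gradient_eq_zero_of_not_differentiableAt h, smul_zero]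
    refine gradient_eq_zero_of_not_differentiableAt fun h' => h ?_
    have h1 : DifferentiableAt ℝ (fun y : Eu N => r⁻¹ • (y - c)) (c + r • x) := by fun_prop
    have h2 : r⁻¹ • ((c + r • x) - c) = x := by simp [smul_smul, hr]
    have h3 := DifferentiableAt.comp (c + r • x) (by rw [h2]; exact h') h1
    refine h3.congr_of_eventuallyEq (.of_forall fun y => ?_)
    simp [smul_smul, hr]

lemma gradient_const_mul (u : Eu N → ℝ) (x : Eu N) (c : ℝ) :
    ∇ (fun x => c * u x) x = c • ∇ u x := by
  by_cases hc : c = 0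
  · simp [hc, gradient_fun_const]
  by_cases h : DifferentiableAt ℝ u x
  · exact (h.hasGradientAt.const_mul' c).gradient
  · rw [gradient_eq_zero_of_not_differentiableAt h, smul_zero]
    refine gradient_eq_zero_of_not_differentiableAt fun h' => h ?_
    simpa [hc] using h'.const_mul c⁻¹

lemma gradient_sub_const (u : Eu N → ℝ) (x : Eu N) (c : ℝ) :
    ∇ (fun x => u x - c) x = ∇ u x := by
  simp [gradient, fderiv_sub_const]

lemma gradient_neg' (u : Eu N → ℝ) (x : Eu N) :
    ∇ (fun x => - u x) x = - ∇ u x := by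
  have := gradient_const_mul u x (-1)
  simpa using this

lemma gradient_comp_add (u : Eu N → ℝ) (c x : Eu N) :
    ∇ (fun x => u (x + c)) x = ∇ u (x + c) := by
  have := gradient_comp_affine u c x one_ne_zero
  simpa [add_comm] using this

lemma gradient_eq_zero_of_isLocalMin (h : IsLocalMin u x) :
    ∇ u x = 0 := by
  simp [gradient, h.fderiv_eq_zero]

lemma gradient_eq_zero_of_isLocalMax (h : IsLocalMax u x) :
    ∇ u x = 0 := by
  simp [gradient, h.fderiv_eq_zero]

lemma gradient_max_sub (hs : Continuous s) (κ : ℝ) (x : Eu N) :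
    ∇ (fun x => max (s x - κ) 0) x = if κ < s x then ∇ s x else 0 := by
  rcases lt_trichotomy κ (s x) with h | h | h
  · rw [if_pos h, ← gradient_sub_const s x κ]
    refine EventuallyEq.gradient_eq ?_
    filter_upwards [hs.continuousAt.eventually (lt_mem_nhds h)] with y hy
    exact max_eq_left (sub_nonneg.2 hy.le)
  · rw [if_neg h.not_lt]
    refine gradient_eq_zero_of_isLocalMin (.of_forall fun y => ?_)
    simp [h]
  · rw [if_neg h.not_gt]
    refine gradient_eq_zero_of_isLocalMin ?_
    filter_upwards with y
    rw [max_eq_right (by linarith)]; exact le_max_right _ _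

lemma gradient_min_max_sub (hs : Continuous s) (κ : ℝ) (hd : 0 < d) (x : Eu N) :
    ∇ (fun x => min (max (s x - κ) 0) d) x =
      if κ < s x ∧ s x < κ + d then ∇ s x else 0 := by
  by_cases h : s x < κ + d
  · simp only [h, and_true]
    rw [← gradient_max_sub hs]
    refine EventuallyEq.gradient_eq ?_
    filter_upwards [hs.continuousAt.eventually (gt_mem_nhds h)] with y hy
    exact min_eq_left (max_le (by linarith) hd.le)
  · rw [if_neg (by tauto)]
    refine gradient_eq_zero_of_isLocalMax (.of_forall fun y => ?_)
    have : d ≤ max (s x - κ) 0 := le_max_of_le_left (by linarith)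
    simp [this]

lemma gradient_eq_zero_of_notMem_tsupport (h : x ∉ tsupport u) :
    ∇ u x = 0 := by
  rw [(notMem_tsupport_iff_eventuallyEq.1 h).gradient_eq]
  exact gradient_fun_const x (0 : ℝ)

lemma integrable_of_bdd (hf : Measurable f) {K : Set (Eu N)}
    (hK : Bornology.IsBounded K) (h0 : ∀ x, x ∉ K → f x = 0) (hC : ∀ x, |f x| ≤ C) :
    Integrable f := by
  have h1 : IntegrableOn f (closure K) :=
    Measure.integrableOn_of_bounded (M := C) hK.isCompact_closure.measure_lt_top.ne
      hf.aestronglyMeasurable (.of_forall fun x => hC x)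
  refine h1.integrable_of_forall_notMem_eq_zero fun x hx => h0 x fun hx' => hx (subset_closure hx')

/-- Lipschitz functions with compact support in `U`. -/
def LipTest (U : Set (Eu N)) (φ : Eu N → ℝ) : Prop :=
  IsLip φ ∧ HasCompactSupport φ ∧ tsupport φ ⊆ U

lemma LipTest.mono (h : LipTest U φ) (hUV : U ⊆ V) :
    LipTest V φ := ⟨h.1, h.2.1, h.2.2.trans hUV⟩

lemma LipTest.integrable_inner (h : LipTest U φ) (hF : Measurable F) (hC : ∀ x, ‖F x‖ ≤ C) :
    Integrable (fun x => ⟪F x, ∇ φ x⟫) := by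
  obtain ⟨D, hD, hD'⟩ := h.1.exists_norm_gradient_le
  refine integrable_of_bdd (C := C * D) (hF.inner (measurable_gradient φ))
    h.2.1.isCompact.isBounded (fun x hx => ?_) fun x => ?_
  · rw [gradient_eq_zero_of_notMem_tsupport hx, inner_zero_right]
  · exact (abs_real_inner_le_norm _ _).trans
      (mul_le_mul (hC x) (hD' x) (norm_nonneg _) ((norm_nonneg _).trans (hC x)))

lemma LipTest.integrable_norm_gradient (h : LipTest U φ) :
    Integrable (fun x => ‖∇ φ x‖) := by
  obtain ⟨D, hD, hD'⟩ := h.1.exists_norm_gradient_le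
  refine integrable_of_bdd (C := D) (measurable_gradient φ).norm
    h.2.1.isCompact.isBounded (fun x hx => ?_) fun x => ?_
  · rw [gradient_eq_zero_of_notMem_tsupport hx, norm_zero]
  · rw [abs_of_nonneg (norm_nonneg _)]; exact hD' x

lemma LipTest.integrable_mul (h : LipTest U φ) (hk : Measurable k) (hC : ∀ x, |k x| ≤ C) :
    Integrable (fun x => k x * φ x) := by
  obtain ⟨D, hD'⟩ := h.2.1.exists_bound_of_continuous h.1.continuous
  refine integrable_of_bdd (C := C * D) (hk.mul h.1.continuous.measurable)
    h.2.1.isCompact.isBounded (fun x hx => ?_) fun x => ?_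
  · rw [image_eq_zero_of_notMem_tsupport hx, mul_zero]
  · rw [abs_mul]
    exact mul_le_mul (hC x) (hD' x) (abs_nonneg _) ((abs_nonneg _).trans (hC x))

/-- The cutoff `(R² - ‖x‖²)₊`. -/
def cut (R : ℝ) (x : Eu N) : ℝ := max (R - ‖x‖) 0 * (R + ‖x‖)

lemma cut_nonneg (hR : 0 ≤ R) (x : Eu N) : 0 ≤ cut R x :=
  mul_nonneg (le_max_right _ _) (by positivity)

lemma cut_eq_zero (h : R ≤ ‖x‖) : cut R x = 0 := by
  rw [cut, max_eq_right (by linarith), zero_mul]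

lemma cut_eq (h : ‖x‖ ≤ R) : cut R x = R ^ 2 - ‖x‖ ^ 2 := by
  rw [cut, max_eq_left (by linarith)]; ring

lemma cut_le (x : Eu N) : cut R x ≤ R ^ 2 := by
  rcases le_total ‖x‖ R with h | h
  · rw [cut_eq h]; nlinarith [sq_nonneg ‖x‖]
  · rw [cut_eq_zero h]; positivity

lemma tsupport_max_sub_norm (R : ℝ) :
    tsupport (fun x : Eu N => max (R - ‖x‖) 0) ⊆ closedBall 0 R := by
  refine closure_minimal (fun x hx => ?_) isClosed_closedBall
  rw [mem_closedBall_zero_iff]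
  by_contra h
  exact hx (max_eq_right (by linarith))

lemma tsupport_cut (R : ℝ) : tsupport (cut R : Eu N → ℝ) ⊆ closedBall 0 R := by
  refine closure_minimal (fun x hx => ?_) isClosed_closedBall
  rw [mem_closedBall_zero_iff]
  by_contra h
  exact hx (cut_eq_zero (by linarith))

lemma hasCompactSupport_cut (R : ℝ) : HasCompactSupport (cut R : Eu N → ℝ) :=
  HasCompactSupport.of_support_subset_isCompact (isCompact_closedBall 0 R)
    ((subset_tsupport _).trans (tsupport_cut R))

lemma isLip_cut (R : ℝ) : IsLip (cut R : Eu N → ℝ) := by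
  refine IsLip.mul_of_hasCompactSupport (((isLip_const R).sub isLip_norm).max (isLip_const 0)) ?_
    ((isLip_const R).add isLip_norm)
  exact HasCompactSupport.of_support_subset_isCompact (isCompact_closedBall 0 R)
    ((subset_tsupport _).trans (tsupport_max_sub_norm R))

lemma gradient_cut (hR : 0 ≤ R) (x : Eu N) :
    ∇ (cut R) x = if ‖x‖ < R then (-2 : ℝ) • x else 0 := by
  split_ifs with h
  · have h1 : HasGradientAt (fun x : Eu N => R ^ 2 - ‖x‖ ^ 2) ((-2 : ℝ) • x) x := by
      rw [hasGradientAt_iff_hasFDerivAt]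
      refine ((hasStrictFDerivAt_norm_sq x).hasFDerivAt.const_sub (R ^ 2)).congr_fderiv ?_
      ext y; simp
    refine (h1.congr_of_eventuallyEq ?_).gradient
    filter_upwards [continuous_norm.continuousAt.eventually (gt_mem_nhds h)] with y hy
    exact cut_eq hy.le
  · refine gradient_eq_zero_of_isLocalMin (.of_forall fun y => ?_)
    rw [cut_eq_zero (not_lt.1 h)]; exact cut_nonneg hR y

lemma norm_gradient_cut_le (hR : 0 ≤ R) (x : Eu N) : ‖∇ (cut R) x‖ ≤ 2 * R := by
  rw [gradient_cut hR]
  split_ifs with h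
  · rw [norm_smul]; norm_num; exact h.le
  · simp; exact hR

lemma le_cut (hr : 0 ≤ r) (hrR : r ≤ R) (hx : ‖x‖ ≤ r) : (R - r) * R ≤ cut R x:= by
  rw [cut_eq (hx.trans hrR)]
  nlinarith [norm_nonneg x, mul_nonneg hr (sub_nonneg.2 hrR)]

/-- Subsolution data for a uniformly elliptic equation in divergence form above a level. -/
structure EllData (lam Lam K : ℝ) (U : Set (Eu N)) (κ₀ : ℝ) (s : Eu N → ℝ) (F : Eu N → Eu N) :
    Prop where
  lip : IsLip s
  meas : Measurable F
  bdd : ∃ C, ∀ x, ‖F x‖ ≤ C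
  ell : ∀ᵐ x, x ∈ U → κ₀ < s x → lam * ‖∇ s x‖ ^ 2 ≤ ⟪F x, ∇ s x⟫ ∧
    ‖F x‖ ≤ Lam * ‖∇ s x‖
  eqn : ∀ φ, LipTest U φ → |∫ x, ⟪F x, ∇ φ x⟫| ≤ K * ∫ x, ‖∇ φ x‖

lemma LipTest.cut_mul (hR : R < R') (hv : IsLip v) :
    LipTest (ball 0 R') (fun x => cut R x * v x) :=
  ⟨(isLip_cut R).mul_of_hasCompactSupport (hasCompactSupport_cut R) hv,
    (hasCompactSupport_cut R).mul_right,
    (closure_mono (Function.support_mul_subset_left _ _)).trans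
      ((tsupport_cut R).trans (closedBall_subset_ball hR))⟩

lemma measurableSet_lt_of_isLip (hs : IsLip s) (κ : ℝ) :
    MeasurableSet {x | κ < s x} := (isOpen_lt continuous_const hs.continuous).measurableSet

lemma integrableOn_of_bdd (hf : Measurable f) {K : Set (Eu N)}
    (hK : Bornology.IsBounded K) (hC : ∀ x, |f x| ≤ C) : IntegrableOn f K :=
  Measure.integrableOn_of_bounded (M := C) hK.measure_lt_top.ne
      hf.aestronglyMeasurable (.of_forall fun x => hC x)

lemma EllData.caccioppoli
    (hlam : 0 < lam) (hLam : 0 ≤ Lam) (h : EllData lam Lam K (ball 0 R') κ₀ s F)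
    (hκ : κ₀ ≤ κ) (hd : 0 < d) (hK : K ≤ d) (hR : 0 < R) (hR2 : R ≤ 2) (hRR : R < R')
    (hs : ∀ x ∈ ball 0 R, s x ≤ κ + d) :
    ∫ x in ball 0 R ∩ {x | κ < s x}, (cut R x * ‖∇ s x‖) ^ 2 ≤
      (2 / lam * ((8 * Lam + 4) ^ 2 / (2 * lam) + 32)) * d ^ 2 *
        volume.real (ball 0 R ∩ {x | κ < s x}) := by
  set A := ball 0 R ∩ {x | κ < s x} with hA
  set C0 := (8 * Lam + 4) ^ 2 / (2 * lam) + 32 with hC0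
  have hAm : MeasurableSet A := measurableSet_ball.inter (measurableSet_lt_of_isLip h.lip κ)
  have hAb : Bornology.IsBounded A := isBounded_ball.subset inter_subset_left
  set v : Eu N → ℝ := fun x => max (s x - κ) 0 with hv
  have hvl : IsLip v := (h.lip.sub (isLip_const κ)).max (isLip_const 0)
  have hT1 : LipTest (ball 0 R') (fun x => cut R x * v x) := LipTest.cut_mul hRR hvl
  have hT : LipTest (ball 0 R') (fun x => cut R x * (cut R x * v x)) := LipTest.cut_mul hRR hT1.1
  obtain ⟨C, hC⟩ := h.bdd
  obtain ⟨M, hM0, hM⟩ := h.lip.exists_norm_gradient_le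
  have hcut0 : ∀ x : Eu N, 0 ≤ cut R x := cut_nonneg hR.le
  have hcut4 : ∀ x : Eu N, cut R x ≤ 4 := fun x => (cut_le x).trans (by nlinarith)
  have hfm : Measurable fun x => (cut R x * ‖∇ s x‖) ^ 2 :=
    ((isLip_cut R).continuous.measurable.mul (measurable_gradient s).norm).pow_const 2
  have hfm2 : Measurable fun x => lam / 2 * (cut R x * ‖∇ s x‖) ^ 2 - C0 * d ^ 2 :=
    (hfm.const_mul _).sub_const _
  have hpt : ∀ᵐ x, A.indicator (fun x => lam / 2 * (cut R x * ‖∇ s x‖) ^ 2 - C0 * d ^ 2) x ≤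
      ⟪F x, ∇ (fun x => cut R x * (cut R x * v x)) x⟫ -
        d * ‖∇ (fun x => cut R x * (cut R x * v x)) x‖ := by
    filter_upwards [h.ell, (isLip_cut R).hasGradientAt_ae, hvl.hasGradientAt_ae] with x hx hc hvx
    have hg := (hc.mul' (hc.mul' hvx)).gradient
    rw [hg, gradient_max_sub h.lip.continuous]
    by_cases hxA : x ∈ A
    · rw [indicator_of_mem hxA, if_pos (show κ < s x from hxA.2)]
      obtain ⟨e1, e2⟩ := hx (ball_subset_ball hRR.le hxA.1) (hκ.trans_lt hxA.2)
      have hvx0 : 0 ≤ v x := le_max_right _ _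
      have hvxd : v x ≤ d := max_le (by have := hs x hxA.1; linarith) hd.le
      have hq : ‖∇ (cut R) x‖ ≤ 4 := (norm_gradient_cut_le hR.le x).trans (by linarith)
      set g := ∇ s x
      set q := ∇ (cut R) x
      have hη0 := hcut0 x
      have hη4 := hcut4 x
      set η := cut R x
      have e3 : ‖η • (η • g + v x • q) + (η * v x) • q‖ ≤ η * (η * ‖g‖) + 2 * (η * d) * 4 := by
        rw [show η • (η • g + v x • q) + (η * v x) • q = (η * η) • g + (2 * (η * v x)) • q by module]
        refine (norm_add_le _ _).trans ?_
        rw [norm_smul, norm_smul, norm_of_nonneg (by positivity),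
          norm_of_nonneg (by positivity), mul_assoc]
        gcongr
      have e4 : η ^ 2 * ⟪F x, g⟫ - 2 * (η * d) * ((Lam * ‖g‖) * 4) ≤
          ⟪F x, η • (η • g + v x • q) + (η * v x) • q⟫ := by
        rw [show η • (η • g + v x • q) + (η * v x) • q = (η ^ 2) • g + (2 * (η * v x)) • q by module,
          inner_add_right, inner_smul_right, inner_smul_right]
        have : -((Lam * ‖g‖) * 4) ≤ ⟪F x, q⟫ := by
          have h1 := abs_le.1 (abs_real_inner_le_norm (F x) q)
          have h2 : ‖F x‖ * ‖q‖ ≤ (Lam * ‖g‖) * 4 := mul_le_mul e2 hq (norm_nonneg _) (by positivity)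
          linarith [h1.1]
        have h3 : 2 * (η * v x) * -((Lam * ‖g‖) * 4) ≤ 2 * (η * v x) * ⟪F x, q⟫ :=
          mul_le_mul_of_nonneg_left this (by positivity)
        have h4 : 2 * (η * v x) * ((Lam * ‖g‖) * 4) ≤ 2 * (η * d) * ((Lam * ‖g‖) * 4) := by gcongr
        linarith
      have e5 : lam * (η * ‖g‖) ^ 2 ≤ η ^ 2 * ⟪F x, g⟫ := by
        have := mul_le_mul_of_nonneg_left e1 (sq_nonneg η); nlinarith
      set X := η * ‖g‖ with hX
      have hX0 : 0 ≤ X := by positivity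
      have e6 : η * X ≤ 4 * X := by gcongr
      have e7 : (8 * Lam + 4) * d * X ≤ lam / 2 * X ^ 2 + (8 * Lam + 4) ^ 2 / (2 * lam) * d ^ 2 := by
        have : lam / 2 * X ^ 2 + (8 * Lam + 4) ^ 2 / (2 * lam) * d ^ 2 - (8 * Lam + 4) * d * X =
          lam / 2 * (X - (8 * Lam + 4) * d / lam) ^ 2 := by field_simp; ring
        have h2 : 0 ≤ lam / 2 * (X - (8 * Lam + 4) * d / lam) ^ 2 := by positivity
        linarith
      have e8 : d * ‖η • (η • g + v x • q) + (η * v x) • q‖ ≤ d * (4 * X + 2 * (4 * d) * 4) := by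
        refine mul_le_mul_of_nonneg_left (e3.trans ?_) hd.le
        gcongr
      have e9 : 2 * (η * d) * ((Lam * ‖g‖) * 4) = 8 * Lam * d * X := by rw [hX]; ring
      rw [hC0]
      nlinarith
    · rw [indicator_of_notMem hxA]
      by_cases hxR : x ∈ ball 0 R
      · have hxs : ¬ κ < s x := fun h' => hxA ⟨hxR, h'⟩
        have : v x = 0 := max_eq_right (by linarith)
        simp [this, hxs]
      · have : cut R x = 0 := cut_eq_zero (by simpa using hxR)
        simp [this]
  have hint := integral_mono_ae (integrable_indicator_iff hAm |>.2
      (integrableOn_of_bdd (C := lam / 2 * (4 * M) ^ 2 + C0 * d ^ 2)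
        hfm2 hAb fun x => ?_))
      ((hT.integrable_inner h.meas hC).sub (hT.integrable_norm_gradient.const_mul d)) hpt
  · simp only [Pi.sub_apply] at hint
    rw [integral_indicator hAm, integral_sub (hT.integrable_inner h.meas hC)
      (hT.integrable_norm_gradient.const_mul d), integral_const_mul] at hint
    rw [integral_sub, integral_const_mul, setIntegral_const] at hint
    · have h1 := (le_abs_self _).trans (h.eqn _ hT)
      have h2 : K * ∫ x, ‖∇ (fun x => cut R x * (cut R x * v x)) x‖ ≤
          d * ∫ x, ‖∇ (fun x => cut R x * (cut R x * v x)) x‖ :=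
        mul_le_mul_of_nonneg_right hK (integral_nonneg fun x => norm_nonneg _)
      have h3 : lam / 2 * ∫ x in A, (cut R x * ‖∇ s x‖) ^ 2 ≤
          C0 * d ^ 2 * volume.real A := by
        rw [smul_eq_mul] at hint; linarith
      calc _ = 2 / lam * (lam / 2 * ∫ x in A, (cut R x * ‖∇ s x‖) ^ 2) := by
            field_simp
        _ ≤ 2 / lam * (C0 * d ^ 2 * volume.real A) := by gcongr
        _ = _ := by ring
    · refine Integrable.const_mul (integrableOn_of_bdd (C := (4 * M) ^ 2)
        hfm hAb fun x => ?_) _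
      rw [abs_of_nonneg (by positivity)]
      have := hcut0 x; have := hcut4 x; have := hM x; gcongr
    · exact integrableOn_const hAb.measure_lt_top.ne
  · have := hcut0 x; have := hcut4 x; have := hM x
    refine (abs_sub _ _).trans (add_le_add ?_ ?_)
    · rw [abs_of_nonneg (by positivity)]; gcongr
    · rw [abs_of_nonneg (by positivity)]

lemma IsLip.integrable_of_hasCompactSupport (hv : IsLip v)
    (hc : HasCompactSupport v) : Integrable v :=
  hv.continuous.integrable_of_hasCompactSupport hc

lemma IsLip.integrable_norm_gradient (hv : IsLip v) (hc : HasCompactSupport v) :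
    Integrable fun x => ‖∇ v x‖ :=
  LipTest.integrable_norm_gradient (U := univ) ⟨hv, hc, subset_univ _⟩

lemma IsLip.integral_abs_le_of_volume_support_le (hv : IsLip v)
    (hc : HasCompactSupport v) (hr : 0 < r)
    (hs : volume {x | v x ≠ 0} ≤ volume (ball (0 : Eu N) r) / 2) :
    ∫ x, |v x| ≤ 2 * r * ∫ x, ‖∇ v x‖ := by
  have h := hv.lintegral_le_of_volume_support_le hr hs
  have h1 : ENNReal.ofReal (∫ x, |v x|) = ∫⁻ x, ‖v x‖ₑ := by
    simpa using ofReal_integral_norm_eq_lintegral_enorm (hv.integrable_of_hasCompactSupport hc)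
  have h2 : ENNReal.ofReal (∫ x, ‖∇ v x‖) = ∫⁻ x, ‖∇ v x‖ₑ := by
    simpa using ofReal_integral_norm_eq_lintegral_enorm (hv.integrable_norm_gradient hc)
  have h3 : 2 * ENNReal.ofReal r * ENNReal.ofReal (∫ x, ‖∇ v x‖) =
      ENNReal.ofReal (2 * r * ∫ x, ‖∇ v x‖) := by
    rw [ENNReal.ofReal_mul (by positivity), ENNReal.ofReal_mul (by norm_num)]; simp
  rw [← h1, ← h2, h3] at h
  exact (ENNReal.ofReal_le_ofReal_iff
    (mul_nonneg (by positivity) (integral_nonneg fun x => norm_nonneg _))).1 h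

/-- Energy bound on superlevel sets, the input of the iteration for local boundedness. -/
def EnergyBound (C : ℝ) (s : Eu N → ℝ) : Prop :=
  ∀ κ r R, 0 ≤ κ → κ ≤ 1 → 1 / 2 ≤ r → r < R → R ≤ 1 →
    ∫ x in ball 0 r ∩ {x | κ < s x ∧ s x < κ + 1}, ‖∇ s x‖ ^ 2 ≤
      C / (R - r) ^ 2 * volume.real (ball 0 R ∩ {x | κ < s x})

lemma EnergyBound.step (hs : IsLip s) (h : EnergyBound C s)
    (hκ : 0 ≤ κ) (hκ1 : κ ≤ 1) (hd : 0 < d) (hd1 : d ≤ 1) (hr : 1 / 2 ≤ r)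
    (hrR : r < R) (hR : R ≤ 1) (ht : 0 < t)
    (hm : volume (ball (0 : Eu N) R ∩ {x | κ < s x}) ≤ volume (ball (0 : Eu N) t) / 2) :
    volume.real (ball (0 : Eu N) r ∩ {x | κ + d < s x}) ≤
      t * (16 * C + 20) / (d * (R - r) ^ 3) *
        volume.real (ball (0 : Eu N) R ∩ {x | κ < s x}) := by
  obtain ⟨R1, hR1⟩ : ∃ R1, R1 = (r + R) / 2 := ⟨_, rfl⟩
  have hRr : 0 < R - r := sub_pos.2 hrR
  set v : Eu N → ℝ := fun x => min (max (s x - κ) 0) d with hv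
  have hvl : IsLip v := ((hs.sub (isLip_const κ)).max (isLip_const 0)).min (isLip_const d)
  have hv0 : ∀ x, 0 ≤ v x := fun x => le_min (le_max_right _ _) hd.le
  have hvd : ∀ x, v x ≤ d := fun x => min_le_right _ _
  have hvz : ∀ x, ¬ κ < s x → v x = 0 := fun x hx => by
    simp only [hv]; rw [max_eq_right (by linarith), min_eq_left hd.le]
  have hT : LipTest (ball 0 R) (fun x => cut R1 x * v x) :=
    LipTest.cut_mul (by rw [hR1]; linarith) hvl
  set m := volume.real (ball (0 : Eu N) R ∩ {x | κ < s x}) with hmdef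
  have hzero : ∀ x, x ∉ ball (0 : Eu N) R1 ∩ {x | κ < s x} → cut R1 x * v x = 0 := by
    intro x hx
    by_cases h1 : κ < s x
    · rw [cut_eq_zero, zero_mul]
      by_contra h2
      exact hx ⟨by simpa using h2, h1⟩
    · rw [hvz x h1, mul_zero]
  have hsub : ball (0 : Eu N) R1 ∩ {x | κ < s x} ⊆ ball (0 : Eu N) R ∩ {x | κ < s x} :=
    inter_subset_inter_left _ (ball_subset_ball (by rw [hR1]; linarith))
  have hgain := IsLip.integral_abs_le_of_volume_support_le hT.1 hT.2.1 ht
    ((measure_mono (fun x hx => hsub (by by_contra h'; exact hx (hzero x h')))).trans hm)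
  have hbA : Bornology.IsBounded (ball (0 : Eu N) R1 ∩ {x | κ < s x}) :=
    isBounded_ball.subset inter_subset_left
  have hAm : MeasurableSet (ball (0 : Eu N) R1 ∩ {x | κ < s x}) :=
    measurableSet_ball.inter (measurableSet_lt_of_isLip hs κ)
  have hA'm : MeasurableSet (ball (0 : Eu N) R1 ∩ {x | κ < s x ∧ s x < κ + 1}) :=
    measurableSet_ball.inter ((measurableSet_lt_of_isLip hs κ).inter
      (isOpen_lt hs.continuous continuous_const).measurableSet)
  have hbA' : Bornology.IsBounded (ball (0 : Eu N) R1 ∩ {x | κ < s x ∧ s x < κ + 1}) :=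
    isBounded_ball.subset inter_subset_left
  obtain ⟨M, hM0, hM⟩ := hs.exists_norm_gradient_le
  have hi1 : Integrable (indicator (ball (0 : Eu N) R1 ∩ {x | κ < s x ∧ s x < κ + 1})
      fun x => ‖∇ s x‖ ^ 2) :=
    (integrable_indicator_iff hA'm).2 (integrableOn_of_bdd (C := M ^ 2)
      ((measurable_gradient s).norm.pow_const 2) hbA' fun x => by
        rw [abs_of_nonneg (by positivity)]; have := hM x; gcongr)
  have hi2 : Integrable (indicator (ball (0 : Eu N) R1 ∩ {x | κ < s x}) fun _ => (5 / 2 : ℝ)) :=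
    (integrable_indicator_iff hAm).2 (integrableOn_const hbA.measure_lt_top.ne)
  have hup : ∫ x, ‖∇ (fun x => cut R1 x * v x) x‖ ≤
      (2 * C + 5 / 2) / (R - r) ^ 2 * m := by
    have h1 : ∀ᵐ x, ‖∇ (fun x => cut R1 x * v x) x‖ ≤
        1 / 2 * (indicator (ball (0 : Eu N) R1 ∩ {x | κ < s x ∧ s x < κ + 1})
          (fun x => ‖∇ s x‖ ^ 2) x) +
        indicator (ball (0 : Eu N) R1 ∩ {x | κ < s x}) (fun _ => (5 / 2 : ℝ)) x := by
      filter_upwards [(isLip_cut R1).hasGradientAt_ae, hvl.hasGradientAt_ae] with x hc hvx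
      rw [(hc.mul' hvx).gradient, gradient_min_max_sub hs.continuous κ hd]
      have hR10 : 0 ≤ R1 := by rw [hR1]; linarith
      have hR11 : R1 ≤ 1 := by rw [hR1]; linarith
      by_cases hx1 : ‖x‖ < R1
      · by_cases hx2 : κ < s x
        · have e1 : ‖v x • ∇ (cut R1) x‖ ≤ 2 := by
            rw [norm_smul, norm_of_nonneg (hv0 x)]
            have := norm_gradient_cut_le hR10 x
            nlinarith [hvd x, hv0 x, norm_nonneg (∇ (cut R1) x)]
          have e2 : cut R1 x ≤ 1 := (cut_le x).trans (by nlinarith)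
          have e3 := cut_nonneg hR10 x
          by_cases hx3 : s x < κ + d
          · have hx4 : s x < κ + 1 := by linarith
            simp only [mem_inter_iff, mem_ball_zero_iff, hx1, mem_ofPred_eq, hx2, hx3, hx4,
              and_self, if_true, indicator_of_mem]
            refine (norm_add_le _ _).trans ?_
            rw [norm_smul, norm_of_nonneg e3]
            have : cut R1 x * ‖∇ s x‖ ≤ ‖∇ s x‖ := mul_le_of_le_one_left (norm_nonneg _) e2
            nlinarith [sq_nonneg (‖∇ s x‖ - 1)]
          · have : (0:ℝ) ≤ indicator (ball (0 : Eu N) R1 ∩ {x | κ < s x ∧ s x < κ + 1})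
              (fun x => ‖∇ s x‖ ^ 2) x := indicator_nonneg (fun _ _ => by positivity) _
            simp only [mem_inter_iff, mem_ball_zero_iff, hx1, mem_ofPred_eq, hx2, hx3,
              and_self, and_false, if_false, indicator_of_mem, smul_zero, zero_add]
            linarith
        · simp [hx2, hvz x hx2]
      · have : cut R1 x = 0 := cut_eq_zero (not_lt.1 hx1)
        simp [this, hx1, gradient_cut hR10]
    refine (integral_mono_ae (hT.integrable_norm_gradient) ((hi1.const_mul (1 / 2)).add hi2)
      h1).trans ?_
    simp only [Pi.add_apply]
    rw [integral_add (hi1.const_mul _) hi2, integral_const_mul, integral_indicator hA'm,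
      integral_indicator hAm, setIntegral_const, smul_eq_mul]
    have h2 := h κ R1 R hκ hκ1 (by rw [hR1]; linarith) (by rw [hR1]; linarith) hR
    have h3 : volume.real (ball (0 : Eu N) R1 ∩ {x | κ < s x}) ≤ m :=
      measureReal_mono hsub (isBounded_ball.subset inter_subset_left).measure_lt_top.ne
    have hm0 : 0 ≤ m := measureReal_nonneg
    have h4 : 1 ≤ 1 / (R - r) ^ 2 := by
      rw [le_div_iff₀ (by positivity)]; nlinarith
    rw [show R - R1 = (R - r) / 2 by rw [hR1]; ring] at h2
    have h5 : C / ((R - r) / 2) ^ 2 * m = 4 * (C * (1 / (R - r) ^ 2) * m) := by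
      field_simp; ring
    rw [h5] at h2
    have h6 : (2 * C + 5 / 2) / (R - r) ^ 2 * m = 2 * (C * (1 / (R - r) ^ 2) * m) +
      5 / 2 * (1 / (R - r) ^ 2 * m) := by ring
    rw [h6]
    nlinarith
  have hlow : d * (R - r) / 4 * volume.real (ball (0 : Eu N) r ∩ {x | κ + d < s x}) ≤
      ∫ x, |cut R1 x * v x| := by
    have hBm : MeasurableSet (ball (0 : Eu N) r ∩ {x | κ + d < s x}) :=
      measurableSet_ball.inter (measurableSet_lt_of_isLip hs _)
    have hi := (hT.1.integrable_of_hasCompactSupport hT.2.1).abs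
    calc d * (R - r) / 4 * volume.real (ball (0 : Eu N) r ∩ {x | κ + d < s x})
        = ∫ x in ball (0 : Eu N) r ∩ {x | κ + d < s x}, d * (R - r) / 4 := by
          rw [setIntegral_const, smul_eq_mul, mul_comm]
      _ ≤ ∫ x in ball (0 : Eu N) r ∩ {x | κ + d < s x}, |cut R1 x * v x| := by
          refine setIntegral_mono_on (integrableOn_const
            (isBounded_ball.subset inter_subset_left).measure_lt_top.ne) hi.integrableOn hBm ?_
          rintro x ⟨hx1, hx2⟩
          have e1 : v x = d := by
            simp only [mem_ofPred_eq] at hx2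
            exact min_eq_right (le_max_of_le_left (by linarith))
          have e2 := le_cut (R := R1) (by linarith) (by rw [hR1]; linarith)
            (mem_ball_zero_iff.1 hx1).le
          rw [e1]
          refine le_trans ?_ (le_abs_self _)
          have : (R - r) / 4 ≤ (R1 - r) * R1 := by rw [hR1]; nlinarith
          nlinarith
      _ ≤ _ := setIntegral_le_integral hi (.of_forall fun x => abs_nonneg _)
  have hfin : d * (R - r) / 4 * volume.real (ball (0 : Eu N) r ∩ {x | κ + d < s x}) ≤
      2 * t * ((2 * C + 5 / 2) / (R - r) ^ 2 * m) :=
    hlow.trans (hgain.trans (by gcongr))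
  have hpos : 0 < d * (R - r) / 4 := by positivity
  rw [← le_div_iff₀' hpos] at hfin
  refine hfin.trans (le_of_eq ?_)
  field_simp; ring

lemma volume_real_ball_mul {c : ℝ} (hc : 0 < c) (r : ℝ) :
    volume.real (ball (0 : Eu N) (c * r)) = c ^ N * volume.real (ball (0 : Eu N) r) := by
  rw [measureReal_def, Measure.addHaar_ball_mul_of_pos volume 0 hc r, ENNReal.toReal_mul,
    ENNReal.toReal_ofReal (by positivity), finrank_euclideanSpace_fin, measureReal_def]

theorem exists_sup_bound_of_energyBound (N : ℕ) (hC : 0 ≤ C) : ∃ ν : ℝ, 0 < ν ∧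
    ∀ s : Eu N → ℝ, IsLip s → EnergyBound C s →
      volume.real (ball (0 : Eu N) 1 ∩ {x | 0 < s x}) ≤ ν →
        ∀ x ∈ ball (0 : Eu N) (1 / 2), s x ≤ 1 := by
  obtain ⟨q, hq⟩ : ∃ q : ℝ, q = 1 / 2 * (1 / 16) ^ N := ⟨_, rfl⟩
  have hq0 : 0 < q := by rw [hq]; positivity
  obtain ⟨ρ, hρ⟩ : ∃ ρ : ℝ, ρ = q / (128 * (16 * C + 20)) := ⟨_, rfl⟩
  have hρ0 : 0 < ρ := by rw [hρ]; positivity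
  have hν : 0 < volume.real (ball (0 : Eu N) ρ) := by
    rw [measureReal_def]
    exact ENNReal.toReal_pos (measure_ball_pos _ _ hρ0).ne' measure_ball_lt_top.ne
  refine ⟨volume.real (ball (0 : Eu N) ρ) / 2, by positivity, fun s hs h h0 => ?_⟩
  set ν := volume.real (ball (0 : Eu N) ρ) / 2 with hνdef
  set a : ℕ → ℝ := fun j => volume.real
    (ball (0 : Eu N) (1 / 2 + (1 / 2) ^ (j + 1)) ∩ {x | 1 - (1 / 2) ^ j < s x}) with ha
  have hb : ∀ r κ, volume (ball (0 : Eu N) r ∩ {x | κ < s x}) ≠ ⊤ := fun r κ =>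
    (isBounded_ball.subset inter_subset_left).measure_lt_top.ne
  have key : ∀ j, a j ≤ q ^ j * ν := by
    intro j
    induction j with
    | zero => simp only [ha]; norm_num; simpa using h0
    | succ j ih =>
      have hp : (0 : ℝ) < (1 / 2) ^ j := by positivity
      have hp1 : ((1 : ℝ) / 2) ^ j ≤ 1 := pow_le_one₀ (by norm_num) (by norm_num)
      have hp2 : (0 : ℝ) < (1 / 16) ^ j := by positivity
      have hvol : volume.real (ball (0 : Eu N) (ρ * (1 / 16) ^ j)) =
          ((1 / 16) ^ j) ^ N * (2 * ν) := by
        rw [mul_comm, volume_real_ball_mul hp2]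
        simp only [hνdef]; ring
      have hst := h.step hs (κ := 1 - (1 / 2) ^ j) (d := (1 / 2) ^ (j + 1))
        (r := 1 / 2 + (1 / 2) ^ (j + 2)) (R := 1 / 2 + (1 / 2) ^ (j + 1))
        (t := ρ * (1 / 16) ^ j) (by linarith) (by linarith) (by positivity)
        (by rw [pow_succ]; linarith)
        (by have : (0 : ℝ) < (1 / 2) ^ (j + 2) := by positivity
            linarith)
        (by rw [pow_succ, pow_succ]; linarith) (by rw [pow_succ]; linarith) (by positivity) (by
          rw [← ENNReal.toReal_le_toReal (hb _ _) (ENNReal.div_lt_top measure_ball_lt_top.ne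
            (by norm_num)).ne, ENNReal.toReal_div]
          change a j ≤ volume.real _ / _
          rw [hvol]
          refine ih.trans ?_
          rw [hq, mul_pow, ← pow_mul, ← pow_mul, mul_comm N j]
          have : ((1 : ℝ) / 2) ^ j * (1 / 16) ^ (j * N) ≤ 1 * (1 / 16) ^ (j * N) := by gcongr
          have hν0 : 0 ≤ ν := by positivity
          have h7 := mul_le_mul_of_nonneg_right this hν0
          rw [ENNReal.toReal_ofNat]; linarith)
      have hconst : ρ * (1 / 16) ^ j * (16 * C + 20) / ((1 / 2) ^ (j + 1) *
          ((1 / 2 + (1 / 2) ^ (j + 1)) - (1 / 2 + (1 / 2) ^ (j + 2))) ^ 3) = q := by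
        have e : ((1 : ℝ) / 16) ^ j = ((1 / 2) ^ j) ^ 4 := by
          rw [← pow_mul, mul_comm, pow_mul]; norm_num
        rw [e, hρ, pow_succ ((1:ℝ)/2) (j+1), pow_succ ((1:ℝ)/2) j]
        generalize ((1 : ℝ) / 2) ^ j = X at *
        have hX := hp.ne'
        have : X * (1 / 2) * (1 / 2 + X * (1 / 2) - (1 / 2 + X * (1 / 2) * (1 / 2))) ^ 3 =
          X ^ 4 / 128 := by ring
        rw [this]
        field_simp
      rw [hconst, show (1 : ℝ) - (1 / 2) ^ j + (1 / 2) ^ (j + 1) = 1 - (1 / 2) ^ (j + 1) by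
        rw [pow_succ]; ring] at hst
      calc a (j + 1) ≤ q * a j := hst
        _ ≤ q * (q ^ j * ν) := by gcongr
        _ = _ := by rw [pow_succ]; ring
  intro x hx
  by_contra hx1
  have hq1 : q < 1 := by
    have : ((1 : ℝ) / 16) ^ N ≤ 1 := pow_le_one₀ (by norm_num) (by norm_num)
    rw [hq]; linarith
  have hopen : IsOpen (ball (0 : Eu N) (1 / 2) ∩ {x | 1 < s x}) :=
    isOpen_ball.inter (isOpen_lt continuous_const hs.continuous)
  have hpos : 0 < volume.real (ball (0 : Eu N) (1 / 2) ∩ {x | 1 < s x}) := by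
    rw [measureReal_def]
    exact ENNReal.toReal_pos (hopen.measure_pos volume ⟨x, hx, not_le.1 hx1⟩).ne' (hb _ _)
  have hle : ∀ j, volume.real (ball (0 : Eu N) (1 / 2) ∩ {x | 1 < s x}) ≤ q ^ j * ν := fun j => by
    refine (measureReal_mono ?_ (hb _ _)).trans (key j)
    have hp : (0 : ℝ) < (1 / 2) ^ j := by positivity
    refine inter_subset_inter (ball_subset_ball ?_) fun y hy => ?_
    · have : (0 : ℝ) < (1 / 2) ^ (j + 1) := by positivity
      linarith
    · simp only [mem_ofPred_eq] at hy ⊢; linarith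
  have hlim : Tendsto (fun j : ℕ => q ^ j * ν) atTop (nhds (0 * ν)) :=
    (tendsto_pow_atTop_nhds_zero_of_lt_one hq0.le hq1).mul_const ν
  have := ge_of_tendsto' hlim hle
  linarith

lemma ae_comp_affine {p : Eu N → Prop} (h : ∀ᵐ x, p x) (c : Eu N) (hr : r ≠ 0) :
    ∀ᵐ y, p (c + r • y) := by
  rw [ae_iff] at h ⊢
  have : {y | ¬ p (c + r • y)} = (fun y : Eu N => r • y) ⁻¹' ((fun x => c + x) ⁻¹' {x | ¬ p x}) := rfl
  rw [this, Measure.addHaar_preimage_smul volume hr, measure_preimage_add, h, mul_zero]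

lemma integral_comp_affine (f : Eu N → ℝ) (c : Eu N) (r : ℝ) :
    ∫ y, f (c + r • y) = |(r ^ N)⁻¹| * ∫ x, f x := by
  have h := Measure.integral_comp_smul (volume : Measure (Eu N)) (fun x => f (c + x)) r
  rw [h, finrank_euclideanSpace_fin, smul_eq_mul, integral_add_left_eq_self]

lemma hasCompactSupport_comp_affine (h : HasCompactSupport φ) (c : Eu N)
    (hr : r ≠ 0) : HasCompactSupport fun y => φ (c + r • y) :=
  h.comp_homeomorph ((Homeomorph.smulOfNeZero r hr).trans (Homeomorph.addLeft c))

lemma LipTest.comp_affine (h : LipTest U φ) (c : Eu N)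
    (hr : r ≠ 0) : LipTest ((fun y => c + r • y) ⁻¹' U) fun y => φ (c + r • y) :=
  ⟨h.1.comp_affine c r, hasCompactSupport_comp_affine h.2.1 c hr,
    (tsupport_comp_subset_preimage φ (by fun_prop)).trans (preimage_mono h.2.2)⟩

lemma EllData.mono {κ₁ : ℝ}
    (h : EllData lam Lam K U κ₀ s F) (hK : K ≤ K') (hU : U' ⊆ U) (hκ : κ₀ ≤ κ₁) :
    EllData lam Lam K' U' κ₁ s F where
  lip := h.lip
  meas := h.meas
  bdd := h.bdd
  ell := h.ell.mono fun _ hx hU' hs => hx (hU hU') (hκ.trans_lt hs)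
  eqn φ hφ := (h.eqn φ (hφ.mono hU)).trans
    (mul_le_mul_of_nonneg_right hK (integral_nonneg fun _ => norm_nonneg _))

lemma EllData.rescale
    (h : EllData lam Lam K U κ₀ s F) (c : Eu N) (hr : 0 < r) (hm : 0 < m) (b : ℝ) :
    EllData lam Lam (K * r / m) ((fun y => c + r • y) ⁻¹' U) ((κ₀ - b) / m)
      (fun y => (s (c + r • y) - b) / m) (fun y => (r / m) • F (c + r • y)) := by
  have hgr : ∀ y, ∇ (fun y => (s (c + r • y) - b) / m) y =
      (r / m) • ∇ s (c + r • y) := by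
    intro y
    have e : (fun y => (s (c + r • y) - b) / m) = fun y => m⁻¹ * (s (c + r • y) - b) := by
      ext y; rw [div_eq_inv_mul]
    rw [e, gradient_const_mul, gradient_sub_const, gradient_comp_affine s c y hr.ne', smul_smul]
    congr 1; field_simp
  have hrm : 0 < r / m := by positivity
  refine ⟨?_, ?_, ?_, ?_, ?_⟩
  · have e : (fun y => (s (c + r • y) - b) / m) = fun y => m⁻¹ * (s (c + r • y) - b) := by
      ext y; rw [div_eq_inv_mul]
    rw [e]
    exact ((h.lip.comp_affine c r).sub (isLip_const b)).const_mul _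
  · exact (h.meas.comp (by fun_prop)).const_smul (r / m)
  · obtain ⟨C, hC⟩ := h.bdd
    refine ⟨r / m * C, fun x => ?_⟩
    rw [norm_smul, norm_of_nonneg hrm.le]
    exact mul_le_mul_of_nonneg_left (hC _) hrm.le
  · filter_upwards [ae_comp_affine h.ell c hr.ne'] with y hy hyU hys
    rw [hgr]
    obtain ⟨h1, h2⟩ := hy hyU (by
      rw [div_lt_div_iff_of_pos_right hm] at hys; linarith)
    rw [inner_smul_left, inner_smul_right, norm_smul, norm_smul, norm_of_nonneg hrm.le]
    simp only [conj_trivial]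
    constructor
    · have := mul_le_mul_of_nonneg_left h1 (mul_pos hrm hrm).le
      nlinarith
    · have := mul_le_mul_of_nonneg_left h2 hrm.le
      nlinarith
  · intro φ hφ
    have hri : r⁻¹ ≠ 0 := inv_ne_zero hr.ne'
    set ψ : Eu N → ℝ := fun x => φ (-(r⁻¹ • c) + r⁻¹ • x) with hψ
    have hback : ∀ y : Eu N, -(r⁻¹ • c) + r⁻¹ • (c + r • y) = y := fun y => by
      rw [smul_add, smul_smul, inv_mul_cancel₀ hr.ne', one_smul]; abel
    have hback' : ∀ x : Eu N, c + r • (-(r⁻¹ • c) + r⁻¹ • x) = x := fun x => by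
      rw [smul_add, smul_neg, smul_smul, smul_smul, mul_inv_cancel₀ hr.ne', one_smul, one_smul]
      abel
    have hψT : LipTest U ψ := by
      refine (hφ.comp_affine (-(r⁻¹ • c)) hri).mono fun x hx => ?_
      rwa [mem_preimage, mem_preimage, hback'] at hx
    have hgψ : ∀ y, ∇ φ y = r • ∇ ψ (c + r • y) := by
      intro y
      rw [hψ, gradient_comp_affine φ _ _ hri, hback, smul_smul, mul_inv_cancel₀ hr.ne', one_smul]
    have e1 : ∫ y, ⟪(r / m) • F (c + r • y), ∇ φ y⟫ =
        r * (r / m) * (|(r ^ N)⁻¹| * ∫ x, ⟪F x, ∇ ψ x⟫) := by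
      rw [← integral_comp_affine (fun x => ⟪F x, ∇ ψ x⟫) c r, ← integral_const_mul]
      refine integral_congr_ae (.of_forall fun y => ?_)
      simp only [hgψ, inner_smul_left, inner_smul_right, conj_trivial]; ring
    have e2 : ∫ y, ‖∇ φ y‖ = r * (|(r ^ N)⁻¹| * ∫ x, ‖∇ ψ x‖) := by
      rw [← integral_comp_affine (fun x => ‖∇ ψ x‖) c r, ← integral_const_mul]
      refine integral_congr_ae (.of_forall fun y => ?_)
      simp only [hgψ, norm_smul, norm_of_nonneg hr.le]
    rw [e1, e2, abs_mul (r * (r / m)), abs_mul |(r ^ N)⁻¹|, abs_abs, abs_of_pos (mul_pos hr hrm)]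
    have := mul_le_mul_of_nonneg_left (h.eqn ψ hψT)
      (mul_nonneg (mul_pos hr hrm).le (abs_nonneg (r ^ N)⁻¹))
    calc _ = r * (r / m) * |(r ^ N)⁻¹| * |∫ x, ⟪F x, ∇ ψ x⟫| := by ring
      _ ≤ _ := this
      _ = _ := by ring

/-- Data elliptic at every point, without restriction to a superlevel set. -/
def EllEq (lam Lam K : ℝ) (U : Set (Eu N)) (s : Eu N → ℝ) (F : Eu N → Eu N) : Prop :=
  ∀ κ₀, EllData lam Lam K U κ₀ s F

lemma EllEq.rescale (h : EllEq lam Lam K U s F) (c : Eu N) (hr : 0 < r) (hm : 0 < m) (b : ℝ) :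
    EllEq lam Lam (K * r / m) ((fun y => c + r • y) ⁻¹' U)
      (fun y => (s (c + r • y) - b) / m) (fun y => (r / m) • F (c + r • y)) := fun κ₀ => by
  have := (h (κ₀ * m + b)).rescale c hr hm b
  rwa [add_sub_cancel_right, mul_div_cancel_right₀ _ hm.ne'] at this

lemma EllEq.mono (h : EllEq lam Lam K U s F) (hK : K ≤ K') (hU : U' ⊆ U) : EllEq lam Lam K' U' s F:=
  fun κ₀ => (h κ₀).mono hK hU le_rfl

lemma EllEq.ell (h : EllEq lam Lam K U s F) : ∀ᵐ x, x ∈ U → lam * ‖∇ s x‖ ^ 2 ≤ ⟪F x, ∇ s x⟫ ∧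
    ‖F x‖ ≤ Lam * ‖∇ s x‖ := by
  have : ∀ᵐ x, ∀ n : ℕ, x ∈ U → -(n : ℝ) < s x → lam * ‖∇ s x‖ ^ 2 ≤ ⟪F x, ∇ s x⟫ ∧
    ‖F x‖ ≤ Lam * ‖∇ s x‖ := ae_all_iff.2 fun n => (h (-n)).ell
  filter_upwards [this] with x hx hU
  obtain ⟨n, hn⟩ := exists_nat_gt (-s x)
  exact hx n hU (by linarith)

lemma EllEq.neg
    (h : EllEq lam Lam K U s F) : EllEq lam Lam K U (fun x => -s x) (fun x => -F x) := fun κ₀ => by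
  refine ⟨(h 0).lip.neg, (h 0).meas.neg, ?_, ?_, fun φ hφ => ?_⟩
  · simpa using (h 0).bdd
  · filter_upwards [h.ell] with x hx hU _
    rw [gradient_neg']
    simpa using hx hU
  · simpa [integral_neg] using (h 0).eqn φ hφ

lemma ofReal_setIntegral_norm {E : Type*} [NormedAddCommGroup E] {f : Eu N → E} {A : Set (Eu N)}
    (hf : IntegrableOn f A) : ENNReal.ofReal (∫ x in A, ‖f x‖) = ∫⁻ x in A, ‖f x‖ₑ :=
  ofReal_integral_norm_eq_lintegral_enorm hf

lemma IsLip.integrableOn_gradient (hv : IsLip v) {A : Set (Eu N)}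
    (hA : Bornology.IsBounded A) : IntegrableOn (∇ v) A := by
  obtain ⟨M, -, hM⟩ := hv.exists_norm_gradient_le
  exact Measure.integrableOn_of_bounded (M := M) hA.measure_lt_top.ne
      (measurable_gradient v).aestronglyMeasurable (.of_forall hM)

lemma IsLip.integrableOn (hv : IsLip v) {A : Set (Eu N)}
    (hA : Bornology.IsBounded A) : IntegrableOn v A :=
  (hv.continuous.continuousOn.integrableOn_compact hA.isCompact_closure).mono_set subset_closure

lemma IsLip.volume_mul_integral_le (hv : IsLip v) (hR : 0 ≤ R)
    (hZm : MeasurableSet Z) (hZ : Z ⊆ ball c R) (hvZ : ∀ x ∈ Z, v x = 0) :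
    volume.real Z * ∫ x in ball c R, |v x| ≤
      2 * R * volume.real (ball (0 : Eu N) (2 * R)) * ∫ x in ball c R, ‖∇ v x‖ := by
  have h := hv.volume_mul_lintegral_le hZm hZ hvZ
  rw [← ofReal_setIntegral_norm (hv.integrableOn isBounded_ball),
    ← ofReal_setIntegral_norm (hv.integrableOn_gradient isBounded_ball),
    ← ofReal_measureReal ((isBounded_ball.subset hZ).measure_lt_top.ne),
    ← ofReal_measureReal (measure_ball_lt_top.ne), ← ENNReal.ofReal_mul measureReal_nonneg,
    ← ENNReal.ofReal_mul (by positivity), ← ENNReal.ofReal_mul (by positivity)] at h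
  exact (ENNReal.ofReal_le_ofReal_iff (mul_nonneg (by positivity)
    (integral_nonneg fun x => norm_nonneg _))).1 h

/-- The constant of the Caccioppoli inequality. -/
def cacc (lam Lam : ℝ) : ℝ := 2 / lam * ((8 * Lam + 4) ^ 2 / (2 * lam) + 32)

lemma cacc_pos (h : 0 < lam) : 0 < cacc lam Lam := by
  unfold cacc; positivity

lemma measurable_cut_mul_gradient_sq (R : ℝ) (s : Eu N → ℝ) :
    Measurable fun x => (cut R x * ‖∇ s x‖) ^ 2 :=
  ((isLip_cut R).continuous.measurable.mul (measurable_gradient s).norm).pow_const 2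

lemma EllData.integral_sq_le
    (hlam : 0 < lam) (hLam : 0 ≤ Lam) (h : EllData lam Lam K (ball 0 R') κ₀ s F)
    (hκ : κ₀ ≤ κ) (hd : 0 < d) (hK : K ≤ d) (hr : 0 ≤ r) (hrR : r < R) (hR2 : R ≤ 2) (hRR : R < R')
    (hs : ∀ x ∈ ball 0 R, s x ≤ κ + d) :
    ((R - r) * R) ^ 2 * ∫ x in ball 0 r ∩ {x | κ < s x}, ‖∇ s x‖ ^ 2 ≤
      cacc lam Lam * d ^ 2 * volume.real (ball 0 R ∩ {x | κ < s x}) := by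
  have hR : 0 < R := hr.trans_lt hrR
  refine le_trans ?_ (h.caccioppoli hlam hLam hκ hd hK hR hR2 hRR hs)
  obtain ⟨M, hM0, hM⟩ := h.lip.exists_norm_gradient_le
  have hi : IntegrableOn (fun x => (cut R x * ‖∇ s x‖) ^ 2) (ball 0 R ∩ {x | κ < s x}) :=
    integrableOn_of_bdd (C := (R ^ 2 * M) ^ 2)
      (measurable_cut_mul_gradient_sq R s)
      (isBounded_ball.subset inter_subset_left) fun x => by
        rw [abs_of_nonneg (by positivity)]
        have := hM x; have := cut_nonneg hR.le x; have := cut_le (R := R) x; gcongr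
  have hsub : ball 0 r ∩ {x | κ < s x} ⊆ ball 0 R ∩ {x | κ < s x} :=
    inter_subset_inter_left _ (ball_subset_ball hrR.le)
  rw [← integral_const_mul]
  refine (setIntegral_mono_on ?_ (hi.mono_set hsub)
    (measurableSet_ball.inter (measurableSet_lt_of_isLip h.lip κ)) ?_).trans
    (setIntegral_mono_set hi (.of_forall fun x => sq_nonneg _)
      (.of_forall hsub))
  · refine Integrable.const_mul (integrableOn_of_bdd (C := M ^ 2)
      ((measurable_gradient s).norm.pow_const 2) (isBounded_ball.subset inter_subset_left)
      fun x => ?_) _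
    rw [abs_of_nonneg (by positivity)]; have := hM x; gcongr
  · rintro x ⟨hx, -⟩
    rw [mul_pow (cut R x)]
    have := le_cut hr hrR.le (mem_ball_zero_iff.1 hx).le
    have h0 : 0 ≤ (R - r) * R := mul_nonneg (by linarith) hR.le
    gcongr

lemma EllData.volume_step
    (hlam : 0 < lam) (hLam : 0 ≤ Lam) (h : EllData lam Lam K (ball 0 3) κ₀ s F)
    (hκ : κ₀ ≤ κ) (hd : 0 < d) (hK : K ≤ d) (hs : ∀ x ∈ ball (0 : Eu N) 2, s x ≤ κ + d)
    (hν : ν ≤ volume.real (ball (0 : Eu N) 1 ∩ {x | s x ≤ κ₀})) (hτ : 0 < τ) :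
    ν * volume.real (ball (0 : Eu N) 1 ∩ {x | κ + d / 2 < s x}) ≤
      2 * volume.real (ball (0 : Eu N) 2) * (τ * cacc lam Lam * volume.real (ball (0 : Eu N) 2) +
        (volume.real (ball (0 : Eu N) 1 ∩ {x | κ < s x}) -
          volume.real (ball (0 : Eu N) 1 ∩ {x | κ + d / 2 < s x})) / τ) := by
  set V := volume.real (ball (0 : Eu N) 2) with hV
  have hlt : ∀ κ', MeasurableSet (ball (0 : Eu N) 1 ∩ {x | κ' < s x}) := fun κ' =>
    measurableSet_ball.inter (measurableSet_lt_of_isLip h.lip κ')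
  have hfin : ∀ B : Set (Eu N), volume (ball (0 : Eu N) 1 ∩ B) ≠ ⊤ := fun B =>
    (isBounded_ball.subset inter_subset_left).measure_lt_top.ne
  have hd2 : 0 < d / 2 := by positivity
  set v : Eu N → ℝ := fun x => min (max (s x - κ) 0) (d / 2) with hv
  have hvl : IsLip v := ((h.lip.sub (isLip_const κ)).max (isLip_const 0)).min (isLip_const _)
  have hP := hvl.volume_mul_integral_le (R := 1) zero_le_one (c := 0)
    (Z := ball (0 : Eu N) 1 ∩ {x | s x ≤ κ₀})
    (measurableSet_ball.inter (isClosed_le h.lip.continuous continuous_const).measurableSet)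
    inter_subset_left (by
      rintro x ⟨-, hx⟩
      simp only [mem_ofPred_eq] at hx
      simp only [hv]
      rw [max_eq_right (by linarith), min_eq_left hd2.le])
  rw [show (2 : ℝ) * 1 = 2 by norm_num, ← hV] at hP
  set A := ball (0 : Eu N) 1 ∩ {x | κ < s x} with hA
  set A' := ball (0 : Eu N) 1 ∩ {x | κ + d / 2 < s x} with hA'
  set D := A \ A' with hD
  have hA'A : A' ⊆ A := inter_subset_inter_right _ fun x hx => by
    simp only [mem_ofPred_eq] at hx ⊢; linarith
  have hDm : MeasurableSet D := (hlt _).diff (hlt _)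
  have hDvol : volume.real D = volume.real A - volume.real A' :=
    measureReal_sdiff hA'A (hlt _) (hfin _)
  have hlow : d / 2 * volume.real A' ≤ ∫ x in ball (0 : Eu N) 1, |v x| := by
    have hi : IntegrableOn (fun x => |v x|) (ball (0 : Eu N) 1) :=
      (hvl.integrableOn isBounded_ball).abs
    calc d / 2 * volume.real A' = ∫ x in A', d / 2 := by
          rw [setIntegral_const, smul_eq_mul, mul_comm]
      _ ≤ ∫ x in A', |v x| := by
          refine setIntegral_mono_on (integrableOn_const (hfin _)) (hi.mono_set inter_subset_left)
            (hlt _) ?_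
          rintro x ⟨-, hx⟩
          simp only [mem_ofPred_eq] at hx
          refine le_trans (le_of_eq ?_) (le_abs_self _)
          simp only [hv]
          rw [min_eq_right (le_max_of_le_left (by linarith))]
      _ ≤ _ := setIntegral_mono_set hi (.of_forall fun x => abs_nonneg _)
          (.of_forall inter_subset_left)
  have hE : ∫ x in A, ‖∇ s x‖ ^ 2 ≤ cacc lam Lam * d ^ 2 * V := by
    have h1 := h.integral_sq_le hlam hLam hκ hd hK zero_le_one (by norm_num : (1:ℝ) < 2) le_rfl
      (by norm_num) hs
    have h2 : volume.real (ball (0 : Eu N) 2 ∩ {x | κ < s x}) ≤ V :=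
      measureReal_mono inter_subset_left measure_ball_lt_top.ne
    have h0 : 0 ≤ ∫ x in A, ‖∇ s x‖ ^ 2 := integral_nonneg fun _ => sq_nonneg _
    have h3 : cacc lam Lam * d ^ 2 * volume.real (ball (0 : Eu N) 2 ∩ {x | κ < s x}) ≤
        cacc lam Lam * d ^ 2 * V := by have := cacc_pos (Lam := Lam) hlam; gcongr
    norm_num at h1
    linarith
  obtain ⟨M, hM0, hM⟩ := h.lip.exists_norm_gradient_le
  have hsq : IntegrableOn (fun x => ‖∇ s x‖ ^ 2) A :=
    integrableOn_of_bdd (C := M ^ 2) ((measurable_gradient s).norm.pow_const 2)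
      (isBounded_ball.subset inter_subset_left) fun x => by
        rw [abs_of_nonneg (by positivity)]; have := hM x; gcongr
  have hup : ∫ x in ball (0 : Eu N) 1, ‖∇ v x‖ ≤
      d / 2 * (τ * cacc lam Lam * V + volume.real D / τ) := by
    have hpt : ∀ x ∈ ball (0 : Eu N) 1, ‖∇ v x‖ ≤
        D.indicator (fun x => τ / (2 * d) * ‖∇ s x‖ ^ 2 + d / (2 * τ)) x := by
      intro x hx
      rw [gradient_min_max_sub h.lip.continuous κ hd2]
      have hpos : ∀ g : ℝ, 0 ≤ τ / (2 * d) * g ^ 2 + d / (2 * τ) := fun g => by positivity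
      split_ifs with hc
      · rw [indicator_of_mem]
        · have : τ / (2 * d) * ‖∇ s x‖ ^ 2 + d / (2 * τ) - ‖∇ s x‖ =
            (τ * ‖∇ s x‖ - d) ^ 2 / (2 * d * τ) := by field_simp; ring
          have h0 : 0 ≤ (τ * ‖∇ s x‖ - d) ^ 2 / (2 * d * τ) := by positivity
          linarith
        · exact ⟨⟨hx, hc.1⟩, fun h' => not_lt.2 hc.2.le h'.2⟩
      · rw [norm_zero]
        exact indicator_nonneg (fun y _ => hpos _) x
    have hDs : IntegrableOn (fun x => ‖∇ s x‖ ^ 2) D := hsq.mono_set sdiff_subset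
    have hDfin : volume D ≠ ⊤ := measure_ne_top_of_subset sdiff_subset (hfin _)
    have hiD : IntegrableOn (fun x => τ / (2 * d) * ‖∇ s x‖ ^ 2 + d / (2 * τ)) D :=
      (hDs.const_mul _).add (integrableOn_const hDfin)
    calc ∫ x in ball (0 : Eu N) 1, ‖∇ v x‖
        ≤ ∫ x in ball (0 : Eu N) 1,
          D.indicator (fun x => τ / (2 * d) * ‖∇ s x‖ ^ 2 + d / (2 * τ)) x :=
          setIntegral_mono_on (hvl.integrableOn_gradient isBounded_ball).norm
            ((integrable_indicator_iff hDm).2 hiD).integrableOn measurableSet_ball hpt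
      _ = ∫ x in D, (τ / (2 * d) * ‖∇ s x‖ ^ 2 + d / (2 * τ)) := by
          rw [setIntegral_indicator hDm, inter_eq_right.2]
          exact sdiff_subset.trans inter_subset_left
      _ = τ / (2 * d) * (∫ x in D, ‖∇ s x‖ ^ 2) + d / (2 * τ) * volume.real D := by
          rw [integral_add (hDs.const_mul _) (integrableOn_const hDfin), integral_const_mul,
            setIntegral_const, smul_eq_mul, mul_comm (volume.real D)]
      _ ≤ τ / (2 * d) * (cacc lam Lam * d ^ 2 * V) + d / (2 * τ) * volume.real D := by
          gcongr
          exact (setIntegral_mono_set hsq (.of_forall fun x => sq_nonneg _)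
            (.of_forall sdiff_subset)).trans hE
      _ = _ := by field_simp
  have h0 : 0 ≤ volume.real A' := measureReal_nonneg
  have hV0 : 0 ≤ V := measureReal_nonneg
  have hmain : ν * (d / 2 * volume.real A') ≤
      2 * V * (d / 2 * (τ * cacc lam Lam * V + volume.real D / τ)) :=
    calc ν * (d / 2 * volume.real A')
        ≤ volume.real (ball (0 : Eu N) 1 ∩ {x | s x ≤ κ₀}) * ∫ x in ball (0 : Eu N) 1, |v x| :=
          mul_le_mul hν hlow (by positivity) measureReal_nonneg
      _ ≤ 2 * V * ∫ x in ball (0 : Eu N) 1, ‖∇ v x‖ := hP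
      _ ≤ _ := by gcongr
  rw [← hDvol]
  refine le_of_mul_le_mul_left ?_ hd2
  linarith

theorem exists_sup_decrease (N : ℕ) (hlam : 0 < lam) (hLam : 0 ≤ Lam)
    (hκ₀ : κ₀ < 1) (hν : 0 < ν) : ∃ δ : ℝ, 0 < δ ∧ ∀ (s : Eu N → ℝ) (F : Eu N → Eu N),
      EllData lam Lam δ (ball 0 3) κ₀ s F → (∀ x ∈ ball (0 : Eu N) 2, s x ≤ 1) →
      ν ≤ volume.real (ball (0 : Eu N) 1 ∩ {x | s x ≤ κ₀}) →
      ∀ x ∈ ball (0 : Eu N) (1 / 2), s x ≤ 1 - δ := by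
  have hc := cacc_pos (Lam := Lam) hlam
  obtain ⟨ν₁, hν₁, hsup⟩ := exists_sup_bound_of_energyBound N (C := 16 * cacc lam Lam) (by positivity)
  set V := volume.real (ball (0 : Eu N) 2) with hV
  have hV0 : 0 ≤ V := measureReal_nonneg
  obtain ⟨τ, hτ, hτ1⟩ : ∃ τ : ℝ, 0 < τ ∧ 2 * V * (τ * cacc lam Lam * V) ≤ ν * ν₁ / 2 := by
    refine ⟨ν * ν₁ / (4 * cacc lam Lam * (V ^ 2 + 1)), by positivity, ?_⟩
    rw [show 2 * V * (ν * ν₁ / (4 * cacc lam Lam * (V ^ 2 + 1)) * cacc lam Lam * V) =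
      ν * ν₁ / 2 * (V ^ 2 / (V ^ 2 + 1)) by field_simp; ring]
    refine mul_le_of_le_one_right (by positivity) ?_
    rw [div_le_one (by positivity)]; linarith
  obtain ⟨n, hn⟩ := exists_nat_gt (2 * V * V / τ / (ν * ν₁ / 2))
  rw [div_lt_iff₀ (by positivity)] at hn
  have hdpos : ∀ k : ℕ, 0 < (1 - κ₀) * (1 / 2) ^ k := fun k =>
    mul_pos (by linarith) (by positivity)
  have hdanti : ∀ k ≤ n, (1 - κ₀) * (1 / 2) ^ n ≤ (1 - κ₀) * (1 / 2) ^ k := fun k hk =>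
    mul_le_mul_of_nonneg_left (pow_le_pow_of_le_one (by norm_num) (by norm_num) hk) (by linarith)
  refine ⟨(1 - κ₀) * (1 / 2) ^ n / 2, half_pos (hdpos n), fun s F h hs hνs => ?_⟩
  set δ := (1 - κ₀) * (1 / 2) ^ n / 2 with hδ
  set a : ℕ → ℝ := fun k =>
    volume.real (ball (0 : Eu N) 1 ∩ {x | 1 - (1 - κ₀) * (1 / 2) ^ k < s x}) with ha
  have hfin : ∀ B : Set (Eu N), volume (ball (0 : Eu N) 1 ∩ B) ≠ ⊤ := fun B =>
    (isBounded_ball.subset inter_subset_left).measure_lt_top.ne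
  have hstep : ∀ k < n, ν * a (k + 1) ≤ 2 * V * (τ * cacc lam Lam * V + (a k - a (k + 1)) / τ) := by
    intro k hk
    have h1 : ((1 : ℝ) / 2) ^ k ≤ 1 := pow_le_one₀ (by norm_num) (by norm_num)
    have := h.volume_step hlam hLam (κ := 1 - (1 - κ₀) * (1 / 2) ^ k)
      (d := (1 - κ₀) * (1 / 2) ^ k) (by nlinarith) (hdpos k)
      (by have := hdanti k hk.le; have := hdpos n; linarith)
      (by simpa using hs) hνs hτ
    rwa [show 1 - (1 - κ₀) * (1 / 2) ^ k + (1 - κ₀) * (1 / 2) ^ k / 2 =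
      1 - (1 - κ₀) * (1 / 2) ^ (k + 1) by rw [pow_succ]; ring] at this
  have hanti : ∀ k ≤ n, a n ≤ a k := fun k hk =>
    measureReal_mono (inter_subset_inter_right _ fun x hx => by
      have := hdanti k hk
      simp only [mem_ofPred_eq] at hx ⊢; linarith) (hfin _)
  have hsum : ∀ k ≤ n, k * (ν * a n) ≤ 2 * V * (k * (τ * cacc lam Lam * V) + (a 0 - a k) / τ) := by
    intro k
    induction k with
    | zero => intro _; simp
    | succ k ih =>
      intro hk
      have h1 := ih (by omega)
      have h2 := hstep k (by omega)
      have h3 : ν * a n ≤ ν * a (k + 1) := by have := hanti (k + 1) hk; gcongr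
      push_cast
      have e : (a 0 - a (k + 1)) / τ = (a 0 - a k) / τ + (a k - a (k + 1)) / τ := by ring
      rw [e]; linarith
  have hsmall : a n ≤ ν₁ := by
    have h1 := hsum n le_rfl
    have h2 : (a 0 - a n) / τ ≤ V / τ := by
      have : a 0 ≤ V := measureReal_mono
        (inter_subset_left.trans (ball_subset_ball (by norm_num))) measure_ball_lt_top.ne
      have : 0 ≤ a n := measureReal_nonneg
      gcongr; linarith
    have hn0 : 0 < (n : ℝ) := by
      by_contra h'
      have h0 : 0 ≤ 2 * V * V / τ := by positivity
      have : (n : ℝ) * (ν * ν₁ / 2) ≤ 0 :=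
        mul_nonpos_of_nonpos_of_nonneg (not_lt.1 h') (by positivity)
      linarith
    have h3 : 2 * V * ((a 0 - a n) / τ) ≤ 2 * V * (V / τ) := by gcongr
    have h4 : 2 * V * (V / τ) = 2 * V * V / τ := by ring
    have h5 := mul_le_mul_of_nonneg_left hτ1 hn0.le
    have h6 : (n : ℝ) * (ν * a n) ≤ n * (ν * ν₁) := by linarith
    exact le_of_mul_le_mul_left (le_of_mul_le_mul_left h6 hn0) hν
  obtain ⟨d, hd⟩ : ∃ d, d = (1 - κ₀) * (1 / 2) ^ n := ⟨_, rfl⟩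
  have hd0 : 0 < d := hd ▸ hdpos n
  have hdκ : κ₀ ≤ 1 - d := by
    have h1 : ((1 : ℝ) / 2) ^ n ≤ 1 := pow_le_one₀ (by norm_num) (by norm_num)
    rw [hd]; nlinarith
  have hδd : δ = d / 2 := by rw [hδ, hd]
  clear_value δ
  have hsl : IsLip fun x => 2 / d * (s x - (1 - d)) := (h.lip.sub (isLip_const _)).const_mul _
  have hset : ∀ κ : ℝ, {x | κ < 2 / d * (s x - (1 - d))} = {x | 1 - d + κ * d / 2 < s x} := by
    intro κ; ext x; simp only [mem_ofPred_eq]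
    rw [div_mul_eq_mul_div, lt_div_iff₀ hd0]
    constructor <;> intro h' <;> linarith
  have hE : EnergyBound (16 * cacc lam Lam) fun x => 2 / d * (s x - (1 - d)) := by
    intro κ r R hκ hκ1 hr hrR hR
    rw [hset κ]
    have hg : ∀ x, ∇ (fun x => 2 / d * (s x - (1 - d))) x = (2 / d) • ∇ s x := fun x => by
      rw [gradient_const_mul, gradient_sub_const]
    have h1 := h.integral_sq_le hlam hLam (κ := 1 - d + κ * d / 2) (d := d)
      (by have := mul_nonneg hκ hd0.le; linarith) hd0 (by linarith) (by linarith) hrR (by linarith) (by linarith)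
      (fun x hx => by
        have := hs x (ball_subset_ball (by linarith) hx)
        have := mul_nonneg hκ hd0.le; linarith)
    have hRr : 0 < R - r := by linarith
    obtain ⟨M, hM0, hM⟩ := h.lip.exists_norm_gradient_le
    have h2 : ∫ x in ball 0 r ∩ {x | κ < 2 / d * (s x - (1 - d)) ∧ 2 / d * (s x - (1 - d)) < κ + 1},
        ‖∇ (fun x => 2 / d * (s x - (1 - d))) x‖ ^ 2 ≤
        ∫ x in ball 0 r ∩ {x | 1 - d + κ * d / 2 < s x}, (2 / d) ^ 2 * ‖∇ s x‖ ^ 2 := by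
      simp only [hg, norm_smul, norm_of_nonneg (show 0 ≤ 2 / d by positivity), mul_pow]
      refine setIntegral_mono_set (Integrable.const_mul (integrableOn_of_bdd (C := M ^ 2)
        ((measurable_gradient s).norm.pow_const 2) (isBounded_ball.subset inter_subset_left)
        fun x => ?_) _) (.of_forall fun x => by positivity)
        (.of_forall (inter_subset_inter_right _ fun x hx => ?_))
      · rw [abs_of_nonneg (by positivity)]; have := hM x; gcongr
      · have : x ∈ {x | κ < 2 / d * (s x - (1 - d))} := hx.1
        rwa [hset] at this
    refine h2.trans ?_
    rw [integral_const_mul]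
    set I := ∫ x in ball 0 r ∩ {x | 1 - d + κ * d / 2 < s x}, ‖∇ s x‖ ^ 2
    set W := volume.real (ball (0 : Eu N) R ∩ {x | 1 - d + κ * d / 2 < s x})
    have hI : 0 ≤ I := integral_nonneg fun _ => sq_nonneg _
    have h3 : (R - r) ^ 2 / 4 * I ≤ cacc lam Lam * d ^ 2 * W := by
      refine le_trans ?_ h1
      have : (R - r) ^ 2 / 4 ≤ ((R - r) * R) ^ 2 := by
        rw [mul_pow]; nlinarith [sq_nonneg (R - r), mul_nonneg (sq_nonneg (R - r)) (show 0 ≤ R ^ 2 - 1 / 4 by nlinarith)]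
      gcongr
    rw [div_mul_eq_mul_div, le_div_iff₀ (by positivity)]
    have h4 := mul_le_mul_of_nonneg_left h3 (show 0 ≤ 16 / d ^ 2 by positivity)
    calc (2 / d) ^ 2 * I * (R - r) ^ 2 = 16 / d ^ 2 * ((R - r) ^ 2 / 4 * I) := by ring
      _ ≤ _ := h4
      _ = _ := by field_simp
  intro x hx
  have := hsup _ hsl hE (by
    rw [hset 0]
    refine le_trans (le_of_eq ?_) hsmall
    simp only [ha, hd]; simp) x hx
  rw [div_mul_eq_mul_div, div_le_one hd0] at this
  linarith

/-- One step of the oscillation decay. -/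
lemma exists_oscillation_step (N : ℕ) (hlam : 0 < lam) (hLam : 0 ≤ Lam) :
    ∃ m K₀ : ℝ, 1 / 2 ≤ m ∧ m < 1 ∧ 0 < K₀ ∧ ∀ (s : Eu N → ℝ) (F : Eu N → Eu N),
      EllEq lam Lam K₀ (ball 0 3) s F → (∀ x ∈ ball (0 : Eu N) 3, |s x| ≤ 1) →
      ∃ c, ∀ x ∈ ball (0 : Eu N) (1 / 2), |s x - c| ≤ m := by
  set V := volume.real (ball (0 : Eu N) 1) with hV
  have hV0 : 0 < V := by
    rw [hV, measureReal_def]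
    exact ENNReal.toReal_pos (measure_ball_pos _ _ one_pos).ne' measure_ball_lt_top.ne
  obtain ⟨δ, hδ, hdec⟩ := exists_sup_decrease N hlam hLam (zero_lt_one' ℝ)
    (show 0 < V / 2 by positivity)
  refine ⟨1 - min δ 1 / 2, δ, by linarith [min_le_right δ 1], by
    have := lt_min hδ one_pos; linarith, hδ, fun s F h hs => ?_⟩
  have hfin : ∀ B : Set (Eu N), volume (ball (0 : Eu N) 1 ∩ B) ≠ ⊤ := fun B =>
    (isBounded_ball.subset inter_subset_left).measure_lt_top.ne
  have hsub : ∀ {r : ℝ}, r ≤ 3 → ∀ x ∈ ball (0 : Eu N) r, |s x| ≤ 1 := fun hr x hx =>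
    hs x (ball_subset_ball hr hx)
  by_cases hc : V / 2 ≤ volume.real (ball (0 : Eu N) 1 ∩ {x | s x ≤ 0})
  · refine ⟨-(min δ 1 / 2), fun x hx => ?_⟩
    have h1 := hdec s F (h 0) (fun y hy => (abs_le.1 (hsub (by norm_num) y hy)).2) hc x hx
    have h2 := (abs_le.1 (hsub (by norm_num) x hx)).1
    have := min_le_left δ 1
    rw [abs_le]; constructor <;> linarith
  · have hc' : V / 2 ≤ volume.real (ball (0 : Eu N) 1 ∩ {x | -s x ≤ 0}) := by
      have hle : V ≤ volume.real (ball (0 : Eu N) 1 ∩ {x | s x ≤ 0}) +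
          volume.real (ball (0 : Eu N) 1 ∩ {x | -s x ≤ 0}) := by
        refine (measureReal_mono ?_ ?_).trans (measureReal_union_le _ _)
        · intro x hx
          rcases le_total (s x) 0 with h' | h'
          · exact Or.inl ⟨hx, h'⟩
          · exact Or.inr ⟨hx, neg_nonpos.2 h'⟩
        · rw [← inter_union_distrib_left]; exact hfin _
      linarith
    refine ⟨min δ 1 / 2, fun x hx => ?_⟩
    have h1 := hdec _ _ (h.neg 0) (fun y hy => by
      have := (abs_le.1 (hsub (by norm_num) y hy)).1; linarith) hc' x hx
    have h2 := (abs_le.1 (hsub (by norm_num) x hx)).2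
    have := min_le_left δ 1
    rw [abs_le]; constructor <;> linarith

/-- Uniform smallness of the oscillation of solutions of uniformly elliptic equations. -/
theorem exists_oscillation_le (N : ℕ) (hlam : 0 < lam) (hLam : 0 ≤ Lam)
    (hK : 0 ≤ K) (hτ : 0 < τ) : ∃ r : ℝ, 0 < r ∧ r ≤ 1 ∧ ∀ (s : Eu N → ℝ) (F : Eu N → Eu N),
      EllEq lam Lam K (ball 0 3) s F → (∀ x ∈ ball (0 : Eu N) 3, |s x| ≤ 1) →
      ∀ x ∈ ball (0 : Eu N) r, ∀ y ∈ ball (0 : Eu N) r, |s x - s y| ≤ τ := by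
  obtain ⟨m, K₀, hm, hm1, hK₀, hstep⟩ := exists_oscillation_step N hlam hLam
  have hm0 : 0 < m := by linarith
  obtain ⟨ρ, hρ0, hρ1, hρK⟩ : ∃ ρ : ℝ, 0 < ρ ∧ ρ ≤ 1 ∧ K * ρ ≤ K₀ := by
    refine ⟨min 1 (K₀ / (K + 1)), by positivity, min_le_left _ _, ?_⟩
    calc K * min 1 (K₀ / (K + 1)) ≤ (K + 1) * (K₀ / (K + 1)) := by
          gcongr
          · linarith
          · exact min_le_right _ _
      _ = K₀ := by field_simp
  obtain ⟨n, hn⟩ := exists_pow_lt_of_lt_one (show 0 < τ / 2 by positivity) hm1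
  refine ⟨3 * ((1 / 6) ^ (n + 1) * ρ), by positivity, ?_, fun s F h hs => ?_⟩
  · have : ((1 : ℝ) / 6) ^ (n + 1) ≤ 1 / 6 := pow_le_of_le_one (by norm_num) (by norm_num) (by simp)
    nlinarith [mul_le_mul this hρ1 hρ0.le (by norm_num : (0:ℝ) ≤ 1 / 6)]
  have key : ∀ k : ℕ, ∃ c, ∀ x ∈ ball (0 : Eu N) (3 * ((1 / 6) ^ k * ρ)), |s x - c| ≤ m ^ k := by
    intro k
    induction k with
    | zero => exact ⟨0, fun x hx => by
        simpa using hs x (ball_subset_ball (by rw [pow_zero]; linarith) hx)⟩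
    | succ k ih =>
      obtain ⟨c, hc⟩ := ih
      obtain ⟨t, ht⟩ : ∃ t, t = (1 / 6) ^ k * ρ := ⟨_, rfl⟩
      have ht0 : 0 < t := by rw [ht]; positivity
      have hmk : 0 < m ^ k := by positivity
      have ht1 : t ≤ 1 := by
        have : ((1 : ℝ) / 6) ^ k ≤ 1 := pow_le_one₀ (by norm_num) (by norm_num)
        rw [ht]; nlinarith
      rw [← ht] at hc
      have hmem : ∀ y ∈ ball (0 : Eu N) 3, (0 : Eu N) + t • y ∈ ball (0 : Eu N) (3 * t) := by
        intro y hy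
        rw [mem_ball_zero_iff] at hy ⊢
        rw [zero_add, norm_smul, norm_of_nonneg ht0.le]; nlinarith
      have h3t : ball (0 : Eu N) (3 * t) ⊆ ball 0 3 := ball_subset_ball (by linarith)
      have hpre : ball (0 : Eu N) 3 ⊆ (fun y => (0 : Eu N) + t • y) ⁻¹' ball 0 3 :=
        fun y hy => mem_preimage.2 (h3t (hmem y hy))
      have hr : EllEq lam Lam K₀ (ball 0 3) (fun y => (s (0 + t • y) - c) / m ^ k)
          (fun y => (t / m ^ k) • F (0 + t • y)) := (h.rescale 0 ht0 hmk c).mono (by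
        rw [div_le_iff₀ hmk, ht]
        have : ((1 : ℝ) / 6) ^ k ≤ m ^ k := pow_le_pow_left₀ (by norm_num) (by linarith) k
        calc K * ((1 / 6) ^ k * ρ) = (K * ρ) * (1 / 6) ^ k := by ring
          _ ≤ K₀ * m ^ k := by gcongr) hpre
      obtain ⟨c', hc'⟩ := hstep (fun y => (s (0 + t • y) - c) / m ^ k)
        (fun y => (t / m ^ k) • F (0 + t • y)) hr (fun y hy => by
          rw [abs_div, abs_of_pos hmk, div_le_one hmk]; exact hc _ (hmem y hy))
      refine ⟨c + m ^ k * c', fun x hx => ?_⟩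
      have hx' : t⁻¹ • x ∈ ball (0 : Eu N) (1 / 2) := by
        rw [mem_ball_zero_iff] at hx ⊢
        rw [norm_smul, norm_inv, norm_of_nonneg ht0.le, inv_mul_lt_iff₀ ht0]
        rw [pow_succ, mul_right_comm, ← ht] at hx; linarith
      have := hc' _ hx'
      simp only [zero_add, smul_smul, mul_inv_cancel₀ ht0.ne', one_smul] at this
      have e : s x - (c + m ^ k * c') = m ^ k * ((s x - c) / m ^ k - c') := by field_simp; ring
      rw [e, abs_mul, abs_of_pos hmk, pow_succ]
      gcongr
  obtain ⟨c, hc⟩ := key (n + 1)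
  intro x hx y hy
  have h1 := hc x hx
  have h2 := hc y hy
  have h3 : m ^ (n + 1) ≤ m ^ n := pow_le_pow_of_le_one hm0.le hm1.le (by simp)
  rw [abs_le] at *
  constructor <;> linarith [h1.1, h1.2, h2.1, h2.2]

/-- The regularised flux `(ε + |ξ|²)^{(p-2)/2} ξ`. -/
def flux (p ε : ℝ) (ξ : Eu N) : Eu N := (ε + ‖ξ‖ ^ 2) ^ ((p - 2) / 2) • ξ

lemma continuous_flux (hε : 0 < ε) : Continuous (flux p ε : Eu N → Eu N) := by
  unfold flux
  refine Continuous.smul (Continuous.rpow_const (by fun_prop) fun ξ => Or.inl ?_) continuous_id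
  positivity

lemma measurable_flux (p ε : ℝ) : Measurable (flux p ε : Eu N → Eu N) := by
  unfold flux; fun_prop

lemma norm_flux_le (hε : 0 < ε) (ξ : Eu N) :
    ‖flux p ε ξ‖ ≤ (ε + ‖ξ‖ ^ 2) ^ ((p - 1) / 2) := by
  have hb : 0 < ε + ‖ξ‖ ^ 2 := by positivity
  rw [flux, norm_smul, norm_of_nonneg (by positivity)]
  have h1 : ‖ξ‖ ≤ (ε + ‖ξ‖ ^ 2) ^ ((1 : ℝ) / 2) := by
    rw [← sqrt_eq_rpow]
    exact le_sqrt_of_sq_le (by linarith)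
  calc _ ≤ (ε + ‖ξ‖ ^ 2) ^ ((p - 2) / 2) * (ε + ‖ξ‖ ^ 2) ^ ((1 : ℝ) / 2) := by gcongr
    _ = _ := by rw [← rpow_add hb]; congr 1; ring

lemma norm_flux_le_of_norm_le (hp : 1 < p) (hε : 0 < ε) (h : ‖ξ‖ ≤ M) :
    ‖flux p ε ξ‖ ≤ (ε + M ^ 2) ^ ((p - 1) / 2) :=
  (norm_flux_le hε ξ).trans
    (rpow_le_rpow (by positivity) (by gcongr) (by linarith))

lemma flux_smul (hm : 0 < m) (hε : 0 < ε) (ξ : Eu N) :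
    flux p ε (m • ξ) = m ^ (p - 1) • flux p (ε / m ^ 2) ξ := by
  have h : ε + ‖m • ξ‖ ^ 2 = m ^ 2 * (ε / m ^ 2 + ‖ξ‖ ^ 2) := by
    rw [norm_smul, norm_of_nonneg hm.le]; field_simp
  rw [flux, flux, h, mul_rpow (by positivity) (by positivity), smul_smul, smul_smul]
  congr 1
  rw [← rpow_natCast, ← rpow_mul hm.le, mul_right_comm]
  congr 1
  rw [show p - 1 = ((2 : ℕ) : ℝ) * ((p - 2) / 2) + 1 by push_cast; ring, rpow_add hm,
    rpow_one]

lemma hasDerivAt_flux (hε : 0 < ε) (ξ η : Eu N) (t : ℝ) :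
    HasDerivAt (fun t : ℝ => flux p ε (ξ + t • η)) ((ε + ‖ξ + t • η‖ ^ 2) ^ ((p - 2) / 2) • η +
        ((p - 2) * (ε + ‖ξ + t • η‖ ^ 2) ^ ((p - 2) / 2 - 1) * ⟪ξ + t • η, η⟫) • (ξ + t • η)) t := by
  have h1 : HasDerivAt (fun t : ℝ => ξ + t • η) η t := by
    simpa using ((hasDerivAt_id t).smul_const η).const_add ξ
  have h2 : HasDerivAt (fun t : ℝ => ε + ‖ξ + t • η‖ ^ 2) (2 * ⟪ξ + t • η, η⟫) t := by
    simpa using (h1.norm_sq).const_add ε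
  have hb : ε + ‖ξ + t • η‖ ^ 2 ≠ 0 := by positivity
  have h3 := (h2.rpow_const (p := (p - 2) / 2) (Or.inl hb)).smul h1
  refine h3.congr_deriv ?_
  congr 2; ring

/-- The flux is elliptic with constants `lam`, `Lam` on `S`. -/
def FluxEll (p ε lam Lam : ℝ) (S : Set (Eu N)) : Prop :=
  ∀ ξ ∈ S, ∀ ζ ∈ S, lam * ‖ζ - ξ‖ ^ 2 ≤ ⟪flux p ε ζ - flux p ε ξ, ζ - ξ⟫ ∧
    ‖flux p ε ζ - flux p ε ξ‖ ≤ Lam * ‖ζ - ξ‖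

lemma fluxEll_of_convex {l u : ℝ} (hp : 1 < p) (hε : 0 < ε) {S : Set (Eu N)}
    (hS : Convex ℝ S) (hl : ∀ z ∈ S, l ≤ (ε + ‖z‖ ^ 2) ^ ((p - 2) / 2))
    (hu : ∀ z ∈ S, (ε + ‖z‖ ^ 2) ^ ((p - 2) / 2) ≤ u) :
    FluxEll p ε (min 1 (p - 1) * l) ((1 + |p - 2|) * u) S := by
  intro ξ hξ ζ hζ
  obtain ⟨η, hη⟩ : ∃ η, η = ζ - ξ := ⟨_, rfl⟩
  rw [← hη]
  have hseg : ∀ t ∈ Icc (0 : ℝ) 1, ξ + t • η ∈ S := fun t ht => by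
    rw [hη]; exact hS.add_smul_sub_mem hξ hζ ht
  have hend : flux p ε ζ - flux p ε ξ = flux p ε (ξ + (1 : ℝ) • η) - flux p ε (ξ + (0 : ℝ) • η) := by
    rw [hη]; simp
  have hbpos : ∀ t : ℝ, 0 < ε + ‖ξ + t • η‖ ^ 2 := fun t => by positivity
  have hcs : ∀ t : ℝ, ⟪ξ + t • η, η⟫ ^ 2 ≤ (ε + ‖ξ + t • η‖ ^ 2) * ‖η‖ ^ 2 := fun t => by
    have h1 := abs_real_inner_le_norm (ξ + t • η) η
    have h2 : ⟪ξ + t • η, η⟫ ^ 2 ≤ (‖ξ + t • η‖ * ‖η‖) ^ 2 := sq_le_sq' (by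
      linarith [(abs_le.1 h1).1]) (abs_le.1 h1).2
    nlinarith [sq_nonneg ‖η‖]
  have hpow : ∀ t : ℝ, (ε + ‖ξ + t • η‖ ^ 2) ^ ((p - 2) / 2 - 1) =
      (ε + ‖ξ + t • η‖ ^ 2) ^ ((p - 2) / 2) / (ε + ‖ξ + t • η‖ ^ 2) := fun t =>
    rpow_sub_one (hbpos t).ne' _
  constructor
  · have hd : ∀ t : ℝ, HasDerivAt (fun t : ℝ => ⟪flux p ε (ξ + t • η), η⟫)
        ⟪(ε + ‖ξ + t • η‖ ^ 2) ^ ((p - 2) / 2) • η +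
        ((p - 2) * (ε + ‖ξ + t • η‖ ^ 2) ^ ((p - 2) / 2 - 1) * ⟪ξ + t • η, η⟫) • (ξ + t • η), η⟫
        t := fun t => by
      have := (hasDerivAt_flux (p := p) hε ξ η t).inner ℝ (hasDerivAt_const t η)
      simp only [inner_zero_right, zero_add] at this
      exact this
    obtain ⟨c, hc, hceq⟩ := exists_hasDerivAt_eq_slope _ _ (zero_lt_one' ℝ)
      (fun t _ => (hd t).continuousAt.continuousWithinAt) (fun t _ => hd t)
    rw [hend, inner_sub_left]
    simp only [sub_zero, div_one] at hceq
    rw [← hceq, inner_add_left, inner_smul_left, inner_smul_left, hpow c,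
      real_inner_self_eq_norm_sq]
    simp only [conj_trivial]
    have h1 := hl _ (hseg c ⟨hc.1.le, hc.2.le⟩)
    have h2 := hcs c
    have hb := hbpos c
    set b := ε + ‖ξ + c • η‖ ^ 2
    set B := b ^ ((p - 2) / 2)
    have hB : 0 < B := by positivity
    set y := ⟪ξ + c • η, η⟫
    have h3 : y ^ 2 / b ≤ ‖η‖ ^ 2 := by rw [div_le_iff₀ hb]; linarith
    have h4 : 0 ≤ y ^ 2 / b := by positivity
    have h5 : min 1 (p - 1) * ‖η‖ ^ 2 ≤ ‖η‖ ^ 2 + (p - 2) * (y ^ 2 / b) := by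
      rcases le_total 2 p with h | h
      · have : min 1 (p - 1) * ‖η‖ ^ 2 ≤ 1 * ‖η‖ ^ 2 := by gcongr; exact min_le_left _ _
        nlinarith
      · have : min 1 (p - 1) * ‖η‖ ^ 2 ≤ (p - 1) * ‖η‖ ^ 2 := by gcongr; exact min_le_right _ _
        nlinarith
    have h0 : 0 ≤ min 1 (p - 1) * ‖η‖ ^ 2 :=
      mul_nonneg (le_min zero_le_one (by linarith)) (by positivity)
    calc min 1 (p - 1) * l * ‖η‖ ^ 2 = l * (min 1 (p - 1) * ‖η‖ ^ 2) := by ring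
      _ ≤ B * (min 1 (p - 1) * ‖η‖ ^ 2) := by gcongr
      _ ≤ B * (‖η‖ ^ 2 + (p - 2) * (y ^ 2 / b)) := by gcongr
      _ = _ := by ring
  · rw [hend]
    refine norm_image_sub_le_of_norm_deriv_le_segment_01' (f := fun t : ℝ => flux p ε (ξ + t • η))
      (fun t _ => (hasDerivAt_flux (p := p) hε ξ η t).hasDerivWithinAt) fun t ht => ?_
    have h1 := hu _ (hseg t ⟨ht.1, ht.2.le⟩)
    have hb := hbpos t
    have h2 := abs_real_inner_le_norm (ξ + t • η) η
    have h6 : ‖ξ + t • η‖ ^ 2 ≤ ε + ‖ξ + t • η‖ ^ 2 := by linarith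
    refine (norm_add_le _ _).trans ?_
    rw [norm_smul, norm_smul, hpow t, norm_eq_abs, norm_eq_abs, abs_mul, abs_mul, abs_div]
    set z := ‖ξ + t • η‖
    set b := ε + z ^ 2
    set B := b ^ ((p - 2) / 2)
    have hB : 0 < B := by positivity
    have hz : 0 ≤ z := norm_nonneg _
    rw [abs_of_pos hB, abs_of_pos hb]
    have h3 : |p - 2| * (B / b) * |⟪ξ + t • η, η⟫| * z ≤ |p - 2| * (B / b) * (z * ‖η‖) * z := by
      gcongr
    have h4 : |p - 2| * (B / b) * (z * ‖η‖) * z = |p - 2| * B * ‖η‖ * (z ^ 2 / b) := by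
      field_simp
    have h5 : z ^ 2 / b ≤ 1 := by rw [div_le_one hb]; linarith
    have h7 : |p - 2| * B * ‖η‖ * (z ^ 2 / b) ≤ |p - 2| * B * ‖η‖ * 1 := by gcongr
    have h8 : (1 + |p - 2|) * B * ‖η‖ ≤ (1 + |p - 2|) * u * ‖η‖ := by gcongr
    linarith

lemma rpow_bounds {b q : ℝ} (hm : 0 < m) (h1 : m ≤ b) (h2 : b ≤ M) :
    min (m ^ q) (M ^ q) ≤ b ^ q ∧ b ^ q ≤ max (m ^ q) (M ^ q) := by
  have hb := hm.trans_le h1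
  rcases le_total 0 q with hq | hq
  · exact ⟨(min_le_left _ _).trans (rpow_le_rpow hm.le h1 hq),
      (rpow_le_rpow hb.le h2 hq).trans (le_max_right _ _)⟩
  · exact ⟨(min_le_right _ _).trans (rpow_le_rpow_of_nonpos hb h2 hq),
      (rpow_le_rpow_of_nonpos hm h1 hq).trans (le_max_left _ _)⟩

/-- Ellipticity constants of the flux on a convex set where `m ≤ ε + |ξ|² ≤ M`. -/
def lamOf (p m M : ℝ) : ℝ := min 1 (p - 1) * min (m ^ ((p - 2) / 2)) (M ^ ((p - 2) / 2))

/-- Upper ellipticity constant, see `lamOf`. -/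
def LamOf (p m M : ℝ) : ℝ := (1 + |p - 2|) * max (m ^ ((p - 2) / 2)) (M ^ ((p - 2) / 2))

lemma lamOf_pos (hp : 1 < p) (hm : 0 < m) (hM : 0 < M) : 0 < lamOf p m M :=
  mul_pos (lt_min one_pos (by linarith)) (lt_min (by positivity) (by positivity))

lemma LamOf_nonneg (hm : 0 < m) : 0 ≤ LamOf p m M :=
  mul_nonneg (by positivity) (le_max_of_le_left (by positivity))

lemma fluxEll_of_bounds (hp : 1 < p) (hε : 0 < ε) (hm : 0 < m) {S : Set (Eu N)}
    (hS : Convex ℝ S) (h : ∀ z ∈ S, m ≤ ε + ‖z‖ ^ 2 ∧ ε + ‖z‖ ^ 2 ≤ M) :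
    FluxEll p ε (lamOf p m M) (LamOf p m M) S :=
  fluxEll_of_convex hp hε hS (fun z hz => (rpow_bounds hm (h z hz).1 (h z hz).2).1)
    fun z hz => (rpow_bounds hm (h z hz).1 (h z hz).2).2

/-- A globally Lipschitz function solving `-div (flux p ε ∇w) = k` in `U`, with `|k| ≤ K`. -/
structure Sol (p ε K : ℝ) (U : Set (Eu N)) (w k : Eu N → ℝ) : Prop where
  lip : IsLip w
  meas : Measurable k
  bdd : ∀ x, |k x| ≤ K
  eqn : ∀ φ, LipTest U φ → ∫ x, ⟪flux p ε (∇ w x), ∇ φ x⟫ = ∫ x, k x * φ x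

lemma gradient_affine_sub_div (w : Eu N → ℝ) (c : Eu N) (hr : r ≠ 0) (m b : ℝ) (y : Eu N) :
    ∇ (fun y => (w (c + r • y) - b) / m) y = (r / m) • ∇ w (c + r • y) := by
  have e : (fun y => (w (c + r • y) - b) / m) = fun y => m⁻¹ * (w (c + r • y) - b) := by
    ext y; rw [div_eq_inv_mul]
  rw [e, gradient_const_mul, gradient_sub_const, gradient_comp_affine w c y hr, smul_smul]
  congr 1; field_simp

lemma exists_lipTest_pullback (hr : 0 < r) (hφ : LipTest ((fun y => c + r • y) ⁻¹' U) φ) :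
    ∃ ψ, LipTest U ψ ∧ (∀ y, φ y = ψ (c + r • y)) ∧
      ∀ y, ∇ φ y = r • ∇ ψ (c + r • y) := by
  have hri : r⁻¹ ≠ 0 := inv_ne_zero hr.ne'
  have hback : ∀ y : Eu N, -(r⁻¹ • c) + r⁻¹ • (c + r • y) = y := fun y => by
    rw [smul_add, smul_smul, inv_mul_cancel₀ hr.ne', one_smul]; abel
  have hback' : ∀ x : Eu N, c + r • (-(r⁻¹ • c) + r⁻¹ • x) = x := fun x => by
    rw [smul_add, smul_neg, smul_smul, smul_smul, mul_inv_cancel₀ hr.ne', one_smul, one_smul]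
    abel
  refine ⟨fun x => φ (-(r⁻¹ • c) + r⁻¹ • x), ?_, fun y => by simp only [hback], fun y => ?_⟩
  · refine (hφ.comp_affine (-(r⁻¹ • c)) hri).mono fun x hx => ?_
    rwa [mem_preimage, mem_preimage, hback'] at hx
  · rw [gradient_comp_affine φ _ _ hri, hback, smul_smul, mul_inv_cancel₀ hr.ne', one_smul]

lemma Sol.mono (h : Sol p ε K U w k) (hK : K ≤ K') (hV : V ⊆ U) : Sol p ε K' V w k:=
  ⟨h.lip, h.meas, fun x => (h.bdd x).trans hK, fun φ hφ => h.eqn φ (hφ.mono hV)⟩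

lemma Sol.rescale (h : Sol p ε K U w k) (hε : 0 < ε) (c : Eu N) (hr : 0 < r) (hm : 0 < m) (b : ℝ) :
    Sol p (ε / m ^ 2) (K * r / m ^ (p - 1)) ((fun y => c + r • y) ⁻¹' U)
      (fun y => (w (c + r • y) - b) / (r * m)) (fun y => r / m ^ (p - 1) * k (c + r • y)) := by
  have hmp : 0 < m ^ (p - 1) := by positivity
  refine ⟨?_, ?_, fun x => ?_, fun φ hφ => ?_⟩
  · have e : (fun y => (w (c + r • y) - b) / (r * m)) =
        fun y => (r * m)⁻¹ * (w (c + r • y) - b) := by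
      ext y; rw [div_eq_inv_mul]
    rw [e]
    exact ((h.lip.comp_affine c r).sub (isLip_const b)).const_mul _
  · exact (h.meas.comp (by fun_prop)).const_mul _
  · rw [abs_mul, abs_of_pos (by positivity), mul_comm]
    have := h.bdd (c + r • x)
    calc _ ≤ K * (r / m ^ (p - 1)) := by gcongr
      _ = _ := by ring
  · obtain ⟨ψ, hψ, h1, h2⟩ := exists_lipTest_pullback hr hφ
    have e1 : ∫ y, ⟪flux p (ε / m ^ 2) (∇ (fun y => (w (c + r • y) - b) / (r * m)) y),
        ∇ φ y⟫ = r / m ^ (p - 1) *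
          (|(r ^ N)⁻¹| * ∫ x, ⟪flux p ε (∇ w x), ∇ ψ x⟫) := by
      rw [← integral_comp_affine (fun x => ⟪flux p ε (∇ w x), ∇ ψ x⟫) c r,
        ← integral_const_mul]
      refine integral_congr_ae (.of_forall fun y => ?_)
      simp only [h2, gradient_affine_sub_div w c hr.ne']
      have e3 : flux p ε (∇ w (c + r • y)) = m ^ (p - 1) •
          flux p (ε / m ^ 2) ((r / (r * m)) • ∇ w (c + r • y)) := by
        rw [← flux_smul hm hε, smul_smul,
          show m * (r / (r * m)) = 1 by field_simp, one_smul]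
      rw [e3, inner_smul_left, inner_smul_right]
      simp only [conj_trivial]
      field_simp
    have e2 : ∫ y, r / m ^ (p - 1) * k (c + r • y) * φ y =
        r / m ^ (p - 1) * (|(r ^ N)⁻¹| * ∫ x, k x * ψ x) := by
      rw [← integral_comp_affine (fun x => k x * ψ x) c r, ← integral_const_mul]
      refine integral_congr_ae (.of_forall fun y => ?_)
      simp only [h1]; ring
    rw [e1, e2, h.eqn ψ hψ]

lemma Sol.measurable_flux (_h : Sol p ε K U w k) :
    Measurable fun x => flux p ε (∇ w x) :=
  (_root_.measurable_flux p ε).comp (measurable_gradient w)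

lemma Sol.exists_flux_le (h : Sol p ε K U w k)
    (hp : 1 < p) (hε : 0 < ε) : ∃ C, ∀ x, ‖flux p ε (∇ w x)‖ ≤ C := by
  obtain ⟨L, -, hL'⟩ := h.lip.exists_norm_gradient_le
  exact ⟨_, fun x => norm_flux_le_of_norm_le hp hε (hL' x)⟩

lemma IsLip.integral_abs_sub_le (hφ : IsLip φ) (hc : HasCompactSupport φ)
    (y : Eu N) : ∫ x, |φ (x + y) - φ x| ≤ ‖y‖ * ∫ x, ‖∇ φ x‖ := by
  have h := hφ.lintegral_enorm_sub_le y (A := univ) (B := univ) MeasurableSet.univ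
    MeasurableSet.univ (fun _ _ _ _ => mem_univ _)
  simp only [Measure.restrict_univ] at h
  have hi := hφ.integrable_norm_gradient hc
  have e1 : ∫⁻ x, ‖∇ φ x‖ₑ = ENNReal.ofReal (∫ x, ‖∇ φ x‖) := by
    rw [ofReal_integral_eq_lintegral_ofReal hi (.of_forall fun _ => norm_nonneg _)]
    simp only [ofReal_norm]
  have hcont : Continuous fun x => φ (x + y) - φ x :=
    (hφ.comp_add y).continuous.sub hφ.continuous
  have e2 : ∫ x, |φ (x + y) - φ x| = (∫⁻ x, ‖φ (x + y) - φ x‖ₑ).toReal := by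
    rw [integral_eq_lintegral_of_nonneg_ae (.of_forall fun _ => abs_nonneg _)
      hcont.abs.aestronglyMeasurable]
    congr 1
    refine lintegral_congr fun x => ?_
    rw [← norm_eq_abs, ofReal_norm]
  rw [e1, ← ofReal_norm, ← ENNReal.ofReal_mul (norm_nonneg _)] at h
  rw [e2]
  exact ENNReal.toReal_le_of_le_ofReal (mul_nonneg (norm_nonneg _)
    (integral_nonneg fun _ => norm_nonneg _)) h

lemma LipTest.comp_add (h : LipTest V φ) (y : Eu N)
    (hV : ∀ x, x + y ∈ V → x ∈ U) : LipTest U fun x => φ (x + y) := by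
  have h1 := h.comp_affine y (r := 1) one_ne_zero
  have e : (fun x => φ (y + (1 : ℝ) • x)) = fun x => φ (x + y) := by
    ext x; rw [one_smul, add_comm]
  rw [e] at h1
  refine h1.mono fun x hx => hV x ?_
  rwa [mem_preimage, one_smul, add_comm] at hx

lemma LipTest.sub (h : LipTest U φ) (h' : LipTest U ψ) :
    LipTest U fun x => φ x - ψ x :=
  ⟨h.1.sub h'.1, h.2.1.sub h'.2.1,
    (tsupport_sub φ ψ).trans (union_subset h.2.2 h'.2.2)⟩

/-- The difference quotient of the equation. -/
lemma Sol.abs_integral_diff_le (h : Sol p ε K U w k) (hp : 1 < p) (hε : 0 < ε) (hVU : V ⊆ U)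
    (hV : ∀ x ∈ V, x + y ∈ U) (hφ : LipTest V φ) :
    |∫ x, ⟪flux p ε (∇ w (x + y)) - flux p ε (∇ w x), ∇ φ x⟫| ≤
      K * ‖y‖ * ∫ x, ‖∇ φ x‖ := by
  obtain ⟨C, hC⟩ := h.exists_flux_le hp hε
  have hφ1 : LipTest U fun x => φ (x + -y) := hφ.comp_add (-y) fun x hx => by
    simpa using hV _ hx
  have i1 := hφ1.integrable_inner h.measurable_flux hC
  have i2 := (hφ.mono hVU).integrable_inner h.measurable_flux hC
  have i3 := hφ.integrable_inner (F := fun x => flux p ε (∇ w (x + y)))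
    (h.measurable_flux.comp (measurable_add_const y)) (fun x => hC _)
  have j1 := hφ1.integrable_mul h.meas h.bdd
  have j2 := (hφ.mono hVU).integrable_mul h.meas h.bdd
  have e1 : ∫ x, ⟪flux p ε (∇ w (x + y)), ∇ φ x⟫ = ∫ x, k x * φ (x + -y) := by
    rw [← h.eqn _ hφ1]
    rw [← integral_add_right_eq_self
      (fun x => ⟪flux p ε (∇ w x), ∇ (fun x => φ (x + -y)) x⟫) y]
    simp only [gradient_comp_add, add_neg_cancel_right]
  have e2 : ∫ x, ⟪flux p ε (∇ w (x + y)) - flux p ε (∇ w x), ∇ φ x⟫ =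
      ∫ x, k x * (φ (x + -y) - φ x) := by
    simp only [inner_sub_left, mul_sub]
    rw [integral_sub i3 i2, integral_sub j1 j2, e1, h.eqn φ (hφ.mono hVU)]
  have hK : 0 ≤ K := (abs_nonneg _).trans (h.bdd 0)
  have hint : Integrable fun x => |φ (x + -y) - φ x| := by
    have hc := (hφ1.sub (hφ.mono hVU))
    exact (hc.1.continuous.integrable_of_hasCompactSupport hc.2.1).abs
  rw [e2]
  calc |∫ x, k x * (φ (x + -y) - φ x)| ≤ ∫ x, |k x * (φ (x + -y) - φ x)| := abs_integral_le_integral_abs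
    _ ≤ ∫ x, K * |φ (x + -y) - φ x| := by
        refine integral_mono_of_nonneg (.of_forall fun _ => abs_nonneg _)
          (hint.const_mul K) (.of_forall fun x => ?_)
        simp only [abs_mul]
        exact mul_le_mul_of_nonneg_right (h.bdd x) (abs_nonneg _)
    _ = K * ∫ x, |φ (x + -y) - φ x| := integral_const_mul _ _
    _ ≤ K * (‖-y‖ * ∫ x, ‖∇ φ x‖) := by
        gcongr; exact hφ.1.integral_abs_sub_le hφ.2.1 (-y)
    _ = _ := by rw [norm_neg]; ring

/-- The difference quotient of `w` in direction `e`. -/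
def dq (h : ℝ) (e : Eu N) (w : Eu N → ℝ) (x : Eu N) : ℝ := (w (x + h • e) - w x) / h

/-- The difference quotient of the flux of `w`. -/
def dqFlux (p ε h : ℝ) (e : Eu N) (w : Eu N → ℝ) (x : Eu N) : Eu N :=
  h⁻¹ • (flux p ε (∇ w (x + h • e)) - flux p ε (∇ w x))

lemma isLip_dq (hw : IsLip w) (h : ℝ) (e : Eu N) : IsLip (dq h e w) := by
  have e1 : dq h e w = fun x => h⁻¹ * (w (x + h • e) - w x) := by
    ext x; rw [dq, div_eq_inv_mul]
  rw [e1]; exact ((hw.comp_add _).sub hw).const_mul _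

lemma gradient_dq_ae (hw : IsLip w) (h : ℝ) (e : Eu N) :
    ∀ᵐ x, ∇ (dq h e w) x = h⁻¹ • (∇ w (x + h • e) - ∇ w x) := by
  have e1 : dq h e w = fun x => h⁻¹ * (w (x + h • e) - w x) := by
    ext x; rw [dq, div_eq_inv_mul]
  filter_upwards [hw.hasGradientAt_ae, (hw.comp_add (h • e)).hasGradientAt_ae] with x h1 h2
  rw [gradient_comp_add] at h2
  rw [e1]
  exact ((h2.sub' h1).const_mul' _).gradient

lemma measurable_dqFlux (p ε h : ℝ) (e : Eu N) (w : Eu N → ℝ) :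
    Measurable (dqFlux p ε h e w) := by
  have h1 : Measurable fun x => flux p ε (∇ w x) :=
    (measurable_flux p ε).comp (measurable_gradient w)
  exact ((h1.comp (measurable_add_const (h • e))).sub h1).const_smul h⁻¹

lemma Sol.exists_dqFlux_le (hw : Sol p ε K U w k)
    (hp : 1 < p) (hε : 0 < ε) (h : ℝ) (e : Eu N) : ∃ C, ∀ x, ‖dqFlux p ε h e w x‖ ≤ C := by
  obtain ⟨C, hC⟩ := hw.exists_flux_le hp hε
  refine ⟨|h⁻¹| * (C + C), fun x => ?_⟩
  rw [dqFlux, norm_smul, norm_eq_abs]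
  gcongr
  exact (norm_sub_le _ _).trans (add_le_add (hC _) (hC _))

lemma Sol.abs_integral_dqFlux_le (hw : Sol p ε K U w k) (hp : 1 < p) (hε : 0 < ε) (hh : 0 < h)
    (he : ‖e‖ = 1) (hVU : V ⊆ U) (hV : ∀ x ∈ V, x + h • e ∈ U) (hφ : LipTest V φ) :
    |∫ x, ⟪dqFlux p ε h e w x, ∇ φ x⟫| ≤ K * ∫ x, ‖∇ φ x‖ := by
  have h1 := hw.abs_integral_diff_le hp hε hVU hV hφ
  have h2 : ∫ x, ⟪dqFlux p ε h e w x, ∇ φ x⟫ =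
      h⁻¹ * ∫ x, ⟪flux p ε (∇ w (x + h • e)) - flux p ε (∇ w x), ∇ φ x⟫ := by
    rw [← integral_const_mul]
    simp only [dqFlux, inner_smul_left, conj_trivial]
  rw [h2, abs_mul, abs_of_pos (inv_pos.2 hh), inv_mul_le_iff₀ hh]
  rw [norm_smul, he, norm_of_nonneg hh.le] at h1
  linarith

lemma dqFlux_ell {S : Set (Eu N)} (hS : FluxEll p ε lam Lam S) (hh : 0 < h)
    {g : Eu N} (hg : g = h⁻¹ • (∇ w (x + h • e) - ∇ w x))
    (h1 : ∇ w x ∈ S) (h2 : ∇ w (x + h • e) ∈ S) :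
    lam * ‖g‖ ^ 2 ≤ ⟪dqFlux p ε h e w x, g⟫ ∧ ‖dqFlux p ε h e w x‖ ≤ Lam * ‖g‖ := by
  obtain ⟨h3, h4⟩ := hS _ h1 _ h2
  have hi := inv_pos.2 hh
  rw [hg, dqFlux, inner_smul_left, inner_smul_right, norm_smul, norm_smul,
    norm_of_nonneg hi.le]
  simp only [conj_trivial]
  constructor
  · have := mul_le_mul_of_nonneg_left h3 (mul_pos hi hi).le
    nlinarith
  · have := mul_le_mul_of_nonneg_left h4 hi.le
    nlinarith

lemma Sol.ellData {S : Set (Eu N)} (hw : Sol p ε K U w k) (hp : 1 < p) (hε : 0 < ε) (hh : 0 < h)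
    (he : ‖e‖ = 1) (hVU : V ⊆ U) (hV : ∀ x ∈ V, x + h • e ∈ U) (hS : FluxEll p ε lam Lam S)
    (hs : ∀ᵐ x, x ∈ V → κ₀ < dq h e w x → ∇ w x ∈ S ∧ ∇ w (x + h • e) ∈ S) :
    EllData lam Lam K V κ₀ (dq h e w) (dqFlux p ε h e w) := by
  refine ⟨isLip_dq hw.lip h e, measurable_dqFlux p ε h e w, hw.exists_dqFlux_le hp hε h e, ?_,
    fun φ hφ => hw.abs_integral_dqFlux_le hp hε hh he hVU hV hφ⟩
  filter_upwards [hs, gradient_dq_ae hw.lip h e] with x h1 h2 hxV hxκ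
  obtain ⟨h3, h4⟩ := h1 hxV hxκ
  exact dqFlux_ell hS hh h2 h3 h4

lemma ContDiffOn.continuousOn_gradient (h : ContDiffOn ℝ 1 w U)
    (hU : IsOpen U) : ContinuousOn (∇ w) U :=
  (InnerProductSpace.toDual ℝ (Eu N)).symm.continuous.comp_continuousOn
    (h.continuousOn_fderiv_of_isOpen hU le_rfl)

lemma ContDiffOn.hasGradientAt (h : ContDiffOn ℝ 1 w U)
    (hU : IsOpen U) (hx : x ∈ U) : HasGradientAt w (∇ w x) x :=
  ((h.differentiableOn one_ne_zero).differentiableAt (hU.mem_nhds hx)).hasGradientAt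

lemma exists_sub_eq_inner_gradient (hU : Convex ℝ U)
    (hw : ∀ x ∈ U, HasGradientAt w (∇ w x) x) (hx : x ∈ U) (hy : x + y ∈ U) :
    ∃ θ ∈ Ioo (0 : ℝ) 1, x + θ • y ∈ U ∧ w (x + y) - w x = ⟪∇ w (x + θ • y), y⟫ := by
  have hseg : ∀ t ∈ Icc (0 : ℝ) 1, x + t • y ∈ U := fun t ht => hU.add_smul_mem hx hy ht
  have hd : ∀ t ∈ Icc (0 : ℝ) 1, HasDerivAt (fun t : ℝ => w (x + t • y))
      ⟪∇ w (x + t • y), y⟫ t := by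
    intro t ht
    have h1 : HasDerivAt (fun t : ℝ => x + t • y) y t := by
      simpa using ((hasDerivAt_id t).smul_const y).const_add x
    have h2 := (hasGradientAt_iff_hasFDerivAt.1 (hw _ (hseg t ht))).comp_hasDerivAt t h1
    rwa [InnerProductSpace.toDual_apply_apply] at h2
  obtain ⟨θ, hθ, h⟩ := exists_hasDerivAt_eq_slope (fun t : ℝ => w (x + t • y)) _ (zero_lt_one' ℝ)
    (fun t ht => (hd t ht).continuousAt.continuousWithinAt) fun t ht => hd t ⟨ht.1.le, ht.2.le⟩
  refine ⟨θ, hθ, hseg θ ⟨hθ.1.le, hθ.2.le⟩, ?_⟩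
  rw [h]; simp

lemma exists_uniform_dq (hw : ContDiffOn ℝ 1 w (ball 0 4)) (hτ : 0 < τ) :
    ∃ h₀, 0 < h₀ ∧ h₀ ≤ 1 / 2 ∧ ∀ h, 0 < h → h < h₀ → ∀ e : Eu N, ‖e‖ = 1 → ∀ x ∈ ball (0 : Eu N) 3,
      |dq h e w x - ⟪∇ w x, e⟫| ≤ τ ∧ ‖∇ w (x + h • e) - ∇ w x‖ ≤ τ := by
  have hsub : closedBall (0 : Eu N) (7 / 2) ⊆ ball 0 4 := closedBall_subset_ball (by norm_num)
  have huc := (isCompact_closedBall (0 : Eu N) (7 / 2)).uniformContinuousOn_of_continuous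
    ((hw.continuousOn_gradient isOpen_ball).mono hsub)
  rw [Metric.uniformContinuousOn_iff] at huc
  obtain ⟨d, hd, hd'⟩ := huc τ hτ
  have key : ∀ t, 0 ≤ t → t < min d (1 / 2) → ∀ e : Eu N, ‖e‖ = 1 → ∀ x ∈ ball (0 : Eu N) 3,
      ‖∇ w (x + t • e) - ∇ w x‖ ≤ τ := by
    intro t ht htd e he x hx
    rw [mem_ball_zero_iff] at hx
    have hte : ‖t • e‖ = t := by rw [norm_smul, he, norm_of_nonneg ht, mul_one]
    rw [← dist_eq_norm]
    refine (hd' _ ?_ _ ?_ ?_).le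
    · rw [mem_closedBall_zero_iff]
      have := norm_add_le x (t • e)
      have := min_le_right d (1 / 2)
      linarith
    · rw [mem_closedBall_zero_iff]; linarith
    · rw [dist_eq_norm, add_sub_cancel_left, hte]; exact htd.trans_le (min_le_left _ _)
  refine ⟨min d (1 / 2), lt_min hd (by norm_num), min_le_right _ _, fun h hh hh0 e he x hx =>
    ⟨?_, key h hh.le hh0 e he x hx⟩⟩
  have hx' := mem_ball_zero_iff.1 hx
  have hh1 := hh0.trans_le (min_le_right _ _)
  obtain ⟨θ, hθ, -, h2⟩ := exists_sub_eq_inner_gradient (convex_ball (0 : Eu N) 4)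
    (fun x hx => hw.hasGradientAt isOpen_ball hx) (x := x) (y := h • e)
    (ball_subset_ball (by norm_num) hx) (by
      rw [mem_ball_zero_iff]
      have := norm_add_le x (h • e)
      rw [norm_smul, he, norm_of_nonneg hh.le, mul_one] at this
      linarith)
  rw [dq, h2, inner_smul_right, mul_div_cancel_left₀ _ hh.ne', ← inner_sub_left, smul_smul]
  refine (abs_real_inner_le_norm _ _).trans ?_
  rw [he, mul_one]
  exact key _ (mul_nonneg hθ.1.le hh.le) (lt_of_le_of_lt (by nlinarith [hθ.2]) hh0) e he x hx

/-- A `C¹` solution in `ball 0 4` with gradient bounded by `1`. -/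
structure NSol (p ε K : ℝ) (w k : Eu N → ℝ) : Prop extends Sol p ε K (ball 0 4) w k where
  c1 : ContDiffOn ℝ 1 w (ball 0 4)
  grad : ∀ x ∈ ball 0 4, ‖∇ w x‖ ≤ 1

lemma NSol.abs_dq_le (hw : NSol p ε K w k) (hh : 0 < h) (he : ‖e‖ = 1) (hx : x ∈ ball 0 4)
    (hx' : x + h • e ∈ ball 0 4) : |dq h e w x| ≤ 1 := by
  obtain ⟨θ, hθ, h1, h2⟩ := exists_sub_eq_inner_gradient (convex_ball 0 4)
    (fun x hx => hw.c1.hasGradientAt isOpen_ball hx) hx hx'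
  rw [dq, h2, inner_smul_right, mul_div_cancel_left₀ _ hh.ne']
  refine (abs_real_inner_le_norm _ _).trans ?_
  rw [he, mul_one]; exact hw.grad _ h1

lemma add_smul_mem_ball (hh : 0 < h) (hR : r + h ≤ R) (he : ‖e‖ = 1)
    (hx : x ∈ ball 0 r) : x + h • e ∈ ball 0 R := by
  rw [mem_ball_zero_iff] at *
  have := norm_add_le x (h • e)
  rw [norm_smul, he, norm_of_nonneg hh.le, mul_one] at this
  linarith

lemma norm_le_of_inner_le {v : Eu N} {c : ℝ} (hc : 0 ≤ c)
    (h : ∀ e : Eu N, ‖e‖ = 1 → ⟪v, e⟫ ≤ c) : ‖v‖ ≤ c := by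
  rcases eq_or_ne v 0 with rfl | hv
  · simpa using hc
  have h1 := h ((‖v‖)⁻¹ • v) (norm_smul_inv_norm (𝕜 := ℝ) hv)
  rw [inner_smul_right, real_inner_self_eq_norm_sq] at h1
  have : 0 < ‖v‖ := norm_pos_iff.2 hv
  calc ‖v‖ = ‖v‖⁻¹ * ‖v‖ ^ 2 := by field_simp
    _ ≤ c := h1

/-- Uniform continuity of the gradient in the nondegenerate regime. -/
lemma exists_gradient_osc_of_fluxEll (N : ℕ) (hp : 1 < p) (hlam : 0 < lam)
    (hLam : 0 ≤ Lam) (hτ : 0 < τ) : ∃ r, 0 < r ∧ r ≤ 1 ∧ ∀ (ε : ℝ) (S : Set (Eu N)) (w k : Eu N → ℝ),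
      0 < ε → FluxEll p ε lam Lam S → NSol p ε 1 w k → (∀ x ∈ ball (0 : Eu N) 4, ∇ w x ∈ S) →
      ∀ x ∈ ball (0 : Eu N) r, ∀ y ∈ ball (0 : Eu N) r, ‖∇ w x - ∇ w y‖ ≤ τ := by
  obtain ⟨r, hr, hr1, H⟩ := exists_oscillation_le N hlam hLam zero_le_one (half_pos hτ)
  refine ⟨r, hr, hr1, fun ε S w k hε hS hw hgS x hx y hy => norm_le_of_inner_le hτ.le fun e he => ?_⟩
  obtain ⟨h₀, hh₀, hh₀', hq⟩ := exists_uniform_dq hw.c1 (τ := τ / 4) (by linarith)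
  obtain ⟨h, hh, hh'⟩ := exists_between hh₀
  have h34 : ∀ x ∈ ball (0 : Eu N) 3, x + h • e ∈ ball (0 : Eu N) 4 := fun x hx =>
    add_smul_mem_ball hh (by linarith) he hx
  have hsub : ball (0 : Eu N) 3 ⊆ ball 0 4 := ball_subset_ball (by norm_num)
  have hEll : EllEq lam Lam 1 (ball 0 3) (dq h e w) (dqFlux p ε h e w) := fun κ₀ =>
    hw.toSol.ellData hp hε hh he hsub h34 hS (.of_forall fun x hx _ =>
      ⟨hgS _ (hsub hx), hgS _ (h34 x hx)⟩)
  have h1 := H _ _ hEll (fun x hx => hw.abs_dq_le hh he (hsub hx) (h34 x hx)) x hx y hy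
  have hr3 : ball (0 : Eu N) r ⊆ ball 0 3 := ball_subset_ball (by linarith)
  have h2 := (hq h hh hh' e he x (hr3 hx)).1
  have h3 := (hq h hh hh' e he y (hr3 hy)).1
  rw [inner_sub_left]
  rw [abs_le] at h1 h2 h3
  linarith

lemma NSol.abs_integral_dqFlux_mul_le (hw : NSol p ε K w k)
    (hp : 1 < p) (hε : 0 < ε) (hCa : ∀ x ∈ ball 0 4, ‖flux p ε (∇ w x)‖ ≤ Ca)
    (hh : 0 < h) (hh1 : h ≤ 1 / 2) (he : ‖e‖ = 1) (i : Fin N) (hψ : LipTest (ball 0 1) ψ) :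
    |∫ x, dqFlux p ε h e w x i * ψ x| ≤ Ca * ∫ x, ‖∇ ψ x‖ := by
  obtain ⟨C, hC⟩ := hw.exists_flux_le hp hε
  have hi : ∀ v : Eu N, |v i| ≤ ‖v‖ := fun v => by
    simpa using PiLp.norm_apply_le v i
  have hm : Measurable fun x => flux p ε (∇ w x) i :=
    (by fun_prop : Measurable fun v : Eu N => v i).comp hw.measurable_flux
  have hadd : ∀ x : Eu N, ‖h • e‖ = h := fun x => by
    rw [norm_smul, he, norm_of_nonneg hh.le, mul_one]
  have hψ1 : LipTest (ball 0 4) fun x => ψ (x + -(h • e)) := hψ.comp_add _ fun x hx => by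
    rw [mem_ball_zero_iff] at *
    have := norm_add_le (x + -(h • e)) (h • e)
    rw [neg_add_cancel_right, hadd x] at this
    linarith
  have hψ4 : LipTest (ball 0 4) ψ := hψ.mono (ball_subset_ball (by norm_num))
  have i1 := hψ1.integrable_mul hm fun x => (hi _).trans (hC x)
  have i2 := hψ4.integrable_mul hm fun x => (hi _).trans (hC x)
  have i3 := hψ4.integrable_mul (k := fun x => flux p ε (∇ w (x + h • e)) i)
    (hm.comp (measurable_add_const (h • e))) fun x => (hi _).trans (hC _)
  have e1 : ∫ x, flux p ε (∇ w (x + h • e)) i * ψ x =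
      ∫ x, flux p ε (∇ w x) i * ψ (x + -(h • e)) := by
    rw [← integral_add_right_eq_self
      (fun x => flux p ε (∇ w x) i * ψ (x + -(h • e))) (h • e)]
    simp only [add_neg_cancel_right]
  have e2 : ∫ x, dqFlux p ε h e w x i * ψ x =
      h⁻¹ * ∫ x, flux p ε (∇ w x) i * (ψ (x + -(h • e)) - ψ x) := by
    simp only [mul_sub]
    rw [integral_sub i1 i2, ← e1, ← integral_sub i3 i2, ← integral_const_mul]
    refine integral_congr_ae (.of_forall fun x => ?_)
    simp [dqFlux]; ring
  have hd := hψ1.sub hψ4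
  have hint : Integrable fun x => |ψ (x + -(h • e)) - ψ x| :=
    (hd.1.continuous.integrable_of_hasCompactSupport hd.2.1).abs
  have hCa0 : 0 ≤ Ca := (norm_nonneg _).trans (hCa 0 (by simp))
  rw [e2, abs_mul, abs_of_pos (inv_pos.2 hh), inv_mul_le_iff₀ hh]
  calc |∫ x, flux p ε (∇ w x) i * (ψ (x + -(h • e)) - ψ x)|
      ≤ ∫ x, |flux p ε (∇ w x) i * (ψ (x + -(h • e)) - ψ x)| := abs_integral_le_integral_abs
    _ ≤ ∫ x, Ca * |ψ (x + -(h • e)) - ψ x| := by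
        refine integral_mono_of_nonneg (.of_forall fun _ => abs_nonneg _)
          (hint.const_mul _) (.of_forall fun x => ?_)
        simp only [abs_mul]
        by_cases hx : x ∈ ball 0 4
        · exact mul_le_mul_of_nonneg_right ((hi _).trans (hCa x hx)) (abs_nonneg _)
        · have : ψ (x + -(h • e)) - ψ x = 0 := by
            have := fun h' => hx (hd.2.2 (subset_tsupport _ h'))
            simpa using this
          simp [this]
    _ = Ca * ∫ x, |ψ (x + -(h • e)) - ψ x| := integral_const_mul _ _
    _ ≤ Ca * (‖-(h • e)‖ * ∫ x, ‖∇ ψ x‖) := by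
        gcongr; exact hψ.1.integral_abs_sub_le hψ.2.1 _
    _ = _ := by rw [norm_neg, hadd 0]; ring

set_option maxHeartbeats 1000000 in
lemma NSol.setIntegral_cut_mul_gradient_sq_le {p ε lam Lam Ca κ R : ℝ} {S : Set (Eu N)}
    {w k : Eu N → ℝ} (hw : NSol p ε 1 w k)
    (hp : 1 < p) (hε : 0 < ε) (hCa : ∀ x ∈ ball (0 : Eu N) 4, ‖flux p ε (∇ w x)‖ ≤ Ca)
    {h : ℝ} (hh : 0 < h) (hh1 : h ≤ 1 / 2) {e : Eu N} (he : ‖e‖ = 1) (hlam : 0 < lam)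
    (hS : FluxEll p ε lam Lam S)
    (hgS : ∀ x ∈ ball (0 : Eu N) 1, 1 / 4 < dq h e w x →
      ∇ w x ∈ S ∧ ∇ w (x + h • e) ∈ S) (hκ1 : κ ≤ 1) (hR : 0 < R) (hR1 : R < 1) :
    ∫ x in ball (0 : Eu N) R ∩ {x | κ < 3 - 4 * dq h e w x},
        (cut R x * ‖∇ (fun x => min (max (3 - 4 * dq h e w x - κ) 0) 1) x‖) ^ 2 ≤
      2 / lam * ((4 + 16 * Ca * N) ^ 2 / (2 * lam) + 4 * (4 + 16 * Ca * N)) *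
        volume.real (ball (0 : Eu N) R ∩ {x | κ < 3 - 4 * dq h e w x}) := by
  obtain ⟨s, hs⟩ : ∃ s, s = fun x => 3 - 4 * dq h e w x := ⟨_, rfl⟩
  have hsl : IsLip s := by
    rw [hs]; exact (isLip_const 3).sub ((isLip_dq hw.lip h e).const_mul 4)
  obtain ⟨v, hv⟩ : ∃ v, v = fun x => min (max (s x - κ) 0) 1 := ⟨_, rfl⟩
  have hvl : IsLip v := by
    rw [hv]; exact ((hsl.sub (isLip_const κ)).max (isLip_const 0)).min (isLip_const 1)
  obtain ⟨Z, hZ⟩ : ∃ Z, Z = 4 + 16 * Ca * N := ⟨_, rfl⟩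
  obtain ⟨C0, hC0⟩ : ∃ C0, C0 = Z ^ 2 / (2 * lam) + 4 * Z := ⟨_, rfl⟩
  have hsv : (fun x => min (max (3 - 4 * dq h e w x - κ) 0) 1) = v := by rw [hv, hs]
  have hsA : {x | κ < 3 - 4 * dq h e w x} = {x | κ < s x} := by rw [hs]
  rw [hsv, hsA, ← hZ, ← hC0]
  obtain ⟨A, hA⟩ : ∃ A, A = ball (0 : Eu N) R ∩ {x | κ < s x} := ⟨_, rfl⟩
  rw [← hA]
  have hCa0 : 0 ≤ Ca := (norm_nonneg _).trans (hCa 0 (by simp))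
  have hAm : MeasurableSet A := hA ▸ measurableSet_ball.inter (measurableSet_lt_of_isLip hsl κ)
  have hAb : Bornology.IsBounded A := hA ▸ isBounded_ball.subset inter_subset_left
  obtain ⟨φ, hφ⟩ : ∃ φ : Eu N → ℝ, φ = fun x => cut R x * (cut R x * v x) := ⟨_, rfl⟩
  have hT1 : LipTest (ball 0 1) (fun x => cut R x * v x) := LipTest.cut_mul hR1 hvl
  have hT : LipTest (ball 0 1) φ := hφ ▸ LipTest.cut_mul hR1 hT1.1
  obtain ⟨ψ, hψ⟩ : ∃ ψ : Fin N → Eu N → ℝ, ψ = fun i x => cut R x * v x * x i := ⟨_, rfl⟩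
  have hxi : ∀ i : Fin N, (fun x : Eu N => x i) = fun x => ⟪EuclideanSpace.single i (1 : ℝ), x⟫ :=
    fun i => by ext x; simp [EuclideanSpace.inner_single_left]
  have hTψ : ∀ i, LipTest (ball 0 1) (ψ i) := fun i => by
    rw [hψ]
    refine ⟨hT1.1.mul_of_hasCompactSupport hT1.2.1 (by rw [hxi]; exact isLip_inner _),
      hT1.2.1.mul_right, (closure_mono (Function.support_mul_subset_left _ _)).trans hT1.2.2⟩
  obtain ⟨C, hC⟩ := hw.exists_dqFlux_le hp hε h e
  have hFm := measurable_dqFlux p ε h e w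
  obtain ⟨M, hM0, hM⟩ := hvl.exists_norm_gradient_le
  have hcut0 : ∀ x : Eu N, 0 ≤ cut R x := cut_nonneg hR.le
  have hcut4 : ∀ x : Eu N, cut R x ≤ 1 := fun x => (cut_le x).trans (by nlinarith)
  have hfm : Measurable fun x => (cut R x * ‖∇ v x‖) ^ 2 :=
    ((isLip_cut R).continuous.measurable.mul (measurable_gradient v).norm).pow_const 2
  have hfm2 : Measurable fun x => lam / 2 * (cut R x * ‖∇ v x‖) ^ 2 - C0 :=
    (hfm.const_mul _).sub_const _
  have hB4 : ball (0 : Eu N) 1 ⊆ ball 0 4 := ball_subset_ball (by norm_num)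
  have hgv : ∀ x, ∇ v x = if κ < s x ∧ s x < κ + 1 then ∇ s x else 0 := fun x => by
    rw [hv]; exact gradient_min_max_sub hsl.continuous κ one_pos x
  have hgs : ∀ x, ∇ s x = (-4 : ℝ) • ∇ (dq h e w) x := fun x => by
    have : s = fun x => -4 * (dq h e w x - 3 / 4) := by rw [hs]; ext x; ring
    rw [this, gradient_const_mul, gradient_sub_const]
  have hpt : ∀ᵐ x, A.indicator (fun x => lam / 2 * (cut R x * ‖∇ v x‖) ^ 2 - C0) x ≤
      -4 * ⟪dqFlux p ε h e w x, ∇ φ x⟫ - 16 * (∑ i, dqFlux p ε h e w x i * ψ i x)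
        - 4 * ‖∇ φ x‖ - 16 * Ca * ∑ i, ‖∇ (ψ i) x‖ := by
    filter_upwards [gradient_dq_ae hw.lip h e, (isLip_cut R).hasGradientAt_ae,
      hvl.hasGradientAt_ae] with x hx hc hvx
    have hg : ∇ φ x = cut R x • (cut R x • ∇ v x + v x • ∇ (cut R) x) +
        (cut R x * v x) • ∇ (cut R) x := hφ ▸ (hc.mul' (hc.mul' hvx)).gradient
    have hgψ : ∀ i, ∇ (ψ i) x = (cut R x * v x) • EuclideanSpace.single i (1 : ℝ) +
        x i • (cut R x • ∇ v x + v x • ∇ (cut R) x) := fun i => by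
      have h1 : HasGradientAt (fun x : Eu N => x i) (EuclideanSpace.single i (1 : ℝ)) x := by
        rw [hxi]; exact hasGradientAt_inner _ x
      rw [hψ]; exact ((hc.mul' hvx).mul' h1).gradient
    by_cases hxA : x ∈ A
    · rw [indicator_of_mem hxA]
      rw [hA] at hxA
      have hxR : ‖x‖ < R := mem_ball_zero_iff.1 hxA.1
      have hq : ∇ (cut R) x = (-2 : ℝ) • x := by rw [gradient_cut hR.le, if_pos hxR]
      have hvx0 : 0 ≤ v x := by rw [hv]; exact le_min (le_max_right _ _) zero_le_one
      have hvx1 : v x ≤ 1 := by rw [hv]; exact min_le_right _ _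
      have hη0 := hcut0 x
      have hη1 := hcut4 x
      have hell : lam * (cut R x * ‖∇ v x‖) ^ 2 ≤
          -4 * (cut R x ^ 2 * ⟪dqFlux p ε h e w x, ∇ v x⟫) := by
        by_cases hlev : κ < s x ∧ s x < κ + 1
        · have hd : 1 / 4 < dq h e w x := by
            have := hlev.2; rw [hs] at this; simp only at this; linarith
          have hx1 : x ∈ ball (0 : Eu N) 1 := ball_subset_ball hR1.le hxA.1
          obtain ⟨h1, h2⟩ := hgS x hx1 hd
          have h3 := (dqFlux_ell hS hh hx h1 h2).1
          rw [hgv, if_pos hlev, hgs, norm_smul, inner_smul_right]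
          rw [norm_eq_abs, abs_neg, abs_of_pos (by norm_num : (0:ℝ) < 4)]
          have := mul_le_mul_of_nonneg_left h3 (sq_nonneg (cut R x))
          nlinarith
        · rw [hgv, if_neg hlev]; simp
      have hsum : ∑ i, dqFlux p ε h e w x i * ψ i x =
          cut R x * v x * ⟪dqFlux p ε h e w x, x⟫ := by
        rw [hψ, PiLp.inner_apply, Finset.mul_sum]
        refine Finset.sum_congr rfl fun i _ => ?_
        simp; ring
      have hin : ⟪dqFlux p ε h e w x, ∇ φ x⟫ =
          cut R x ^ 2 * ⟪dqFlux p ε h e w x, ∇ v x⟫ -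
            4 * (cut R x * v x * ⟪dqFlux p ε h e w x, x⟫) := by
        rw [hg, hq]
        simp only [inner_add_right, inner_smul_right]; ring
      rw [hsum, hin]
      have hqn : ‖∇ (cut R) x‖ ≤ 2 := (norm_gradient_cut_le hR.le x).trans (by linarith)
      have hw1 : ‖cut R x • ∇ v x + v x • ∇ (cut R) x‖ ≤
          cut R x * ‖∇ v x‖ + 2 := by
        refine (norm_add_le _ _).trans ?_
        rw [norm_smul, norm_smul, norm_of_nonneg hη0, norm_of_nonneg hvx0]
        nlinarith [norm_nonneg (∇ (cut R) x)]
      have hηv : cut R x * v x ≤ 1 := by nlinarith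
      have hηv0 : 0 ≤ cut R x * v x := by positivity
      have hn1 : ‖∇ φ x‖ ≤ cut R x * ‖∇ v x‖ + 4 := by
        rw [hg]
        refine (norm_add_le _ _).trans ?_
        rw [norm_smul, norm_smul, norm_of_nonneg hη0, norm_of_nonneg hηv0]
        nlinarith [norm_nonneg (∇ (cut R) x),
          norm_nonneg (cut R x • ∇ v x + v x • ∇ (cut R) x)]
      have hn2 : ∀ i, ‖∇ (ψ i) x‖ ≤ cut R x * ‖∇ v x‖ + 4 := fun i => by
        rw [hgψ i]
        refine (norm_add_le _ _).trans ?_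
        have hi : ‖x i‖ ≤ 1 := (PiLp.norm_apply_le x i).trans (hxR.le.trans hR1.le)
        rw [norm_smul, norm_smul, norm_of_nonneg hηv0, PiLp.norm_single, norm_one]
        nlinarith [norm_nonneg (x i),
          norm_nonneg (cut R x • ∇ v x + v x • ∇ (cut R) x)]
      have hn3 : ∑ i, ‖∇ (ψ i) x‖ ≤ N * (cut R x * ‖∇ v x‖ + 4) := by
        refine (Finset.sum_le_card_nsmul _ _ _ fun i _ => hn2 i).trans (le_of_eq ?_)
        rw [Finset.card_univ, Fintype.card_fin, nsmul_eq_mul]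
      obtain ⟨X, hX⟩ : ∃ X, X = cut R x * ‖∇ v x‖ := ⟨_, rfl⟩
      rw [← hX] at hell hn1 hn3 ⊢
      have e7 : Z * X ≤ lam / 2 * X ^ 2 + Z ^ 2 / (2 * lam) := by
        have : lam / 2 * X ^ 2 + Z ^ 2 / (2 * lam) - Z * X = lam / 2 * (X - Z / lam) ^ 2 := by
          field_simp; ring
        have h2 : 0 ≤ lam / 2 * (X - Z / lam) ^ 2 := by positivity
        linarith
      have hn4 := mul_le_mul_of_nonneg_left hn3 (show 0 ≤ 16 * Ca by positivity)
      have e8 : Z * (X + 4) = 4 * (X + 4) + 16 * Ca * (N * (X + 4)) := by rw [hZ]; ring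
      rw [hC0]
      linarith
    · rw [indicator_of_notMem hxA]
      rw [hA] at hxA
      by_cases hxR : x ∈ ball (0 : Eu N) R
      · have hxs : ¬ κ < s x := fun h' => hxA ⟨hxR, h'⟩
        have h0 : v x = 0 := by
          rw [hv]; simp only
          rw [max_eq_right (by linarith), min_eq_left zero_le_one]
        have h1 : ∇ v x = 0 := by rw [hgv, if_neg fun h' => hxs h'.1]
        have h2 : ∀ i, ψ i x = 0 := fun i => by rw [hψ]; simp [h0]
        simp [hg, hgψ, h0, h1, h2]
      · have hxR' : R ≤ ‖x‖ := by simpa using hxR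
        have h0 : cut R x = 0 := cut_eq_zero hxR'
        have h1 : ∇ (cut R) x = 0 := by rw [gradient_cut hR.le, if_neg hxR'.not_gt]
        have h2 : ∀ i, ψ i x = 0 := fun i => by rw [hψ]; simp [h0]
        simp [hg, hgψ, h0, h1, h2]
  have hi : ∀ v : Eu N, ∀ i, |v i| ≤ ‖v‖ := fun v i => by
    simpa using PiLp.norm_apply_le v i
  have hFim : ∀ i, Measurable fun x => dqFlux p ε h e w x i := fun i =>
    (by fun_prop : Measurable fun v : Eu N => v i).comp hFm
  have hI1 := (hT.integrable_inner hFm hC).const_mul (-4)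
  have hI2 : ∀ i, Integrable fun x => dqFlux p ε h e w x i * ψ i x := fun i =>
    (hTψ i).integrable_mul (hFim i) fun x => (hi _ i).trans (hC x)
  have hI2' := (integrable_finsetSum Finset.univ fun i _ => hI2 i).const_mul 16
  have hI3 := hT.integrable_norm_gradient.const_mul 4
  have hI4 := (integrable_finsetSum Finset.univ fun i _ =>
    (hTψ i).integrable_norm_gradient).const_mul (16 * Ca)
  have hZ0 : 0 ≤ Z := by rw [hZ]; positivity
  have hC00 : 0 ≤ C0 := by rw [hC0]; positivity
  have hbd : ∀ x, |lam / 2 * (cut R x * ‖∇ v x‖) ^ 2 - C0| ≤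
      lam / 2 * (1 * M) ^ 2 + C0 := fun x => by
    have := hcut0 x; have := hcut4 x; have := hM x
    refine (abs_sub _ _).trans (add_le_add ?_ ?_)
    · rw [abs_of_nonneg (by positivity)]; gcongr
    · rw [abs_of_nonneg (by positivity)]
  have hint := integral_mono_ae ((integrable_indicator_iff hAm).2
      (integrableOn_of_bdd hfm2 hAb hbd)) (((hI1.sub hI2').sub hI3).sub hI4) hpt
  simp only [Pi.sub_apply] at hint
  rw [integral_indicator hAm] at hint
  have hJ0 := integral_sub ((hI1.sub hI2').sub hI3) hI4
  have hJ1 := integral_sub (hI1.sub hI2') hI3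
  have hJ2 := integral_sub hI1 hI2'
  simp only [Pi.sub_apply] at hJ0 hJ1 hJ2
  rw [hJ0, hJ1, hJ2] at hint
  have hJ3 : IntegrableOn (fun x => lam / 2 * (cut R x * ‖∇ v x‖) ^ 2) A := by
    refine Integrable.const_mul (integrableOn_of_bdd (C := (1 * M) ^ 2) hfm hAb fun x => ?_) _
    rw [abs_of_nonneg (by positivity)]
    have := hcut0 x; have := hcut4 x; have := hM x; gcongr
  rw [integral_sub hJ3 (integrableOn_const hAb.measure_lt_top.ne), setIntegral_const] at hint
  simp only [integral_const_mul, smul_eq_mul] at hint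
  rw [integral_finsetSum _ fun i _ => hI2 i,
    integral_finsetSum _ fun i _ => (hTψ i).integrable_norm_gradient] at hint
  have k1 := (abs_le.1 (hw.abs_integral_dqFlux_le hp hε hh he hB4 (fun x hx =>
    add_smul_mem_ball hh (by linarith) he hx) hT)).1
  have k2 : -(Ca * ∑ i, ∫ x, ‖∇ (ψ i) x‖) ≤ ∑ i, ∫ x, dqFlux p ε h e w x i * ψ i x := by
    rw [Finset.mul_sum, ← Finset.sum_neg_distrib]
    exact Finset.sum_le_sum fun i _ =>
      (abs_le.1 (hw.abs_integral_dqFlux_mul_le hp hε hCa hh hh1 he i (hTψ i))).1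
  have h3 : lam / 2 * ∫ x in A, (cut R x * ‖∇ v x‖) ^ 2 ≤ C0 * volume.real A := by
    linarith
  calc _ = 2 / lam * (lam / 2 * ∫ x in A, (cut R x * ‖∇ v x‖) ^ 2) := by
        field_simp
    _ ≤ 2 / lam * (C0 * volume.real A) := by gcongr
    _ = _ := by ring

lemma NSol.energyBound {S : Set (Eu N)} (hw : NSol p ε 1 w k)
    (hp : 1 < p) (hε : 0 < ε) (hCa : ∀ x ∈ ball 0 4, ‖flux p ε (∇ w x)‖ ≤ Ca)
    (hh : 0 < h) (hh1 : h ≤ 1 / 2) (he : ‖e‖ = 1) (hlam : 0 < lam) (hS : FluxEll p ε lam Lam S)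
    (hgS : ∀ x ∈ ball 0 1, 1 / 4 < dq h e w x →
      ∇ w x ∈ S ∧ ∇ w (x + h • e) ∈ S) :
    EnergyBound (16 * (2 / lam * ((4 + 16 * Ca * N) ^ 2 / (2 * lam) + 4 * (4 + 16 * Ca * N))))
      (fun x => 3 - 4 * dq h e w x) := by
  intro κ r R hκ hκ1 hr hrR hR
  obtain ⟨R', hR'⟩ : ∃ R', R' = (r + R) / 2 := ⟨_, rfl⟩
  have hmain := hw.setIntegral_cut_mul_gradient_sq_le hp hε hCa hh hh1 he hlam hS hgS hκ1
    (R := R') (by linarith) (by linarith)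
  obtain ⟨C, hC⟩ : ∃ C, C = 2 / lam * ((4 + 16 * Ca * N) ^ 2 / (2 * lam) + 4 * (4 + 16 * Ca * N)) :=
    ⟨_, rfl⟩
  rw [← hC] at hmain ⊢
  have hCa0 : 0 ≤ Ca := (norm_nonneg _).trans (hCa 0 (by simp))
  have hC0 : 0 ≤ C := by rw [hC]; positivity
  obtain ⟨s, hs⟩ : ∃ s, s = fun x => 3 - 4 * dq h e w x := ⟨_, rfl⟩
  have hsl : IsLip s := by
    rw [hs]; exact (isLip_const 3).sub ((isLip_dq hw.lip h e).const_mul 4)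
  obtain ⟨v, hv⟩ : ∃ v, v = fun x => min (max (s x - κ) 0) 1 := ⟨_, rfl⟩
  have hvl : IsLip v := by
    rw [hv]; exact ((hsl.sub (isLip_const κ)).max (isLip_const 0)).min (isLip_const 1)
  have hsv : (fun x => min (max (3 - 4 * dq h e w x - κ) 0) 1) = v := by rw [hv, hs]
  have hsA : {x | κ < 3 - 4 * dq h e w x} = {x | κ < s x} := by rw [hs]
  rw [hsv, hsA] at hmain
  rw [hsA, ← hs]
  have hd : 0 < R - r := by linarith
  obtain ⟨M, hM0, hM⟩ := hvl.exists_norm_gradient_le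
  have hlt := measurableSet_lt_of_isLip hsl κ
  have hmA : MeasurableSet (ball 0 R' ∩ {x | κ < s x}) := measurableSet_ball.inter hlt
  have hmB : MeasurableSet (ball 0 r ∩ {x | κ < s x ∧ s x < κ + 1}) :=
    measurableSet_ball.inter (hlt.inter (measurableSet_lt hsl.continuous.measurable measurable_const))
  have hbA : Bornology.IsBounded (ball 0 R' ∩ {x | κ < s x}) :=
    isBounded_ball.subset inter_subset_left
  have hsub : ball 0 r ∩ {x | κ < s x ∧ s x < κ + 1} ⊆ ball 0 R' ∩ {x | κ < s x} :=
    fun x hx => ⟨ball_subset_ball (by linarith) hx.1, hx.2.1⟩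
  have hfm : Measurable fun x => (cut R' x * ‖∇ v x‖) ^ 2 :=
    ((isLip_cut R').continuous.measurable.mul (measurable_gradient v).norm).pow_const 2
  have hfi : IntegrableOn (fun x => (cut R' x * ‖∇ v x‖) ^ 2)
      (ball 0 R' ∩ {x | κ < s x}) := by
    refine integrableOn_of_bdd (C := (1 * M) ^ 2) hfm hbA fun x => ?_
    have h0 := cut_nonneg (show 0 ≤ R' by linarith) x
    have h1 : cut R' x ≤ 1 := (cut_le x).trans (by nlinarith)
    have := hM x
    rw [abs_of_nonneg (by positivity)]; gcongr
  have hsg : IntegrableOn (fun x => ‖∇ s x‖ ^ 2)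
      (ball 0 r ∩ {x | κ < s x ∧ s x < κ + 1}) := by
    obtain ⟨M', hM0', hM'⟩ := hsl.exists_norm_gradient_le
    refine integrableOn_of_bdd (C := M' ^ 2) ((measurable_gradient s).norm.pow_const 2)
      (hbA.subset hsub) fun x => ?_
    have := hM' x
    rw [abs_of_nonneg (by positivity)]; gcongr
  have hfi' : IntegrableOn (fun x => 16 / (R - r) ^ 2 * (cut R' x * ‖∇ v x‖) ^ 2)
      (ball 0 R' ∩ {x | κ < s x}) := Integrable.const_mul hfi (16 / (R - r) ^ 2)
  calc ∫ x in ball 0 r ∩ {x | κ < s x ∧ s x < κ + 1}, ‖∇ s x‖ ^ 2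
      ≤ ∫ x in ball 0 r ∩ {x | κ < s x ∧ s x < κ + 1},
          16 / (R - r) ^ 2 * (cut R' x * ‖∇ v x‖) ^ 2 := by
        refine setIntegral_mono_on hsg (hfi'.mono_set hsub) hmB fun x hx => ?_
        have h1 : ∇ v x = ∇ s x := by
          rw [hv, gradient_min_max_sub hsl.continuous κ one_pos x]
          exact if_pos hx.2
        have h2 := le_cut (R := R') (by linarith) (show r ≤ R' by linarith)
          (mem_ball_zero_iff.1 hx.1).le
        have h3 : (R - r) / 4 ≤ cut R' x := by nlinarith
        rw [h1]
        calc ‖∇ s x‖ ^ 2 = 16 / (R - r) ^ 2 * ((R - r) / 4 * ‖∇ s x‖) ^ 2 := by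
              field_simp; ring
          _ ≤ _ := by gcongr
    _ ≤ ∫ x in ball 0 R' ∩ {x | κ < s x},
          16 / (R - r) ^ 2 * (cut R' x * ‖∇ v x‖) ^ 2 :=
        setIntegral_mono_set hfi' (.of_forall fun x => by positivity)
          hsub.eventuallyLE
    _ = 16 / (R - r) ^ 2 * ∫ x in ball 0 R' ∩ {x | κ < s x},
          (cut R' x * ‖∇ v x‖) ^ 2 := integral_const_mul _ _
    _ ≤ 16 / (R - r) ^ 2 * (C * volume.real (ball 0 R ∩ {x | κ < s x})) := by
        gcongr
        refine hmain.trans (mul_le_mul_of_nonneg_left (measureReal_mono ?_ ?_) hC0)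
        · exact inter_subset_inter_left _ (ball_subset_ball (by linarith))
        · exact (isBounded_ball.subset inter_subset_left).measure_lt_top.ne
    _ = _ := by ring

lemma convex_inner_ge_inter (e : Eu N) (c : ℝ) :
    Convex ℝ {ξ : Eu N | c ≤ ⟪ξ, e⟫ ∧ ‖ξ‖ ≤ 1} := by
  have h1 : Convex ℝ {ξ : Eu N | c ≤ ⟪ξ, e⟫} :=
    convex_halfSpace_ge ⟨fun x y => inner_add_left x y e, fun a x => real_inner_smul_left x e a⟩ c
  have h2 : Convex ℝ {ξ : Eu N | ‖ξ‖ ≤ 1} := by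
    simpa [closedBall, dist_zero_right] using convex_closedBall (0 : Eu N) 1
  exact h1.inter h2

lemma fluxEll_halfSpace {c : ℝ} (hp : 1 < p) (hε : 0 < ε) (hε1 : ε ≤ 1) (hc : 0 < c)
    (he : ‖e‖ = 1) :
    FluxEll p ε (lamOf p (c ^ 2) 2) (LamOf p (c ^ 2) 2) {ξ : Eu N | c ≤ ⟪ξ, e⟫ ∧ ‖ξ‖ ≤ 1} := by
  refine fluxEll_of_bounds hp hε (by positivity) (convex_inner_ge_inter e c) fun z hz => ?_
  have h1 : c ≤ ‖z‖ := by
    refine hz.1.trans ((real_inner_le_norm _ _).trans ?_); rw [he, mul_one]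
  have h2 := hz.2
  constructor
  · nlinarith
  · nlinarith [norm_nonneg z]

/-- If a directional derivative is close to its maximum on most of the unit ball, then it is
bounded below on the half ball. -/
lemma exists_half_le_inner_gradient (N : ℕ) (hp : 1 < p) : ∃ ν, 0 < ν ∧
    ∀ (ε : ℝ) (w k : Eu N → ℝ) (e : Eu N), 0 < ε → ε ≤ 1 → NSol p ε 1 w k → ‖e‖ = 1 →
      volume.real (ball (0 : Eu N) 1 ∩ {x | ⟪∇ w x, e⟫ < 13 / 16}) ≤ ν →
      ∀ x ∈ ball (0 : Eu N) (1 / 2), 1 / 2 ≤ ⟪∇ w x, e⟫ := by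
  obtain ⟨lam, hl⟩ : ∃ lam, lam = lamOf p ((1 / 16) ^ 2) 2 := ⟨_, rfl⟩
  have hlam : 0 < lam := hl ▸ lamOf_pos hp (by norm_num) (by norm_num)
  obtain ⟨Ca, hCa⟩ : ∃ Ca : ℝ, Ca = 2 ^ ((p - 1) / 2) := ⟨_, rfl⟩
  have hCa0 : 0 ≤ Ca := by rw [hCa]; positivity
  obtain ⟨ν, hν, H⟩ := exists_sup_bound_of_energyBound N
    (C := 16 * (2 / lam * ((4 + 16 * Ca * N) ^ 2 / (2 * lam) + 4 * (4 + 16 * Ca * N))))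
    (by positivity)
  refine ⟨ν, hν, fun ε w k e hε hε1 hw he hvol x hx => ?_⟩
  refine le_of_forall_pos_le_add fun τ' hτ' => ?_
  obtain ⟨τ, hτ, hττ, hτ1⟩ : ∃ τ : ℝ, 0 < τ ∧ τ ≤ τ' ∧ τ ≤ 1 / 16 :=
    ⟨min τ' (1 / 16), by positivity, min_le_left _ _, min_le_right _ _⟩
  obtain ⟨h₀, hh₀, hh₀', hq⟩ := exists_uniform_dq hw.c1 hτ
  obtain ⟨h, hh, hh'⟩ := exists_between hh₀
  have h13 : ball (0 : Eu N) 1 ⊆ ball 0 3 := ball_subset_ball (by norm_num)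
  have hCa' : ∀ x ∈ ball (0 : Eu N) 4, ‖flux p ε (∇ w x)‖ ≤ Ca := fun x hx => by
    refine (norm_flux_le_of_norm_le hp hε (hw.grad x hx)).trans ?_
    rw [hCa]
    exact rpow_le_rpow (by positivity) (by linarith) (by linarith)
  have hgS : ∀ x ∈ ball (0 : Eu N) 1, 1 / 4 < dq h e w x →
      ∇ w x ∈ {ξ : Eu N | 1 / 16 ≤ ⟪ξ, e⟫ ∧ ‖ξ‖ ≤ 1} ∧
      ∇ w (x + h • e) ∈ {ξ : Eu N | 1 / 16 ≤ ⟪ξ, e⟫ ∧ ‖ξ‖ ≤ 1} := fun x hx hd => by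
    obtain ⟨h1, h2⟩ := hq h hh hh' e he x (h13 hx)
    have h3 := (abs_le.1 h1).2
    have h4 := (abs_le.1 ((abs_real_inner_le_norm _ _).trans
      (show ‖∇ w (x + h • e) - ∇ w x‖ * ‖e‖ ≤ τ by rw [he, mul_one]; exact h2))).1
    rw [inner_sub_left] at h4
    refine ⟨⟨by linarith, hw.grad _ (ball_subset_ball (by norm_num) hx)⟩, ⟨by linarith,
      hw.grad _ (add_smul_mem_ball hh (by linarith) he hx)⟩⟩
  have hE := hw.energyBound hp hε hCa' hh (by linarith) he hlam
    (hl ▸ fluxEll_halfSpace hp hε hε1 (by norm_num) he) hgS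
  have hsub : ball (0 : Eu N) 1 ∩ {x | 0 < 3 - 4 * dq h e w x} ⊆
      ball (0 : Eu N) 1 ∩ {x | ⟪∇ w x, e⟫ < 13 / 16} := fun x hx => by
    have h0 : 0 < 3 - 4 * dq h e w x := hx.2
    have := (abs_le.1 (hq h hh hh' e he x (h13 hx.1)).1).1
    refine ⟨hx.1, ?_⟩
    show ⟪∇ w x, e⟫ < 13 / 16
    linarith
  have hs1 := H _ ((isLip_const 3).sub ((isLip_dq hw.lip h e).const_mul 4)) hE
    ((measureReal_mono hsub (isBounded_ball.subset inter_subset_left).measure_lt_top.ne).trans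
      hvol) x hx
  have := (abs_le.1 (hq h hh hh' e he x (ball_subset_ball (by norm_num) hx)).1).2
  linarith

lemma NSol.mono (h : NSol p ε K w k) (hK : K ≤ K') :
    NSol p ε K' w k :=
  ⟨h.toSol.mono hK subset_rfl, h.c1, h.grad⟩

lemma gradient_rescale (w : Eu N → ℝ) (c : Eu N) (hr : 0 < r) (b : ℝ) (y : Eu N) :
    ∇ (fun y => (w (c + r • y) - b) / (r * m)) y = m⁻¹ • ∇ w (c + r • y) := by
  rw [gradient_affine_sub_div w c hr.ne']
  congr 1
  rw [div_mul_eq_div_div, div_self hr.ne', one_div]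

lemma Sol.rescale_nsol (h : Sol p ε K U w k) (hc1 : ContDiffOn ℝ 1 w U) (hε : 0 < ε) (hr : 0 < r)
    (hm : 0 < m) (b : ℝ) (hball : ∀ y ∈ ball 0 4, c + r • y ∈ U)
    (hgrad : ∀ y ∈ ball 0 4, ‖∇ w (c + r • y)‖ ≤ m) :
    NSol p (ε / m ^ 2) (K * r / m ^ (p - 1)) (fun y => (w (c + r • y) - b) / (r * m))
      (fun y => r / m ^ (p - 1) * k (c + r • y)) := by
  refine ⟨(h.rescale hε c hr hm b).mono le_rfl hball, ?_, fun y hy => ?_⟩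
  · refine ContDiffOn.div_const (ContDiffOn.sub (hc1.comp (t := U) ?_ hball) contDiffOn_const) _
    exact (contDiff_const.add (contDiff_id.const_smul r)).contDiffOn
  · rw [gradient_rescale w c hr, norm_smul, norm_of_nonneg (by positivity)]
    have := hgrad y hy
    rw [inv_mul_le_iff₀ hm, mul_one]; exact this

lemma norm_gradient_sub_le_of_rescale {b : ℝ} (hr : 0 < r) (hm : 0 < m)
    (H : ∀ y ∈ ball 0 ρ, ∀ y' ∈ ball 0 ρ,
      ‖∇ (fun y => (w (c + r • y) - b) / (r * m)) y -
        ∇ (fun y => (w (c + r • y) - b) / (r * m)) y'‖ ≤ τ) :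
    ∀ x ∈ ball c (r * ρ), ∀ x' ∈ ball c (r * ρ), ‖∇ w x - ∇ w x'‖ ≤ m * τ := by
  have hx : ∀ x ∈ ball c (r * ρ), r⁻¹ • (x - c) ∈ ball 0 ρ ∧
      c + r • r⁻¹ • (x - c) = x := fun x hx => by
    rw [mem_ball_iff_norm] at hx
    rw [mem_ball_zero_iff, norm_smul, norm_of_nonneg (by positivity), inv_mul_lt_iff₀ hr,
      smul_inv_smul₀ hr.ne', add_sub_cancel]
    exact ⟨hx, rfl⟩
  intro x h1 x' h2
  have h3 := H _ (hx x h1).1 _ (hx x' h2).1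
  rw [gradient_rescale w c hr, gradient_rescale w c hr, ← smul_sub, norm_smul,
    norm_of_nonneg (by positivity), inv_mul_le_iff₀ hm, (hx x h1).2, (hx x' h2).2] at h3
  exact h3

/-- Either the gradient bound improves on the half ball, or the gradient is nondegenerate there. -/
lemma exists_gradient_dichotomy (N : ℕ) (hp : 1 < p) : ∃ δ K, 0 < δ ∧ δ ≤ 1 / 2 ∧ 0 < K ∧
    K ≤ 1 ∧ ∀ (ε : ℝ) (w k : Eu N → ℝ), 0 < ε → ε ≤ 1 → NSol p ε K w k →
      (∀ x ∈ ball (0 : Eu N) (1 / 2), ‖∇ w x‖ ≤ 1 - δ) ∨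
      ∃ e : Eu N, ‖e‖ = 1 ∧ ∀ x ∈ ball (0 : Eu N) (1 / 2), 1 / 2 ≤ ⟪∇ w x, e⟫ := by
  obtain ⟨ν, hν, H1⟩ := exists_half_le_inner_gradient N hp
  have hl : 0 < lamOf p ((1 / 2) ^ 2) 2 := lamOf_pos hp (by norm_num) (by norm_num)
  have hL : 0 ≤ LamOf p ((1 / 2) ^ 2) 2 := LamOf_nonneg (by norm_num)
  obtain ⟨δ, hδ, H2⟩ := exists_sup_decrease N hl hL (κ₀ := 7 / 8) (by norm_num) hν
  refine ⟨min (δ / 2) (1 / 2), min δ 1, by positivity, min_le_right _ _, by positivity,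
    min_le_right _ _, fun ε w k hε hε1 hw => ?_⟩
  by_cases hB : ∃ e : Eu N, ‖e‖ = 1 ∧
      volume.real (ball (0 : Eu N) 1 ∩ {x | ⟪∇ w x, e⟫ < 13 / 16}) ≤ ν
  · obtain ⟨e, he, hv⟩ := hB
    exact Or.inr ⟨e, he, H1 ε w k e hε hε1 (hw.mono (min_le_right _ _)) he hv⟩
  left
  push Not at hB
  intro x hx
  refine norm_le_of_inner_le (by linarith [min_le_right (δ / 2) (1 / 2)]) fun e he => ?_
  obtain ⟨τ, hτ, hτδ, hτ1⟩ : ∃ τ : ℝ, 0 < τ ∧ τ ≤ δ / 2 ∧ τ ≤ 1 / 16 :=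
    ⟨min (δ / 2) (1 / 16), by positivity, min_le_left _ _, min_le_right _ _⟩
  obtain ⟨h₀, hh₀, hh₀', hq⟩ := exists_uniform_dq hw.c1 hτ
  obtain ⟨h, hh, hh'⟩ := exists_between hh₀
  have h34 : ∀ x ∈ ball (0 : Eu N) 3, x + h • e ∈ ball (0 : Eu N) 4 := fun x hx =>
    add_smul_mem_ball hh (by linarith) he hx
  have hsub : ball (0 : Eu N) 3 ⊆ ball 0 4 := ball_subset_ball (by norm_num)
  have h13 : ball (0 : Eu N) 1 ⊆ ball 0 3 := ball_subset_ball (by norm_num)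
  have h23 : ball (0 : Eu N) 2 ⊆ ball 0 3 := ball_subset_ball (by norm_num)
  have hE : EllData (lamOf p ((1 / 2) ^ 2) 2) (LamOf p ((1 / 2) ^ 2) 2) δ (ball 0 3) (7 / 8)
      (dq h e w) (dqFlux p ε h e w) := by
    refine (hw.toSol.mono (min_le_left _ _) subset_rfl).ellData hp hε hh he hsub h34
      (fluxEll_halfSpace hp hε hε1 (by norm_num) he)
      (.of_forall fun x hx hd => ?_)
    obtain ⟨h1, h2⟩ := hq h hh hh' e he x hx
    have h3 := (abs_le.1 h1).2
    have h4 := (abs_le.1 ((abs_real_inner_le_norm _ _).trans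
      (show ‖∇ w (x + h • e) - ∇ w x‖ * ‖e‖ ≤ τ by rw [he, mul_one]; exact h2))).1
    rw [inner_sub_left] at h4
    exact ⟨⟨by linarith, hw.grad _ (hsub hx)⟩, ⟨by linarith, hw.grad _ (h34 x hx)⟩⟩
  have hsubset : ball (0 : Eu N) 1 ∩ {x | ⟪∇ w x, e⟫ < 13 / 16} ⊆
      ball (0 : Eu N) 1 ∩ {x | dq h e w x ≤ 7 / 8} := fun x hx => by
    have h0 : ⟪∇ w x, e⟫ < 13 / 16 := hx.2
    have := (abs_le.1 (hq h hh hh' e he x (h13 hx.1)).1).2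
    refine ⟨hx.1, ?_⟩
    show dq h e w x ≤ 7 / 8
    linarith
  have h5 := H2 _ _ hE
    (fun x hx => (abs_le.1 (hw.abs_dq_le hh he (hsub (h23 hx)) (h34 x (h23 hx)))).2)
    ((hB e he).le.trans (measureReal_mono hsubset
      (isBounded_ball.subset inter_subset_left).measure_lt_top.ne)) x hx
  have h6 := (abs_le.1 (hq h hh hh' e he x (ball_subset_ball (by norm_num) hx)).1).1
  linarith [min_le_left (δ / 2) (1 / 2)]

/-- Uniform modulus of continuity of the gradient of normalized solutions. -/
theorem exists_gradient_modulus (N : ℕ) (hp : 1 < p) : ∃ K, 0 < K ∧ K ≤ 1 ∧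
    ∀ τ, 0 < τ → ∃ ρ, 0 < ρ ∧ ρ ≤ 1 ∧ ∀ (ε : ℝ) (w k : Eu N → ℝ), 0 < ε → ε ≤ 4 →
      NSol p ε K w k → ∀ x ∈ ball (0 : Eu N) ρ, ∀ y ∈ ball (0 : Eu N) ρ,
        ‖∇ w x - ∇ w y‖ ≤ τ := by
  obtain ⟨δ, K, hδ, hδ1, hK, hK1, Hdich⟩ := exists_gradient_dichotomy N hp
  refine ⟨K, hK, hK1, fun τ hτ => ?_⟩
  obtain ⟨m, hm⟩ : ∃ m, m = 1 - δ := ⟨_, rfl⟩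
  have hm2 : 1 / 2 ≤ m := by linarith
  have hm0 : 0 < m := by linarith
  have hm1 : m < 1 := by linarith
  suffices hn : ∀ n : ℕ, ∃ ρ, 0 < ρ ∧ ρ ≤ 1 ∧ ∀ (ε : ℝ) (w k : Eu N → ℝ), 0 < ε → ε ≤ 4 →
      NSol p ε K w k → ∀ x ∈ ball (0 : Eu N) ρ, ∀ y ∈ ball (0 : Eu N) ρ,
        ‖∇ w x - ∇ w y‖ ≤ max τ (2 * m ^ n) by
    obtain ⟨n, hn'⟩ := exists_pow_lt_of_lt_one (half_pos hτ) hm1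
    have := hn n
    rwa [max_eq_left (by linarith)] at this
  have hl1 : 0 < lamOf p 1 5 := lamOf_pos hp (by norm_num) (by norm_num)
  have hL1 : 0 ≤ LamOf p 1 5 := LamOf_nonneg (by norm_num)
  obtain ⟨r0, hr0, hr01, H0⟩ := exists_gradient_osc_of_fluxEll N hp hl1 hL1 hτ
  have hl2 : 0 < lamOf p ((1 / 2) ^ 2) 2 := lamOf_pos hp (by norm_num) (by norm_num)
  have hL2 : 0 ≤ LamOf p ((1 / 2) ^ 2) 2 := LamOf_nonneg (by norm_num)
  obtain ⟨r1, hr1, hr11, H1⟩ := exists_gradient_osc_of_fluxEll N hp hl2 hL2 hτ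
  obtain ⟨r, hr⟩ : ∃ r, r = min (1 / 8) (m ^ (p - 1)) := ⟨_, rfl⟩
  have hr_pos : 0 < r := by rw [hr]; positivity
  have hr8 : r ≤ 1 / 8 := hr ▸ min_le_left _ _
  have hrm : r ≤ m ^ (p - 1) := hr ▸ min_le_right _ _
  intro n
  induction n with
  | zero =>
    refine ⟨1, one_pos, le_rfl, fun ε w k hε hε4 hw x hx y hy => ?_⟩
    have h14 : ball (0 : Eu N) 1 ⊆ ball 0 4 := ball_subset_ball (by norm_num)
    refine (norm_sub_le _ _).trans ((add_le_add (hw.grad x (h14 hx)) (hw.grad y (h14 hy))).trans ?_)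
    refine le_max_of_le_right ?_
    norm_num
  | succ n ih =>
    obtain ⟨ρ, hρ, hρ1, IH⟩ := ih
    refine ⟨min r0 (min (1 / 8 * r1) (r * ρ)), by positivity,
      (min_le_left _ _).trans hr01, fun ε w k hε hε4 hw x hx y hy => ?_⟩
    have hb0 : ball (0 : Eu N) (min r0 (min (1 / 8 * r1) (r * ρ))) ⊆ ball 0 r0 :=
      ball_subset_ball (min_le_left _ _)
    have hb1 : ball (0 : Eu N) (min r0 (min (1 / 8 * r1) (r * ρ))) ⊆ ball 0 (1 / 8 * r1) :=
      ball_subset_ball ((min_le_right _ _).trans (min_le_left _ _))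
    have hb2 : ball (0 : Eu N) (min r0 (min (1 / 8 * r1) (r * ρ))) ⊆ ball 0 (r * ρ) :=
      ball_subset_ball ((min_le_right _ _).trans (min_le_right _ _))
    rcases le_total 1 ε with h1 | h1
    · refine le_max_of_le_left (H0 ε (closedBall 0 1) w k hε ?_ (hw.mono hK1)
        (fun x hx => mem_closedBall_zero_iff.2 (hw.grad x hx)) x (hb0 hx) y (hb0 hy))
      refine fluxEll_of_bounds hp hε one_pos (convex_closedBall 0 1) fun z hz => ?_
      have := mem_closedBall_zero_iff.1 hz
      constructor <;> nlinarith [norm_nonneg z]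
    have hscale : ∀ {a : ℝ}, 0 < a → a ≤ 1 / 8 → ∀ y ∈ ball (0 : Eu N) 4,
        0 + a • y ∈ ball (0 : Eu N) (1 / 2) := fun {a} ha ha1 y hy => by
      rw [mem_ball_zero_iff] at *
      rw [zero_add, norm_smul, norm_of_nonneg ha.le]
      nlinarith
    have hh4 : ball (0 : Eu N) (1 / 2) ⊆ ball 0 4 := ball_subset_ball (by norm_num)
    rcases Hdich ε w k hε h1 hw with hA | ⟨e, he, hB⟩
    · have hs := hw.toSol.rescale_nsol hw.c1 hε hr_pos hm0 0 (c := 0)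
        (fun y hy => hh4 (hscale hr_pos hr8 y hy))
        (fun y hy => hm ▸ hA _ (hscale hr_pos hr8 y hy))
      have hKr : K * r / m ^ (p - 1) ≤ K := by
        rw [div_le_iff₀ (by positivity)]; gcongr
      have h2 := IH _ _ _ (by positivity) (by
        rw [div_le_iff₀ (by positivity)]; nlinarith) (hs.mono hKr)
      refine (norm_gradient_sub_le_of_rescale hr_pos hm0 h2 x (hb2 hx) y (hb2 hy)).trans ?_
      rw [mul_max_of_nonneg _ _ hm0.le, pow_succ]
      refine max_le_max (by nlinarith) (by nlinarith)
    · have h8 : (0 : ℝ) < 1 / 8 := by norm_num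
      have hs := hw.toSol.rescale_nsol hw.c1 hε h8 one_pos 0 (c := 0)
        (fun y hy => hh4 (hscale h8 le_rfl y hy))
        (fun y hy => hw.grad _ (hh4 (hscale h8 le_rfl y hy)))
      have hKr : K * (1 / 8) / 1 ^ (p - 1) ≤ 1 := by
        rw [one_rpow]; linarith
      have h2 := H1 _ {ξ : Eu N | 1 / 2 ≤ ⟪ξ, e⟫ ∧ ‖ξ‖ ≤ 1} _ _ (by positivity)
        (fluxEll_halfSpace hp (by positivity) (by simpa using h1) (by norm_num) he)
        (hs.mono hKr) fun y hy => by
          refine ⟨?_, hs.grad y hy⟩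
          rw [gradient_rescale w 0 h8, inv_one, one_smul]
          exact hB _ (hscale h8 le_rfl y hy)
      refine le_max_of_le_left ?_
      simpa using norm_gradient_sub_le_of_rescale h8 one_pos h2 x (hb1 hx) y (hb1 hy)

lemma exists_rescale_threshold {K₁ : ℝ} (hp : 1 < p) (hK : 0 ≤ K) (hK₁ : 0 < K₁) :
    ∃ m₀ : ℝ, 1 ≤ m₀ ∧ ∀ m r, m₀ ≤ m → 0 ≤ r → r ≤ 1 → K * r / m ^ (p - 1) ≤ K₁ := by
  have hp1 : 0 < p - 1 := by linarith
  refine ⟨max 1 ((K / K₁) ^ (p - 1)⁻¹), le_max_left _ _, fun m r hm hr hr1 => ?_⟩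
  have hm1 : 1 ≤ m := (le_max_left _ _).trans hm
  have h1 : K / K₁ ≤ m ^ (p - 1) := by
    have h := rpow_le_rpow (by positivity) ((le_max_right 1 ((K / K₁) ^ (p - 1)⁻¹)).trans hm)
      hp1.le
    rwa [← rpow_mul (by positivity), inv_mul_cancel₀ hp1.ne', rpow_one] at h
  rw [div_le_iff₀ hK₁] at h1
  rw [div_le_iff₀ (by positivity)]
  nlinarith

lemma exists_gradient_bound_unit (N : ℕ) (hp : 1 < p) (hS : 0 ≤ S) (hK : 0 ≤ K) :
    ∃ G, ∀ (ε : ℝ) (w k : Eu N → ℝ), 0 < ε → ε ≤ 1 → Sol p ε K (ball 0 1) w k →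
      ContDiffOn ℝ 1 w (ball 0 1) → (∀ x ∈ ball (0 : Eu N) 1, |w x| ≤ S) →
      ∀ x ∈ ball (0 : Eu N) (5 / 8), ‖∇ w x‖ ≤ G := by
  obtain ⟨K₁, hK₁, -, H⟩ := exists_gradient_modulus N hp
  obtain ⟨ρ, hρ, hρ1, H⟩ := H (1 / 4) (by norm_num)
  obtain ⟨m₀, hm₀, hthr⟩ := exists_rescale_threshold hp hK hK₁
  refine ⟨8 * max m₀ (64 * S / ρ), fun ε w k hε hε1 hw hc1 hwS => ?_⟩
  have hcl : closedBall (0 : Eu N) (3 / 4) ⊆ ball 0 1 := closedBall_subset_ball (by norm_num)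
  have hcont : ContinuousOn (fun x => (3 / 4 - ‖x‖) * ‖∇ w x‖) (closedBall (0 : Eu N) (3 / 4)) :=
    (continuous_const.sub continuous_norm).continuousOn.mul
      ((hc1.continuousOn_gradient isOpen_ball).mono hcl).norm
  obtain ⟨x₀, hx₀, hmax⟩ := (isCompact_closedBall (0 : Eu N) (3 / 4)).exists_isMaxOn
    ⟨0, by simp; norm_num⟩ hcont
  have hmax' : ∀ x ∈ closedBall (0 : Eu N) (3 / 4),
    (3 / 4 - ‖x‖) * ‖∇ w x‖ ≤ (3 / 4 - ‖x₀‖) * ‖∇ w x₀‖ := hmax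
  rw [mem_closedBall_zero_iff] at hx₀
  obtain ⟨d, hd⟩ : ∃ d, d = 3 / 4 - ‖x₀‖ := ⟨_, rfl⟩
  obtain ⟨a, ha⟩ : ∃ a, a = ‖∇ w x₀‖ := ⟨_, rfl⟩
  rw [← hd, ← ha] at hmax'
  have ha0 : 0 ≤ a := ha ▸ norm_nonneg _
  have hd0 : 0 ≤ d := by linarith
  have hd1 : d ≤ 3 / 4 := by linarith [norm_nonneg x₀]
  have hM0 : m₀ ≤ max m₀ (64 * S / ρ) := le_max_left _ _
  have hM1 : 64 * S / ρ ≤ max m₀ (64 * S / ρ) := le_max_right _ _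
  have key : d * a ≤ max m₀ (64 * S / ρ) := by
    by_cases hsmall : d = 0 ∨ 2 * a < m₀
    · rcases hsmall with h | h
      · rw [h]; linarith
      · nlinarith
    push Not at hsmall
    obtain ⟨hdne, hm⟩ := hsmall
    have hdpos : 0 < d := lt_of_le_of_ne hd0 (Ne.symm hdne)
    have hm1 : 1 ≤ 2 * a := hm₀.trans hm
    have hm0 : 0 < 2 * a := by linarith
    have hapos : 0 < a := by linarith
    obtain ⟨r, hr⟩ : ∃ r, r = d / 8 := ⟨_, rfl⟩
    have hr0 : 0 < r := by rw [hr]; positivity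
    have hnorm : ∀ y ∈ ball (0 : Eu N) 4, ‖x₀ + r • y‖ ≤ 3 / 4 - d / 2 := fun y hy => by
      rw [mem_ball_zero_iff] at hy
      refine (norm_add_le _ _).trans ?_
      rw [norm_smul, norm_of_nonneg hr0.le]
      nlinarith
    have hs := hw.rescale_nsol hc1 hε hr0 hm0 0 (c := x₀)
      (fun y hy => by rw [mem_ball_zero_iff]; linarith [hnorm y hy])
      (fun y hy => by
        have h1 := hnorm y hy
        have h2 := hmax' (x₀ + r • y) (by rw [mem_closedBall_zero_iff]; linarith)
        have h3 : d / 2 * ‖∇ w (x₀ + r • y)‖ ≤ d / 2 * (2 * a) := by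
          nlinarith [norm_nonneg (∇ w (x₀ + r • y))]
        exact le_of_mul_le_mul_left h3 (by positivity))
    have hmod := H _ _ _ (by positivity) (by
      rw [div_le_iff₀ (by positivity)]; nlinarith) (hs.mono (hthr _ r hm hr0.le (by linarith)))
    obtain ⟨W, hW⟩ : ∃ W, W = fun y => (w (x₀ + r • y) - 0) / (r * (2 * a)) := ⟨_, rfl⟩
    rw [← hW] at hmod hs
    have hg0 : ∇ W 0 = (2 * a)⁻¹ • ∇ w x₀ := by
      rw [hW, gradient_rescale w x₀ hr0, smul_zero, add_zero]
    have hng : ‖∇ W 0‖ = 1 / 2 := by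
      rw [hg0, norm_smul, ← ha, norm_of_nonneg (by positivity)]; field_simp
    obtain ⟨e, he⟩ : ∃ e, e = (2 : ℝ) • ∇ W 0 := ⟨_, rfl⟩
    have hne : ‖e‖ = 1 := by rw [he, norm_smul, hng]; norm_num
    have hρ4 : ball (0 : Eu N) ρ ⊆ ball 0 4 := ball_subset_ball (by linarith)
    have hye : (ρ / 2) • e ∈ ball (0 : Eu N) ρ := by
      rw [mem_ball_zero_iff, norm_smul, hne, norm_of_nonneg (by positivity)]; linarith
    obtain ⟨θ, hθ, h1, h2⟩ := exists_sub_eq_inner_gradient (convex_ball (0 : Eu N) ρ)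
      (fun x hx => hs.c1.hasGradientAt isOpen_ball (hρ4 hx)) (mem_ball_self hρ)
      (y := (ρ / 2) • e) (by rwa [zero_add])
    have h3 : 1 / 4 ≤ ⟪∇ W (0 + θ • (ρ / 2) • e), e⟫ := by
      have h4 := hmod _ h1 0 (mem_ball_self hρ)
      have h5 := (abs_le.1 ((abs_real_inner_le_norm _ _).trans
        (show ‖∇ W (0 + θ • (ρ / 2) • e) - ∇ W 0‖ * ‖e‖ ≤ 1 / 4 by
          rw [hne, mul_one]; exact h4))).1
      have h6 : ⟪∇ W 0, e⟫ = 1 / 2 := by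
        rw [he, inner_smul_right, real_inner_self_eq_norm_sq, hng]; norm_num
      rw [inner_sub_left, h6] at h5
      linarith
    rw [inner_smul_right] at h2
    have hWb : ∀ y ∈ ball (0 : Eu N) 4, |W y| ≤ S / (r * (2 * a)) := fun y hy => by
      rw [hW]
      simp only
      rw [abs_div, abs_of_pos (show 0 < r * (2 * a) by positivity), sub_zero]
      gcongr
      exact hwS _ (by rw [mem_ball_zero_iff]; linarith [hnorm y hy])
    have h7 := (abs_le.1 (hWb _ (hρ4 hye))).2
    have h8 := (abs_le.1 (hWb _ (hρ4 (mem_ball_self hρ)))).1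
    rw [zero_add] at h2
    have h9 : ρ / 2 * (1 / 4) ≤ 2 * (S / (r * (2 * a))) := by nlinarith
    have h10 : S / (r * (2 * a)) * (d * a) = 4 * S := by
      rw [hr]; field_simp; ring
    refine le_trans ?_ hM1
    rw [le_div_iff₀ hρ]
    nlinarith [mul_nonneg hd0 ha0]
  intro x hx
  rw [mem_ball_zero_iff] at hx
  have h1 := hmax' x (by rw [mem_closedBall_zero_iff]; linarith)
  nlinarith [norm_nonneg (∇ w x)]

lemma exists_gradient_modulus_unit (N : ℕ) (hp : 1 < p) (hS : 0 ≤ S) (hK : 0 ≤ K) (hτ : 0 < τ) :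
    ∃ ρ, 0 < ρ ∧ ρ ≤ 1 ∧ ∀ (ε : ℝ) (w k : Eu N → ℝ), 0 < ε → ε ≤ 1 → Sol p ε K (ball 0 1) w k →
      ContDiffOn ℝ 1 w (ball 0 1) → (∀ x ∈ ball (0 : Eu N) 1, |w x| ≤ S) →
      ∀ x ∈ ball (0 : Eu N) ρ, ‖∇ w x - ∇ w 0‖ ≤ τ := by
  obtain ⟨K₁, hK₁, -, H⟩ := exists_gradient_modulus N hp
  obtain ⟨G, HG⟩ := exists_gradient_bound_unit N hp hS hK
  obtain ⟨m₀, hm₀, hthr⟩ := exists_rescale_threshold hp hK hK₁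
  obtain ⟨m, hm⟩ : ∃ m, m = max m₀ G := ⟨_, rfl⟩
  have hmm : m₀ ≤ m := hm ▸ le_max_left _ _
  have hmG : G ≤ m := hm ▸ le_max_right _ _
  have hm0 : 0 < m := by linarith
  obtain ⟨ρ, hρ, hρ1, H⟩ := H (τ / m) (by positivity)
  refine ⟨1 / 8 * ρ, by positivity, by linarith, fun ε w k hε hε1 hw hc1 hwS x hx => ?_⟩
  have h8 : (0 : ℝ) < 1 / 8 := by norm_num
  have hb : ∀ y ∈ ball (0 : Eu N) 4, 0 + (1 / 8 : ℝ) • y ∈ ball (0 : Eu N) (5 / 8) := fun y hy => by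
    rw [mem_ball_zero_iff] at *
    rw [zero_add, norm_smul, norm_of_nonneg h8.le]; linarith
  have hs := hw.rescale_nsol hc1 hε h8 hm0 0 (c := 0)
    (fun y hy => ball_subset_ball (by norm_num) (hb y hy))
    (fun y hy => (HG ε w k hε hε1 hw hc1 hwS _ (hb y hy)).trans hmG)
  have h1 := H _ _ _ (by positivity) (by
      rw [div_le_iff₀ (by positivity)]; nlinarith) (hs.mono (hthr _ _ hmm h8.le (by norm_num)))
  have h2 := norm_gradient_sub_le_of_rescale h8 hm0 h1 x hx 0 (mem_ball_self (by positivity))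
  rwa [mul_div_cancel₀ _ hm0.ne'] at h2

lemma Sol.rescale_unit (hε : 0 < ε) (hd : 0 < d)
    (hw : Sol p ε K (ball c d) w k) (hc1 : ContDiffOn ℝ 1 w (ball c d))
    (hS : ∀ x ∈ ball c d, |w x| ≤ S) :
    ∃ W k' : Eu N → ℝ, Sol p ε (K * d) (ball 0 1) W k' ∧ ContDiffOn ℝ 1 W (ball 0 1) ∧
      (∀ x ∈ ball 0 1, |W x| ≤ S / d) ∧ ∀ y, ∇ W y = ∇ w (c + d • y) := by
  have hb : ∀ y ∈ ball 0 1, c + d • y ∈ ball c d := fun y hy => by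
    rw [mem_ball_zero_iff] at hy
    rw [mem_ball_iff_norm, add_sub_cancel_left, norm_smul, norm_of_nonneg hd.le]
    nlinarith
  refine ⟨fun y => (w (c + d • y) - 0) / (d * 1), fun y => d / 1 ^ (p - 1) * k (c + d • y),
    ?_, ?_, ?_, fun y => ?_⟩
  · have h := (hw.rescale hε c hd one_pos 0).mono (K' := K * d) (by simp) hb
    rwa [one_pow, div_one] at h
  · refine ContDiffOn.div_const (ContDiffOn.sub (hc1.comp (t := ball c d) ?_ hb)
      contDiffOn_const) _
    exact (contDiff_const.add (contDiff_id.const_smul d)).contDiffOn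
  · intro x hx
    simp only [mul_one, sub_zero, abs_div, abs_of_pos hd]
    gcongr
    exact hS _ (hb x hx)
  · rw [gradient_rescale w c hd, inv_one, one_smul]

/-- Interior gradient bound, uniform in the regularization. -/
theorem exists_gradient_bound (N : ℕ) (hp : 1 < p) (hS : 0 ≤ S) (hK : 0 ≤ K)
    (hd : 0 < d) : ∃ G, ∀ (ε : ℝ) (w k : Eu N → ℝ) (c : Eu N), 0 < ε → ε ≤ 1 →
      Sol p ε K (ball c d) w k → ContDiffOn ℝ 1 w (ball c d) → (∀ x ∈ ball c d, |w x| ≤ S) →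
      ‖∇ w c‖ ≤ G := by
  obtain ⟨G, H⟩ := exists_gradient_bound_unit N (K := K * d) (S := S / d) hp (by positivity)
    (by positivity)
  refine ⟨G, fun ε w k c hε hε1 hw hc1 hwS => ?_⟩
  obtain ⟨W, k', h1, h2, h3, h4⟩ := hw.rescale_unit hε hd hc1 hwS
  have := H ε W k' hε hε1 h1 h2 h3 0 (by simp)
  rwa [h4, smul_zero, add_zero] at this

/-- Interior modulus of continuity of the gradient, uniform in the regularization. -/
theorem exists_interior_gradient_modulus (N : ℕ) (hp : 1 < p) (hS : 0 ≤ S)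
    (hK : 0 ≤ K) (hd : 0 < d) (hτ : 0 < τ) : ∃ ρ, 0 < ρ ∧ ρ ≤ d ∧
      ∀ (ε : ℝ) (w k : Eu N → ℝ) (c : Eu N), 0 < ε → ε ≤ 1 →
      Sol p ε K (ball c d) w k → ContDiffOn ℝ 1 w (ball c d) → (∀ x ∈ ball c d, |w x| ≤ S) →
      ∀ x ∈ ball c ρ, ‖∇ w x - ∇ w c‖ ≤ τ := by
  obtain ⟨ρ, hρ, hρ1, H⟩ := exists_gradient_modulus_unit N (K := K * d) (S := S / d) hp
    (by positivity) (by positivity) hτ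
  refine ⟨d * ρ, by positivity, by nlinarith, fun ε w k c hε hε1 hw hc1 hwS x hx => ?_⟩
  obtain ⟨W, k', h1, h2, h3, h4⟩ := hw.rescale_unit hε hd hc1 hwS
  rw [mem_ball_iff_norm] at hx
  have := H ε W k' hε hε1 h1 h2 h3 (d⁻¹ • (x - c)) (by
    rwa [mem_ball_zero_iff, norm_smul, norm_of_nonneg (by positivity), inv_mul_lt_iff₀ hd])
  rwa [h4, h4, smul_zero, add_zero, smul_inv_smul₀ hd.ne', add_sub_cancel] at this

lemma abs_sub_sub_inner_le_of_osc
    (H : ∀ v : Eu N, v ≠ 0 → ‖v‖ ≤ 2 * ρ → ∀ x ∈ ball c ρ, ∀ y ∈ ball c ρ,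
      |(f (x + v) - f x) - (f (y + v) - f y)| ≤ τ * ‖v‖)
    (ha : a ∈ ball c ρ) (hd : DifferentiableAt ℝ f a) (hx : x ∈ ball c ρ)
    (hy : y ∈ ball c ρ) : |f y - f x - ⟪∇ f a, y - x⟫| ≤ τ * ‖y - x‖ := by
  rcases eq_or_ne y x with rfl | hne
  · simp
  obtain ⟨v, hv⟩ : ∃ v, v = y - x := ⟨_, rfl⟩
  have hv0 : v ≠ 0 := by rw [hv]; exact sub_ne_zero.2 hne
  have hv1 : ‖v‖ ≤ 2 * ρ := by
    rw [hv, ← dist_eq_norm]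
    have := dist_triangle_right y x c
    rw [mem_ball] at hx hy
    linarith
  have hlim := (hd.hasFDerivAt.lim_real v).comp tendsto_natCast_atTop_atTop
  rw [← hv]
  have hfv : (fderiv ℝ f a) v = ⟪∇ f a, v⟫ := (inner_gradient_left ..).symm
  rw [hfv] at hlim
  have hyv : y = x + v := by rw [hv]; abel
  refine le_of_tendsto ((tendsto_const_nhds (x := f y - f x)).sub hlim).abs ?_
  filter_upwards [eventually_ge_atTop 1] with n hn
  have hn0 : (0 : ℝ) < n := by exact_mod_cast hn
  simp only [Function.comp_apply, smul_eq_mul]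
  have htel : f y - f x = ∑ i ∈ Finset.range n, (f (x + (i / n : ℝ) • v + (n : ℝ)⁻¹ • v) -
      f (x + (i / n : ℝ) • v)) := by
    have h1 := Finset.sum_range_sub (fun i : ℕ => f (x + (i / n : ℝ) • v)) n
    rw [div_self hn0.ne', one_smul, ← hyv] at h1
    simp only [Nat.cast_zero, zero_div, zero_smul, add_zero] at h1
    rw [← h1]
    refine Finset.sum_congr rfl fun i _ => ?_
    rw [add_assoc x, ← add_smul]
    congr 4
    push_cast
    ring
  have hc : (n : ℝ) * (f (a + (n : ℝ)⁻¹ • v) - f a) =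
      ∑ i ∈ Finset.range n, (f (a + (n : ℝ)⁻¹ • v) - f a) := by
    rw [Finset.sum_const, Finset.card_range, nsmul_eq_mul]
  rw [htel, hc, ← Finset.sum_sub_distrib]
  refine (Finset.abs_sum_le_sum_abs _ _).trans ?_
  have hb : ∀ i ∈ Finset.range n, |f (x + (i / n : ℝ) • v + (n : ℝ)⁻¹ • v) -
      f (x + (i / n : ℝ) • v) - (f (a + (n : ℝ)⁻¹ • v) - f a)| ≤ τ * ‖v‖ / n := by
    intro i hi
    have hin : (i : ℝ) ≤ n := by exact_mod_cast (Finset.mem_range.1 hi).le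
    have hmem : x + (i / n : ℝ) • v ∈ ball c ρ := by
      rw [hv]
      exact (convex_ball c ρ).add_smul_sub_mem hx hy ⟨by positivity, (div_le_one hn0).2 hin⟩
    have hnv : ‖(n : ℝ)⁻¹ • v‖ = ‖v‖ / n := by
      rw [norm_smul, norm_inv, norm_of_nonneg hn0.le, inv_mul_eq_div]
    have := H ((n : ℝ)⁻¹ • v) (smul_ne_zero (by positivity) hv0) (by
      rw [hnv]
      exact (div_le_self (norm_nonneg v) (by exact_mod_cast hn)).trans hv1) _ hmem a ha
    rwa [hnv, ← mul_div_assoc] at this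
  refine (Finset.sum_le_sum hb).trans ?_
  rw [Finset.sum_const, Finset.card_range, nsmul_eq_mul, mul_div_cancel₀ _ hn0.ne']

lemma Sol.exists_osc_unit (hp : 1 < p) (hε : 0 < ε)
    (hw : Sol p ε K (ball 0 4) w k) (hL : ∀ x y, |w x - w y| ≤ ‖x - y‖) (hτ : 0 < τ) :
    ∃ r, 0 < r ∧ r ≤ 1 / 2 ∧ ∀ v : Eu N, v ≠ 0 → ‖v‖ ≤ 1 → ∀ x ∈ ball (0 : Eu N) r,
      ∀ y ∈ ball (0 : Eu N) r, |(w (x + v) - w x) - (w (y + v) - w y)| ≤ τ * ‖v‖ := by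
  have hg : ∀ x, ∇ w x ∈ closedBall (0 : Eu N) 1 := fun x => by
    rw [mem_closedBall_zero_iff, norm_gradient]
    refine norm_fderiv_le_of_lip' ℝ zero_le_one (.of_forall fun y => ?_)
    rw [one_mul, norm_eq_abs]; exact hL y x
  have hell := fluxEll_of_bounds (p := p) (ε := ε) (m := ε) (M := ε + 1) hp hε hε
    (convex_closedBall (0 : Eu N) 1) fun z hz => by
      rw [mem_closedBall_zero_iff] at hz
      constructor <;> nlinarith [norm_nonneg z]
  have hK : 0 ≤ K := (abs_nonneg _).trans (hw.bdd 0)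
  obtain ⟨r, hr, hr1, H⟩ := exists_oscillation_le N (lamOf_pos hp hε (M := ε + 1) (by linarith))
    (LamOf_nonneg (p := p) (M := ε + 1) hε) hK hτ
  refine ⟨r / 2, by positivity, by linarith, fun v hv hv1 x hx y hy => ?_⟩
  have hh : 0 < ‖v‖ := norm_pos_iff.2 hv
  have he : ‖(‖v‖⁻¹ • v)‖ = 1 := norm_smul_inv_norm (𝕜 := ℝ) hv
  have h34 : ∀ x ∈ ball (0 : Eu N) 3, x + ‖v‖ • (‖v‖⁻¹ • v) ∈ ball (0 : Eu N) 4 := fun x hx =>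
    add_smul_mem_ball hh (by linarith) he hx
  have hsub : ball (0 : Eu N) 3 ⊆ ball 0 4 := ball_subset_ball (by norm_num)
  have hrr : ball (0 : Eu N) (r / 2) ⊆ ball 0 r := ball_subset_ball (by linarith)
  have h1 := H _ _ (fun κ₀ => hw.ellData hp hε hh he hsub h34 hell
    (.of_forall fun x _ _ => ⟨hg _, hg _⟩)) (fun x _ => by
      rw [dq, abs_div, abs_of_pos hh, div_le_one hh]
      refine (hL _ _).trans ?_
      rw [add_sub_cancel_left, norm_smul, he, norm_norm, mul_one]) x (hrr hx) y (hrr hy)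
  rw [dq, dq, smul_inv_smul₀ hh.ne', ← sub_div, abs_div, abs_of_pos hh, div_le_iff₀ hh] at h1
  exact h1

lemma Sol.exists_linear_approx (hp : 1 < p)
    (hε : 0 < ε) (hU : IsOpen U) (hw : Sol p ε K U w k) (hc : c ∈ U) (hτ : 0 < τ) :
    ∃ ρ, 0 < ρ ∧ ∀ a ∈ ball c ρ, DifferentiableAt ℝ w a → ∀ x ∈ ball c ρ, ∀ y ∈ ball c ρ,
      |w y - w x - ⟪∇ w a, y - x⟫| ≤ τ * ‖y - x‖ := by
  obtain ⟨δ, hδ, hδU⟩ := Metric.isOpen_iff.1 hU c hc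
  obtain ⟨L, hL0, hL⟩ := hw.lip.exists_le
  obtain ⟨d, hd⟩ : ∃ d, d = min (δ / 4) 1 := ⟨_, rfl⟩
  have hd0 : 0 < d := by rw [hd]; positivity
  have hdδ : d * 4 ≤ δ := by have := min_le_left (δ / 4) 1; rw [← hd] at this; linarith
  have hd1 : d ≤ 1 := hd ▸ min_le_right _ _
  obtain ⟨m, hm⟩ : ∃ m, m = L + 1 := ⟨_, rfl⟩
  have hm0 : 0 < m := by linarith
  have hb : ball 0 4 ⊆ (fun y => c + d • y) ⁻¹' U := fun y hy => by
    rw [mem_ball_zero_iff] at hy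
    refine hδU ?_
    simp only [mem_ball_iff_norm, add_sub_cancel_left, norm_smul, norm_of_nonneg hd0.le]
    nlinarith
  have hs := (hw.rescale hε c hd0 hm0 0).mono le_rfl hb
  obtain ⟨r, hr, hr1, H⟩ := hs.exists_osc_unit hp (by positivity) (fun x y => by
    rw [← sub_div, abs_div, abs_of_pos (by positivity : 0 < d * m), div_le_iff₀ (by positivity)]
    have := hL (c + d • x) (c + d • y)
    rw [add_sub_add_left_eq_sub, ← smul_sub, norm_smul, norm_of_nonneg hd0.le] at this
    simp only [sub_zero]
    nlinarith [norm_nonneg (x - y), mul_nonneg hd0.le (norm_nonneg (x - y))])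
    (τ := τ / m) (by positivity)
  refine ⟨d * r, by positivity, fun a ha hda x hx y hy =>
    abs_sub_sub_inner_le_of_osc (fun v hv hv1 x hx y hy => ?_) ha hda hx hy⟩
  have hmem : ∀ x ∈ ball c (d * r), d⁻¹ • (x - c) ∈ ball 0 r := fun x hx => by
    rw [mem_ball_iff_norm] at hx
    rwa [mem_ball_zero_iff, norm_smul, norm_of_nonneg (by positivity), inv_mul_lt_iff₀ hd0]
  have hdv : ‖d⁻¹ • v‖ = ‖v‖ / d := by
    rw [norm_smul, norm_inv, norm_of_nonneg hd0.le, inv_mul_eq_div]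
  have h1 := H (d⁻¹ • v) (smul_ne_zero (by positivity) hv) (by
    rw [hdv, div_le_one hd0]; nlinarith) _ (hmem x hx) _ (hmem y hy)
  have e1 : ∀ x, c + d • (d⁻¹ • (x - c)) = x := fun x => by
    rw [smul_inv_smul₀ hd0.ne', add_sub_cancel]
  have e2 : ∀ x, c + d • (d⁻¹ • (x - c) + d⁻¹ • v) = x + v := fun x => by
    rw [← smul_add, smul_inv_smul₀ hd0.ne']; abel
  simp only [e1, e2, hdv, sub_zero] at h1
  rw [← sub_div, ← sub_div, ← sub_div, abs_div, abs_of_pos (by positivity : 0 < d * m),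
    div_le_iff₀ (by positivity)] at h1
  refine h1.trans (le_of_eq ?_)
  field_simp

/-- A Lipschitz weak solution of the regularized equation is continuously differentiable. -/
theorem Sol.contDiffOn (hp : 1 < p)
    (hε : 0 < ε) (hU : IsOpen U) (hw : Sol p ε K U w k) : ContDiffOn ℝ 1 w U := by
  have hae := hw.lip.ae_differentiableAt
  obtain ⟨C, hC0, hC⟩ := hw.lip.exists_norm_gradient_le
  have hpt : ∀ c ∈ U, ∀ ρ > 0, ∃ a ∈ ball c ρ, DifferentiableAt ℝ w a := by
    intro c _ ρ hρ
    by_contra! hcon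
    have h0 : volume (ball c ρ) = 0 :=
      measure_mono_null (fun x hx => hcon x hx) hae
    exact (measure_ball_pos volume c hρ).ne' h0
  have hdiff : ∀ c ∈ U, DifferentiableAt ℝ w c := by
    intro c hc
    have h1 : ∀ n : ℕ, ∃ ρ > 0, ∃ ξ : Eu N, ‖ξ‖ ≤ C ∧ ∀ y ∈ ball c ρ,
        |w y - w c - ⟪ξ, y - c⟫| ≤ (1 / (n + 1) : ℝ) * ‖y - c‖ := by
      intro n
      obtain ⟨ρ, hρ, h⟩ := hw.exists_linear_approx hp hε hU hc (τ := 1 / (n + 1)) (by positivity)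
      obtain ⟨a, ha, hda⟩ := hpt c hc ρ hρ
      exact ⟨ρ, hρ, _, hC a, h a ha hda c (mem_ball_self hρ)⟩
    choose ρ hρ ξ hξ h using h1
    obtain ⟨ζ, -, φ, hφ, hlim⟩ := tendsto_subseq_of_bounded (x := ξ)
      (isBounded_closedBall (x := 0) (r := C)) (fun n => by simpa using hξ n)
    have : HasGradientAt w ζ c := by
      rw [hasGradientAt_iff_hasFDerivAt, hasFDerivAt_iff_isLittleO, Asymptotics.isLittleO_iff]
      intro τ hτ
      have h2 := (hφ.tendsto_atTop.eventually
        ((tendsto_one_div_add_atTop_nhds_zero_nat (𝕜 := ℝ)).eventually_le_const (half_pos hτ)))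
      have h3 := (tendsto_iff_norm_sub_tendsto_zero.1 hlim).eventually_le_const (half_pos hτ)
      obtain ⟨n, hn1, hn2⟩ := (h2.and h3).exists
      filter_upwards [ball_mem_nhds c (hρ (φ n))] with y hy
      have h4 := h (φ n) y hy
      have h5 := abs_real_inner_le_norm (ξ (φ n) - ζ) (y - c)
      simp only [Function.comp_apply] at hn2
      rw [InnerProductSpace.toDual_apply_apply, norm_eq_abs]
      have h6 : w y - w c - ⟪ζ, y - c⟫ = (w y - w c - ⟪ξ (φ n), y - c⟫) +
        ⟪ξ (φ n) - ζ, y - c⟫ := by rw [inner_sub_left]; ring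
      rw [h6]
      refine (abs_add_le _ _).trans ?_
      nlinarith [norm_nonneg (y - c)]
    exact this.differentiableAt
  have hcont : ContinuousOn (∇ w) U := by
    intro c hc
    refine ContinuousAt.continuousWithinAt (Metric.continuousAt_iff.2 fun τ hτ => ?_)
    obtain ⟨ρ, hρ, h⟩ := hw.exists_linear_approx hp hε hU hc (τ := τ / 4) (by positivity)
    obtain ⟨δ, hδ, hδU⟩ := Metric.isOpen_iff.1 hU c hc
    refine ⟨min ρ δ, by positivity, fun a ha => ?_⟩
    have haρ : a ∈ ball c ρ := mem_ball.2 (ha.trans_le (min_le_left _ _))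
    have haU : a ∈ U := hδU (mem_ball.2 (ha.trans_le (min_le_right _ _)))
    rw [dist_eq_norm]
    refine lt_of_le_of_lt (norm_le_of_inner_le (c := τ / 2) (by positivity) fun e he => ?_)
      (half_lt_self hτ)
    have hmem : c + (ρ / 2) • e ∈ ball c ρ := by
      rw [mem_ball_iff_norm, add_sub_cancel_left, norm_smul, he, mul_one,
        norm_of_nonneg (by positivity)]
      linarith
    have h1 := h a haρ (hdiff a haU) c (mem_ball_self hρ) _ hmem
    have h2 := h c (mem_ball_self hρ) (hdiff c hc) c (mem_ball_self hρ) _ hmem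
    rw [add_sub_cancel_left, inner_smul_right, norm_smul, he, mul_one,
      norm_of_nonneg (by positivity)] at h1 h2
    rw [abs_le] at h1 h2
    rw [inner_sub_left]
    have : ρ / 2 * (⟪∇ w a, e⟫ - ⟪∇ w c, e⟫) ≤ ρ / 2 * (τ / 2) := by nlinarith
    exact le_of_mul_le_mul_left this (by positivity)
  rw [show (1 : WithTop ℕ∞) = 0 + 1 by simp, contDiffOn_succ_iff_fderiv_of_isOpen hU]
  refine ⟨fun x hx => (hdiff x hx).differentiableWithinAt, by simp, ?_⟩
  rw [contDiffOn_zero]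
  have : fderiv ℝ w = fun x => InnerProductSpace.toDual ℝ (Eu N) (∇ w x) := by
    funext x; simp [gradient]
  rw [this]
  exact (InnerProductSpace.toDual ℝ (Eu N)).continuous.comp_continuousOn hcont

lemma isLip_of_contDiff (hg : ContDiff ℝ 1 g) (hc : HasCompactSupport g) : IsLip g :=
  ContDiff.lipschitzWith_of_hasCompactSupport hc hg one_ne_zero

lemma exists_isLip_integral_sub_le (hf : Integrable f) (hδ : 0 < δ) :
    ∃ g : Eu N → ℝ, IsLip g ∧ HasCompactSupport g ∧ ∫ x, |f x - g x| ≤ δ := by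
  obtain ⟨g, hgc, hg, h⟩ := (memLp_one_iff_integrable.2 hf).exist_eLpNorm_sub_le
    ENNReal.one_ne_top le_rfl hδ
  have hgi : Integrable g := hg.continuous.integrable_of_hasCompactSupport hgc
  refine ⟨g, isLip_of_contDiff (hg.of_le (by simp)) hgc, hgc, ?_⟩
  rw [eLpNorm_one_eq_lintegral_enorm] at h
  have h1 := integral_norm_eq_lintegral_enorm (hf.sub hgi).aestronglyMeasurable
  simp only [Pi.sub_apply, norm_eq_abs] at h1 h
  rw [h1]
  exact ENNReal.toReal_le_of_le_ofReal hδ.le h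

lemma integral_mul_inner_gradient {d : Eu N → ℝ} (hg : IsLip g) (hd : IsLip d)
    (hc : HasCompactSupport d) (e : Eu N) :
    ∫ x, g x * ⟪e, ∇ d x⟫ = - ∫ x, ⟪e, ∇ g x⟫ * d x := by
  have h := LipschitzWith.integral_lineDeriv_mul_eq (μ := volume) hg.choose_spec hd.choose_spec hc e
  have h1 : ∫ x, lineDeriv ℝ g x e * d x = ∫ x, ⟪e, ∇ g x⟫ * d x := by
    refine integral_congr_ae ?_
    filter_upwards [hg.ae_differentiableAt] with x hx
    rw [hx.lineDeriv_eq_fderiv, real_inner_comm, inner_gradient_left]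
  have h2 : ∫ x, lineDeriv ℝ d x (-e) * g x = ∫ x, -(g x * ⟪e, ∇ d x⟫) := by
    refine integral_congr_ae ?_
    filter_upwards [hd.ae_differentiableAt] with x hx
    rw [hx.lineDeriv_eq_fderiv, real_inner_comm, inner_gradient_left, map_neg]
    ring
  rw [h1, h2, integral_neg] at h
  rw [h, neg_neg]

lemma tendsto_integral_mul_inner_gradient (hf : Integrable f) {d : ℕ → Eu N → ℝ}
    (hd : ∀ n, IsLip (d n)) (hc : ∀ n, HasCompactSupport (d n))
    (hC : ∀ n x, ‖∇ (d n) x‖ ≤ C) (hC' : ∀ n x, |d n x| ≤ C')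
    (hlim : ∀ x, Tendsto (fun n => d n x) atTop (nhds 0)) (he : ‖e‖ ≤ 1) :
    Tendsto (fun n => ∫ x, f x * ⟪e, ∇ (d n) x⟫) atTop (nhds 0) := by
  have hC0 : 0 ≤ C := (norm_nonneg _).trans (hC 0 0)
  have hin : ∀ n x, |⟪e, ∇ (d n) x⟫| ≤ C := fun n x =>
    (abs_real_inner_le_norm _ _).trans (by nlinarith [hC n x, norm_nonneg (∇ (d n) x)])
  have hmeas : ∀ n, Measurable fun x => ⟪e, ∇ (d n) x⟫ := fun n =>
    measurable_const.inner (measurable_gradient _)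
  rw [Metric.tendsto_atTop]
  intro τ hτ
  obtain ⟨g, hg, hgc, hgf⟩ := exists_isLip_integral_sub_le hf (δ := τ / (2 * (C + 1)))
    (by positivity)
  have hgi := hg.integrable_of_hasCompactSupport hgc
  have h1 : Tendsto (fun n => ∫ x, g x * ⟪e, ∇ (d n) x⟫) atTop (nhds 0) := by
    simp_rw [fun n => integral_mul_inner_gradient hg (hd n) (hc n) e]
    rw [← neg_zero]
    refine Tendsto.neg ?_
    rw [← integral_zero (Eu N) ℝ]
    refine tendsto_integral_of_dominated_convergence (fun x => ‖∇ g x‖ * C') (fun n => ?_)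
      ((hg.integrable_norm_gradient hgc).mul_const _) (fun n => ?_) ?_
    · exact ((measurable_const.inner (measurable_gradient _)).mul
        (hd n).continuous.measurable).aestronglyMeasurable
    · refine .of_forall fun x => ?_
      rw [norm_mul, norm_eq_abs, norm_eq_abs]
      refine mul_le_mul ?_ (hC' n x) (abs_nonneg _) (norm_nonneg _)
      exact (abs_real_inner_le_norm _ _).trans (by nlinarith [norm_nonneg (∇ g x)])
    · refine .of_forall fun x => ?_
      simpa using (hlim x).const_mul ⟪e, ∇ g x⟫
  obtain ⟨n₀, hn₀⟩ := Metric.tendsto_atTop.1 h1 (τ / 2) (by positivity)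
  refine ⟨n₀, fun n hn => ?_⟩
  have h2 := hn₀ n hn
  rw [dist_zero_right, norm_eq_abs] at h2 ⊢
  have hi1 : Integrable fun x => f x * ⟪e, ∇ (d n) x⟫ :=
    hf.mul_bdd (c := C) (hmeas n).aestronglyMeasurable (.of_forall (hin n))
  have hi2 : Integrable fun x => g x * ⟪e, ∇ (d n) x⟫ :=
    hgi.mul_bdd (c := C) (hmeas n).aestronglyMeasurable (.of_forall (hin n))
  have h3 : |∫ x, f x * ⟪e, ∇ (d n) x⟫ - g x * ⟪e, ∇ (d n) x⟫| ≤
      ∫ x, |f x - g x| * C := by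
    refine (abs_integral_le_integral_abs).trans (integral_mono_of_nonneg
      (.of_forall fun x => abs_nonneg _) ((hf.sub hgi).abs.mul_const C)
      (.of_forall fun x => ?_))
    simp only [← sub_mul, abs_mul]
    exact mul_le_mul_of_nonneg_left (hin n x) (abs_nonneg _)
  have h4 := integral_sub hi1 hi2
  rw [integral_mul_const] at h3
  rw [h4] at h3
  have h5 : (∫ x, |f x - g x|) * C ≤ τ / (2 * (C + 1)) * C := by gcongr
  have h6 : τ / (2 * (C + 1)) * C ≤ τ / 2 := by
    rw [div_mul_eq_mul_div, div_le_div_iff₀ (by positivity) (by positivity)]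
    nlinarith
  rw [abs_lt] at h2 ⊢
  have := abs_le.1 (h3.trans (h5.trans h6))
  constructor <;> linarith

lemma tendsto_integral_inner_gradient (hF : Integrable F) {d : ℕ → Eu N → ℝ}
    (hd : ∀ n, IsLip (d n)) (hc : ∀ n, HasCompactSupport (d n))
    (hC : ∀ n x, ‖∇ (d n) x‖ ≤ C) (hC' : ∀ n x, |d n x| ≤ C')
    (hlim : ∀ x, Tendsto (fun n => d n x) atTop (nhds 0)) :
    Tendsto (fun n => ∫ x, ⟪F x, ∇ (d n) x⟫) atTop (nhds 0) := by
  let b := EuclideanSpace.basisFun (Fin N) ℝ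
  have hb : ∀ i, ‖b i‖ ≤ 1 := fun i => (b.orthonormal.1 i).le
  have hFi : ∀ i, Integrable fun x => ⟪F x, b i⟫ := fun i => hF.inner_const _
  have h1 : ∀ n, ∫ x, ⟪F x, ∇ (d n) x⟫ =
      ∑ i, ∫ x, ⟪F x, b i⟫ * ⟪b i, ∇ (d n) x⟫ := by
    intro n
    rw [← integral_finsetSum]
    · exact integral_congr_ae (.of_forall fun x =>
        (b.sum_inner_mul_inner _ _).symm)
    · intro i _
      refine (hFi i).mul_bdd (c := C)
        (measurable_const.inner (measurable_gradient _)).aestronglyMeasurable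
        (.of_forall fun x => (abs_real_inner_le_norm _ _).trans ?_)
      nlinarith [hC n x, norm_nonneg (∇ (d n) x), hb i]
  simp_rw [h1]
  have h2 := tendsto_finsetSum (Finset.univ : Finset (Fin N)) fun i _ =>
    tendsto_integral_mul_inner_gradient (hFi i) hd hc hC hC' hlim (hb i)
  rwa [Finset.sum_const_zero] at h2

/-- Diagonal extraction of a pointwise convergent subsequence from an equicontinuous sequence. -/
lemma exists_subseq_tendsto {F : Type*} [NormedAddCommGroup F] [ProperSpace F]
    (f : ℕ → Eu N → F) (hb : ∀ x ∈ U, ∃ C, ∀ n, ‖f n x‖ ≤ C)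
    (heq : ∀ x ∈ U, ∀ τ > 0, ∃ ρ > 0, ∀ n, ∀ y ∈ ball x ρ, ‖f n y - f n x‖ ≤ τ) :
    ∃ φ : ℕ → ℕ, StrictMono φ ∧ ∃ g : Eu N → F, ∀ x ∈ U,
      Tendsto (fun n => f (φ n) x) atTop (nhds (g x)) := by
  obtain ⟨t, htU, htc, htd⟩ :=
    (TopologicalSpace.IsSeparable.of_separableSpace U).exists_countable_dense_subset
  have : Countable t := htc.to_subtype
  choose! C hC using hb
  have hK : IsCompact (Set.pi univ fun x : t => closedBall (0 : F) (C x)) :=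
    isCompact_univ_pi fun x => isCompact_closedBall _ _
  obtain ⟨g, -, φ, hφ, hlim⟩ := hK.tendsto_subseq (x := fun n (x : t) => f n x) fun n x _ => by
    rw [mem_closedBall_zero_iff]
    exact hC x (htU x.2) n
  refine ⟨φ, hφ, ?_⟩
  have hcau : ∀ x ∈ U, ∃ l, Tendsto (fun n => f (φ n) x) atTop (nhds l) := by
    intro x hx
    refine cauchySeq_tendsto_of_complete (Metric.cauchySeq_iff'.2 fun τ hτ => ?_)
    obtain ⟨ρ, hρ, h⟩ := heq x hx (τ / 4) (by positivity)
    obtain ⟨q, hqt, hq⟩ := Metric.mem_closure_iff.1 (htd hx) ρ hρ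
    have h1 := (tendsto_pi_nhds.1 hlim ⟨q, hqt⟩).cauchySeq
    obtain ⟨n₀, hn₀⟩ := Metric.cauchySeq_iff'.1 h1 (τ / 4) (by positivity)
    refine ⟨n₀, fun n hn => ?_⟩
    have h2 := hn₀ n hn
    have hqb : q ∈ ball x ρ := by rwa [mem_ball, dist_comm]
    have h3 := h (φ n) q hqb
    have h4 := h (φ n₀) q hqb
    rw [← dist_eq_norm] at h3 h4
    simp only [Function.comp_apply] at h2
    have h5 := dist_triangle4 (f (φ n) x) (f (φ n) q) (f (φ n₀) q) (f (φ n₀) x)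
    rw [dist_comm] at h3
    linarith
  choose! l hl using hcau
  exact ⟨l, hl⟩

lemma exists_mem_sphere_of_mem_of_notMem (hx : x ∈ closedBall c R)
    (hy : y ∉ ball c R) : ∃ z ∈ sphere c R, ‖x - z‖ + ‖z - y‖ = ‖x - y‖ := by
  have hcont : ContinuousOn (fun t : ℝ => ‖x + t • (y - x) - c‖) (Icc 0 1) := by fun_prop
  rw [mem_closedBall_iff_norm] at hx
  rw [mem_ball_iff_norm, not_lt] at hy
  obtain ⟨t, ht, htR⟩ := intermediate_value_Icc (zero_le_one' ℝ) hcont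
    (show R ∈ Icc _ _ from ⟨by simpa using hx, by simpa using hy⟩)
  refine ⟨x + t • (y - x), mem_sphere_iff_norm.2 htR, ?_⟩
  have e1 : x - (x + t • (y - x)) = t • (x - y) := by rw [smul_sub, smul_sub]; abel
  have e2 : x + t • (y - x) - y = (1 - t) • (x - y) := by
    rw [sub_smul, one_smul, smul_sub, smul_sub]; abel
  rw [e1, e2, norm_smul, norm_smul, norm_of_nonneg ht.1,
    norm_of_nonneg (by linarith [ht.2] : (0 : ℝ) ≤ 1 - t)]
  ring

/-- Gluing of Lipschitz bounds across a sphere. -/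
lemma abs_sub_le_of_glue
    (h1 : ∀ x ∈ closedBall c R, ∀ y ∈ closedBall c R, |v x - v y| ≤ L * ‖x - y‖)
    (h2 : ∀ x, x ∉ ball c R → ∀ y, y ∉ ball c R → |v x - v y| ≤ L * ‖x - y‖) (x y : Eu N) :
    |v x - v y| ≤ L * ‖x - y‖ := by
  have key : ∀ x y, x ∈ closedBall c R → y ∉ ball c R → |v x - v y| ≤ L * ‖x - y‖ := by
    intro x y hx hy
    obtain ⟨z, hz, hzeq⟩ := exists_mem_sphere_of_mem_of_notMem hx hy
    have hz1 : z ∈ closedBall c R := sphere_subset_closedBall hz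
    have hz2 : z ∉ ball c R := fun h => (mem_ball.1 h).ne (mem_sphere.1 hz)
    have h3 := h1 x hx z hz1
    have h4 := h2 z hz2 y hy
    have h5 := abs_sub_le (v x) (v z) (v y)
    rw [← hzeq]
    linarith
  by_cases hx : x ∈ closedBall c R
  · by_cases hy : y ∈ ball c R
    · exact h1 x hx y (ball_subset_closedBall hy)
    · exact key x y hx hy
  · have hx' : x ∉ ball c R := fun h => hx (ball_subset_closedBall h)
    by_cases hy : y ∈ closedBall c R
    · rw [abs_sub_comm, norm_sub_rev]; exact key y x hy hx'
    · exact h2 x hx' y fun h => hy (ball_subset_closedBall h)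

lemma gradient_ae_eq_zero_of_eq_zero {d : Eu N → ℝ} (hR : 0 < R)
    (h : ∀ x, x ∉ ball c R → d x = 0) : ∀ᵐ x, x ∉ ball c R → ∇ d x = 0 := by
  have h0 : ∀ᵐ x, x ∉ sphere c R := measure_eq_zero_iff_ae_notMem.1
    (Measure.addHaar_sphere_of_ne_zero volume c hR.ne')
  filter_upwards [h0] with x hx hxb
  have hx' : x ∈ (closedBall c R)ᶜ := fun hxc => by
    rw [← ball_union_sphere] at hxc
    exact hxc.elim hxb hx
  have : d =ᶠ[nhds x] fun _ => 0 := by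
    filter_upwards [isClosed_closedBall.isOpen_compl.mem_nhds hx'] with y hy
    exact h y fun hy' => hy (ball_subset_closedBall hy')
  rw [this.gradient_eq]
  exact gradient_fun_const x 0

lemma hasCompactSupport_of_eq_zero {d : Eu N → ℝ}
    (h : ∀ x, x ∉ ball c R → d x = 0) : HasCompactSupport d :=
  HasCompactSupport.intro (isCompact_closedBall c R) fun x hx =>
    h x fun hx' => hx (ball_subset_closedBall hx')

lemma flux_mono (hp : 1 < p) (hε : 0 < ε) (ξ ζ : Eu N) :
    0 ≤ ⟪flux p ε ζ - flux p ε ξ, ζ - ξ⟫ := by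
  obtain ⟨M, hM⟩ : ∃ M, M = max ‖ξ‖ ‖ζ‖ := ⟨_, rfl⟩
  have hM0 : 0 ≤ M := hM ▸ (norm_nonneg ξ).trans (le_max_left _ _)
  have h := fluxEll_of_bounds (M := ε + M ^ 2) hp hε hε (convex_closedBall (0 : Eu N) M)
    fun z hz => by
      rw [mem_closedBall, dist_zero_right] at hz
      exact ⟨by nlinarith [norm_nonneg z], by gcongr⟩
  have h1 := (h ξ (by simp [hM]) ζ (by simp [hM])).1
  refine le_trans (mul_nonneg (lamOf_pos hp hε (by positivity)).le (by positivity)) h1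

/-- The energy density whose gradient is `flux p ε`. -/
def fluxEnergy (p ε : ℝ) (ξ : Eu N) : ℝ := (ε + ‖ξ‖ ^ 2) ^ (p / 2) / p

lemma hasDerivAt_fluxEnergy (hp : 1 < p) (hε : 0 < ε) (ξ η : Eu N) (t : ℝ) :
    HasDerivAt (fun t : ℝ => fluxEnergy p ε (ξ + t • η)) ⟪flux p ε (ξ + t • η), η⟫ t := by
  have h1 : HasDerivAt (fun t : ℝ => ξ + t • η) η t := by
    simpa using ((hasDerivAt_id t).smul_const η).const_add ξ
  have h2 : HasDerivAt (fun t : ℝ => ε + ‖ξ + t • η‖ ^ 2) (2 * ⟪ξ + t • η, η⟫) t := by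
    simpa using (h1.norm_sq).const_add ε
  have hb : ε + ‖ξ + t • η‖ ^ 2 ≠ 0 := by positivity
  refine ((h2.rpow_const (p := p / 2) (Or.inl hb)).div_const p).congr_deriv ?_
  have hp0 : p ≠ 0 := by positivity
  rw [flux, inner_smul_left, conj_trivial, show p / 2 - 1 = (p - 2) / 2 by ring]
  field_simp

lemma fluxEnergy_sub_ge (hp : 1 < p) (hε : 0 < ε) (ξ ζ : Eu N) :
    ⟪flux p ε ξ, ζ - ξ⟫ ≤ fluxEnergy p ε ζ - fluxEnergy p ε ξ := by
  obtain ⟨s, hs, hseq⟩ := exists_hasDerivAt_eq_slope _ _ (zero_lt_one' ℝ)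
    (fun t _ => (hasDerivAt_fluxEnergy hp hε ξ (ζ - ξ) t).continuousAt.continuousWithinAt)
    (fun t _ => hasDerivAt_fluxEnergy hp hε ξ (ζ - ξ) t)
  simp only [one_smul, add_sub_cancel, zero_smul, add_zero, sub_zero, div_one] at hseq
  rw [← hseq]
  have h := flux_mono hp hε ξ (ξ + s • (ζ - ξ))
  rw [add_sub_cancel_left, inner_smul_right, inner_sub_left] at h
  have := nonneg_of_mul_nonneg_right h hs.1
  linarith

lemma measurable_fluxEnergy (p ε : ℝ) : Measurable (fluxEnergy p ε : Eu N → ℝ) := by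
  unfold fluxEnergy; fun_prop

lemma fluxEnergy_bdd (hp : 1 < p) (hε : 0 < ε) (h : ‖ξ‖ ≤ M) :
    |fluxEnergy p ε ξ| ≤ (ε + M ^ 2) ^ (p / 2) / p := by
  rw [fluxEnergy, abs_of_nonneg (by positivity)]
  have := norm_nonneg ξ
  gcongr

/-- The competitors of the obstacle-free gradient-constrained problem in a ball. -/
def Adm (c : Eu N) (R L : ℝ) (ψ v : Eu N → ℝ) : Prop :=
  (∀ x y, |v x - v y| ≤ L * ‖x - y‖) ∧ ∀ x, x ∉ ball c R → v x = ψ x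

lemma norm_gradient_le_of_le (hL : 0 ≤ L)
    (h : ∀ x y, |v x - v y| ≤ L * ‖x - y‖) (x : Eu N) : ‖∇ v x‖ ≤ L := by
  rw [norm_gradient]
  have h1 : LipschitzWith ⟨L, hL⟩ v := LipschitzWith.of_dist_le_mul fun a b => by
    rw [dist_eq, dist_eq_norm]; exact h a b
  exact norm_fderiv_le_of_lipschitz ℝ h1

lemma gradient_sub_ae (hv : IsLip v) (hw : IsLip w) :
    ∀ᵐ x, ∇ (fun x => v x - w x) x = ∇ v x - ∇ w x := by
  filter_upwards [hv.hasGradientAt_ae, hw.hasGradientAt_ae] with x h1 h2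
  exact (h1.sub' h2).gradient

lemma gradient_add_ae (hv : IsLip v) (hw : IsLip w) :
    ∀ᵐ x, ∇ (fun x => v x + w x) x = ∇ v x + ∇ w x := by
  filter_upwards [hv.hasGradientAt_ae, hw.hasGradientAt_ae] with x h1 h2
  exact (h1.add' h2).gradient

namespace Adm

lemma isLip (_hL : 0 ≤ L) (h : Adm c R L ψ v) : IsLip v := isLip_of_le h.1

lemma norm_gradient_le (hL : 0 ≤ L) (h : Adm c R L ψ v) (x : Eu N) : ‖∇ v x‖ ≤ L :=
  norm_gradient_le_of_le hL h.1 x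

lemma abs_sub_le_const (hN : 0 < N) (hR : 0 < R) (hL : 0 ≤ L) (hv : Adm c R L ψ v) (hw : Adm c R L ψ w)
    (x : Eu N) : |v x - w x| ≤ 4 * L * R := by
  by_cases hx : x ∈ ball c R
  · have : Nonempty (Fin N) := ⟨⟨0, hN⟩⟩
    have : Nontrivial (Eu N) := inferInstance
    obtain ⟨z, hz⟩ := (NormedSpace.sphere_nonempty (x := c) (r := R)).2 hR.le
    have hz2 : z ∉ ball c R := fun h => (mem_ball.1 h).ne (mem_sphere.1 hz)
    have h1 := hv.1 x z
    have h2 := hw.1 z x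
    have h3 : ‖x - z‖ ≤ 2 * R := by
      have := dist_triangle x c z
      rw [mem_ball] at hx
      rw [mem_sphere, dist_comm] at hz
      rw [← dist_eq_norm]; linarith
    rw [norm_sub_rev] at h2
    have h4 : v z = w z := by rw [hv.2 z hz2, hw.2 z hz2]
    have h5 : L * ‖x - z‖ ≤ L * (2 * R) := by gcongr
    have := abs_sub_le (v x) (v z) (w x)
    rw [h4] at this h1
    rw [abs_le] at *
    constructor <;> linarith
  · rw [hv.2 x hx, hw.2 x hx, sub_self, abs_zero]; positivity

lemma convex (hv : Adm c R L ψ v) (hw : Adm c R L ψ w) (h0 : 0 ≤ t) (h1 : t ≤ 1) :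
    Adm c R L ψ (fun x => w x + t * (v x - w x)) := by
  refine ⟨fun x y => ?_, fun x hx => by
    simp only [hv.2 x hx, hw.2 x hx]; ring⟩
  have e : w x + t * (v x - w x) - (w y + t * (v y - w y)) =
      (1 - t) * (w x - w y) + t * (v x - v y) := by ring
  rw [e]
  refine (abs_add_le _ _).trans ?_
  rw [abs_mul, abs_mul, abs_of_nonneg h0, abs_of_nonneg (by linarith : 0 ≤ 1 - t)]
  nlinarith [hv.1 x y, hw.1 x y]

end Adm

/-- The energy in a ball. -/
def ballEnergy (p ε μ : ℝ) (c : Eu N) (R : ℝ) (ψ k v : Eu N → ℝ) : ℝ :=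
  ∫ x in ball c R, (fluxEnergy p ε (∇ v x) + (μ / 2 * (v x - ψ x) ^ 2 - k x * v x))

/-- The first variation of `ballEnergy` in direction `d`. -/
def ballVar (p ε μ : ℝ) (c : Eu N) (R : ℝ) (ψ k w d : Eu N → ℝ) : ℝ :=
  ∫ x in ball c R, (⟪flux p ε (∇ w x), ∇ d x⟫ + (μ * (w x - ψ x) - k x) * d x)

section
variable {d : Eu N → ℝ}

lemma IsLip.bdd_ball (hv : IsLip v) (c : Eu N) (R : ℝ) : ∃ C, 0 ≤ C ∧ ∀ x ∈ ball c R, |v x| ≤ C := by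
  obtain ⟨C, hC⟩ := (isCompact_closedBall c R).exists_bound_of_continuousOn hv.continuous.continuousOn
  exact ⟨Max.max C 0, le_max_right _ _,
    fun x hx => (hC x (ball_subset_closedBall hx)).trans (le_max_left _ _)⟩

lemma integrableOn_ball_of_bdd (hf : Measurable f)
    (hC : ∀ x ∈ ball c R, |f x| ≤ C) : IntegrableOn f (ball c R) :=
  Measure.integrableOn_of_bounded (M := C) measure_ball_lt_top.ne hf.aestronglyMeasurable
    ((ae_restrict_iff' measurableSet_ball).2 (.of_forall hC))

lemma integrableOn_ballEnergy (hp : 1 < p) (hε : 0 < ε) (hψ : IsLip ψ) (hk : Measurable k)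
    (hK : ∀ x, |k x| ≤ K) (hv : IsLip v) :
    IntegrableOn (fun x => fluxEnergy p ε (∇ v x) + (μ / 2 * (v x - ψ x) ^ 2 - k x * v x))
      (ball c R) := by
  have hvm := hv.continuous.measurable
  obtain ⟨G, hG0, hG⟩ := hv.exists_norm_gradient_le
  obtain ⟨C, hC0, hC⟩ := hv.bdd_ball c R
  obtain ⟨D, hD0, hD⟩ := (hv.sub hψ).bdd_ball c R
  refine (integrableOn_ball_of_bdd ((measurable_fluxEnergy p ε).comp (measurable_gradient v))
    fun x _ => fluxEnergy_bdd hp hε (hG x)).add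
    (IntegrableOn.sub (f := fun x => μ / 2 * (v x - ψ x) ^ 2) (g := fun x => k x * v x)
    (integrableOn_ball_of_bdd (C := |μ / 2| * D ^ 2)
      (((hvm.sub hψ.continuous.measurable).pow_const 2).const_mul _) fun x hx => ?_)
    (integrableOn_ball_of_bdd (C := K * C) (hk.mul hvm) fun x hx => ?_))
  · rw [abs_mul, abs_pow]; gcongr; exact hD x hx
  · rw [abs_mul]
    exact mul_le_mul (hK x) (hC x hx) (abs_nonneg _) ((abs_nonneg _).trans (hK x))

lemma ballVar_integrand_le (hp : 1 < p) (hε : 0 < ε) (hK : ∀ x, |k x| ≤ K) {G D D' : ℝ}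
    (hG : ‖∇ w x‖ ≤ G) (hD : ‖∇ d x‖ ≤ D) (hA : |w x - ψ x| ≤ A) (hD' : |d x| ≤ D') :
    |⟪flux p ε (∇ w x), ∇ d x⟫ + (μ * (w x - ψ x) - k x) * d x| ≤
      (ε + G ^ 2) ^ ((p - 1) / 2) * D + (|μ| * A + K) * D' := by
  have h1 := abs_real_inner_le_norm (flux p ε (∇ w x)) (∇ d x)
  have h2 : ‖flux p ε (∇ w x)‖ * ‖∇ d x‖ ≤ (ε + G ^ 2) ^ ((p - 1) / 2) * D :=
    mul_le_mul (norm_flux_le_of_norm_le hp hε hG) hD (norm_nonneg _) (by positivity)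
  have h3 : |μ * (w x - ψ x) - k x| ≤ |μ| * A + K := by
    refine (abs_sub _ _).trans ?_
    rw [abs_mul]
    have := hK x
    gcongr
  refine (abs_add_le _ _).trans (add_le_add (h1.trans h2) ?_)
  rw [abs_mul]
  exact mul_le_mul h3 hD' (abs_nonneg _) ((abs_nonneg _).trans h3)

lemma integrableOn_ballVar (hp : 1 < p) (hε : 0 < ε) (hψ : IsLip ψ) (hk : Measurable k)
    (hK : ∀ x, |k x| ≤ K) (hw : IsLip w) (hd : IsLip d) :
    IntegrableOn (fun x => ⟪flux p ε (∇ w x), ∇ d x⟫ +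
      (μ * (w x - ψ x) - k x) * d x) (ball c R) := by
  obtain ⟨G, hG0, hG⟩ := hw.exists_norm_gradient_le
  obtain ⟨D, hD0, hD⟩ := hd.exists_norm_gradient_le
  obtain ⟨A, hA0, hA⟩ := (hw.sub hψ).bdd_ball c R
  obtain ⟨D', hD'0, hD'⟩ := hd.bdd_ball c R
  refine integrableOn_ball_of_bdd ?_ fun x hx =>
    ballVar_integrand_le hp hε hK (hG x) (hD x) (hA x hx) (hD' x hx)
  exact (((measurable_flux p ε).comp (measurable_gradient w)).inner (measurable_gradient d)).add
    ((((hw.continuous.measurable.sub hψ.continuous.measurable).const_mul _).sub hk).mul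
      hd.continuous.measurable)

lemma ballEnergy_sub_ge (hp : 1 < p) (hε : 0 < ε) (hμ : 0 ≤ μ) (hψ : IsLip ψ) (hk : Measurable k)
    (hK : ∀ x, |k x| ≤ K) (hv : IsLip v) (hw : IsLip w) :
    ballVar p ε μ c R ψ k w (fun x => v x - w x) ≤
      ballEnergy p ε μ c R ψ k v - ballEnergy p ε μ c R ψ k w := by
  have hiv := integrableOn_ballEnergy (μ := μ) (c := c) (R := R) hp hε hψ hk hK hv
  have hiw := integrableOn_ballEnergy (μ := μ) (c := c) (R := R) hp hε hψ hk hK hw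
  have h := integral_sub hiv hiw
  unfold ballEnergy ballVar
  rw [← h]
  refine integral_mono_ae (integrableOn_ballVar hp hε hψ hk hK hw (hv.sub hw)) (hiv.sub hiw) ?_
  filter_upwards [ae_restrict_of_ae (gradient_sub_ae hv hw)] with x hx
  rw [hx]
  have h1 := fluxEnergy_sub_ge hp hε (∇ w x) (∇ v x)
  nlinarith [mul_nonneg hμ (sq_nonneg (v x - w x))]

lemma ballVar_smul (t : ℝ) : ballVar p ε μ c R ψ k w (fun x => t * d x) =
    t * ballVar p ε μ c R ψ k w d := by
  unfold ballVar
  rw [← integral_const_mul]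
  congr 1; ext x
  rw [gradient_const_mul, inner_smul_right]; ring

lemma tendsto_ballVar (hp : 1 < p) (hε : 0 < ε) (hψ : IsLip ψ) (hk : Measurable k)
    (hK : ∀ x, |k x| ≤ K) (hw : IsLip w) {d : ℕ → Eu N → ℝ} (hd : ∀ n, IsLip (d n))
    (h0 : ∀ n x, x ∉ ball c R → d n x = 0) (hC : ∀ n x, ‖∇ (d n) x‖ ≤ C)
    (hC' : ∀ n x, |d n x| ≤ C') (hlim : ∀ x, Tendsto (fun n => d n x) atTop (nhds 0)) :
    Tendsto (fun n => ballVar p ε μ c R ψ k w (d n)) atTop (nhds 0) := by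
  obtain ⟨G, hG0, hG⟩ := hw.exists_norm_gradient_le
  obtain ⟨A, hA0, hA⟩ := (hw.sub hψ).bdd_ball c R
  have hFm : Measurable fun x => flux p ε (∇ w x) :=
    (measurable_flux p ε).comp (measurable_gradient w)
  have hF : IntegrableOn (fun x => flux p ε (∇ w x)) (ball c R) :=
    Measure.integrableOn_of_bounded measure_ball_lt_top.ne hFm.aestronglyMeasurable
      (.of_forall fun x => norm_flux_le_of_norm_le hp hε (hG x))
  have hqm : Measurable fun x => μ * (w x - ψ x) - k x :=
    ((hw.continuous.measurable.sub hψ.continuous.measurable).const_mul _).sub hk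
  have hq : ∀ x ∈ ball c R, |μ * (w x - ψ x) - k x| ≤ |μ| * A + K := fun x hx => by
    refine (abs_sub _ _).trans ?_
    rw [abs_mul]
    have := hK x
    have := hA x hx
    gcongr
  have h1 := tendsto_integral_inner_gradient ((integrable_indicator_iff measurableSet_ball).2 hF)
    hd (fun n => hasCompactSupport_of_eq_zero (h0 n)) hC hC' hlim
  have h2 : Tendsto (fun n => ∫ x in ball c R, (μ * (w x - ψ x) - k x) * d n x)
      atTop (nhds 0) := by
    rw [← integral_zero (Eu N) ℝ (μ := volume.restrict (ball c R))]
    refine tendsto_integral_of_dominated_convergence (fun x => (|μ| * A + K) * C')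
      (fun n => (hqm.mul (hd n).continuous.measurable).aestronglyMeasurable)
      (integrableOn_const measure_ball_lt_top.ne) (fun n => ?_) (.of_forall fun x => ?_)
    · refine (ae_restrict_iff' measurableSet_ball).2 (.of_forall fun x hx => ?_)
      rw [norm_eq_abs, abs_mul]
      exact mul_le_mul (hq x hx) (hC' n x) (abs_nonneg _) ((abs_nonneg _).trans (hq x hx))
    · simpa using (hlim x).const_mul (μ * (w x - ψ x) - k x)
  have h3 := h1.add h2
  rw [add_zero] at h3
  refine h3.congr fun n => ?_
  unfold ballVar
  rw [integral_add (f := fun x => ⟪flux p ε (∇ w x), ∇ (d n) x⟫)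
    (g := fun x => (μ * (w x - ψ x) - k x) * d n x)]
  · congr 1
    rw [← integral_indicator measurableSet_ball]
    congr 1; ext x
    by_cases hx : x ∈ ball c R
    · rw [indicator_of_mem hx, indicator_of_mem hx]
    · rw [indicator_of_notMem hx, indicator_of_notMem hx, inner_zero_left]
  · refine integrableOn_ball_of_bdd (hFm.inner (measurable_gradient _)) fun x _ =>
      (abs_real_inner_le_norm _ _).trans (mul_le_mul (norm_flux_le_of_norm_le hp hε (hG x))
      (hC n x) (norm_nonneg _) (by positivity))
  · refine integrableOn_ball_of_bdd (C := (|μ| * A + K) * C')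
      (hqm.mul (hd n).continuous.measurable) fun x hx => ?_
    rw [abs_mul]
    exact mul_le_mul (hq x hx) (hC' n x) (abs_nonneg _) ((abs_nonneg _).trans (hq x hx))

/-- Existence of a solution to the gradient-constrained variational inequality. -/
theorem exists_variational_inequality (hN : 0 < N) (hp : 1 < p) (hε : 0 < ε) (hμ : 0 ≤ μ)
    (hR : 0 < R) (hL : 0 ≤ L) (hψ : ∀ x y, |ψ x - ψ y| ≤ L * ‖x - y‖) (hk : Measurable k)
    (hK : ∀ x, |k x| ≤ K) :
    ∃ w, Adm c R L ψ w ∧ ∀ v, Adm c R L ψ v →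
      0 ≤ ∫ x, (⟪flux p ε (∇ w x), ∇ (fun x => v x - w x) x⟫ +
        (μ * (w x - ψ x) - k x) * (v x - w x)) := by
  have hψA : Adm c R L ψ ψ := ⟨hψ, fun _ _ => rfl⟩
  have hψl := hψA.isLip hL
  have hK0 : 0 ≤ K := (abs_nonneg _).trans (hK 0)
  have hsub0 : ∀ {v w : Eu N → ℝ}, Adm c R L ψ v → Adm c R L ψ w → ∀ x, x ∉ ball c R →
      v x - w x = 0 := fun hv hw x hx => by rw [hv.2 x hx, hw.2 x hx, sub_self]
  have hsubL : ∀ {v w : Eu N → ℝ}, Adm c R L ψ v → Adm c R L ψ w → ∀ x y,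
      |(v x - w x) - (v y - w y)| ≤ 2 * L * ‖x - y‖ := fun {v w} hv hw x y => by
    have h1 := hv.1 x y
    have h2 := hw.1 x y
    rw [abs_le] at *
    constructor <;> linarith
  obtain ⟨E, hE⟩ : ∃ E, E = fun v => ballEnergy p ε μ c R ψ k v := ⟨_, rfl⟩
  have hlow : BddBelow (E '' {v | Adm c R L ψ v}) := by
    refine ⟨E ψ - ((ε + L ^ 2) ^ ((p - 1) / 2) * (2 * L) + (|μ| * 0 + K) * (4 * L * R)) *
      (volume.real (ball c R)), ?_⟩
    rintro _ ⟨v, hv, rfl⟩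
    have h1 := ballEnergy_sub_ge (c := c) (R := R) hp hε hμ hψl hk hK (hv.isLip hL) hψl
    have h2 := norm_setIntegral_le_of_norm_le_const (μ := volume) (s := ball c R)
      (C := (ε + L ^ 2) ^ ((p - 1) / 2) * (2 * L) + (|μ| * 0 + K) * (4 * L * R))
      (f := fun x => ⟪flux p ε (∇ ψ x), ∇ (fun x => v x - ψ x) x⟫ +
        (μ * (ψ x - ψ x) - k x) * (v x - ψ x)) measure_ball_lt_top fun x _ => ballVar_integrand_le (d := fun x => v x - ψ x)
        (μ := μ) (ψ := ψ) hp hε hK (hψA.norm_gradient_le hL x)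
        (norm_gradient_le_of_le (by positivity) (hsubL hv hψA) x)
        (by rw [sub_self, abs_zero]) (Adm.abs_sub_le_const hN hR hL hv hψA x)
    have h3 := neg_le_of_abs_le h2
    unfold ballVar at h1
    rw [hE]
    simp only
    linarith
  obtain ⟨u, hu1, hu2, hu3⟩ := exists_seq_tendsto_sInf (⟨_, ψ, hψA, rfl⟩ :
    (E '' {v | Adm c R L ψ v}).Nonempty) hlow
  choose v hv hvu using hu3
  obtain ⟨φ, hφ, w, hw⟩ := exists_subseq_tendsto (U := univ) v
    (fun x _ => ⟨|ψ x| + 4 * L * R, fun n => by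
      have := Adm.abs_sub_le_const hN hR hL (hv n) hψA x
      have h2 := abs_add_le (v n x - ψ x) (ψ x)
      rw [sub_add_cancel] at h2
      rw [norm_eq_abs]; linarith⟩)
    (fun x _ τ hτ => ⟨τ / (L + 1), by positivity, fun n y hy => by
      refine ((hv n).1 y x).trans ?_
      rw [mem_ball, dist_eq_norm, lt_div_iff₀ (by positivity)] at hy
      nlinarith [norm_nonneg (y - x)]⟩)
  have hwA : Adm c R L ψ w := by
    refine ⟨fun x y => le_of_tendsto (((hw x trivial).sub (hw y trivial)).abs)
      (.of_forall fun n => (hv _).1 x y), fun x hx => ?_⟩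
    refine tendsto_nhds_unique (hw x trivial) ?_
    simp_rw [fun n => (hv (φ n)).2 x hx]
    exact tendsto_const_nhds
  have hwl := hwA.isLip hL
  have hmin : ∀ v', Adm c R L ψ v' → E w ≤ E v' := by
    have h1 := tendsto_ballVar (μ := μ) (d := fun n x => v (φ n) x - w x) hp hε hψl hk hK hwl
      (fun n => ((hv _).isLip hL).sub hwl) (fun n => hsub0 (hv _) hwA)
      (fun n => norm_gradient_le_of_le (by positivity) (hsubL (hv _) hwA))
      (fun n => Adm.abs_sub_le_const hN hR hL (hv _) hwA)
      (fun x => by simpa using (hw x trivial).sub_const (w x))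
    have h2 : E w ≤ sInf (E '' {v | Adm c R L ψ v}) := by
      have h3 := (h1.const_add (E w))
      rw [add_zero] at h3
      refine le_of_tendsto_of_tendsto' h3 (hu2.comp hφ.tendsto_atTop) fun n => ?_
      rw [Function.comp_apply, ← hvu]
      have := ballEnergy_sub_ge (c := c) (R := R) hp hε hμ hψl hk hK ((hv (φ n)).isLip hL) hwl
      rw [hE]
      simp only
      linarith
    exact fun v' hv' => h2.trans (csInf_le hlow ⟨v', hv', rfl⟩)
  refine ⟨w, hwA, fun v' hv' => ?_⟩
  have hv'l := hv'.isLip hL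
  have hdl := hv'l.sub hwl
  obtain ⟨d, hd⟩ : ∃ d, d = fun x => v' x - w x := ⟨_, rfl⟩
  rw [← hd] at hdl ⊢
  have hd0 : ∀ x, x ∉ ball c R → d x = 0 := by rw [hd]; exact hsub0 hv' hwA
  have hdg : ∀ x, ‖∇ d x‖ ≤ 2 * L := by
    rw [hd]; exact norm_gradient_le_of_le (by positivity) (hsubL hv' hwA)
  have hdb : ∀ x, |d x| ≤ 4 * L * R := by rw [hd]; exact Adm.abs_sub_le_const hN hR hL hv' hwA
  have hkey : ∀ n : ℕ, 0 ≤ ballVar p ε μ c R ψ k (fun x => w x + 1 / ((n : ℝ) + 1) * d x) d := by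
    intro n
    have ht : 0 < 1 / ((n : ℝ) + 1) := by positivity
    have ht1 : 1 / ((n : ℝ) + 1) ≤ 1 := by rw [div_le_one (by positivity)]; linarith [n.cast_nonneg (α := ℝ)]
    have hwt := hv'.convex hwA ht.le ht1
    have h1 := ballEnergy_sub_ge (c := c) (R := R) hp hε hμ hψl hk hK hwl (hwt.isLip hL)
    have h2 := hmin _ hwt
    rw [hE] at h2
    simp only at h2
    have e : (fun x => w x - (w x + 1 / ((n : ℝ) + 1) * (v' x - w x))) =
        fun x => (-(1 / ((n : ℝ) + 1))) * d x := by ext x; rw [hd]; ring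
    rw [e, ballVar_smul] at h1
    rw [hd]
    rw [hd] at h1
    nlinarith
  have hlim : Tendsto (fun n : ℕ => ballVar p ε μ c R ψ k
      (fun x => w x + 1 / ((n : ℝ) + 1) * d x) d) atTop
      (nhds (ballVar p ε μ c R ψ k w d)) := by
    have ht := tendsto_one_div_add_atTop_nhds_zero_nat (𝕜 := ℝ)
    have hAdm : ∀ n : ℕ, Adm c R L ψ (fun x => w x + 1 / ((n : ℝ) + 1) * d x) := fun n => by
      rw [hd]
      exact hv'.convex hwA (by positivity)
        (by rw [div_le_one (by positivity)]; linarith [n.cast_nonneg (α := ℝ)])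
    have hae : ∀ᵐ x, ∀ n : ℕ, ∇ (fun x => w x + 1 / ((n : ℝ) + 1) * d x) x =
        ∇ w x + (1 / ((n : ℝ) + 1)) • ∇ d x := by
      refine ae_all_iff.2 fun n => ?_
      filter_upwards [gradient_add_ae hwl (hdl.const_mul (1 / ((n : ℝ) + 1)))] with x hx
      rw [hx, gradient_const_mul]
    unfold ballVar
    refine tendsto_integral_of_dominated_convergence
      (fun _ => (ε + L ^ 2) ^ ((p - 1) / 2) * (2 * L) + (|μ| * (4 * L * R) + K) * (4 * L * R))
      (fun n => (integrableOn_ballVar hp hε hψl hk hK ((hAdm n).isLip hL) hdl).1)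
      (integrableOn_const measure_ball_lt_top.ne) (fun n => .of_forall fun x =>
        ballVar_integrand_le hp hε hK ((hAdm n).norm_gradient_le hL x) (hdg x)
        (Adm.abs_sub_le_const hN hR hL (hAdm n) hψA x) (hdb x)) (ae_restrict_of_ae ?_)
    filter_upwards [hae] with x hx
    simp_rw [hx]
    have h1 : Tendsto (fun n : ℕ => ∇ w x + (1 / ((n : ℝ) + 1)) • ∇ d x)
        atTop (nhds (∇ w x)) := by
      simpa using (ht.smul_const (∇ d x)).const_add (∇ w x)
    have h2 : Tendsto (fun n : ℕ => w x + 1 / ((n : ℝ) + 1) * d x)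
        atTop (nhds (w x)) := by
      simpa using (ht.mul_const (d x)).const_add (w x)
    exact ((((continuous_flux hε).tendsto _).comp h1).inner tendsto_const_nhds).add
      ((((h2.sub_const _).const_mul _).sub_const _).mul_const _)
  have hfin := ge_of_tendsto' hlim hkey
  unfold ballVar at hfin
  rw [setIntegral_eq_integral_of_ae_compl_eq_zero] at hfin
  · simpa only [hd] using hfin
  · filter_upwards [gradient_ae_eq_zero_of_eq_zero hR hd0] with x hx hxb
    rw [hx hxb, hd0 x hxb, inner_zero_right, mul_zero, add_zero]

end

lemma eq_zero_of_integral_nonpos {d q : Eu N → ℝ} (hd : Continuous d) (h0 : ∀ x, 0 ≤ d x)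
    (hq : ∀ x, 0 < d x → 0 < q x) (hi : Integrable fun x => q x * d x)
    (h : ∫ x, q x * d x ≤ 0) (x : Eu N) : d x = 0 := by
  have hnn : ∀ x, 0 ≤ q x * d x := fun x => by
    rcases (h0 x).eq_or_lt with h1 | h1
    · rw [← h1, mul_zero]
    · exact (mul_pos (hq x h1) h1).le
  have h1 := (integral_eq_zero_iff_of_nonneg hnn hi).1
    (le_antisymm h (integral_nonneg hnn))
  have h2 : d =ᵐ[volume] fun _ => (0 : ℝ) := by
    filter_upwards [h1] with x hx
    by_contra hne
    have hpos := lt_of_le_of_ne (h0 x) (Ne.symm hne)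
    exact (mul_pos (hq x hpos) hpos).ne' hx
  exact congrFun ((Continuous.ae_eq_iff_eq volume hd continuous_const).1 h2) x

lemma integral_inner_const_gradient {d : Eu N → ℝ} (hd : IsLip d) (hc : HasCompactSupport d)
    (e : Eu N) : ∫ x, ⟪e, ∇ d x⟫ = 0 := by
  have h := integral_mul_inner_gradient (isLip_const (1 : ℝ)) hd hc e
  have h1 : ∀ x : Eu N, ∇ (fun _ : Eu N => (1 : ℝ)) x = 0 := fun x => by
    simp [gradient]
  simp only [h1, inner_zero_right, zero_mul, integral_zero, neg_zero, one_mul] at h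
  exact h

lemma flux_neg (p ε : ℝ) (ξ : Eu N) : flux p ε (-ξ) = - flux p ε ξ := by
  simp [flux]

/-- Solutions of the gradient-constrained variational inequality. -/
def VI (p ε μ : ℝ) (c : Eu N) (R L : ℝ) (ψ k w : Eu N → ℝ) : Prop :=
  Adm c R L ψ w ∧ ∀ v, Adm c R L ψ v →
    0 ≤ ∫ x, (⟪flux p ε (∇ w x), ∇ (fun x => v x - w x) x⟫ +
      (μ * (w x - ψ x) - k x) * (v x - w x))

variable {d : Eu N → ℝ}

lemma Adm.neg (h : Adm c R L ψ v) : Adm c R L (fun x => - ψ x) (fun x => - v x) :=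
  ⟨fun x y => by rw [neg_sub_neg, abs_sub_comm]; exact h.1 x y,
    fun x hx => by simp only [h.2 x hx]⟩

lemma VI.neg (h : VI p ε μ c R L ψ k w) :
    VI p ε μ c R L (fun x => - ψ x) (fun x => - k x) (fun x => - w x) := by
  refine ⟨h.1.neg, fun v hv => ?_⟩
  have hv' := hv.neg
  simp only [neg_neg] at hv'
  have h1 := h.2 _ hv'
  refine h1.trans_eq (integral_congr_ae (.of_forall fun x => ?_))
  simp only
  rw [gradient_neg', flux_neg, inner_neg_left, ← inner_neg_right, ← gradient_neg']
  have e : (fun x => -(v x - -w x)) = fun x => -v x - w x := by ext y; ring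
  rw [e]; ring

/-- The setting for the a priori bounds. -/
structure VIData (p ε μ K : ℝ) (c : Eu N) (R L : ℝ) (ψ k w : Eu N → ℝ) : Prop where
  hN : 0 < N
  hp : 1 < p
  hε : 0 < ε
  hR : 0 < R
  hL : 0 ≤ L
  hψ : IsLip ψ
  hk : Measurable k
  hK : ∀ x, |k x| ≤ K
  hψL : ∀ x y, |ψ x - ψ y| ≤ L * ‖x - y‖
  vi : VI p ε μ c R L ψ k w

namespace VIData

lemma neg (h : VIData p ε μ K c R L ψ k w) :
    VIData p ε μ K c R L (fun x => - ψ x) (fun x => - k x) (fun x => - w x) where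
  hN := h.hN
  hp := h.hp
  hε := h.hε
  hR := h.hR
  hL := h.hL
  hψ := h.hψ.neg
  hk := h.hk.neg
  hK := fun x => by rw [abs_neg]; exact h.hK x
  hψL := fun x y => by rw [neg_sub_neg, abs_sub_comm]; exact h.hψL x y
  vi := h.vi.neg

lemma isLip (h : VIData p ε μ K c R L ψ k w) : IsLip w := h.vi.1.isLip h.hL

lemma measurable_rhs (h : VIData p ε μ K c R L ψ k w) :
    Measurable fun x => μ * (w x - ψ x) - k x :=
  ((h.isLip.continuous.measurable.sub h.hψ.continuous.measurable).const_mul _).sub h.hk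

lemma abs_rhs_le (h : VIData p ε μ K c R L ψ k w) (x : Eu N) :
    |μ * (w x - ψ x) - k x| ≤ |μ| * (4 * L * R) + K := by
  refine (abs_sub _ _).trans ?_
  rw [abs_mul]
  have := h.hK x
  have := Adm.abs_sub_le_const h.hN h.hR h.hL h.vi.1 ⟨h.hψL, fun _ _ => rfl⟩ x
  gcongr

lemma exists_flux_le (h : VIData p ε μ K c R L ψ k w) : ∃ C, ∀ x, ‖flux p ε (∇ w x)‖ ≤ C :=
  ⟨_, fun x => norm_flux_le_of_norm_le h.hp h.hε (h.vi.1.norm_gradient_le h.hL x)⟩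

lemma integrable_inner (h : VIData p ε μ K c R L ψ k w) (hd : IsLip d) (hc : HasCompactSupport d) :
    Integrable fun x => ⟪flux p ε (∇ w x), ∇ d x⟫ := by
  obtain ⟨C, hC⟩ := h.exists_flux_le
  exact LipTest.integrable_inner (U := univ) ⟨hd, hc, subset_univ _⟩
    ((measurable_flux p ε).comp (measurable_gradient w)) hC

lemma integrable_mul (h : VIData p ε μ K c R L ψ k w) (hd : IsLip d) (hc : HasCompactSupport d) :
    Integrable fun x => (μ * (w x - ψ x) - k x) * d x :=
  LipTest.integrable_mul (U := univ) ⟨hd, hc, subset_univ _⟩ h.measurable_rhs h.abs_rhs_le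

lemma apply (h : VIData p ε μ K c R L ψ k w) (hd : IsLip d) (h0 : ∀ x, x ∉ ball c R → d x = 0)
    (hA : Adm c R L ψ fun x => w x + d x) :
    0 ≤ (∫ x, ⟪flux p ε (∇ w x), ∇ d x⟫) +
      ∫ x, (μ * (w x - ψ x) - k x) * d x := by
  have hc := hasCompactSupport_of_eq_zero h0
  rw [← integral_add (h.integrable_inner hd hc) (h.integrable_mul hd hc)]
  have h1 := h.vi.2 _ hA
  simp only [add_sub_cancel_left] at h1
  exact h1

lemma apply_neg (h : VIData p ε μ K c R L ψ k w) (hd : IsLip d)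
    (h0 : ∀ x, x ∉ ball c R → d x = 0) (hA : Adm c R L ψ fun x => w x - d x) :
    (∫ x, ⟪flux p ε (∇ w x), ∇ d x⟫) +
      ∫ x, (μ * (w x - ψ x) - k x) * d x ≤ 0 := by
  have h1 := h.apply hd.neg (fun x hx => by simp only [h0 x hx, neg_zero])
    (by simpa only [← sub_eq_add_neg] using hA)
  simp only [gradient_neg', inner_neg_right, mul_neg, integral_neg] at h1
  linarith

lemma le_affine (h : VIData p ε μ K c R L ψ k w) {a : ℝ} (he : ‖e‖ ≤ L)
    (hs : ∀ x ∈ sphere c R, ψ x ≤ a + ⟪e, x⟫)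
    (hq : ∀ x ∈ ball c R, a + ⟪e, x⟫ < w x → 0 < μ * (w x - ψ x) - k x) :
    ∀ x ∈ ball c R, w x ≤ a + ⟪e, x⟫ := by
  obtain ⟨s, hs'⟩ : ∃ s, s = fun x => w x - ⟪e, x⟫ := ⟨_, rfl⟩
  have hsl : IsLip s := by rw [hs']; exact h.isLip.sub (isLip_inner e)
  obtain ⟨d, hd⟩ : ∃ d, d = (closedBall c R).indicator fun x => max (s x - a) 0 := ⟨_, rfl⟩
  have hws : ∀ x, x ∈ sphere c R → w x = ψ x := fun x hx =>
    h.vi.1.2 x fun hb => (mem_ball.1 hb).ne (mem_sphere.1 hx)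
  have hd1 : ∀ x ∈ closedBall c R, d x = max (s x - a) 0 := fun x hx => by
    rw [hd]; exact indicator_of_mem hx _
  have hd0 : ∀ x, x ∉ ball c R → d x = 0 := fun x hx => by
    by_cases hxc : x ∈ closedBall c R
    · have hx2 : x ∈ sphere c R :=
        mem_sphere.2 (le_antisymm (mem_closedBall.1 hxc) (not_lt.1 hx))
      rw [hd1 x hxc, hs']
      have := hs x hx2
      rw [← hws x hx2] at this
      exact max_eq_right (by linarith)
    · rw [hd]; exact indicator_of_notMem hxc _
  have hdnn : ∀ x, 0 ≤ d x := fun x => by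
    rw [hd]; exact indicator_nonneg (fun x _ => le_max_right _ _) x
  obtain ⟨C, hC0, hC⟩ := ((hsl.sub (isLip_const a)).max (isLip_const 0)).exists_le
  have hdl : IsLip d := by
    refine isLip_of_le (C := C) (abs_sub_le_of_glue (c := c) (R := R) (fun x hx y hy => ?_)
      fun x hx y hy => ?_)
    · rw [hd1 x hx, hd1 y hy]; exact hC x y
    · rw [hd0 x hx, hd0 y hy, sub_self, abs_zero]; positivity
  have hA : Adm c R L ψ fun x => w x - d x := by
    refine ⟨abs_sub_le_of_glue (c := c) (R := R) (fun x hx y hy => ?_) fun x hx y hy => ?_,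
      fun x hx => by simp only [hd0 x hx, sub_zero]; exact h.vi.1.2 x hx⟩
    · have e1 : ∀ x ∈ closedBall c R, w x - d x = min (w x) (a + ⟪e, x⟫) := fun x hx => by
        rw [hd1 x hx, hs']
        rcases le_total (w x) (a + ⟪e, x⟫) with h1 | h1
        · rw [min_eq_left h1, max_eq_right (by linarith)]; ring
        · rw [min_eq_right h1, max_eq_left (by linarith)]; ring
      rw [e1 x hx, e1 y hy]
      refine (abs_min_sub_min_le_max _ _ _ _).trans (max_le (h.vi.1.1 x y) ?_)
      rw [add_sub_add_left_eq_sub, ← inner_sub_right]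
      exact (abs_real_inner_le_norm _ _).trans (by gcongr)
    · simp only [hd0 x hx, hd0 y hy, sub_zero]; exact h.vi.1.1 x y
  have hc := hasCompactSupport_of_eq_zero hd0
  have h1 := h.apply_neg hdl hd0 hA
  have h2 := integral_inner_const_gradient hdl hc (flux p ε e)
  have h3 : 0 ≤ ∫ x, (⟪flux p ε (∇ w x), ∇ d x⟫ - ⟪flux p ε e, ∇ d x⟫) := by
    refine integral_nonneg_of_ae ?_
    filter_upwards [h.isLip.hasGradientAt_ae, gradient_ae_eq_zero_of_eq_zero h.hR hd0] with x hx hx0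
    rw [Pi.zero_apply, ← inner_sub_left]
    by_cases hxb : x ∈ ball c R
    · have e1 : ∇ d x = ∇ (fun x => max (s x - a) 0) x := by
        refine EventuallyEq.gradient_eq ?_
        filter_upwards [isOpen_ball.mem_nhds hxb] with y hy
        exact hd1 y (ball_subset_closedBall hy)
      have e2 : ∇ s x = ∇ w x - e := by
        rw [hs']; exact (hx.sub' (hasGradientAt_inner e x)).gradient
      rw [e1, gradient_max_sub hsl.continuous]
      split_ifs
      · rw [e2]; exact flux_mono h.hp h.hε _ _
      · rw [inner_zero_right]
    · rw [hx0 hxb, inner_zero_right]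
  rw [integral_sub (h.integrable_inner hdl hc) (LipTest.integrable_inner (U := univ)
    ⟨hdl, hc, subset_univ _⟩ measurable_const fun _ => le_rfl), h2, sub_zero] at h3
  have h4 := eq_zero_of_integral_nonpos (q := fun x => μ * (w x - ψ x) - k x) hdl.continuous hdnn
    (fun x hx => by
      have hxb : x ∈ ball c R := by
        by_contra hxb; rw [hd0 x hxb] at hx; exact lt_irrefl _ hx
      rw [hd1 x (ball_subset_closedBall hxb), lt_max_iff] at hx
      rcases hx with hx | hx
      · rw [hs'] at hx; exact hq x hxb (by simp only at hx; linarith)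
      · exact absurd hx (lt_irrefl _))
    (h.integrable_mul hdl hc) (by linarith)
  intro x hx
  have h5 := h4 x
  rw [hd1 x (ball_subset_closedBall hx)] at h5
  have h6 := le_max_left (s x - a) 0
  rw [h5, hs'] at h6
  simp only at h6
  linarith

/-- Translation comparison. -/
lemma le_translate (h : VIData p ε μ K c R L ψ k w)
    (hb : ∀ x, x ∉ ball c R ∨ x + y ∉ ball c R → w x - w (x + y) ≤ m)
    (hq : ∀ x, m < w x - w (x + y) →
      μ * (w (x + y) - ψ (x + y)) - k (x + y) < μ * (w x - ψ x) - k x) (x : Eu N) :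
    w x - w (x + y) ≤ m := by
  have hwl := h.isLip
  obtain ⟨s, hs⟩ : ∃ s, s = fun x => w x - w (x + y) := ⟨_, rfl⟩
  have hsl : IsLip s := by rw [hs]; exact hwl.sub (hwl.comp_add y)
  obtain ⟨d, hd⟩ : ∃ d, d = fun x => max (s x - m) 0 := ⟨_, rfl⟩
  have hdl : IsLip d := by rw [hd]; exact (hsl.sub (isLip_const m)).max (isLip_const 0)
  have hd0' : ∀ x, x ∉ ball c R ∨ x + y ∉ ball c R → d x = 0 := fun x hx => by
    rw [hd]; have := hb x hx; rw [hs]; exact max_eq_right (by simp only; linarith)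
  have hd0 : ∀ x, x ∉ ball c R → d x = 0 := fun x hx => hd0' x (Or.inl hx)
  obtain ⟨d', hd'⟩ : ∃ d', d' = fun x => d (x + -y) := ⟨_, rfl⟩
  have hd'l : IsLip d' := by rw [hd']; exact hdl.comp_add (-y)
  have hd'0 : ∀ x, x ∉ ball c R → d' x = 0 := fun x hx => by
    rw [hd']; exact hd0' _ (Or.inr (by rwa [neg_add_cancel_right]))
  have hc := hasCompactSupport_of_eq_zero hd0
  have hc' := hasCompactSupport_of_eq_zero hd'0
  have h1 := h.apply_neg hdl hd0 (by
    refine ⟨fun x z => ?_, fun x hx => by simp only [hd0 x hx, sub_zero]; exact h.vi.1.2 x hx⟩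
    have e1 : ∀ x, w x - d x = min (w x) (w (x + y) + m) := fun x => by
      rw [hd, hs]; simp only
      rcases le_total (w x) (w (x + y) + m) with h1 | h1
      · rw [min_eq_left h1, max_eq_right (by linarith)]; ring
      · rw [min_eq_right h1, max_eq_left (by linarith)]; ring
    simp only [e1]
    refine (abs_min_sub_min_le_max _ _ _ _).trans (max_le (h.vi.1.1 x z) ?_)
    rw [add_sub_add_right_eq_sub]
    simpa using h.vi.1.1 (x + y) (z + y))
  have h2 := h.apply hd'l hd'0 (by
    refine ⟨fun x z => ?_, fun x hx => by simp only [hd'0 x hx, add_zero]; exact h.vi.1.2 x hx⟩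
    have e1 : ∀ x, w x + d' x = max (w x) (w (x + -y) - m) := fun x => by
      rw [hd', hd, hs]; simp only [neg_add_cancel_right]
      rcases le_total (w (x + -y) - m) (w x) with h1 | h1
      · rw [max_eq_left h1, max_eq_right (by linarith)]; ring
      · rw [max_eq_right h1, max_eq_left (by linarith)]; ring
    simp only [e1]
    refine (abs_max_sub_max_le_max _ _ _ _).trans (max_le (h.vi.1.1 x z) ?_)
    rw [sub_sub_sub_cancel_right]
    simpa using h.vi.1.1 (x + -y) (z + -y))
  obtain ⟨C, hC⟩ := h.exists_flux_le
  have hFm : Measurable fun x => flux p ε (∇ w x) :=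
    (measurable_flux p ε).comp (measurable_gradient w)
  have hT : LipTest univ d := ⟨hdl, hc, subset_univ _⟩
  have i1 := h.integrable_inner hdl hc
  have i2 := h.integrable_mul hdl hc
  have i3 : Integrable fun x => ⟪flux p ε (∇ w (x + y)), ∇ d x⟫ :=
    hT.integrable_inner (hFm.comp (measurable_add_const y)) fun x => hC (x + y)
  have i4 : Integrable fun x => (μ * (w (x + y) - ψ (x + y)) - k (x + y)) * d x :=
    hT.integrable_mul (h.measurable_rhs.comp (measurable_add_const y))
      fun x => h.abs_rhs_le (x + y)
  have t1 : ∫ x, ⟪flux p ε (∇ w x), ∇ d' x⟫ =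
      ∫ x, ⟪flux p ε (∇ w (x + y)), ∇ d x⟫ := by
    rw [← integral_add_right_eq_self _ y]
    simp only [hd', gradient_comp_add, add_neg_cancel_right]
  have t2 : ∫ x, (μ * (w x - ψ x) - k x) * d' x =
      ∫ x, (μ * (w (x + y) - ψ (x + y)) - k (x + y)) * d x := by
    rw [← integral_add_right_eq_self _ y]
    simp only [hd', add_neg_cancel_right]
  rw [t1, t2] at h2
  have h3 : 0 ≤ ∫ x, (⟪flux p ε (∇ w x), ∇ d x⟫ -
      ⟪flux p ε (∇ w (x + y)), ∇ d x⟫) := by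
    refine integral_nonneg_of_ae ?_
    filter_upwards [gradient_sub_ae hwl (hwl.comp_add y)] with x hx
    rw [Pi.zero_apply, ← inner_sub_left, hd, gradient_max_sub hsl.continuous]
    split_ifs
    · rw [hs, hx, gradient_comp_add]; exact flux_mono h.hp h.hε _ _
    · rw [inner_zero_right]
  have h4 := integral_sub i1 i3
  have h5 := integral_sub i2 i4
  rw [h4] at h3
  simp only [← sub_mul] at h5
  have h6 := eq_zero_of_integral_nonpos (q := fun x => μ * (w x - ψ x) - k x -
    (μ * (w (x + y) - ψ (x + y)) - k (x + y))) hdl.continuous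
    (fun x => by rw [hd]; exact le_max_right _ _)
    (fun x hx => by
      rw [hd] at hx
      rcases lt_max_iff.1 hx with hx | hx
      · rw [hs] at hx; simp only at hx; have := hq x (by linarith); linarith
      · exact absurd hx (lt_irrefl _))
    ((i2.sub i4).congr (.of_forall fun x => (sub_mul _ _ _).symm)) (by linarith) x
  have h7 := le_max_left (s x - m) 0
  rw [hd] at h6
  simp only at h6
  rw [h6, hs] at h7
  simp only at h7
  linarith

end VIData

lemma norm_sub_sq_le_inner (hz : z ∈ sphere c R) (hx : x ∈ closedBall c R) :
    ‖x - z‖ ^ 2 ≤ 2 * ⟪z - x, z - c⟫ := by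
  rw [mem_sphere, dist_eq_norm] at hz
  rw [mem_closedBall, dist_eq_norm] at hx
  have h1 := norm_sub_sq_real (z - c) (z - x)
  rw [sub_sub_sub_cancel_left, hz, real_inner_comm, norm_sub_rev z x] at h1
  have h2 : ‖x - c‖ ^ 2 ≤ R ^ 2 := by gcongr
  linarith

lemma VIData.le_barrier (h : VIData p ε μ K c R L ψ k w) (hμ : 0 < μ)
    (hz : z ∈ sphere c R) (hψz : ∀ x, ψ x ≤ ψ z + ⟪ξ, x - z⟫ + C * ‖x - z‖ ^ 2)
    (hδ : 0 < δ) (hkδ : ∀ x, k x ≠ 0 → δ ≤ ‖x - z‖) (hA : K < μ * ((A / 2 - C) * δ ^ 2))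
    (hC : 0 ≤ C) (hL : ‖ξ‖ + A * R ≤ L) (hx : x ∈ ball c R) :
    w x ≤ ψ z + (‖ξ‖ + A * R) * ‖x - z‖ := by
  have hK0 : 0 ≤ K := (abs_nonneg _).trans (h.hK 0)
  have hAC : 0 < A / 2 - C := by
    have h1 := hK0.trans_lt hA
    exact (mul_pos_iff_of_pos_right (by positivity : 0 < δ ^ 2)).1
      ((mul_pos_iff_of_pos_left hμ).1 h1)
  have hA0 : 0 ≤ A := by linarith
  have hzR : ‖z - c‖ = R := by rwa [mem_sphere, dist_eq_norm] at hz
  have hb : ∀ x, ψ z - ⟪ξ, z⟫ + A * ⟪z, z - c⟫ + ⟪ξ - A • (z - c), x⟫ =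
      ψ z + ⟪ξ, x - z⟫ + A * ⟪z - x, z - c⟫ := fun x => by
    rw [inner_sub_left, inner_smul_left, inner_sub_right ξ, inner_sub_left z x,
      real_inner_comm x (z - c), conj_trivial]
    ring
  have hψb : ∀ x ∈ closedBall c R, ψ x + (A / 2 - C) * ‖x - z‖ ^ 2 ≤
      ψ z + ⟪ξ, x - z⟫ + A * ⟪z - x, z - c⟫ := fun x hx => by
    have h1 := hψz x
    have h2 := norm_sub_sq_le_inner hz hx
    nlinarith
  have h1 := h.le_affine (e := ξ - A • (z - c)) (a := ψ z - ⟪ξ, z⟫ + A * ⟪z, z - c⟫)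
    ((norm_sub_le _ _).trans (by rwa [norm_smul, hzR, norm_of_nonneg hA0]))
    (fun x hx => by
      rw [hb]
      have := hψb x (sphere_subset_closedBall hx)
      nlinarith [sq_nonneg ‖x - z‖])
    (fun x hx hlt => by
      rw [hb] at hlt
      have h2 := hψb x (ball_subset_closedBall hx)
      have h3 : (A / 2 - C) * ‖x - z‖ ^ 2 < w x - ψ x := by linarith
      by_cases hk : k x = 0
      · rw [hk, sub_zero]
        exact mul_pos hμ (lt_of_le_of_lt (by positivity) h3)
      · have h4 : (A / 2 - C) * δ ^ 2 ≤ (A / 2 - C) * ‖x - z‖ ^ 2 := by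
          have := hkδ x hk; gcongr
        have h5 := mul_le_mul_of_nonneg_left (h4.trans h3.le) hμ.le
        have h6 := (le_abs_self _).trans (h.hK x)
        linarith) x hx
  rw [hb] at h1
  refine h1.trans ?_
  have h2 := (le_abs_self _).trans (abs_real_inner_le_norm ξ (x - z))
  have h3 := (le_abs_self _).trans (abs_real_inner_le_norm (z - x) (z - c))
  rw [hzR, norm_sub_rev z x] at h3
  nlinarith

lemma VIData.abs_sub_le_boundary (h : VIData p ε μ K c R L ψ k w) (hμ : 0 < μ)
    (hψL : ∀ x y, |ψ x - ψ y| ≤ Lψ * ‖x - y‖) (hLψ : 0 ≤ Lψ)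
    (hT : ∀ z x, |ψ x - ψ z - ⟪∇ ψ z, x - z⟫| ≤ C * ‖x - z‖ ^ 2)
    (hδ : 0 < δ) (hkδ : ∀ x, k x ≠ 0 → ∀ z ∈ sphere c R, δ ≤ ‖x - z‖)
    (hA : K < μ * ((A / 2 - C) * δ ^ 2)) (hC : 0 ≤ C) (hA0 : 0 ≤ A) (hL : Lψ + A * R ≤ L)
    (x y : Eu N) (hy : y ∉ ball c R) : |w x - w y| ≤ (Lψ + A * R) * ‖x - y‖ := by
  have hR := h.hR
  have hout : ∀ x, x ∉ ball c R → w x = ψ x := h.vi.1.2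
  have key : ∀ x ∈ ball c R, ∀ z ∈ sphere c R, |w x - w z| ≤ (Lψ + A * R) * ‖x - z‖ := by
    intro x hx z hz
    have hg := norm_gradient_le_of_le hLψ hψL z
    have h1 := h.le_barrier hμ hz (fun x => by linarith [(abs_le.1 (hT z x)).2]) hδ
      (fun x hx => hkδ x hx z hz) hA hC (by linarith) hx
    have h2 := h.neg.le_barrier (ξ := - ∇ ψ z) hμ hz
      (fun x => by rw [inner_neg_left]; linarith [(abs_le.1 (hT z x)).1]) hδ
      (fun x hx => hkδ x (by simpa using hx) z hz) hA hC (by rw [norm_neg]; linarith) hx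
    rw [norm_neg] at h2
    rw [hout z fun hb => (mem_ball.1 hb).ne (mem_sphere.1 hz)]
    have h3 : (‖∇ ψ z‖ + A * R) * ‖x - z‖ ≤ (Lψ + A * R) * ‖x - z‖ := by gcongr
    rw [abs_le]; constructor <;> linarith
  have hψ' : ∀ x y, |ψ x - ψ y| ≤ (Lψ + A * R) * ‖x - y‖ := fun x y =>
    (hψL x y).trans (by gcongr; nlinarith)
  by_cases hx : x ∈ ball c R
  · obtain ⟨z, hz, hzeq⟩ := exists_mem_sphere_of_mem_of_notMem (ball_subset_closedBall hx) hy
    have h1 := key x hx z hz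
    have h2 := hψ' z y
    rw [← hout y hy, ← hout z fun hb => (mem_ball.1 hb).ne (mem_sphere.1 hz)] at h2
    have := abs_sub_le (w x) (w z) (w y)
    rw [← hzeq, mul_add]; linarith
  · rw [hout x hx, hout y hy]; exact hψ' x y

lemma VIData.abs_sub_le (h : VIData p ε μ K c R L ψ k w) (hμ : 0 < μ)
    (hψL : ∀ x y, |ψ x - ψ y| ≤ Lψ * ‖x - y‖) (hkL : ∀ x y, |k x - k y| ≤ Lk * ‖x - y‖)
    (hbd : ∀ x y, y ∉ ball c R → |w x - w y| ≤ m * ‖x - y‖) (hm : Lk < μ * (m - Lψ))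
    (x y : Eu N) : |w x - w y| ≤ m * ‖x - y‖ := by
  have key : ∀ x y : Eu N, w x - w (x + y) ≤ m * ‖y‖ := by
    intro x y
    rcases eq_or_ne y 0 with rfl | hy
    · simp
    refine h.le_translate (fun x hx => ?_) (fun x hx => ?_) x
    · rcases hx with hx | hx
      · have := (abs_le.1 (hbd (x + y) x hx)).1
        rw [add_sub_cancel_left] at this; linarith
      · have := (abs_le.1 (hbd x (x + y) hx)).2
        rwa [norm_sub_rev, add_sub_cancel_left] at this
    · have h1 := (abs_le.1 (hψL x (x + y))).2
      have h2 := (abs_le.1 (hkL x (x + y))).2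
      rw [norm_sub_rev, add_sub_cancel_left] at h1 h2
      have h3 := norm_pos_iff.2 hy
      have h4 := mul_lt_mul_of_pos_right hm h3
      nlinarith
  have h1 := key x (y - x)
  have h2 := key y (x - y)
  rw [add_sub_cancel, norm_sub_rev] at h1
  rw [add_sub_cancel] at h2
  rw [abs_le]; constructor <;> linarith

/-- Existence of Lipschitz solutions of the regularised problem with smooth data. -/
theorem exists_sol_of_smooth (hN : 0 < N) (hp : 1 < p) (hε : 0 < ε) (hμ : 0 < μ) (hR : 0 < R)
    (hψL : ∀ x y, |ψ x - ψ y| ≤ Lψ * ‖x - y‖) (hLψ : 0 ≤ Lψ)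
    (hT : ∀ z x, |ψ x - ψ z - ⟪∇ ψ z, x - z⟫| ≤ C * ‖x - z‖ ^ 2) (hC : 0 ≤ C)
    (hkL : ∀ x y, |k x - k y| ≤ Lk * ‖x - y‖) (hLk : 0 ≤ Lk) (hK : ∀ x, |k x| ≤ K)
    (hδ : 0 < δ) (hkδ : ∀ x, k x ≠ 0 → ∀ z ∈ sphere c R, δ ≤ ‖x - z‖) :
    ∃ w, (∀ x, x ∉ ball c R → w x = ψ x) ∧
      ∃ K', Sol p ε K' (ball c R) w (fun x => k x - μ * (w x - ψ x)) := by
  have hK0 : 0 ≤ K := (abs_nonneg _).trans (hK 0)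
  obtain ⟨A, hA⟩ : ∃ A, A = 2 * (C + (K + 1) / (μ * δ ^ 2)) := ⟨_, rfl⟩
  have hA0 : 0 ≤ A := by rw [hA]; positivity
  have hAK : K < μ * ((A / 2 - C) * δ ^ 2) := by
    have : μ * ((A / 2 - C) * δ ^ 2) = K + 1 := by rw [hA]; field_simp; ring
    linarith
  obtain ⟨m, hm⟩ : ∃ m, m = Lψ + A * R + Lk / μ + 1 := ⟨_, rfl⟩
  have hAR : 0 ≤ A * R := by positivity
  have hLkμ : 0 ≤ Lk / μ := by positivity
  have hm0 : 0 ≤ m := by rw [hm]; positivity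
  have hkm : Measurable k := (isLip_of_le hkL).continuous.measurable
  have hψL' : ∀ x y, |ψ x - ψ y| ≤ (m + 1) * ‖x - y‖ := fun x y => (hψL x y).trans (by
    gcongr; linarith)
  obtain ⟨w, hw⟩ := exists_variational_inequality (c := c) hN hp hε hμ.le hR
    (by linarith : 0 ≤ m + 1) hψL' hkm hK
  have h : VIData p ε μ K c R (m + 1) ψ k w :=
    ⟨hN, hp, hε, hR, by linarith, isLip_of_le hψL, hkm, hK, hψL', hw⟩
  have hbd := h.abs_sub_le_boundary hμ hψL hLψ hT hδ hkδ hAK hC hA0 (by linarith)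
  have hlip := h.abs_sub_le (m := m) hμ hψL hkL
    (fun x y hy => (hbd x y hy).trans (by gcongr; linarith)) (by
      have : μ * (m - Lψ) = μ * (A * R) + Lk + μ := by rw [hm]; field_simp; ring
      nlinarith [mul_nonneg hμ.le hAR])
  refine ⟨w, hw.1.2, |μ| * (4 * (m + 1) * R) + K, h.isLip, ?_, fun x => ?_, fun φ hφ => ?_⟩
  · have := h.measurable_rhs.neg
    simpa only [neg_sub, Pi.neg_def] using this
  · rw [abs_sub_comm]; exact h.abs_rhs_le x
  have hφ0 : ∀ x, x ∉ ball c R → φ x = 0 := fun x hx =>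
    image_eq_zero_of_notMem_tsupport fun h => hx (hφ.2.2 h)
  obtain ⟨D, hD0, hD⟩ := hφ.1.exists_le
  have ht : 0 < 1 / (D + 1) := by positivity
  have key : ∀ t : ℝ, |t| = 1 / (D + 1) →
      0 ≤ t * ((∫ x, ⟪flux p ε (∇ w x), ∇ φ x⟫) +
        ∫ x, (μ * (w x - ψ x) - k x) * φ x) := by
    intro t ht
    have h1 := h.apply (hφ.1.const_mul t) (fun x hx => by simp only [hφ0 x hx, mul_zero]) (by
      refine ⟨fun x y => ?_, fun x hx => by
        simp only [hφ0 x hx, mul_zero, add_zero]; exact hw.1.2 x hx⟩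
      have e : w x + t * φ x - (w y + t * φ y) = (w x - w y) + t * (φ x - φ y) := by ring
      rw [e]
      refine (abs_add_le _ _).trans ?_
      rw [abs_mul, ht, add_mul]
      refine add_le_add (hlip x y) ?_
      rw [one_mul, one_div, inv_mul_le_iff₀ (by positivity)]
      nlinarith [hD x y, norm_nonneg (x - y)])
    have e1 : ∫ x, ⟪flux p ε (∇ w x), ∇ (fun x => t * φ x) x⟫ =
        t * ∫ x, ⟪flux p ε (∇ w x), ∇ φ x⟫ := by
      rw [← integral_const_mul]; congr 1; ext x; rw [gradient_const_mul, inner_smul_right]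
    have e2 : ∫ x, (μ * (w x - ψ x) - k x) * (t * φ x) =
        t * ∫ x, (μ * (w x - ψ x) - k x) * φ x := by
      rw [← integral_const_mul]; congr 1; ext x; ring
    rw [e1, e2] at h1
    rw [mul_add]; exact h1
  have h1 := nonneg_of_mul_nonneg_right (key _ (abs_of_pos ht)) ht
  have h2 := key (-(1 / (D + 1))) (by rw [abs_neg, abs_of_pos ht])
  rw [neg_mul] at h2
  have h3 := nonneg_of_mul_nonneg_right (b := -((∫ x, ⟪flux p ε (∇ w x), ∇ φ x⟫) +
        ∫ x, (μ * (w x - ψ x) - k x) * φ x)) (by rwa [mul_neg]) ht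
  have e3 : ∫ x, (k x - μ * (w x - ψ x)) * φ x = - ∫ x, (μ * (w x - ψ x) - k x) * φ x := by
    rw [← integral_neg]; congr 1; ext x; ring
  rw [e3]; linarith

lemma HasGradientAt.comp_hasDerivAt {f : ℝ → ℝ} {f' : ℝ}
    (hf : HasDerivAt f f' (g x)) (hg : HasGradientAt g a x) :
    HasGradientAt (fun x => f (g x)) (f' • a) x := by
  rw [hasGradientAt_iff_hasFDerivAt] at *
  refine (hf.comp_hasFDerivAt x hg).congr_fderiv ?_
  ext v; simp

/-- The scalar flux in a fixed direction of norm `m`. -/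
def scalarFlux (p ε m s : ℝ) : ℝ := (ε + (m * s) ^ 2) ^ ((p - 2) / 2) * s

lemma flux_smul_eq (p ε s : ℝ) (e : Eu N) : flux p ε (s • e) = scalarFlux p ε ‖e‖ s • e := by
  rw [flux, scalarFlux, norm_smul, smul_smul, norm_eq_abs, mul_comm |s|, mul_pow, sq_abs,
    mul_pow]

lemma hasDerivAt_scalarFlux {s : ℝ} (hε : 0 < ε) :
    ∃ h', HasDerivAt (scalarFlux p ε m) h' s ∧
      min 1 (p - 1) * (ε + (m * s) ^ 2) ^ ((p - 2) / 2) ≤ h' := by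
  have hb : 0 < ε + (m * s) ^ 2 := by positivity
  have h1 : HasDerivAt (fun s : ℝ => ε + (m * s) ^ 2) (2 * (m * s) * m) s := by
    have := (((hasDerivAt_id s).const_mul m).pow 2).const_add ε
    refine this.congr_deriv ?_
    simp
  have h2 := (h1.rpow_const (p := (p - 2) / 2) (Or.inl hb.ne')).mul (hasDerivAt_id s)
  refine ⟨_, h2, ?_⟩
  rw [rpow_sub_one hb.ne', id]
  obtain ⟨B, hB⟩ : ∃ B, B = (ε + (m * s) ^ 2) ^ ((p - 2) / 2) := ⟨_, rfl⟩
  have hB0 : 0 < B := by rw [hB]; positivity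
  obtain ⟨y, hy⟩ : ∃ y, y = (m * s) ^ 2 / (ε + (m * s) ^ 2) := ⟨_, rfl⟩
  have hy0 : 0 ≤ y := by rw [hy]; positivity
  have hy1 : y ≤ 1 := by rw [hy, div_le_one hb]; linarith
  rw [← hB]
  have e : 2 * (m * s) * m * ((p - 2) / 2) * (B / (ε + (m * s) ^ 2)) * s + B * 1 =
      B * (1 + (p - 2) * y) := by rw [hy]; field_simp; ring
  rw [e, mul_comm]
  refine mul_le_mul_of_nonneg_left ?_ hB0.le
  rcases le_total 2 p with h | h
  · exact (min_le_left _ _).trans (by nlinarith)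
  · exact (min_le_right _ _).trans (by nlinarith)

/-- The concave barrier profile. -/
def prof (t : ℝ) : ℝ := 3 * t + cos t - 1

lemma hasDerivAt_prof (t : ℝ) : HasDerivAt prof (3 - sin t) t := by
  have := (((hasDerivAt_id t).const_mul 3).add (hasDerivAt_cos t)).sub_const 1
  exact this.congr_deriv (by ring)

lemma two_mul_le_prof (h0 : 0 ≤ t) (h1 : t ≤ 1) : 2 * t ≤ prof t := by
  have := one_sub_sq_div_two_le_cos (x := t)
  unfold prof; nlinarith

lemma prof_le (t : ℝ) : prof t ≤ 3 * t := by
  have := cos_le_one t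
  unfold prof; linarith

lemma abs_prof_sub_le (s t : ℝ) : |prof s - prof t| ≤ 4 * |s - t| := by
  have h1 := abs_cos_sub_cos_le s t
  have e : prof s - prof t = 3 * (s - t) + (cos s - cos t) := by unfold prof; ring
  rw [e]
  refine (abs_add_le _ _).trans ?_
  rw [abs_mul, abs_of_pos (by norm_num : (0 : ℝ) < 3)]
  linarith

lemma lipTest_glue (hs : IsLip s) (h : ∀ x ∈ sphere c R, s x ≤ 0) (hκ : 0 < κ) :
    ∃ d, LipTest (ball c R) d ∧ (∀ x ∈ ball c R, d x = max (s x - κ) 0) ∧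
      ∀ x, x ∉ ball c R → d x = 0 := by
  obtain ⟨d, hd⟩ : ∃ d, d = (closedBall c R).indicator fun x => max (s x - κ) 0 := ⟨_, rfl⟩
  have hd1 : ∀ x ∈ closedBall c R, d x = max (s x - κ) 0 := fun x hx => by
    rw [hd]; exact indicator_of_mem hx _
  have hd0 : ∀ x, x ∉ ball c R → d x = 0 := fun x hx => by
    by_cases hxc : x ∈ closedBall c R
    · have hx2 : x ∈ sphere c R :=
        mem_sphere.2 (le_antisymm (mem_closedBall.1 hxc) (not_lt.1 hx))
      rw [hd1 x hxc]
      exact max_eq_right (by linarith [h x hx2])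
    · rw [hd]; exact indicator_of_notMem hxc _
  obtain ⟨C, hC0, hC⟩ := ((hs.sub (isLip_const κ)).max (isLip_const 0)).exists_le
  refine ⟨d, ⟨?_, hasCompactSupport_of_eq_zero hd0, ?_⟩,
    fun x hx => hd1 x (ball_subset_closedBall hx), hd0⟩
  · refine isLip_of_le (C := C) (abs_sub_le_of_glue (c := c) (R := R) (fun x hx y hy => ?_)
      fun x hx y hy => ?_)
    · rw [hd1 x hx, hd1 y hy]; exact hC x y
    · rw [hd0 x hx, hd0 y hy, sub_self, abs_zero]; positivity
  · have h1 : tsupport d ⊆ closedBall c R ∩ {x | κ ≤ s x} := by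
      refine closure_minimal (fun x hx => ?_)
        (isClosed_closedBall.inter (isClosed_le continuous_const hs.continuous))
      by_contra hne
      refine hx ?_
      by_cases hxc : x ∈ closedBall c R
      · have : s x < κ := by
          by_contra h2; exact hne ⟨hxc, not_lt.1 h2⟩
        rw [hd1 x hxc]; exact max_eq_right (by linarith)
      · exact hd0 x fun hb => hxc (ball_subset_closedBall hb)
    intro x hx
    obtain ⟨h2, h3⟩ := h1 hx
    by_contra hb
    have := h x (mem_sphere.2 (le_antisymm (mem_closedBall.1 h2) (not_lt.1 hb)))
    rw [mem_ofPred_eq] at h3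
    linarith

lemma exists_barrier_threshold (hp : 1 < p) (hm : 0 < m) (K : ℝ) :
    ∃ A₀, 1 ≤ A₀ ∧ ∀ A, A₀ ≤ A → ∀ ε, 0 < ε → ε ≤ 1 → ∀ s, 2 * A ≤ s → s ≤ 4 * A →
      K < min 1 (p - 1) * (ε + (m * s) ^ 2) ^ ((p - 2) / 2) * (A * cos 1 * m ^ 2) := by
  obtain ⟨κ, hκ⟩ : ∃ κ, κ = min ((4 * m ^ 2) ^ ((p - 2) / 2)) ((1 + 16 * m ^ 2) ^ ((p - 2) / 2)) :=
    ⟨_, rfl⟩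
  have hκ0 : 0 < κ := by rw [hκ]; exact lt_min (by positivity) (by positivity)
  have hp1 : 0 < min 1 (p - 1) := lt_min one_pos (by linarith)
  have hcos := cos_one_pos
  obtain ⟨κ', hκ'⟩ : ∃ κ', κ' = min 1 (p - 1) * κ * (cos 1 * m ^ 2) := ⟨_, rfl⟩
  have hκ'0 : 0 < κ' := by rw [hκ']; positivity
  have htend := (tendsto_rpow_atTop (by linarith : 0 < p - 1)).const_mul_atTop hκ'0
  obtain ⟨A₁, hA₁⟩ := eventually_atTop.1 (htend.eventually_gt_atTop K)
  refine ⟨max A₁ 1, le_max_right _ _, fun A hA ε hε hε1 s hs1 hs2 => ?_⟩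
  have h1A : 1 ≤ A := (le_max_right _ _).trans hA
  have hA0 : 0 < A := by linarith
  refine (hA₁ A ((le_max_left _ _).trans hA)).trans_le ?_
  have hApow : A ^ (p - 1) = (A ^ 2) ^ ((p - 2) / 2) * A := by
    rw [← rpow_natCast, ← rpow_mul hA0.le]
    nth_rewrite 3 [← rpow_one A]
    rw [← rpow_add hA0]; congr 1; push_cast; ring
  have hs0 : 0 < s := by linarith
  have key : κ * (A ^ 2) ^ ((p - 2) / 2) ≤ (ε + (m * s) ^ 2) ^ ((p - 2) / 2) := by
    have hsq1 : (2 * A) ^ 2 ≤ s ^ 2 := by gcongr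
    have hsq2 : s ^ 2 ≤ (4 * A) ^ 2 := by gcongr
    rcases le_total 2 p with h | h
    · calc κ * (A ^ 2) ^ ((p - 2) / 2) ≤ (4 * m ^ 2) ^ ((p - 2) / 2) * (A ^ 2) ^ ((p - 2) / 2) := by
            gcongr; rw [hκ]; exact min_le_left _ _
        _ = (4 * m ^ 2 * A ^ 2) ^ ((p - 2) / 2) := (mul_rpow (by positivity) (by positivity)).symm
        _ ≤ _ := rpow_le_rpow (by positivity) (by
            rw [mul_pow]; nlinarith [sq_nonneg m]) (by linarith)
    · calc κ * (A ^ 2) ^ ((p - 2) / 2) ≤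
            (1 + 16 * m ^ 2) ^ ((p - 2) / 2) * (A ^ 2) ^ ((p - 2) / 2) := by
            gcongr; rw [hκ]; exact min_le_right _ _
        _ = ((1 + 16 * m ^ 2) * A ^ 2) ^ ((p - 2) / 2) :=
            (mul_rpow (by positivity) (by positivity)).symm
        _ ≤ _ := rpow_le_rpow_of_nonpos (by positivity) (by
            rw [mul_pow]; nlinarith [sq_nonneg m]) (by linarith)
  rw [hApow, hκ']
  calc _ = min 1 (p - 1) * (κ * (A ^ 2) ^ ((p - 2) / 2)) * (A * cos 1 * m ^ 2) := by ring
    _ ≤ _ := by gcongr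

/-- Comparison with a one-dimensional concave barrier touching the ball at `z`. -/
lemma Sol.le_prof {a : ℝ} (hp : 1 < p)
    (hε : 0 < ε) (hR : 0 < R) (h : Sol p ε K' (ball c R) w k) (hz : z ∈ sphere c R)
    (hA1 : 1 ≤ A) (hA : ∀ s, 2 * A ≤ s → s ≤ 4 * A →
      K < min 1 (p - 1) * (ε + (1 / (2 * R) * s) ^ 2) ^ ((p - 2) / 2) *
        (A * cos 1 * (1 / (2 * R)) ^ 2))
    (hs : ∀ x ∈ sphere c R, w x ≤ a + A * prof (⟪z - x, z - c⟫ / (2 * R ^ 2)))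
    (hk : ∀ x ∈ ball c R, a + A * prof (⟪z - x, z - c⟫ / (2 * R ^ 2)) < w x → k x ≤ K) :
    ∀ x ∈ ball c R, w x ≤ a + A * prof (⟪z - x, z - c⟫ / (2 * R ^ 2)) := by
  obtain ⟨e, he⟩ : ∃ e, e = (1 / (2 * R ^ 2)) • (z - c) := ⟨_, rfl⟩
  have hzR : ‖z - c‖ = R := by rwa [mem_sphere, dist_eq_norm] at hz
  have hen : ‖e‖ = 1 / (2 * R) := by
    rw [he, norm_smul, hzR, norm_of_nonneg (by positivity)]; field_simp
  obtain ⟨τ, hτ⟩ : ∃ τ : Eu N → ℝ, τ = fun x => ⟪z - x, z - c⟫ / (2 * R ^ 2) := ⟨_, rfl⟩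
  have hτe : ∀ x, τ x = ⟪e, z⟫ - ⟪e, x⟫ := fun x => by
    rw [hτ, he, inner_smul_left, inner_smul_left, ← mul_sub, ← inner_sub_right, conj_trivial,
      real_inner_comm]; ring
  have hτl : IsLip τ := by
    rw [show τ = fun x => ⟪e, z⟫ - ⟪e, x⟫ from funext hτe]
    exact (isLip_const _).sub (isLip_inner e)
  have hτg : ∀ x, HasGradientAt τ (-e) x := fun x => by
    rw [show τ = fun x => ⟪e, z⟫ - ⟪e, x⟫ from funext hτe, hasGradientAt_iff_hasFDerivAt, map_neg]
    exact ((hasGradientAt_iff_hasFDerivAt.1 (hasGradientAt_inner e x)).const_sub _)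
  have hτ01 : ∀ x ∈ ball c R, 0 ≤ τ x ∧ τ x ≤ 1 := fun x hx => by
    have h1 := norm_sub_sq_le_inner hz (ball_subset_closedBall hx)
    have h2 := (le_abs_self _).trans (abs_real_inner_le_norm (z - x) (z - c))
    have h3 : ‖z - x‖ ≤ 2 * R := by
      have := dist_triangle z c x
      rw [mem_ball, dist_comm] at hx
      rw [← dist_eq_norm]; rw [mem_sphere] at hz; linarith
    rw [hzR] at h2
    rw [hτ]
    refine ⟨div_nonneg (by nlinarith [sq_nonneg ‖x - z‖]) (by positivity), ?_⟩
    rw [div_le_one (by positivity)]; nlinarith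
  obtain ⟨b, hb⟩ : ∃ b : Eu N → ℝ, b = fun x => a + A * prof (τ x) := ⟨_, rfl⟩
  have hbx : ∀ x, b x = a + A * prof (⟪z - x, z - c⟫ / (2 * R ^ 2)) := fun x => by rw [hb, hτ]
  have hprofl : IsLip fun x => prof (τ x) := by
    obtain ⟨C, hC0, hC⟩ := hτl.exists_le
    exact isLip_of_le (C := 4 * C) fun x y => (abs_prof_sub_le _ _).trans (by
      rw [mul_assoc]; exact mul_le_mul_of_nonneg_left (hC x y) (by norm_num))
  have hbl : IsLip b := by rw [hb]; exact (isLip_const a).add (hprofl.const_mul A)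
  obtain ⟨σ, hσ⟩ : ∃ σ : Eu N → ℝ, σ = fun x => A * (3 - sin (τ x)) := ⟨_, rfl⟩
  have hσ24 : ∀ x, 2 * A ≤ σ x ∧ σ x ≤ 4 * A := fun x => by
    have h1 := sin_le_one (τ x)
    have h2 := neg_one_le_sin (τ x)
    rw [hσ]; constructor <;> nlinarith
  have hbg : ∀ x, HasGradientAt b (-(σ x) • e) x := fun x => by
    have h1 := ((hasDerivAt_prof (τ x)).const_mul A).const_add a
    have h2 := HasGradientAt.comp_hasDerivAt (f := fun t => a + A * prof t) h1 (hτg x)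
    rw [smul_neg, ← neg_smul] at h2
    rw [hb, hσ]; exact h2
  have hfb : ∀ x, flux p ε (∇ b x) = (-(scalarFlux p ε ‖e‖ (σ x))) • e := fun x => by
    rw [(hbg x).gradient, neg_smul, flux_neg, flux_smul_eq, neg_smul]
  obtain ⟨g, hg⟩ : ∃ g, g = fun x => scalarFlux p ε ‖e‖ (σ x) := ⟨_, rfl⟩
  have hσl : IsLip σ := by
    obtain ⟨C, hC0, hC⟩ := hτl.exists_le
    refine isLip_of_le (C := A * C) fun x y => ?_
    rw [hσ]; simp only
    rw [← mul_sub, abs_mul, abs_of_pos (by linarith), sub_sub_sub_cancel_left, mul_assoc,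
      abs_sub_comm]
    exact mul_le_mul_of_nonneg_left ((abs_sin_sub_sin_le _ _).trans (hC x y)) (by linarith)
  have he0 : 0 < ‖e‖ := by rw [hen]; positivity
  have hgl : IsLip g := by
    have hFE := fluxEll_of_bounds (p := p) (M := ε + (4 * A * ‖e‖) ^ 2) hp hε hε
      (convex_closedBall (0 : Eu N) (4 * A * ‖e‖)) fun z hz => by
        rw [mem_closedBall, dist_zero_right] at hz
        exact ⟨by nlinarith [norm_nonneg z], by gcongr⟩
    have hin : ∀ x, σ x • e ∈ closedBall (0 : Eu N) (4 * A * ‖e‖) := fun x => by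
      rw [mem_closedBall, dist_zero_right, norm_smul, norm_of_nonneg (by
        linarith [(hσ24 x).1])]
      gcongr; exact (hσ24 x).2
    obtain ⟨C, hC0, hC⟩ := hσl.exists_le
    refine isLip_of_le (C := LamOf p ε (ε + (4 * A * ‖e‖) ^ 2) * C) fun x y => ?_
    have h1 := (hFE _ (hin y) _ (hin x)).2
    rw [flux_smul_eq, flux_smul_eq, ← sub_smul, ← sub_smul, norm_smul, norm_smul, ← mul_assoc] at h1
    have h2 := le_of_mul_le_mul_right h1 he0
    rw [norm_eq_abs, norm_eq_abs] at h2
    rw [hg, mul_assoc]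
    exact h2.trans (mul_le_mul_of_nonneg_left (hC x y) (LamOf_nonneg hε))
  have hgg : ∀ x ∈ ball c R, K < ⟪e, ∇ g x⟫ := fun x hx => by
    obtain ⟨h', hd, hlow⟩ := hasDerivAt_scalarFlux (m := ‖e‖) (s := σ x) hε
    have h1 : HasDerivAt (fun t => A * (3 - sin t)) (-(A * cos (τ x))) (τ x) :=
      (((hasDerivAt_sin (τ x)).const_sub 3).const_mul A).congr_deriv (by ring)
    have h2 : HasDerivAt (fun t => scalarFlux p ε ‖e‖ (A * (3 - sin t)))
        (h' * -(A * cos (τ x))) (τ x) :=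
      HasDerivAt.comp (h₂ := scalarFlux p ε ‖e‖) (τ x) (by rw [hσ] at hd; exact hd) h1
    have h3 := (HasGradientAt.comp_hasDerivAt (g := τ) h2 (hτg x)).gradient
    have h4 : ∇ g x = (h' * -(A * cos (τ x))) • -e := by rw [hg, hσ]; exact h3
    rw [h4, inner_smul_right, inner_neg_right, real_inner_self_eq_norm_sq]
    obtain ⟨h5, h6⟩ := hτ01 x hx
    have h7 : cos 1 ≤ cos (τ x) :=
      cos_le_cos_of_nonneg_of_le_pi h5 (by linarith [pi_gt_three]) h6
    have h8 := hA _ (hσ24 x).1 (hσ24 x).2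
    rw [← hen] at h8
    have hp1 : 0 < min 1 (p - 1) := lt_min one_pos (by linarith)
    refine h8.trans_le ?_
    have h9 : h' * -(A * cos (τ x)) * -‖e‖ ^ 2 = h' * (A * cos (τ x) * ‖e‖ ^ 2) := by ring
    have hcos := cos_one_pos
    have hA0 : 0 < A := by linarith
    rw [h9]
    gcongr
    exact le_trans (by positivity) hlow
  obtain ⟨s, hs'⟩ : ∃ s, s = fun x => w x - b x := ⟨_, rfl⟩
  have hsl : IsLip s := by rw [hs']; exact h.lip.sub hbl
  have hfin : ∀ κ > 0, ∀ x ∈ ball c R, s x ≤ κ := by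
    intro κ hκ
    obtain ⟨d, hd, hd1, hd0⟩ := lipTest_glue hsl (c := c) (R := R) (κ := κ)
      (fun x hx => by rw [hs']; have := hs x hx; rw [← hbx] at this; simp only; linarith) hκ
    have h1 := h.eqn d hd
    have hdT : LipTest univ d := hd.mono (subset_univ _)
    obtain ⟨G, hG0, hG⟩ := hgl.exists_norm_gradient_le
    have h2 : ∫ x, ⟪flux p ε (∇ b x), ∇ d x⟫ = ∫ x, ⟪e, ∇ g x⟫ * d x := by
      have h3 := integral_mul_inner_gradient hgl hd.1 hd.2.1 e
      rw [← neg_eq_iff_eq_neg, ← integral_neg] at h3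
      rw [← h3]
      congr 1; ext x
      rw [hfb, inner_smul_left, conj_trivial, hg]; ring
    obtain ⟨C1, hC1⟩ := h.exists_flux_le hp hε
    obtain ⟨B, hB0, hB⟩ := hbl.exists_norm_gradient_le
    have i1 : Integrable fun x => ⟪flux p ε (∇ w x), ∇ d x⟫ :=
      hdT.integrable_inner ((_root_.measurable_flux p ε).comp (measurable_gradient w)) hC1
    have i2 : Integrable fun x => ⟪flux p ε (∇ b x), ∇ d x⟫ :=
      hdT.integrable_inner ((_root_.measurable_flux p ε).comp (measurable_gradient b))
        fun x => norm_flux_le_of_norm_le hp hε (hB x)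
    have i3 : Integrable fun x => k x * d x := hdT.integrable_mul h.meas h.bdd
    have i4 : Integrable fun x => ⟪e, ∇ g x⟫ * d x :=
      hdT.integrable_mul (measurable_const.inner (measurable_gradient g)) (C := ‖e‖ * G)
        fun x => (abs_real_inner_le_norm _ _).trans (by gcongr; exact hG x)
    have h3 : 0 ≤ ∫ x, (⟪flux p ε (∇ w x), ∇ d x⟫ -
        ⟪flux p ε (∇ b x), ∇ d x⟫) := by
      refine integral_nonneg_of_ae ?_
      filter_upwards [gradient_sub_ae h.lip hbl, gradient_ae_eq_zero_of_eq_zero hR hd0] with x hx hx0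
      rw [Pi.zero_apply, ← inner_sub_left]
      by_cases hxb : x ∈ ball c R
      · have e1 : ∇ d x = ∇ (fun x => max (s x - κ) 0) x := by
          refine EventuallyEq.gradient_eq ?_
          filter_upwards [isOpen_ball.mem_nhds hxb] with y hy
          exact hd1 y hy
        rw [e1, gradient_max_sub hsl.continuous]
        split_ifs
        · rw [hs', hx]; exact flux_mono hp hε _ _
        · rw [inner_zero_right]
      · rw [hx0 hxb, inner_zero_right]
    rw [integral_sub i1 i2, h1, h2] at h3
    have h4 := integral_sub i4 i3
    simp only [← sub_mul] at h4
    have h5 := eq_zero_of_integral_nonpos (q := fun x => ⟪e, ∇ g x⟫ - k x) hd.1.continuous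
      (fun x => by
        by_cases hxb : x ∈ ball c R
        · rw [hd1 x hxb]; exact le_max_right _ _
        · rw [hd0 x hxb])
      (fun x hx => by
        have hxb : x ∈ ball c R := by
          by_contra hxb; rw [hd0 x hxb] at hx; exact lt_irrefl _ hx
        rw [hd1 x hxb] at hx
        rcases lt_max_iff.1 hx with hx | hx
        · rw [hs'] at hx; simp only at hx
          have := hk x hxb (by rw [← hbx]; linarith)
          linarith [hgg x hxb]
        · exact absurd hx (lt_irrefl _))
      ((i4.sub i3).congr (.of_forall fun x => (sub_mul _ _ _).symm))
      (by linarith)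
    intro x hx
    have h6 := h5 x
    rw [hd1 x hx] at h6
    have h7 := le_max_left (s x - κ) 0
    rw [h6] at h7; linarith
  intro x hx
  rw [← hbx]
  have := le_of_forall_pos_le_add (a := s x) (b := 0) fun κ hκ => by
    rw [zero_add]; exact hfin κ hκ x hx
  rw [hs'] at this; simp only at this; linarith

lemma norm_flux_le_of_nonneg (hp : 1 < p) (hε : 0 ≤ ε) (h : ‖ξ‖ ≤ M) :
    ‖flux p ε ξ‖ ≤ (ε + M ^ 2) ^ ((p - 1) / 2) := by
  have hM : 0 ≤ M := (norm_nonneg _).trans h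
  have hmono : (ε + ‖ξ‖ ^ 2) ^ ((p - 1) / 2) ≤ (ε + M ^ 2) ^ ((p - 1) / 2) :=
    rpow_le_rpow (by positivity) (by gcongr) (by linarith)
  rcases eq_or_ne ξ 0 with rfl | hξ
  · rw [flux, smul_zero, norm_zero]; positivity
  · refine le_trans ?_ hmono
    have hξ0 : 0 < ‖ξ‖ := norm_pos_iff.2 hξ
    have hb : 0 < ε + ‖ξ‖ ^ 2 := by positivity
    rw [flux, norm_smul, norm_of_nonneg (by positivity)]
    have h1 : ‖ξ‖ ≤ (ε + ‖ξ‖ ^ 2) ^ ((1 : ℝ) / 2) := by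
      rw [← sqrt_eq_rpow]
      exact le_sqrt_of_sq_le (by linarith)
    calc _ ≤ (ε + ‖ξ‖ ^ 2) ^ ((p - 2) / 2) * (ε + ‖ξ‖ ^ 2) ^ ((1 : ℝ) / 2) := by gcongr
      _ = _ := by rw [← rpow_add hb]; congr 1; ring

lemma tendsto_flux (hp : 1 < p) {ε : ℕ → ℝ} (hε : ∀ n, 0 ≤ ε n)
    (hε0 : Tendsto ε atTop (nhds 0)) {ξ : ℕ → Eu N} (hξ : Tendsto ξ atTop (nhds ζ)) :
    Tendsto (fun n => flux p (ε n) (ξ n)) atTop (nhds (flux p 0 ζ)) := by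
  have h1 : Tendsto (fun n => ε n + ‖ξ n‖ ^ 2) atTop (nhds (0 + ‖ζ‖ ^ 2)) :=
    hε0.add (hξ.norm.pow 2)
  rcases eq_or_ne ζ 0 with rfl | hζ
  · rw [flux, smul_zero]
    have h2 := h1.rpow_const (p := (p - 1) / 2) (Or.inr (by linarith))
    rw [norm_zero, zero_pow two_ne_zero, zero_add, zero_rpow (by linarith)] at h2
    exact squeeze_zero_norm (fun n => norm_flux_le_of_nonneg hp (hε n) le_rfl) h2
  · have hζ0 : 0 < ‖ζ‖ := norm_pos_iff.2 hζ
    exact (h1.rpow_const (Or.inl (by positivity))).smul hξ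

lemma inner_flux_sub_pos (hp : 1 < p) (h : ξ ≠ ζ) :
    0 < ⟪flux p 0 ζ - flux p 0 ξ, ζ - ξ⟫ := by
  have key : ∀ a : ℝ, 0 ≤ a → (0 + a ^ 2) ^ ((p - 2) / 2) * a = a ^ (p - 1) := fun a ha => by
    rcases eq_or_lt_of_le ha with rfl | ha
    · rw [mul_zero, zero_rpow (by linarith)]
    · rw [zero_add, ← rpow_natCast, ← rpow_mul ha.le]
      nth_rewrite 2 [← rpow_one a]
      rw [← rpow_add ha]; congr 1; push_cast; ring
  obtain ⟨a, ha⟩ : ∃ a, a = ‖ξ‖ := ⟨_, rfl⟩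
  obtain ⟨b, hb⟩ : ∃ b, b = ‖ζ‖ := ⟨_, rfl⟩
  have ha0 : 0 ≤ a := ha ▸ norm_nonneg _
  have hb0 : 0 ≤ b := hb ▸ norm_nonneg _
  obtain ⟨A, hA⟩ : ∃ A, A = (0 + a ^ 2) ^ ((p - 2) / 2) := ⟨_, rfl⟩
  obtain ⟨B, hB⟩ : ∃ B, B = (0 + b ^ 2) ^ ((p - 2) / 2) := ⟨_, rfl⟩
  have hA0 : 0 ≤ A := by rw [hA]; positivity
  have hB0 : 0 ≤ B := by rw [hB]; positivity
  have hAa : A * a = a ^ (p - 1) := by rw [hA]; exact key a ha0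
  have hBb : B * b = b ^ (p - 1) := by rw [hB]; exact key b hb0
  obtain ⟨i, hi⟩ : ∃ i, i = ⟪ξ, ζ⟫ := ⟨_, rfl⟩
  have hiab : i ≤ a * b := by rw [hi, ha, hb]; exact real_inner_le_norm _ _
  have e1 : ⟪flux p 0 ζ - flux p 0 ξ, ζ - ξ⟫ = (B * b - A * a) * (b - a) + (A + B) * (a * b - i) := by
    rw [flux, flux, ← ha, ← hb, ← hA, ← hB, inner_sub_left, inner_sub_right, inner_sub_right,
      inner_smul_left, inner_smul_left, inner_smul_left, inner_smul_left,
      real_inner_self_eq_norm_sq, real_inner_self_eq_norm_sq, real_inner_comm ξ ζ, ← hi, ← ha, ← hb]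
    simp only [conj_trivial]; ring
  rw [e1, hAa, hBb]
  have h2 : 0 ≤ (A + B) * (a * b - i) := mul_nonneg (by positivity) (by linarith)
  rcases lt_trichotomy a b with hab | hab | hab
  · have := rpow_lt_rpow ha0 hab (by linarith : 0 < p - 1)
    nlinarith
  · have ha' : 0 < a := by
      by_contra hcon
      have h0 : a = 0 := le_antisymm (not_lt.1 hcon) ha0
      refine h ?_
      have h1 : ‖ξ‖ = 0 := by rw [← ha, h0]
      have h2 : ‖ζ‖ = 0 := by rw [← hb, ← hab, h0]
      rw [norm_eq_zero.1 h1, norm_eq_zero.1 h2]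
    have hA' : 0 < A := by rw [hA]; positivity
    have h3 : i ≠ a * b := fun h3 => by
      refine h ?_
      have h4 : ‖ζ - ξ‖ ^ 2 = 0 := by
        rw [norm_sub_sq_real, real_inner_comm, ← hi, ← ha, ← hb, h3, hab]; ring
      have h5 := norm_eq_zero.1 (pow_eq_zero_iff two_ne_zero |>.1 h4)
      exact (sub_eq_zero.1 h5).symm
    have h4 : i < a * b := lt_of_le_of_ne hiab h3
    rw [hab, sub_self, zero_mul, zero_add]
    rw [← hab]
    exact mul_pos (by positivity) (by rw [← hab] at h4; linarith)
  · have := rpow_lt_rpow hb0 hab (by linarith : 0 < p - 1)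
    nlinarith

lemma Sol.neg (h : Sol p ε K U w k) :
    Sol p ε K U (fun x => -w x) fun x => -k x := by
  refine ⟨h.lip.neg, h.meas.neg, fun x => by rw [abs_neg]; exact h.bdd x, fun φ hφ => ?_⟩
  have h1 := h.eqn φ hφ
  simp only [gradient_neg', flux_neg, inner_neg_left, neg_mul, integral_neg, h1]

lemma Sol.congr_right (h : Sol p ε K U w k)
    (hm : Measurable k') (hK : ∀ x, |k' x| ≤ K') (he : ∀ x ∈ U, k' x = k x) :
    Sol p ε K' U w k' := by
  refine ⟨h.lip, hm, hK, fun φ hφ => (h.eqn φ hφ).trans ?_⟩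
  congr 1; ext x
  by_cases hx : x ∈ tsupport φ
  · rw [he x (hφ.2.2 hx)]
  · rw [image_eq_zero_of_notMem_tsupport hx, mul_zero, mul_zero]

lemma LipTest.integrable_inner_of_bdd (h : LipTest U φ)
    (hF : Measurable F) (hC : ∀ x ∈ tsupport φ, ‖F x‖ ≤ C) :
    Integrable (fun x => ⟪F x, ∇ φ x⟫) := by
  obtain ⟨D, hD, hD'⟩ := h.1.exists_norm_gradient_le
  refine integrable_of_bdd (C := |C| * D) (hF.inner (measurable_gradient φ))
    h.2.1.isCompact.isBounded (fun x hx => ?_) fun x => ?_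
  · rw [gradient_eq_zero_of_notMem_tsupport hx, inner_zero_right]
  · by_cases hx : x ∈ tsupport φ
    · exact (abs_real_inner_le_norm _ _).trans
        (mul_le_mul ((hC x hx).trans (le_abs_self _)) (hD' x) (norm_nonneg _) (abs_nonneg _))
    · rw [gradient_eq_zero_of_notMem_tsupport hx, inner_zero_right, abs_zero]; positivity

lemma LipTest.integrable_mul_of_bdd (h : LipTest U φ)
    (hk : Measurable k) (hC : ∀ x ∈ U, |k x| ≤ C) :
    Integrable (fun x => k x * φ x) := by
  obtain ⟨D, hD'⟩ := h.2.1.exists_bound_of_continuous h.1.continuous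
  refine integrable_of_bdd (C := |C| * |D|) (hk.mul h.1.continuous.measurable)
    h.2.1.isCompact.isBounded (fun x hx => ?_) fun x => ?_
  · rw [image_eq_zero_of_notMem_tsupport hx, mul_zero]
  · by_cases hx : x ∈ tsupport φ
    · rw [abs_mul]
      exact mul_le_mul ((hC x (h.2.2 hx)).trans (le_abs_self _)) ((hD' x).trans (le_abs_self _))
        (abs_nonneg _) (abs_nonneg _)
    · rw [image_eq_zero_of_notMem_tsupport hx, mul_zero, abs_zero]; positivity

/-- A continuously differentiable weak solution of `-div (flux p ε ∇w) = k` in `U`. -/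
structure CSol (p ε K : ℝ) (U : Set (Eu N)) (w k : Eu N → ℝ) : Prop where
  cd : ContDiffOn ℝ 1 w U
  meas : Measurable k
  bdd : ∀ x ∈ U, |k x| ≤ K
  eqn : ∀ φ, LipTest U φ → ∫ x, ⟪flux p ε (∇ w x), ∇ φ x⟫ = ∫ x, k x * φ x

/-- `G` bounds the gradient at the centre of a ball of radius `d`, uniformly in `ε`. -/
def GradBd (N : ℕ) (p S K d G : ℝ) : Prop :=
  ∀ (ε : ℝ) (w k : Eu N → ℝ) (c : Eu N), 0 < ε → ε ≤ 1 →
    Sol p ε K (ball c d) w k → ContDiffOn ℝ 1 w (ball c d) → (∀ x ∈ ball c d, |w x| ≤ S) →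
    ‖∇ w c‖ ≤ G

/-- `ρ` is a modulus of continuity for the gradient at the centre of a ball of radius `d`. -/
def GradMod (N : ℕ) (p S K d τ ρ : ℝ) : Prop :=
  ∀ (ε : ℝ) (w k : Eu N → ℝ) (c : Eu N), 0 < ε → ε ≤ 1 →
    Sol p ε K (ball c d) w k → ContDiffOn ℝ 1 w (ball c d) → (∀ x ∈ ball c d, |w x| ≤ S) →
    ∀ x ∈ ball c ρ, ‖∇ w x - ∇ w c‖ ≤ τ

/-- A solution inheriting the interior gradient estimates of the regularized problems. -/
structure RSol (p ε S K : ℝ) (U : Set (Eu N)) (w k : Eu N → ℝ) : Prop extends CSol p ε K U w k where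
  le : ∀ x ∈ U, |w x| ≤ S
  grad : ∀ d G c, ball c d ⊆ U → 0 < d → GradBd N p S K d G → ‖∇ w c‖ ≤ G
  modulus : ∀ d τ ρ c, ball c d ⊆ U → 0 < d → ρ ≤ d → GradMod N p S K d τ ρ →
    ∀ x ∈ ball c ρ, ‖∇ w x - ∇ w c‖ ≤ τ

lemma Sol.rSol (hp : 1 < p) (hε : 0 < ε)
    (hε1 : ε ≤ 1) (hU : IsOpen U) (h : Sol p ε K U w k) (hS : ∀ x ∈ U, |w x| ≤ S) :
    RSol p ε S K U w k where
  cd := h.contDiffOn hp hε hU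
  meas := h.meas
  bdd x _ := h.bdd x
  eqn := h.eqn
  le := hS
  grad _ _ c hd _ hG := hG ε w k c hε hε1 (h.mono le_rfl hd) ((h.contDiffOn hp hε hU).mono hd)
    fun x hx => hS x (hd hx)
  modulus _ _ _ c hd _ _ hG := hG ε w k c hε hε1 (h.mono le_rfl hd) ((h.contDiffOn hp hε hU).mono hd)
    fun x hx => hS x (hd hx)

lemma contDiffOn_one_of_hasGradientAt (hU : IsOpen U)
    (h : ∀ x ∈ U, HasGradientAt w (∇ w x) x) (hc : ContinuousOn (∇ w) U) :
    ContDiffOn ℝ 1 w U := by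
  rw [show (1 : WithTop ℕ∞) = 0 + 1 by simp, contDiffOn_succ_iff_fderiv_of_isOpen hU]
  refine ⟨fun x hx => (h x hx).differentiableAt.differentiableWithinAt, by simp, ?_⟩
  rw [contDiffOn_zero]
  have : fderiv ℝ w = fun x => InnerProductSpace.toDual ℝ (Eu N) (∇ w x) := by
    funext x; simp [gradient]
  rw [this]
  exact (InnerProductSpace.toDual ℝ (Eu N)).continuous.comp_continuousOn hc

lemma abs_sub_sub_inner_le_of_gradient (hw : ContDiffOn ℝ 1 w (ball c ρ))
    (h : ∀ x ∈ ball c ρ, ‖∇ w x - ∇ w c‖ ≤ τ) (hy : y ∈ ball c ρ) :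
    |w y - w c - ⟪∇ w c, y - c⟫| ≤ τ * ‖y - c‖ := by
  have hρ : 0 < ρ := pos_of_mem_ball hy
  obtain ⟨θ, -, h1, h2⟩ := exists_sub_eq_inner_gradient (x := c) (y := y - c) (convex_ball c ρ)
    (fun x hx => hw.hasGradientAt isOpen_ball hx) (mem_ball_self hρ) (by simpa using hy)
  rw [add_sub_cancel] at h2
  rw [h2, ← inner_sub_left]
  exact (abs_real_inner_le_norm _ _).trans (by gcongr; exact h _ h1)

/-- Compactness of solutions with inherited interior estimates. -/
theorem exists_subseq_rSol (hp : 1 < p) (hS : 0 ≤ S) (hK : 0 ≤ K)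
    (hU : IsOpen U) {ε : ℕ → ℝ} (hε : ∀ n, 0 ≤ ε n)
    (hε0 : Tendsto ε atTop (nhds 0)) {w k : ℕ → Eu N → ℝ} {k₀ : Eu N → ℝ}
    (h : ∀ n, RSol p (ε n) S K U (w n) (k n)) (hkm : Measurable k₀) (hkb : ∀ x ∈ U, |k₀ x| ≤ K)
    (hk : ∀ φ, LipTest U φ → Tendsto (fun n => ∫ x, k n x * φ x) atTop (nhds (∫ x, k₀ x * φ x))) :
    ∃ θ : ℕ → ℕ, StrictMono θ ∧ ∃ y, RSol p 0 S K U y k₀ ∧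
      ∀ x ∈ U, Tendsto (fun n => w (θ n) x) atTop (nhds (y x)) := by
  have hgb : ∀ d, 0 < d → ∃ G, ∀ c, ball c d ⊆ U → ∀ n, ‖∇ (w n) c‖ ≤ G := fun d hd => by
    obtain ⟨G, hG⟩ := exists_gradient_bound N hp hS hK hd
    exact ⟨G, fun c hc n => (h n).grad d G c hc hd hG⟩
  have hmod : ∀ x ∈ U, ∀ τ > 0, ∃ ρ > 0, ball x ρ ⊆ U ∧
      ∀ n, ∀ y ∈ ball x ρ, ‖∇ (w n) y - ∇ (w n) x‖ ≤ τ := fun x hx τ hτ => by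
    obtain ⟨d, hd, hdU⟩ := Metric.isOpen_iff.1 hU x hx
    obtain ⟨ρ, hρ, hρd, hM⟩ := exists_interior_gradient_modulus N hp hS hK hd hτ
    exact ⟨ρ, hρ, (ball_subset_ball hρd).trans hdU, fun n => (h n).modulus d τ ρ x hdU hd hρd hM⟩
  have hlin : ∀ x ∈ U, ∀ τ > 0, ∃ ρ > 0, ball x ρ ⊆ U ∧ ∀ n, ∀ y ∈ ball x ρ,
      ‖∇ (w n) y - ∇ (w n) x‖ ≤ τ ∧
      |w n y - w n x - ⟪∇ (w n) x, y - x⟫| ≤ τ * ‖y - x‖ := fun x hx τ hτ => by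
    obtain ⟨ρ, hρ, hρU, h1⟩ := hmod x hx τ hτ
    exact ⟨ρ, hρ, hρU, fun n y hy => ⟨h1 n y hy,
      abs_sub_sub_inner_le_of_gradient ((h n).cd.mono hρU) (h1 n) hy⟩⟩
  obtain ⟨θ, hθ, g, hg⟩ := exists_subseq_tendsto (U := U) (fun n x => (w n x, ∇ (w n) x))
    (fun x hx => by
      obtain ⟨d, hd, hdU⟩ := Metric.isOpen_iff.1 hU x hx
      obtain ⟨G, hG⟩ := hgb d hd
      refine ⟨max S G, fun n => ?_⟩
      rw [Prod.norm_def]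
      exact max_le_max ((h n).le x hx) (hG x hdU n))
    (fun x hx τ hτ => by
      obtain ⟨d, hd, hdU⟩ := Metric.isOpen_iff.1 hU x hx
      obtain ⟨G, hG⟩ := hgb d hd
      obtain ⟨ρ, hρ, hρU, h1⟩ := hlin x hx τ hτ
      have hG0 : 0 ≤ G := (norm_nonneg _).trans (hG x hdU 0)
      refine ⟨min ρ (τ / (G + τ + 1)), by positivity, fun n y hy => ?_⟩
      rw [mem_ball, lt_min_iff, ← mem_ball, dist_eq_norm] at hy
      obtain ⟨h2, h3⟩ := h1 n y hy.1
      rw [Prod.norm_def]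
      refine max_le ?_ h2
      have h4 := (abs_real_inner_le_norm (∇ (w n) x) (y - x)).trans
        (mul_le_mul_of_nonneg_right (hG x hdU n) (norm_nonneg _))
      have h5 := hy.2
      rw [lt_div_iff₀ (by positivity)] at h5
      rw [Prod.fst_sub, norm_eq_abs, abs_le]
      rw [abs_le] at h3 h4
      constructor <;> nlinarith [norm_nonneg (y - x)])
  have hy : ∀ x ∈ U, Tendsto (fun n => w (θ n) x) atTop (nhds (g x).1) := fun x hx =>
    ((continuous_fst.tendsto _).comp (hg x hx))
  have hgr : ∀ x ∈ U, Tendsto (fun n => ∇ (w (θ n)) x) atTop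
      (nhds (g x).2) := fun x hx => ((continuous_snd.tendsto _).comp (hg x hx))
  have hG : ∀ x ∈ U, HasGradientAt (fun x => (g x).1) (g x).2 x := fun x hx => by
    rw [hasGradientAt_iff_hasFDerivAt, hasFDerivAt_iff_isLittleO, Asymptotics.isLittleO_iff]
    intro τ hτ
    obtain ⟨ρ, hρ, hρU, h1⟩ := hlin x hx τ hτ
    filter_upwards [ball_mem_nhds x hρ] with y hyb
    rw [InnerProductSpace.toDual_apply_apply, norm_eq_abs]
    exact le_of_tendsto ((((hy y (hρU hyb)).sub (hy x hx)).sub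
      ((hgr x hx).inner tendsto_const_nhds)).abs) (.of_forall fun n =>
        (h1 (θ n) y hyb).2)
  have hgr' : ∀ x ∈ U, Tendsto (fun n => ∇ (w (θ n)) x) atTop
      (nhds (∇ (fun x => (g x).1) x)) := fun x hx => by
    rw [(hG x hx).gradient]; exact hgr x hx
  refine ⟨θ, hθ, fun x => (g x).1, ⟨⟨?_, hkm, hkb, fun φ hφ => ?_⟩, fun x hx => ?_, ?_, ?_⟩, hy⟩
  · refine contDiffOn_one_of_hasGradientAt hU
      (fun x hx => by rw [(hG x hx).gradient]; exact hG x hx) fun x hx => ?_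
    refine ContinuousAt.continuousWithinAt (Metric.continuousAt_iff.2 fun τ hτ => ?_)
    obtain ⟨ρ, hρ, hρU, h1⟩ := hmod x hx (τ / 2) (by positivity)
    refine ⟨ρ, hρ, fun y hyb => ?_⟩
    rw [dist_eq_norm]
    exact (le_of_tendsto (((hgr' y (hρU hyb)).sub (hgr' x hx)).norm)
      (.of_forall fun n => h1 (θ n) y hyb)).trans_lt (half_lt_self hτ)
  · obtain ⟨d, hd, hdU⟩ := hφ.2.1.isCompact.exists_thickening_subset_open hU hφ.2.2
    obtain ⟨G, hGb⟩ := hgb d hd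
    obtain ⟨E, hE⟩ := hε0.bddAbove_range
    obtain ⟨D, hD, hD'⟩ := hφ.1.exists_norm_gradient_le
    have h1 : ∀ x ∈ tsupport φ, ∀ n, ‖∇ (w n) x‖ ≤ G := fun x hx n =>
      hGb x ((ball_subset_thickening hx d).trans hdU) n
    have hE0 : 0 ≤ E := (hε 0).trans (hE (mem_range_self 0))
    refine tendsto_nhds_unique (tendsto_integral_of_dominated_convergence
      (F := fun n x => ⟪flux p (ε (θ n)) (∇ (w (θ n)) x), ∇ φ x⟫)
      ((tsupport φ).indicator fun _ => (E + G ^ 2) ^ ((p - 1) / 2) * D) (fun n => ?_) ?_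
      (fun n => .of_forall fun x => ?_) (.of_forall fun x => ?_)) ?_
    · exact (((measurable_flux p _).comp (measurable_gradient _)).inner
        (measurable_gradient φ)).aestronglyMeasurable
    · exact (integrable_indicator_iff hφ.2.1.isCompact.measurableSet).2
        (integrableOn_const hφ.2.1.isCompact.measure_lt_top.ne)
    · by_cases hx : x ∈ tsupport φ
      · rw [indicator_of_mem hx]
        have h2 : ‖flux p (ε (θ n)) (∇ (w (θ n)) x)‖ ≤ (E + G ^ 2) ^ ((p - 1) / 2) :=
          (norm_flux_le_of_nonneg hp (hε _) (h1 x hx _)).trans (rpow_le_rpow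
            (add_nonneg (hε _) (sq_nonneg _)) (by gcongr; exact hE (mem_range_self _)) (by linarith))
        exact (norm_inner_le_norm _ _).trans (mul_le_mul h2 (hD' x) (norm_nonneg _) (by positivity))
      · rw [indicator_of_notMem hx, gradient_eq_zero_of_notMem_tsupport hx, inner_zero_right,
          norm_zero]
    · by_cases hx : x ∈ tsupport φ
      · exact (tendsto_flux hp (fun n => hε _) (hε0.comp hθ.tendsto_atTop)
          (hgr' x (hφ.2.2 hx))).inner tendsto_const_nhds
      · simp only [gradient_eq_zero_of_notMem_tsupport hx, inner_zero_right]
        exact tendsto_const_nhds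
    · refine ((hk φ hφ).comp hθ.tendsto_atTop).congr fun n => ?_
      exact ((h (θ n)).eqn φ hφ).symm
  · exact le_of_tendsto (hy x hx).abs (.of_forall fun n => (h (θ n)).le x hx)
  · intro d G c hc hd hGd
    exact le_of_tendsto (hgr' c (hc (mem_ball_self hd))).norm
      (.of_forall fun n => (h (θ n)).grad d G c hc hd hGd)
  · intro d τ ρ c hc hd hρd hM x hx
    have hx' := hc (ball_subset_ball hρd hx)
    exact le_of_tendsto ((hgr' x hx').sub (hgr' c (hc (mem_ball_self hd)))).norm
      (.of_forall fun n => (h (θ n)).modulus d τ ρ c hc hd hρd hM x hx)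

lemma exists_taylor_bound (h : ContDiff ℝ 2 ψ) (hc : HasCompactSupport ψ) :
    ∃ C, 0 ≤ C ∧ ∀ z x, |ψ x - ψ z - ⟪∇ ψ z, x - z⟫| ≤ C * ‖x - z‖ ^ 2 := by
  have h1 : ContDiff ℝ 1 (fderiv ℝ ψ) := h.fderiv_right (by norm_num)
  obtain ⟨C, hC⟩ := ContDiff.lipschitzWith_of_hasCompactSupport (hc.fderiv (𝕜 := ℝ)) h1 one_ne_zero
  refine ⟨C * 2, by positivity, fun z x => ?_⟩
  rcases eq_or_ne x z with rfl | hxz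
  · simp
  have h0 : 0 < ‖x - z‖ := norm_pos_iff.2 (sub_ne_zero.2 hxz)
  have h2 := abs_sub_sub_inner_le_of_gradient (w := ψ) (c := z) (ρ := 2 * ‖x - z‖)
    (τ := C * (2 * ‖x - z‖)) ((h.of_le (by norm_num)).contDiffOn) (fun y hy => ?_) (y := x)
    (by rw [mem_ball_iff_norm]; linarith)
  · exact h2.trans (le_of_eq (by ring))
  · have h3 := hC.dist_le_mul y z
    rw [mem_ball] at hy
    rw [gradient, gradient, ← map_sub, LinearIsometryEquiv.norm_map, ← dist_eq_norm]
    exact h3.trans (by gcongr)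

lemma exists_smooth_approx (hψ : Continuous ψ) (c : Eu N) (hR : 0 < R)
    (hη : 0 < η) : ∃ g : Eu N → ℝ, ContDiff ℝ 2 g ∧ HasCompactSupport g ∧
      ∀ x ∈ closedBall c R, |g x - ψ x| ≤ η := by
  obtain ⟨g, hg, hgψ⟩ := hψ.exists_contDiff_approx (n := 2) (ε := fun _ => η) continuous_const
    fun _ => hη
  let f : ContDiffBump c := ⟨R, R + 1, hR, by linarith⟩
  refine ⟨fun x => f x * g x, f.contDiff.mul hg, f.hasCompactSupport.mul_right, fun x hx => ?_⟩
  simp only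
  rw [f.one_of_mem_closedBall hx, one_mul]
  have := hgψ.1 x
  rw [dist_eq] at this
  exact this.le

lemma exists_rhs_approx (hk : Measurable k) (hK : ∀ x, |k x| ≤ K)
    (c : Eu N) {s : ℝ} (hs : 0 < s) (hη : 0 < η) : ∃ g : Eu N → ℝ, IsLip g ∧
      (∀ x, |g x| ≤ K) ∧ (∀ x, g x ≠ 0 → ∀ z ∈ sphere c R, s ≤ ‖x - z‖) ∧
      ∀ φ D, LipTest (ball c (R - 2 * s)) φ → (∀ x, |φ x| ≤ D) →
        |∫ x, (g x - k x) * φ x| ≤ η * D := by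
  have hK0 : 0 ≤ K := (abs_nonneg _).trans (hK c)
  have hfm : MeasurableSet (ball c (R - 2 * s)) := measurableSet_ball
  obtain ⟨f, hf⟩ : ∃ f, f = (ball c (R - 2 * s)).indicator k := ⟨_, rfl⟩
  have hfi : Integrable f := by
    rw [hf, integrable_indicator_iff hfm]
    exact integrableOn_of_bdd hk isBounded_ball hK
  obtain ⟨g, hgl, hgc, hg⟩ := exists_isLip_integral_sub_le hfi hη
  obtain ⟨χ, hχ⟩ : ∃ χ : Eu N → ℝ, χ = fun x => max (min ((R - s) / s - 1 / s * ‖x - c‖) 1) 0 :=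
    ⟨_, rfl⟩
  have e : ∀ x, (R - s) / s - 1 / s * ‖x - c‖ = (R - s - ‖x - c‖) / s := fun x => by ring
  have hnl : IsLip fun x : Eu N => ‖x - c‖ := by
    have := (isLip_norm (N := N)).comp_add (-c)
    simpa only [← sub_eq_add_neg] using this
  have hχl : IsLip χ := by
    rw [hχ]; exact (((isLip_const _).sub (hnl.const_mul _)).min (isLip_const 1)).max (isLip_const 0)
  have hχ0 : ∀ x, R - s ≤ ‖x - c‖ → χ x = 0 := fun x hx => by
    rw [hχ]; refine max_eq_right ((min_le_left _ _).trans ?_)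
    rw [e]; exact div_nonpos_of_nonpos_of_nonneg (by linarith) hs.le
  have hχ1 : ∀ x ∈ ball c (R - 2 * s), χ x = 1 := fun x hx => by
    rw [mem_ball_iff_norm] at hx
    rw [hχ]; simp only
    rw [min_eq_right, max_eq_left zero_le_one]
    rw [e, le_div_iff₀ hs]; linarith
  have hχb : ∀ x, 0 ≤ χ x ∧ χ x ≤ 1 := fun x => by
    rw [hχ]; exact ⟨le_max_right _ _, max_le (min_le_right _ _) zero_le_one⟩
  have hχc : HasCompactSupport χ := hasCompactSupport_of_eq_zero (c := c) (R := R - s) fun x hx =>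
    hχ0 x (by rw [mem_ball_iff_norm] at hx; exact not_lt.1 hx)
  have hcl : ∀ x, |max (min (g x) K) (-K)| ≤ K := fun x =>
    abs_le.2 ⟨le_max_right _ _, max_le (min_le_right _ _) (by linarith)⟩
  refine ⟨fun x => χ x * max (min (g x) K) (-K), IsLip.mul_of_hasCompactSupport hχl hχc
    ((hgl.min (isLip_const K)).max (isLip_const (-K))), fun x => ?_, fun x hx z hz => ?_,
    fun φ D hφ hD => ?_⟩
  · rw [abs_mul, abs_of_nonneg (hχb x).1]
    exact (mul_le_of_le_one_left (abs_nonneg _) (hχb x).2).trans (hcl x)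
  · have h1 : ‖x - c‖ < R - s := by
      by_contra hcon
      exact hx (by simp only [hχ0 x (not_lt.1 hcon), zero_mul])
    rw [mem_sphere, dist_eq_norm] at hz
    have := norm_sub_le_norm_sub_add_norm_sub z x c
    rw [norm_sub_rev z x] at this
    linarith
  · have hD0 : 0 ≤ D := (abs_nonneg _).trans (hD c)
    have hfg : Integrable fun x => |f x - g x| :=
      (hfi.sub (hgl.integrable_of_hasCompactSupport hgc)).abs
    rw [← norm_eq_abs]
    refine (norm_integral_le_of_norm_le (hfg.const_mul D) (.of_forall
      fun x => ?_)).trans ?_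
    · rw [norm_eq_abs, abs_mul]
      by_cases hx : x ∈ tsupport φ
      · have hxb := hφ.2.2 hx
        simp only
        rw [hχ1 x hxb, one_mul, mul_comm D]
        have hfx : f x = k x := by rw [hf]; exact indicator_of_mem hxb k
        rw [hfx]
        refine mul_le_mul ?_ (hD x) (abs_nonneg _) (abs_nonneg _)
        have h1 := abs_le.1 (hK x)
        have h2 : k x = max (min (k x) K) (-K) := by rw [min_eq_left h1.2, max_eq_left h1.1]
        rw [abs_sub_comm (k x)]
        nth_rewrite 1 [h2]
        exact (abs_max_sub_max_le_abs _ _ _).trans (abs_inf_sub_inf_le_abs _ _ _)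
      · rw [image_eq_zero_of_notMem_tsupport hx, abs_zero, mul_zero]; positivity
    · rw [integral_const_mul, mul_comm]; gcongr

lemma barrier_arg_mem (hR : 0 < R) (hz : z ∈ sphere c R) (hx : x ∈ closedBall c R) :
    0 ≤ ⟪z - x, z - c⟫ / (2 * R ^ 2) ∧ ⟪z - x, z - c⟫ / (2 * R ^ 2) ≤ 1 := by
  have hzR : ‖z - c‖ = R := by rwa [mem_sphere, dist_eq_norm] at hz
  have h1 := norm_sub_sq_le_inner hz hx
  have h2 := (le_abs_self _).trans (abs_real_inner_le_norm (z - x) (z - c))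
  have h3 : ‖z - x‖ ≤ 2 * R := by
    rw [mem_closedBall_iff_norm] at hx
    have := norm_sub_le_norm_sub_add_norm_sub z c x
    rw [norm_sub_rev c x] at this; linarith
  rw [hzR] at h2
  refine ⟨div_nonneg (by nlinarith [sq_nonneg ‖x - z‖]) (by positivity), ?_⟩
  rw [div_le_one (by positivity)]; nlinarith

lemma Sol.le_add_of_sphere {a : ℝ} (hp : 1 < p)
    (hε : 0 < ε) (hR : 0 < R) (h : Sol p ε K' (ball c R) w k) (hz : z ∈ sphere c R)
    (hA1 : 1 ≤ A) (hA : ∀ s, 2 * A ≤ s → s ≤ 4 * A →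
      K < min 1 (p - 1) * (ε + (1 / (2 * R) * s) ^ 2) ^ ((p - 2) / 2) *
        (A * cos 1 * (1 / (2 * R)) ^ 2))
    (hs : ∀ x ∈ sphere c R, w x ≤ a) (hk : ∀ x ∈ ball c R, a < w x → k x ≤ K) :
    ∀ x ∈ ball c R, w x ≤ a + 3 * A := by
  have h0 : ∀ x ∈ closedBall c R, 0 ≤ A * prof (⟪z - x, z - c⟫ / (2 * R ^ 2)) := fun x hx => by
    obtain ⟨h1, h2⟩ := barrier_arg_mem hR hz hx
    have := two_mul_le_prof h1 h2
    exact mul_nonneg (by linarith) (by linarith)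
  intro x hx
  have h1 := h.le_prof (a := a) hp hε hR hz hA1 hA
    (fun x hx => by have := h0 x (sphere_subset_closedBall hx); linarith [hs x hx])
    (fun x hx hlt => hk x hx (by have := h0 x (ball_subset_closedBall hx); linarith)) x hx
  obtain ⟨h2, h3⟩ := barrier_arg_mem hR hz (ball_subset_closedBall hx)
  have h4 := prof_le (⟪z - x, z - c⟫ / (2 * R ^ 2))
  nlinarith

/-- Regularized problems with uniform estimates and uniform boundary barriers. -/
lemma exists_regularized (hN : 0 < N) (hp : 1 < p) {A₀ : ℝ} (hR : 0 < R)
    (hψ : Continuous ψ) (hS : ∀ x ∈ closedBall c R, |ψ x| ≤ S)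
    (hk : Measurable k) (hK : ∀ x, |k x| ≤ K) (hA₀ : 1 ≤ A₀)
    (hA : ∀ A, A₀ ≤ A → ∀ ε, 0 < ε → ε ≤ 1 → ∀ s, 2 * A ≤ s → s ≤ 4 * A →
      K + 1 < min 1 (p - 1) * (ε + (1 / (2 * R) * s) ^ 2) ^ ((p - 2) / 2) *
        (A * cos 1 * (1 / (2 * R)) ^ 2)) (hη : 0 < η) (hη1 : η ≤ 1) :
    ∃ w k', RSol p η (S + 1 + 3 * A₀) (K + 1) (ball c R) w k' ∧
      (∀ φ D, LipTest (ball c (R - 2 * η)) φ → (∀ x, |φ x| ≤ D) →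
        |∫ x, (k' x - k x) * φ x| ≤ 2 * η * D) ∧
      ∀ z ∈ sphere c R, ∀ δ A, A₀ ≤ A →
        (∀ x ∈ sphere c R, |ψ x - ψ z| ≤ δ + A * prof (⟪z - x, z - c⟫ / (2 * R ^ 2))) →
        ∀ x ∈ ball c R, |w x - ψ z| ≤ δ + η + A * prof (⟪z - x, z - c⟫ / (2 * R ^ 2)) := by
  have hS0 : 0 ≤ S := (abs_nonneg _).trans (hS c (mem_closedBall_self hR.le))
  obtain ⟨ψ', hψ'1, hψ'2, hψ'⟩ := exists_smooth_approx hψ c hR hη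
  obtain ⟨C, hC, hT⟩ := exists_taylor_bound hψ'1 hψ'2
  obtain ⟨Lψ, hLψ, hψL⟩ := (isLip_of_contDiff (hψ'1.of_le (by norm_num)) hψ'2).exists_le
  obtain ⟨g, hg, hgK, hgδ, hgφ⟩ := exists_rhs_approx hk hK c (R := R) hη hη
  obtain ⟨Lk, hLk, hgL⟩ := hg.exists_le
  obtain ⟨V, hV⟩ : ∃ V, V = volume.real (ball c R) := ⟨_, rfl⟩
  have hV0 : 0 ≤ V := hV ▸ measureReal_nonneg
  obtain ⟨T, hTT⟩ : ∃ T, T = 2 * S + 2 + 3 * A₀ := ⟨_, rfl⟩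
  have hT0 : 0 < T := by rw [hTT]; linarith
  obtain ⟨μ, hμ⟩ : ∃ μ, μ = η / (T * (V + 1)) := ⟨_, rfl⟩
  have hμ0 : 0 < μ := by rw [hμ]; positivity
  have hμT : μ * T * (V + 1) = η := by rw [hμ]; field_simp
  have hμT1 : μ * T ≤ 1 := by nlinarith [mul_pos hμ0 hT0]
  have hμTV : μ * T * V ≤ η := by nlinarith [mul_pos hμ0 hT0]
  obtain ⟨w, hw0, K', hw⟩ := exists_sol_of_smooth hN hp hη hμ0 hR hψL hLψ hT hC hgL hLk hgK hη hgδ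
  have hψ'S : ∀ x ∈ closedBall c R, |ψ' x| ≤ S + 1 := fun x hx => by
    have h1 := abs_le.1 (hψ' x hx)
    have h2 := abs_le.1 (hS x hx)
    exact abs_le.2 ⟨by linarith, by linarith⟩
  have hws : ∀ x ∈ sphere c R, w x = ψ' x := fun x hx => hw0 x fun hb =>
    (mem_ball.1 hb).ne (mem_sphere.1 hx)
  have : Nonempty (Fin N) := ⟨⟨0, hN⟩⟩
  obtain ⟨z₀, hz₀⟩ := (NormedSpace.sphere_nonempty (x := c) (r := R)).2 hR.le
  have hAη := fun A hA' => hA A hA' η hη hη1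
  have hup := hw.le_add_of_sphere (K := K + 1) (a := S + 1) hp hη hR hz₀ hA₀ (hAη A₀ le_rfl)
    (fun x hx => by rw [hws x hx]; exact (abs_le.1 (hψ'S x (sphere_subset_closedBall hx))).2)
    (fun x hx hlt => by
      have h1 := (abs_le.1 (hψ'S x (ball_subset_closedBall hx))).2
      have h2 := (abs_le.1 (hgK x)).2
      nlinarith)
  have hlo := hw.neg.le_add_of_sphere (K := K + 1) (a := S + 1) hp hη hR hz₀ hA₀ (hAη A₀ le_rfl)
    (fun x hx => by
      rw [hws x hx]; linarith [(abs_le.1 (hψ'S x (sphere_subset_closedBall hx))).1])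
    (fun x hx hlt => by
      have h1 := (abs_le.1 (hψ'S x (ball_subset_closedBall hx))).1
      have h2 := (abs_le.1 (hgK x)).1
      nlinarith)
  have hdiff : ∀ x ∈ ball c R, |w x - ψ' x| ≤ T := fun x hx => by
    have h1 := abs_le.1 (hψ'S x (ball_subset_closedBall hx))
    have h2 := hup x hx
    have h3 := hlo x hx
    exact abs_le.2 ⟨by linarith, by linarith⟩
  have hkb : ∀ x ∈ ball c R, |g x - μ * (w x - ψ' x)| ≤ K + 1 := fun x hx => by
    refine (_root_.abs_sub _ _).trans ?_
    rw [abs_mul, abs_of_pos hμ0]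
    have := mul_le_mul_of_nonneg_left (hdiff x hx) hμ0.le
    linarith [hgK x]
  have hK1 : 0 ≤ K + 1 := (abs_nonneg _).trans (hkb c (mem_ball_self hR))
  have hw' := hw.congr_right (K' := K + 1)
    (k' := (ball c R).indicator fun x => g x - μ * (w x - ψ' x))
    (hw.meas.indicator measurableSet_ball)
    (fun x => by
      by_cases hx : x ∈ ball c R
      · rw [indicator_of_mem hx]; exact hkb x hx
      · rw [indicator_of_notMem hx, abs_zero]; exact hK1)
    (fun x hx => indicator_of_mem hx _)
  refine ⟨w, _, hw'.rSol hp hη hη1 isOpen_ball fun x hx =>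
    abs_le.2 ⟨by linarith [hlo x hx], hup x hx⟩, fun φ D hφ hD => ?_, fun z hz δ A hAA hzψ => ?_⟩
  · have hD0 : 0 ≤ D := (abs_nonneg _).trans (hD c)
    have hφ' : LipTest (ball c R) φ := hφ.mono (ball_subset_ball (by linarith))
    have i1 : Integrable fun x => (g x - k x) * φ x :=
      hφ.integrable_mul (hg.continuous.measurable.sub hk) (C := K + K) fun x =>
        (_root_.abs_sub _ _).trans (add_le_add (hgK x) (hK x))
    have hm : Measurable fun x => μ * (w x - ψ' x) :=
      ((hw.lip.continuous.sub hψ'1.continuous).const_mul μ).measurable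
    have i2 : Integrable fun x => μ * (w x - ψ' x) * φ x :=
      hφ'.integrable_mul_of_bdd hm (C := μ * T) fun x hx => by
        rw [abs_mul, abs_of_pos hμ0]; exact mul_le_mul_of_nonneg_left (hdiff x hx) hμ0.le
    have e1 : ∫ x, ((ball c R).indicator (fun x => g x - μ * (w x - ψ' x)) x - k x) * φ x =
        ∫ x, ((g x - k x) * φ x - μ * (w x - ψ' x) * φ x) := by
      congr 1; ext x
      by_cases hx : x ∈ ball c R
      · rw [indicator_of_mem hx]; ring
      · rw [image_eq_zero_of_notMem_tsupport fun h => hx (hφ'.2.2 h)]; ring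
    rw [e1, integral_sub i1 i2]
    have e2 : ∫ x, μ * (w x - ψ' x) * φ x = ∫ x in ball c R, μ * (w x - ψ' x) * φ x := by
      refine (setIntegral_eq_integral_of_forall_compl_eq_zero fun x hx => ?_).symm
      rw [image_eq_zero_of_notMem_tsupport fun h => hx (hφ'.2.2 h), mul_zero]
    have h2 : |∫ x, μ * (w x - ψ' x) * φ x| ≤ μ * T * D * V := by
      rw [e2, ← norm_eq_abs, hV]
      refine norm_setIntegral_le_of_norm_le_const measure_ball_lt_top fun x hx => ?_
      rw [norm_eq_abs, abs_mul, abs_mul, abs_of_pos hμ0]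
      gcongr
      · exact hdiff x hx
      · exact hD x
    have h3 := hgφ φ D hφ hD
    refine (_root_.abs_sub _ _).trans ?_
    nlinarith [mul_le_mul_of_nonneg_right hμTV hD0]
  · intro x hx
    have hA1 : 1 ≤ A := hA₀.trans hAA
    have h1 := hw.le_prof (K := K + 1) (a := ψ z + δ + η) hp hη hR hz hA1 (hAη A hAA)
      (fun x hx => by
        have h2 := (abs_le.1 (hzψ x hx)).2
        have h3 := (abs_le.1 (hψ' x (sphere_subset_closedBall hx))).2
        rw [hws x hx]; linarith)
      (fun x hx _ => (abs_le.1 (hkb x hx)).2) x hx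
    have h2 := hw.neg.le_prof (K := K + 1) (a := -ψ z + δ + η) hp hη hR hz hA1 (hAη A hAA)
      (fun x hx => by
        have h2 := (abs_le.1 (hzψ x hx)).1
        have h3 := (abs_le.1 (hψ' x (sphere_subset_closedBall hx))).1
        rw [hws x hx]; linarith)
      (fun x hx _ => neg_le.1 (abs_le.1 (hkb x hx)).1) x hx
    exact abs_le.2 ⟨by linarith, by linarith⟩

lemma gradient_congr_of_isOpen (hU : IsOpen U)
    (h : ∀ x ∈ U, w' x = w x) (hx : x ∈ U) : ∇ w' x = ∇ w x :=
  EventuallyEq.gradient_eq (eventuallyEq_of_mem (hU.mem_nhds hx) h)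

lemma CSol.congr (hU : IsOpen U)
    (h : CSol p ε K U w k) (hw : ∀ x ∈ U, w' x = w x) : CSol p ε K U w' k where
  cd := h.cd.congr hw
  meas := h.meas
  bdd := h.bdd
  eqn φ hφ := by
    rw [← h.eqn φ hφ]
    congr 1; ext x
    by_cases hx : x ∈ tsupport φ
    · rw [gradient_congr_of_isOpen hU hw (hφ.2.2 hx)]
    · rw [gradient_eq_zero_of_notMem_tsupport hx, inner_zero_right, inner_zero_right]

lemma RSol.congr (hU : IsOpen U)
    (h : RSol p ε S K U w k) (hw : ∀ x ∈ U, w' x = w x) : RSol p ε S K U w' k where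
  toCSol := h.toCSol.congr hU hw
  le x hx := by rw [hw x hx]; exact h.le x hx
  grad d G c hd h0 hG := by
    rw [gradient_congr_of_isOpen hU hw (hd (mem_ball_self h0))]; exact h.grad d G c hd h0 hG
  modulus d τ ρ c hd h0 hρ hG x hx := by
    rw [gradient_congr_of_isOpen hU hw (hd (mem_ball_self h0)),
      gradient_congr_of_isOpen hU hw (hd (ball_subset_ball hρ hx))]
    exact h.modulus d τ ρ c hd h0 hρ hG x hx

/-- The Dirichlet problem for the `p`-Laplacian in a ball with continuous boundary data. -/
theorem exists_dirichlet (hN : 0 < N) (hp : 1 < p) (c : Eu N) (hR : 0 < R)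
    (S₀ K₀ : ℝ) : ∃ S, ∀ ψ k : Eu N → ℝ, Continuous ψ → (∀ x ∈ closedBall c R, |ψ x| ≤ S₀) →
      Measurable k → (∀ x, |k x| ≤ K₀) →
      ∃ y, RSol p 0 S (K₀ + 1) (ball c R) y k ∧ ContinuousOn y (closedBall c R) ∧
        ∀ x ∈ sphere c R, y x = ψ x := by
  have hm : 0 < 1 / (2 * R) := by positivity
  obtain ⟨A₀, hA₀, hA⟩ := exists_barrier_threshold hp hm (K₀ + 1)
  refine ⟨S₀ + 1 + 3 * A₀, fun ψ k hψ hS hk hK => ?_⟩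
  have hS0 : 0 ≤ S₀ := (abs_nonneg _).trans (hS c (mem_closedBall_self hR.le))
  have hK0 : 0 ≤ K₀ := (abs_nonneg _).trans (hK c)
  obtain ⟨η, hηd⟩ : ∃ η : ℕ → ℝ, η = fun n : ℕ => 1 / ((n : ℝ) + 1) := ⟨_, rfl⟩
  have hη0 : ∀ n, 0 < η n := fun n => by rw [hηd]; positivity
  have hη1 : ∀ n, η n ≤ 1 := fun n => by
    rw [hηd]; simp only
    rw [div_le_one (by positivity)]; linarith [n.cast_nonneg (α := ℝ)]
  have hηt : Tendsto η atTop (nhds 0) := by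
    rw [hηd]; exact tendsto_one_div_add_atTop_nhds_zero_nat
  choose w k' hw hwk hwb using fun n =>
    exists_regularized hN hp hR hψ hS hk hK hA₀ hA (hη0 n) (hη1 n)
  obtain ⟨θ, hθ, y, hy, hyl⟩ := exists_subseq_rSol hp (S := S₀ + 1 + 3 * A₀) (by linarith)
    (by linarith) isOpen_ball (fun n => (hη0 n).le) hηt hw hk (fun x _ => (hK x).trans (by linarith))
    (fun φ hφ => by
      obtain ⟨D, hD⟩ := hφ.2.1.exists_bound_of_continuous hφ.1.continuous
      obtain ⟨R', hR', hsub⟩ : ∃ R' < R, tsupport φ ⊆ ball c R' :=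
        exists_lt_subset_ball (isClosed_tsupport φ) hφ.2.2
      have hev : ∀ᶠ n in atTop, η n < (R - R') / 2 :=
        hηt.eventually (gt_mem_nhds (by linarith))
      have hlim : Tendsto (fun n => 2 * η n * D) atTop (nhds 0) := by
        simpa using (hηt.const_mul 2).mul_const D
      rw [tendsto_iff_norm_sub_tendsto_zero]
      refine squeeze_zero' (.of_forall fun n => norm_nonneg _) ?_ hlim
      filter_upwards [hev] with n hn
      have h1 := hwk n φ D ⟨hφ.1, hφ.2.1, hsub.trans (ball_subset_ball (by linarith))⟩ hD
      have i1 := hφ.integrable_mul_of_bdd (hw n).meas (hw n).bdd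
      have i2 := hφ.integrable_mul_of_bdd hk fun x _ => hK x
      have hJ := integral_sub i1 i2
      simp only [← sub_mul] at hJ
      rw [← hJ]; exact h1)
  have hbar : ∀ z ∈ sphere c R, ∀ δ A, A₀ ≤ A →
      (∀ x ∈ sphere c R, |ψ x - ψ z| ≤ δ + A * prof (⟪z - x, z - c⟫ / (2 * R ^ 2))) →
      ∀ x ∈ ball c R, |y x - ψ z| ≤ δ + A * prof (⟪z - x, z - c⟫ / (2 * R ^ 2)) := by
    intro z hz δ A hAA h x hx
    have h1 : Tendsto (fun n => |w (θ n) x - ψ z|) atTop (nhds |y x - ψ z|) :=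
      ((hyl x hx).sub_const _).abs
    have h2 : Tendsto (fun n => δ + η (θ n) + A * prof (⟪z - x, z - c⟫ / (2 * R ^ 2)))
        atTop (nhds (δ + 0 + A * prof (⟪z - x, z - c⟫ / (2 * R ^ 2)))) :=
      ((hηt.comp hθ.tendsto_atTop).const_add δ).add_const _
    rw [add_zero] at h2
    exact le_of_tendsto_of_tendsto' h1 h2 fun n => hwb (θ n) z hz δ A hAA h x hx
  classical
  obtain ⟨y', hy'⟩ : ∃ y' : Eu N → ℝ, y' = fun x => if x ∈ ball c R then y x else ψ x := ⟨_, rfl⟩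
  have hin : ∀ x ∈ ball c R, y' x = y x := fun x hx => by rw [hy']; exact if_pos hx
  have hout : ∀ x ∈ sphere c R, y' x = ψ x := fun x hx => by
    rw [hy']; exact if_neg fun h => (mem_ball.1 h).ne (mem_sphere.1 hx)
  refine ⟨y', hy.congr isOpen_ball hin, fun z hz => ?_, hout⟩
  by_cases hzb : z ∈ ball c R
  · have h1 : ContinuousAt y z := hy.cd.continuousOn.continuousAt (isOpen_ball.mem_nhds hzb)
    exact (h1.congr (eventuallyEq_of_mem (isOpen_ball.mem_nhds hzb)
      fun x hx => (hin x hx).symm)).continuousWithinAt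
  have hzs : z ∈ sphere c R := by
    rw [mem_sphere]; exact le_antisymm hz (not_lt.1 hzb)
  rw [Metric.continuousWithinAt_iff]
  intro e he
  obtain ⟨ρ, hρ, hρψ⟩ := Metric.continuousAt_iff.1 (hψ.continuousAt (x := z)) (e / 3) (by linarith)
  obtain ⟨A, hAd⟩ : ∃ A, A = max A₀ (4 * S₀ * R ^ 2 / ρ ^ 2) := ⟨_, rfl⟩
  have hAA : A₀ ≤ A := hAd ▸ le_max_left _ _
  have hA2 : 4 * S₀ * R ^ 2 ≤ A * ρ ^ 2 := by
    rw [← div_le_iff₀ (by positivity)]; exact hAd ▸ le_max_right _ _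
  have hA0 : 0 < A := by linarith
  have hkey := hbar z hzs (e / 3) A hAA fun x hx => by
    obtain ⟨t0, t1⟩ := barrier_arg_mem hR hzs (sphere_subset_closedBall hx)
    have h1 := two_mul_le_prof t0 t1
    by_cases hxz : dist x z < ρ
    · have h2 := hρψ hxz
      rw [dist_eq] at h2
      nlinarith
    · have h2 := abs_le.1 (hS x (sphere_subset_closedBall hx))
      have h3 := abs_le.1 (hS z hz)
      have h4 := norm_sub_sq_le_inner hzs (sphere_subset_closedBall hx)
      rw [not_lt, dist_eq_norm] at hxz
      have h5 : ρ ^ 2 ≤ ‖x - z‖ ^ 2 := by gcongr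
      have h6 : ρ ^ 2 / (4 * R ^ 2) ≤ ⟪z - x, z - c⟫ / (2 * R ^ 2) := by
        rw [div_le_div_iff₀ (by positivity) (by positivity)]; nlinarith [sq_nonneg R]
      have h7 : 2 * S₀ ≤ A * (2 * (ρ ^ 2 / (4 * R ^ 2))) := by
        rw [show A * (2 * (ρ ^ 2 / (4 * R ^ 2))) = A * ρ ^ 2 / (2 * R ^ 2) by field_simp; ring,
          le_div_iff₀ (by positivity)]
        linarith
      have h8 : A * (2 * (ρ ^ 2 / (4 * R ^ 2))) ≤ A * prof (⟪z - x, z - c⟫ / (2 * R ^ 2)) := by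
        gcongr; linarith
      exact abs_le.2 ⟨by linarith, by linarith⟩
  refine ⟨min ρ (2 * R * e / (9 * A)), by positivity, fun {x} hx hxz => ?_⟩
  rw [hout z hzs, dist_eq]
  by_cases hxb : x ∈ ball c R
  · rw [hin x hxb]
    refine (hkey x hxb).trans_lt ?_
    have h1 := prof_le (⟪z - x, z - c⟫ / (2 * R ^ 2))
    have h2 := (le_abs_self _).trans (abs_real_inner_le_norm (z - x) (z - c))
    have h3 : ‖z - c‖ = R := by rwa [mem_sphere, dist_eq_norm] at hzs
    have h4 : ‖z - x‖ < 2 * R * e / (9 * A) := by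
      rw [norm_sub_rev, ← dist_eq_norm]; exact hxz.trans_le (min_le_right _ _)
    rw [lt_div_iff₀ (by positivity)] at h4
    rw [h3] at h2
    have h5 : ⟪z - x, z - c⟫ / (2 * R ^ 2) < e / (9 * A) := by
      rw [div_lt_div_iff₀ (by positivity) (by positivity)]; nlinarith
    have h6 : A * prof (⟪z - x, z - c⟫ / (2 * R ^ 2)) < A * (3 * (e / (9 * A))) := by
      gcongr; linarith
    have h7 : A * (3 * (e / (9 * A))) = e / 3 := by field_simp; norm_num
    linarith
  · have hxs : x ∈ sphere c R := by rw [mem_sphere]; exact le_antisymm hx (not_lt.1 hxb)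
    rw [hout x hxs, ← dist_eq]
    exact (hρψ (hxz.trans_le (min_le_left _ _))).trans (by linarith)

open scoped ContDiff Manifold in
lemma exists_cutoff {K : Set (Eu N)} (hK : IsCompact K) (hU : IsOpen U) (hKU : K ⊆ U) :
    ∃ χ : Eu N → ℝ, ContDiff ℝ ∞ χ ∧ HasCompactSupport χ ∧ tsupport χ ⊆ U ∧
      (∀ x, 0 ≤ χ x ∧ χ x ≤ 1) ∧ ∃ V, IsOpen V ∧ K ⊆ V ∧ ∀ x ∈ V, χ x = 1 := by
  obtain ⟨L, hL, hKL, hLU⟩ := exists_compact_between hK hU hKU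
  obtain ⟨f, hf1, hf0, hf⟩ := exists_contMDiffMap_one_nhds_of_subset_interior (n := ⊤)
    (𝓘(ℝ, Eu N)) hK.isClosed hKL
  have hsub : tsupport f ⊆ L := closure_minimal (fun x hx => by
    by_contra h; exact hx (hf0 x h)) hL.isClosed
  obtain ⟨V, hV, hKV, hV1⟩ := mem_nhdsSet_iff_exists.1 hf1
  exact ⟨f, f.contMDiff.contDiff, hL.of_isClosed_subset (isClosed_tsupport f) hsub,
    hsub.trans hLU, hf, V, hV, hKV, fun x hx => hV1 hx⟩

lemma eq_zero_of_gradient_ae_eq_zero (hN : 0 < N) {d : Eu N → ℝ} (hd : IsLip d)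
    (hc : HasCompactSupport d) (h : ∀ᵐ x, ∇ d x = 0) (x : Eu N) : d x = 0 := by
  have : Nonempty (Fin N) := ⟨⟨0, hN⟩⟩
  obtain ⟨y, hy⟩ : ∃ y, d y = 0 := by
    by_contra! hne
    have h1 : tsupport d = univ := eq_univ_of_forall fun x => subset_tsupport d (hne x)
    exact noncompact_univ (Eu N) (h1 ▸ hc.isCompact)
  have h1 := hd.integral_abs_sub_le hc (x - y)
  have h2 : ∫ x, ‖∇ d x‖ = 0 := by
    rw [integral_eq_zero_of_ae]; filter_upwards [h] with x hx; simp [hx]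
  rw [h2, mul_zero] at h1
  have hcont : Continuous fun z => |d (z + (x - y)) - d z| :=
    ((hd.continuous.comp (continuous_id.add_const _)).sub hd.continuous).abs
  have hi : Integrable fun z => |d (z + (x - y)) - d z| := by
    have i0 := hd.integrable_of_hasCompactSupport hc
    exact ((i0.comp_add_right (x - y)).sub i0).abs
  have h3 := (integral_eq_zero_iff_of_nonneg (fun z => abs_nonneg _) hi).1
    (le_antisymm h1 (integral_nonneg fun z => abs_nonneg _))
  have h4 := congrFun ((Continuous.ae_eq_iff_eq volume hcont continuous_const).1 h3) y
  simp only [add_sub_cancel, hy, sub_zero] at h4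
  exact abs_eq_zero.1 h4

/-- Weak comparison for the `p`-Laplacian. -/
theorem le_of_flux_le (hN : 0 < N) (hp : 1 < p) (hU : IsOpen U)
    (hb : Bornology.IsBounded U) (hv : ContinuousOn v (closure U))
    (hw : ContinuousOn w (closure U)) (hv1 : ContDiffOn ℝ 1 v U) (hw1 : ContDiffOn ℝ 1 w U)
    (h : ∀ φ, LipTest U φ → (∀ x, 0 ≤ φ x) →
      ∫ x, ⟪flux p 0 (∇ v x), ∇ φ x⟫ ≤ ∫ x, ⟪flux p 0 (∇ w x), ∇ φ x⟫)
    (hf : ∀ x ∈ frontier U, v x ≤ w x) : ∀ x ∈ U, v x ≤ w x := by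
  intro x₀ hx₀
  by_contra! hlt
  obtain ⟨κ, hκ⟩ : ∃ κ, κ = (v x₀ - w x₀) / 2 := ⟨_, rfl⟩
  have hκ0 : 0 < κ := by rw [hκ]; linarith
  obtain ⟨E, hE⟩ : ∃ E, E = closure U ∩ (fun x => v x - w x) ⁻¹' Ici κ := ⟨_, rfl⟩
  have hEc : IsCompact E := by
    rw [hE]
    exact hb.isCompact_closure.of_isClosed_subset
      ((hv.sub hw).preimage_isClosed_of_isClosed isClosed_closure isClosed_Ici) inter_subset_left
  have hEU : E ⊆ U := fun x hx => by
    rw [hE] at hx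
    by_contra hxU
    have h1 := hf x ⟨hx.1, by rwa [hU.interior_eq]⟩
    have h2 : κ ≤ v x - w x := hx.2
    linarith
  obtain ⟨χ, hχ, hχc, hχU, hχ01, V, hV, hEV, hχ1⟩ := exists_cutoff hEc hU hEU
  obtain ⟨s, hs⟩ : ∃ s : Eu N → ℝ, s = fun x => χ x * (v x - w x) := ⟨_, rfl⟩
  have hs1 : ContDiff ℝ 1 s := by
    rw [contDiff_iff_contDiffAt]
    intro x
    by_cases hx : x ∈ tsupport χ
    · have hxU := hU.mem_nhds (hχU hx)
      rw [hs]
      exact (hχ.contDiffAt.of_le (by norm_cast)).mul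
        ((hv1.contDiffAt hxU).sub (hw1.contDiffAt hxU))
    · have h0 : s =ᶠ[nhds x] fun _ => 0 := by
        filter_upwards [notMem_tsupport_iff_eventuallyEq.1 hx] with y hy
        rw [hs]; simp only; rw [hy]; simp
      exact contDiffAt_const.congr_of_eventuallyEq h0
  have hsc : HasCompactSupport s := by rw [hs]; exact hχc.mul_right
  have hsl := isLip_of_contDiff hs1 hsc
  obtain ⟨d, hd⟩ : ∃ d : Eu N → ℝ, d = fun x => max (s x - κ) 0 := ⟨_, rfl⟩
  have hsE : ∀ x, κ < s x → x ∈ E := fun x hx => by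
    rw [hs] at hx
    simp only at hx
    have hxU : x ∈ U := by
      by_contra hxU
      rw [image_eq_zero_of_notMem_tsupport fun h => hxU (hχU h), zero_mul] at hx
      linarith
    rw [hE]
    refine ⟨subset_closure hxU, ?_⟩
    have := hχ01 x
    change κ ≤ v x - w x
    by_contra! hlt
    nlinarith
  have hd0 : ∀ x ∉ E, d x = 0 := fun x hx => by
    rw [hd]; exact max_eq_right (by linarith [not_lt.1 fun h => hx (hsE x h)])
  have hdE : tsupport d ⊆ E := closure_minimal (fun x hx => by
    by_contra h; exact hx (hd0 x h)) hEc.isClosed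
  have hdl : IsLip d := by
    rw [hd]; exact (hsl.sub (isLip_const κ)).max (isLip_const 0)
  have hdc : HasCompactSupport d := hEc.of_isClosed_subset (isClosed_tsupport d) hdE
  have hdT : LipTest U d := ⟨hdl, hdc, hdE.trans hEU⟩
  have hgd : ∀ x, ∇ d x = if κ < s x then ∇ v x - ∇ w x else 0 := fun x => by
    rw [hd, gradient_max_sub hsl.continuous]
    split_ifs with hx
    · have hxE := hsE x hx
      have h1 : ∇ s x = ∇ (fun x => v x - w x) x := by
        refine EventuallyEq.gradient_eq ?_
        filter_upwards [hV.mem_nhds (hEV hxE)] with y hy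
        rw [hs]; simp only; rw [hχ1 y hy, one_mul]
      rw [h1]
      exact ((hv1.hasGradientAt hU (hEU hxE)).sub' (hw1.hasGradientAt hU (hEU hxE))).gradient
    · rfl
  have bdd : ∀ {u : Eu N → ℝ}, ContDiffOn ℝ 1 u U →
      Integrable fun x => ⟪flux p 0 (∇ u x), ∇ d x⟫ := fun {u} hu => by
    obtain ⟨M, hM⟩ := (hdc.isCompact.of_isClosed_subset (isClosed_tsupport d) Subset.rfl
      ).exists_bound_of_continuousOn ((hu.continuousOn_gradient hU).mono hdT.2.2)
    exact hdT.integrable_inner_of_bdd ((measurable_flux p 0).comp (measurable_gradient u))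
      fun x hx => norm_flux_le_of_nonneg hp le_rfl (hM x hx)
  have hJ := integral_sub (bdd hv1) (bdd hw1)
  simp only [← inner_sub_left] at hJ
  have hle := h d hdT fun x => by rw [hd]; exact le_max_right _ _
  have hnn : ∀ x, 0 ≤ ⟪flux p 0 (∇ v x) - flux p 0 (∇ w x), ∇ d x⟫ := fun x => by
    rw [hgd]
    split_ifs with hx
    · by_cases he : ∇ w x = ∇ v x
      · rw [he, sub_self, inner_zero_left]
      · exact (inner_flux_sub_pos hp he).le
    · rw [inner_zero_right]
  have hint : Integrable fun x =>
      ⟪flux p 0 (∇ v x) - flux p 0 (∇ w x), ∇ d x⟫ := by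
    simp only [inner_sub_left]; exact (bdd hv1).sub (bdd hw1)
  have hz := (integral_eq_zero_iff_of_nonneg hnn hint).1
    (le_antisymm (by linarith) (integral_nonneg hnn))
  have hae : ∀ᵐ x, ∇ d x = 0 := by
    filter_upwards [hz] with x hx
    rw [hgd] at hx ⊢
    split_ifs with hlt
    · by_contra hne
      rw [if_pos hlt] at hx
      exact (inner_flux_sub_pos hp fun he => hne (sub_eq_zero.2 he.symm)).ne' hx
    · rfl
  have hfin := eq_zero_of_gradient_ae_eq_zero hN hdl hdc hae x₀
  have hx₀E : x₀ ∈ E := by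
    rw [hE]; exact ⟨subset_closure hx₀, by change κ ≤ v x₀ - w x₀; rw [hκ]; linarith⟩
  rw [hd, hs] at hfin
  simp only at hfin
  rw [hχ1 x₀ (hEV hx₀E), one_mul, max_eq_left (by rw [hκ]; linarith), hκ] at hfin
  linarith

open scoped Convolution ContDiff in
lemma exists_contDiff_approx_of_lipschitz {C : NNReal} (h : LipschitzWith C φ) (hδ : 0 < δ) :
    ∃ ψ : Eu N → ℝ, ContDiff ℝ ∞ ψ ∧ LipschitzWith C ψ ∧ (∀ x, |ψ x - φ x| ≤ C * δ) ∧
      tsupport ψ ⊆ cthickening δ (tsupport φ) := by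
  obtain ⟨b, hb⟩ : ∃ b : ContDiffBump (0 : Eu N), b.rOut = δ :=
    ⟨⟨δ / 2, δ, by positivity, by linarith⟩, rfl⟩
  have hbc : HasCompactSupport (b.normed volume) := b.hasCompactSupport_normed
  have hi : ∀ x, Integrable fun t => b.normed volume t * φ (x - t) := fun x => by
    have hcont : Continuous fun t => b.normed volume t * φ (x - t) :=
      b.continuous_normed.mul (h.continuous.comp (by fun_prop))
    exact hcont.integrable_of_hasCompactSupport hbc.mul_right
  have he : ∀ x, (b.normed volume ⋆[ContinuousLinearMap.lsmul ℝ ℝ, volume] φ) x =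
      ∫ t, b.normed volume t * φ (x - t) := fun x => rfl
  refine ⟨b.normed volume ⋆[ContinuousLinearMap.lsmul ℝ ℝ, volume] φ,
    hbc.contDiff_convolution_left _ b.contDiff_normed h.continuous.locallyIntegrable,
    LipschitzWith.of_dist_le_mul fun x y => ?_, fun x => ?_, ?_⟩
  · rw [dist_eq, he, he, ← integral_sub (hi x) (hi y), ← norm_eq_abs]
    have h1 : ∫ t, b.normed volume t * (C * dist x y) = C * dist x y := by
      rw [integral_mul_const, b.integral_normed, one_mul]
    rw [← h1]
    refine norm_integral_le_of_norm_le (b.integrable_normed.mul_const _)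
      (.of_forall fun t => ?_)
    rw [← mul_sub, norm_mul, norm_of_nonneg (b.nonneg_normed t)]
    refine mul_le_mul_of_nonneg_left ?_ (b.nonneg_normed t)
    have := h.dist_le_mul (x - t) (y - t)
    rwa [dist_sub_right, dist_eq] at this
  · rw [← dist_eq]
    refine b.dist_normed_convolution_le h.continuous.aestronglyMeasurable fun y hy => ?_
    rw [hb, mem_ball] at hy
    exact (h.dist_le_mul y x).trans (by gcongr)
  · refine closure_minimal (fun x hx => ?_) isClosed_cthickening
    by_contra hxn
    have h0 : ∀ y ∈ ball x b.rOut, φ y = 0 := fun y hy => by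
      by_contra hne
      refine hxn (mem_cthickening_of_dist_le x y δ _ (subset_tsupport φ hne) ?_)
      rw [← hb, dist_comm]; exact (mem_ball.1 hy).le
    have hx0 := h0 x (mem_ball_self b.rOut_pos)
    refine hx ?_
    rw [b.normed_convolution_eq_right fun y hy => by rw [h0 y hy, hx0], hx0]

/-- The weak equation `-Δ_p w = k` in `U`, tested with Lipschitz functions. -/
def WeakEq (p : ℝ) (U : Set (Eu N)) (w k : Eu N → ℝ) : Prop :=
  ∀ φ, LipTest U φ → ∫ x, ⟪flux p 0 (∇ w x), ∇ φ x⟫ = ∫ x, k x * φ x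

lemma inner_flux_zero (p : ℝ) (ξ ζ : Eu N) : ⟪flux p 0 ξ, ζ⟫ = ‖ξ‖ ^ (p - 2) * ⟪ξ, ζ⟫ := by
  unfold flux
  rw [real_inner_smul_left, zero_add, ← rpow_natCast, ← rpow_mul (norm_nonneg _)]
  congr 2; push_cast; ring

lemma norm_gradient_le_of_lipschitzWith {C : NNReal} (h : LipschitzWith C φ)
    (x : Eu N) : ‖∇ φ x‖ ≤ C := by
  rw [norm_gradient]; exact norm_fderiv_le_of_lipschitz ℝ h

lemma exists_flux_bound (hp : 1 < p) {L : Set (Eu N)} (hU : IsOpen U)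
    (hw : ContDiffOn ℝ 1 w U) (hL : IsCompact L) (hLU : L ⊆ U) :
    ∃ C, 0 ≤ C ∧ ∀ x ∈ L, ‖flux p 0 (∇ w x)‖ ≤ C := by
  obtain ⟨M, hM⟩ := hL.exists_bound_of_continuousOn ((hw.continuousOn_gradient hU).mono hLU)
  exact ⟨max ((0 + M ^ 2) ^ ((p - 1) / 2)) 0, le_max_right _ _,
    fun x hx => (norm_flux_le_of_nonneg hp le_rfl (hM x hx)).trans (le_max_left _ _)⟩

lemma measurable_flux_gradient (p : ℝ) (w : Eu N → ℝ) :
    Measurable fun x => flux p 0 (∇ w x) :=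
  (measurable_flux p 0).comp (measurable_gradient w)

lemma LipTest.integrable_flux (hp : 1 < p) (hU : IsOpen U)
    (hw : ContDiffOn ℝ 1 w U) (hφ : LipTest U φ) :
    Integrable fun x => ⟪flux p 0 (∇ w x), ∇ φ x⟫ := by
  obtain ⟨C, -, hC⟩ := exists_flux_bound hp hU hw hφ.2.1.isCompact hφ.2.2
  exact hφ.integrable_inner_of_bdd (measurable_flux_gradient p w) hC

lemma LipTest.integrable_mul_of_locally_bdd (hφ : LipTest U φ)
    (hk : Measurable k) (hb : ∀ L, IsCompact L → L ⊆ U → ∃ C, ∀ x ∈ L, |k x| ≤ C) :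
    Integrable fun x => k x * φ x := by
  obtain ⟨C, hC⟩ := hb _ hφ.2.1.isCompact hφ.2.2
  have hφ' : LipTest (tsupport φ) φ := ⟨hφ.1, hφ.2.1, Subset.rfl⟩
  exact hφ'.integrable_mul_of_bdd hk hC

open scoped ContDiff in
lemma WeakEq.of_contDiff (hp : 1 < p) (hU : IsOpen U) (hw : ContDiffOn ℝ 1 w U) (hk : Measurable k)
    (hb : ∀ L, IsCompact L → L ⊆ U → ∃ C, ∀ x ∈ L, |k x| ≤ C)
    (h : ∀ φ, ContDiff ℝ ∞ φ → LipTest U φ →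
      ∫ x, ⟪flux p 0 (∇ w x), ∇ φ x⟫ = ∫ x, k x * φ x) : WeakEq p U w k := by
  intro φ hφ
  obtain ⟨Cφ, hCφ⟩ := hφ.1
  obtain ⟨δ, hδ, hδU⟩ := hφ.2.1.isCompact.exists_cthickening_subset_open hU hφ.2.2
  have hLc : IsCompact (cthickening δ (tsupport φ)) := hφ.2.1.isCompact.cthickening
  obtain ⟨L, hL⟩ : ∃ L, L = cthickening δ (tsupport φ) := ⟨_, rfl⟩
  rw [← hL] at hδU hLc
  obtain ⟨η, hηd⟩ : ∃ η : ℕ → ℝ, η = fun n : ℕ => δ * (1 / ((n : ℝ) + 1)) := ⟨_, rfl⟩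
  have hη0 : ∀ n, 0 < η n := fun n => by rw [hηd]; positivity
  have hηδ : ∀ n, η n ≤ δ := fun n => by
    rw [hηd]; simp only
    refine mul_le_of_le_one_right hδ.le ?_
    rw [div_le_one (by positivity)]; linarith [n.cast_nonneg (α := ℝ)]
  have hηt : Tendsto η atTop (nhds 0) := by
    rw [hηd]; simpa using (tendsto_one_div_add_atTop_nhds_zero_nat (𝕜 := ℝ)).const_mul δ
  choose ψ h1 h2 h3 h4 using fun n => exists_contDiff_approx_of_lipschitz hCφ (hη0 n)
  have hsL : ∀ n, tsupport (ψ n) ⊆ L := fun n => by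
    rw [hL]; exact (h4 n).trans (cthickening_mono (hηδ n) _)
  have hφL : tsupport φ ⊆ L := by rw [hL]; exact self_subset_cthickening _
  have hψT : ∀ n, LipTest U (ψ n) := fun n =>
    ⟨⟨Cφ, h2 n⟩, hLc.of_isClosed_subset (isClosed_tsupport _) (hsL n), (hsL n).trans hδU⟩
  have hdT : ∀ n, LipTest U fun x => ψ n x - φ x := fun n => (hψT n).sub hφ
  have hdL : ∀ n x, x ∉ L → ψ n x - φ x = 0 := fun n x hx => by
    rw [image_eq_zero_of_notMem_tsupport fun h => hx (hsL n h),
      image_eq_zero_of_notMem_tsupport fun h => hx (hφL h), sub_self]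
  have hdsL : ∀ n, tsupport (fun x => ψ n x - φ x) ⊆ L := fun n => closure_minimal
    (fun x hx => by by_contra h; exact hx (hdL n x h)) hLc.isClosed
  have hlim : ∀ x, Tendsto (fun n => ψ n x - φ x) atTop (nhds 0) := fun x => by
    refine squeeze_zero_norm (fun n => h3 n x) ?_
    simpa using hηt.const_mul (Cφ : ℝ)
  have hA : ∀ n, ∫ x, ⟪flux p 0 (∇ w x), ∇ (fun x => ψ n x - φ x) x⟫ =
      (∫ x, k x * ψ n x) - ∫ x, ⟪flux p 0 (∇ w x), ∇ φ x⟫ := fun n => by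
    have hJ := integral_sub ((hψT n).integrable_flux hp hU hw) (hφ.integrable_flux hp hU hw)
    rw [← h (ψ n) (h1 n) (hψT n), ← hJ]
    refine integral_congr_ae ?_
    filter_upwards [gradient_sub_ae (hψT n).1 hφ.1] with x hx
    rw [hx, inner_sub_right]
  obtain ⟨Cw, hCw0, hCw⟩ := exists_flux_bound hp hU hw hLc hδU
  obtain ⟨Ck, hCk⟩ := hb L hLc hδU
  have hFi : Integrable (L.indicator fun x => flux p 0 (∇ w x)) := by
    rw [integrable_indicator_iff hLc.measurableSet]
    exact Measure.integrableOn_of_bounded hLc.measure_lt_top.ne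
      (measurable_flux_gradient p w).aestronglyMeasurable
      ((ae_restrict_iff' hLc.measurableSet).2 (.of_forall hCw))
  have hki : Integrable (L.indicator k) := by
    rw [integrable_indicator_iff hLc.measurableSet]
    exact Measure.integrableOn_of_bounded hLc.measure_lt_top.ne hk.aestronglyMeasurable
      ((ae_restrict_iff' hLc.measurableSet).2 (.of_forall hCk))
  have hdb : ∀ n x, |ψ n x - φ x| ≤ Cφ * δ := fun n x => (h3 n x).trans (by gcongr; exact hηδ n)
  have hlim1 := tendsto_integral_inner_gradient hFi (d := fun n x => ψ n x - φ x)
    (C := ((Cφ + Cφ : NNReal) : ℝ)) (fun n => (hdT n).1) (fun n => (hdT n).2.1)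
    (fun n x => norm_gradient_le_of_lipschitzWith ((h2 n).sub hCφ) x) hdb hlim
  have e1 : ∀ n, ∫ x, ⟪(L.indicator fun x => flux p 0 (∇ w x)) x,
      ∇ (fun x => ψ n x - φ x) x⟫ =
      (∫ x, k x * ψ n x) - ∫ x, ⟪flux p 0 (∇ w x), ∇ φ x⟫ := fun n => by
    rw [← hA n]
    congr 1; ext x
    by_cases hx : x ∈ L
    · rw [indicator_of_mem hx]
    · rw [gradient_eq_zero_of_notMem_tsupport fun h => hx (hdsL n h), inner_zero_right,
        inner_zero_right]
  simp only [e1] at hlim1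
  have hlim2 : Tendsto (fun n => ∫ x, k x * ψ n x) atTop (nhds (∫ x, k x * φ x)) := by
    rw [tendsto_iff_norm_sub_tendsto_zero]
    refine squeeze_zero (fun n => norm_nonneg _) (fun n => ?_)
      (g := fun n => ∫ x, |L.indicator k x| * (Cφ * η n)) ?_
    · have hJ := integral_sub ((hψT n).integrable_mul_of_locally_bdd hk hb)
        (hφ.integrable_mul_of_locally_bdd hk hb)
      rw [← hJ]
      refine norm_integral_le_of_norm_le (hki.abs.mul_const _)
        (.of_forall fun x => ?_)
      rw [← mul_sub, norm_mul, norm_eq_abs, norm_eq_abs]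
      by_cases hx : x ∈ L
      · rw [indicator_of_mem hx]; gcongr; exact h3 n x
      · rw [hdL n x hx, abs_zero, mul_zero]
        have := (hη0 n).le
        positivity
    · simp only [integral_mul_const]
      simpa using (hηt.const_mul (Cφ : ℝ)).const_mul (∫ x, |L.indicator k x|)
  have hlim3 : Tendsto (fun n => ∫ x, k x * ψ n x) atTop
      (nhds (∫ x, ⟪flux p 0 (∇ w x), ∇ φ x⟫)) := by
    simpa using hlim1.add_const (∫ x, ⟪flux p 0 (∇ w x), ∇ φ x⟫)
  exact tendsto_nhds_unique hlim3 hlim2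

/-- Being a weak solution is a local property. -/
lemma WeakEq.of_forall_exists_ball (hp : 1 < p) (hU : IsOpen U)
    (hw : ContDiffOn ℝ 1 w U) (hk : Measurable k)
    (hb : ∀ L, IsCompact L → L ⊆ U → ∃ C, ∀ x ∈ L, |k x| ≤ C)
    (h : ∀ x ∈ U, ∃ V, IsOpen V ∧ x ∈ V ∧ V ⊆ U ∧ WeakEq p V w k) : WeakEq p U w k := by
  have key : ∀ L, IsCompact L → L ⊆ U → ∃ V, IsOpen V ∧ L ⊆ V ∧ V ⊆ U ∧ WeakEq p V w k := by
    intro L hL hLU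
    refine hL.induction_on (p := fun s => ∃ V, IsOpen V ∧ s ⊆ V ∧ V ⊆ U ∧ WeakEq p V w k)
      ⟨∅, isOpen_empty, Subset.rfl, empty_subset U, fun φ hφ => ?_⟩
      (fun s t hst ⟨V, h1, h2, h3⟩ => ⟨V, h1, hst.trans h2, h3⟩) ?_ fun x hx => ?_
    · have h0 : φ = fun _ => 0 := by
        funext x; exact image_eq_zero_of_notMem_tsupport fun h => hφ.2.2 h
      rw [h0]; simp [gradient]
    · rintro s t ⟨V₁, ho₁, hs, hV₁, he₁⟩ ⟨V₂, ho₂, ht, hV₂, he₂⟩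
      refine ⟨V₁ ∪ V₂, ho₁.union ho₂, union_subset_union hs ht, union_subset hV₁ hV₂, fun φ hφ => ?_⟩
      obtain ⟨K₁, K₂, hK₁, hK₂, hs₁, hs₂, hK⟩ := hφ.2.1.isCompact.binary_compact_cover ho₁ ho₂ hφ.2.2
      obtain ⟨χ, hχ, hχc, hχV, -, O, hO, hKO, hχ1⟩ := exists_cutoff hK₁ ho₁ hs₁
      have hχl : IsLip χ := isLip_of_contDiff (hχ.of_le (by norm_cast)) hχc
      have hl : IsLip fun x => χ x * φ x := hχl.mul_of_hasCompactSupport hχc hφ.1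
      have hT₁ : LipTest V₁ fun x => χ x * φ x :=
        ⟨hl, hχc.mul_right, (tsupport_mul_subset_left).trans hχV⟩
      have hT₁U := hT₁.mono hV₁
      have hφU := hφ.mono (union_subset hV₁ hV₂)
      have hT₂ : LipTest V₂ fun x => φ x - χ x * φ x := by
        have hsub : tsupport (fun x => φ x - χ x * φ x) ⊆ K₂ := by
          refine closure_minimal (fun x hx => ?_) hK₂.isClosed
          have h1 : x ∈ K₁ ∪ K₂ := hK ▸ subset_tsupport φ fun h0 => hx (by simp only [h0, mul_zero, sub_zero])
          refine h1.resolve_left fun h2 => hx ?_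
          simp only [hχ1 x (hKO h2), one_mul, sub_self]
        exact ⟨hφ.1.sub hl, hK₂.of_isClosed_subset (isClosed_tsupport _) hsub, hsub.trans hs₂⟩
      have hT₂U := hT₂.mono hV₂
      have a1 := integral_add (hT₁U.integrable_flux hp hU hw) (hT₂U.integrable_flux hp hU hw)
      have a2 := integral_add (hT₁U.integrable_mul_of_locally_bdd hk hb)
        (hT₂U.integrable_mul_of_locally_bdd hk hb)
      rw [he₁ _ hT₁, he₂ _ hT₂, ← a2] at a1
      have e2 : (fun x => k x * (χ x * φ x) + k x * (φ x - χ x * φ x)) = fun x => k x * φ x := by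
        ext x; ring
      rw [e2] at a1
      rw [← a1]
      refine integral_congr_ae ?_
      filter_upwards [gradient_sub_ae hφ.1 hl] with x hx
      rw [hx, inner_sub_right]; ring
    · obtain ⟨V, h1, h2, h3⟩ := h x (hLU hx)
      exact ⟨V, mem_nhdsWithin_of_mem_nhds (h1.mem_nhds h2), V, h1, Subset.rfl, h3⟩
  intro φ hφ
  obtain ⟨V, -, hV, -, he⟩ := key _ hφ.2.1.isCompact hφ.2.2
  exact he φ ⟨hφ.1, hφ.2.1, hV⟩

lemma WeakEq.mono (h : WeakEq p U w k) (hV : V ⊆ U) :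
    WeakEq p V w k := fun φ hφ => h φ (hφ.mono hV)

lemma WeakEq.congr (hU : IsOpen U)
    (h : WeakEq p U w k) (hw : ∀ x ∈ U, w' x = w x) (hk : ∀ x ∈ U, k' x = k x) :
    WeakEq p U w' k' := fun φ hφ => by
  have e1 : ∀ x, ⟪flux p 0 (∇ w' x), ∇ φ x⟫ =
      ⟪flux p 0 (∇ w x), ∇ φ x⟫ := fun x => by
    by_cases hx : x ∈ tsupport φ
    · rw [gradient_congr_of_isOpen hU hw (hφ.2.2 hx)]
    · rw [gradient_eq_zero_of_notMem_tsupport hx, inner_zero_right, inner_zero_right]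
  have e2 : ∀ x, k' x * φ x = k x * φ x := fun x => by
    by_cases hx : x ∈ tsupport φ
    · rw [hk x (hφ.2.2 hx)]
    · rw [image_eq_zero_of_notMem_tsupport hx, mul_zero, mul_zero]
  simp only [e1, e2]
  exact h φ hφ

/-- Local boundedness in an open set. -/
def LocBdd (U : Set (Eu N)) (k : Eu N → ℝ) : Prop :=
  ∀ L, IsCompact L → L ⊆ U → ∃ C, ∀ x ∈ L, |k x| ≤ C

lemma LocBdd.mono (h : LocBdd U k) (hV : V ⊆ U) : LocBdd V k :=
  fun L hL hLV => h L hL (hLV.trans hV)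

lemma WeakEq.le (hN : 0 < N) (hp : 1 < p) (hU : IsOpen U)
    (hb : Bornology.IsBounded U) {l : Eu N → ℝ} (hv : ContinuousOn v (closure U))
    (hw : ContinuousOn w (closure U)) (hv1 : ContDiffOn ℝ 1 v U) (hw1 : ContDiffOn ℝ 1 w U)
    (hve : WeakEq p U v k) (hwe : WeakEq p U w l) (hkm : Measurable k) (hlm : Measurable l)
    (hkb : LocBdd U k) (hlb : LocBdd U l) (hkl : ∀ x ∈ U, k x ≤ l x)
    (hf : ∀ x ∈ frontier U, v x ≤ w x) : ∀ x ∈ U, v x ≤ w x := by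
  refine le_of_flux_le hN hp hU hb hv hw hv1 hw1 (fun φ hφ h0 => ?_) hf
  rw [hve φ hφ, hwe φ hφ]
  refine integral_mono (hφ.integrable_mul_of_locally_bdd hkm hkb)
    (hφ.integrable_mul_of_locally_bdd hlm hlb) fun x => ?_
  by_cases hx : x ∈ tsupport φ
  · exact mul_le_mul_of_nonneg_right (hkl x (hφ.2.2 hx)) (h0 x)
  · simp only [image_eq_zero_of_notMem_tsupport hx, mul_zero, le_refl]

/-- The right-hand side `β(x, w) + g`, extended by zero. -/
def src (β : Eu N → ℝ → ℝ) (g : Eu N → ℝ) (Ω : Set (Eu N)) (w : Eu N → ℝ) : Eu N → ℝ :=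
  Ω.indicator fun x => β x (w x) + g x

/-- Standing assumptions on the domain and the right-hand side. -/
structure SrcData (Ω : Set (Eu N)) (β : Eu N → ℝ → ℝ) (g : Eu N → ℝ) : Prop where
  isOpen : IsOpen Ω
  cont : ContinuousOn (fun q : Eu N × ℝ => β q.1 q.2) (Ω ×ˢ (univ : Set ℝ))
  mono : ∀ x ∈ Ω, Monotone (β x)
  zero : ∀ x ∈ Ω, 0 ≤ β x 0
  meas : Measurable g
  nonneg : ∀ x ∈ Ω, 0 ≤ g x
  bdd : ∃ M, ∀ x ∈ Ω, |g x| ≤ M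

variable {β : Eu N → ℝ → ℝ}

lemma src_apply (hx : x ∈ Ω) : src β g Ω w x = β x (w x) + g x :=
  indicator_of_mem hx _

lemma SrcData.continuousOn (h : SrcData Ω β g) (hw : ContinuousOn w Ω) :
    ContinuousOn (fun x => β x (w x)) Ω :=
  h.cont.comp (continuousOn_id.prodMk hw) fun _ hx => ⟨hx, mem_univ _⟩

lemma measurable_indicator_of_continuousOn (hU : IsOpen U)
    (hk : ContinuousOn k U) : Measurable (U.indicator k) := by
  refine measurable_of_restrict_of_restrict_compl hU.measurableSet ?_ ?_
  · have : U.domRestrict (U.indicator k) = U.domRestrict k := by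
      ext x; exact indicator_of_mem x.2 _
    rw [this]; exact (continuousOn_iff_continuous_domRestrict.1 hk).measurable
  · have : Uᶜ.domRestrict (U.indicator k) = fun _ => 0 := by
      ext x; exact indicator_of_notMem x.2 _
    rw [this]; exact measurable_const

lemma SrcData.measurable (h : SrcData Ω β g) (hw : ContinuousOn w Ω) :
    Measurable (src β g Ω w) := by
  have : src β g Ω w = fun x => Ω.indicator (fun x => β x (w x)) x + Ω.indicator g x := by
    ext x
    by_cases hx : x ∈ Ω
    · rw [src_apply hx, indicator_of_mem hx, indicator_of_mem hx]
    · rw [src, indicator_of_notMem hx, indicator_of_notMem hx, indicator_of_notMem hx, add_zero]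
  rw [this]
  exact (measurable_indicator_of_continuousOn h.isOpen (h.continuousOn hw)).add
    (h.meas.indicator h.isOpen.measurableSet)

lemma SrcData.locBdd (h : SrcData Ω β g) (hw : ContinuousOn w Ω) :
    LocBdd Ω (src β g Ω w) := fun L hL hLΩ => by
  obtain ⟨C, hC⟩ := hL.exists_bound_of_continuousOn ((h.continuousOn hw).mono hLΩ)
  obtain ⟨M, hM⟩ := h.bdd
  refine ⟨C + M, fun x hx => ?_⟩
  rw [src_apply (hLΩ hx)]
  exact (abs_add_le _ _).trans (add_le_add (hC x hx) (hM x (hLΩ hx)))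

lemma SrcData.src_nonneg (h : SrcData Ω β g) (hx : x ∈ Ω) (hw : 0 ≤ w x) : 0 ≤ src β g Ω w x:= by
  rw [src_apply hx]
  exact add_nonneg ((h.zero x hx).trans (h.mono x hx hw)) (h.nonneg x hx)

lemma SrcData.src_le (h : SrcData Ω β g) (hx : x ∈ Ω)
    (hvw : v x ≤ w x) (hgf : g x ≤ f x) : src β g Ω v x ≤ src β f Ω w x := by
  rw [src_apply hx, src_apply hx]
  exact add_le_add (h.mono x hx hvw) hgf

lemma continuous_ball_retraction (c : Eu N) (hR : 0 < R) :
    Continuous fun x : Eu N => c + (R / max R ‖x - c‖) • (x - c) := by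
  have h1 : ∀ x : Eu N, max R ‖x - c‖ ≠ 0 := fun x => (lt_max_of_lt_left hR).ne'
  exact continuous_const.add ((continuous_const.div (by fun_prop) h1).smul (by fun_prop))

lemma exists_continuous_extension (hR : 0 < R) (hw : ContinuousOn w (closedBall c R)) :
    ∃ ψ : Eu N → ℝ, Continuous ψ ∧ ∀ x ∈ closedBall c R, ψ x = w x := by
  refine ⟨fun x => w (c + (R / max R ‖x - c‖) • (x - c)),
    hw.comp_continuous (continuous_ball_retraction c hR) fun x => ?_, fun x hx => ?_⟩
  · rw [mem_closedBall_iff_norm, add_sub_cancel_left, norm_smul, norm_of_nonneg (by positivity),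
      div_mul_eq_mul_div, div_le_iff₀ (lt_max_of_lt_left hR)]
    gcongr; exact le_max_right _ _
  · rw [mem_closedBall_iff_norm] at hx
    simp only
    rw [max_eq_left hx, div_self hR.ne', one_smul, add_sub_cancel]

lemma SrcData.exists_local_solution (hN : 0 < N) (hp : 1 < p) (h : SrcData Ω β g)
    {m : Eu N → ℝ} (hm : ContinuousOn m Ω) (hR : 0 < R) (hB : closedBall c R ⊆ Ω) :
    ∃ S K, 0 ≤ S ∧ 0 ≤ K ∧ ∀ w, ContinuousOn w Ω → (∀ x ∈ Ω, 0 ≤ w x) → (∀ x ∈ Ω, w x ≤ m x) →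
      (∀ x ∈ ball c R, |src β g Ω w x| ≤ K) ∧
      ∃ y, RSol p 0 S K (ball c R) y ((ball c R).indicator (src β g Ω w)) ∧
        ContinuousOn y (closedBall c R) ∧ ∀ x ∈ sphere c R, y x = w x := by
  obtain ⟨S₀, hS₀⟩ := (isCompact_closedBall c R).exists_bound_of_continuousOn (hm.mono hB)
  obtain ⟨K₀, hK₀⟩ := h.locBdd hm _ (isCompact_closedBall c R) hB
  have hK0 : 0 ≤ K₀ := (abs_nonneg _).trans (hK₀ c (mem_closedBall_self hR.le))
  obtain ⟨S, hS⟩ := exists_dirichlet hN hp c hR S₀ K₀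
  have hSw : ∀ w, ContinuousOn w Ω → (∀ x ∈ Ω, 0 ≤ w x) → (∀ x ∈ Ω, w x ≤ m x) →
      (∀ x ∈ ball c R, |src β g Ω w x| ≤ K₀ + 1) ∧
      ∃ y, RSol p 0 S (K₀ + 1) (ball c R) y ((ball c R).indicator (src β g Ω w)) ∧
        ContinuousOn y (closedBall c R) ∧ ∀ x ∈ sphere c R, y x = w x := by
    intro w hw hw0 hwm
    have hk : ∀ x ∈ ball c R, |src β g Ω w x| ≤ K₀ := fun x hx => by
      have hxB := ball_subset_closedBall hx
      have hxΩ := hB hxB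
      rw [abs_of_nonneg (h.src_nonneg hxΩ (hw0 x hxΩ))]
      exact (h.src_le hxΩ (hwm x hxΩ) le_rfl).trans ((le_abs_self _).trans (hK₀ x hxB))
    obtain ⟨ψ, hψ, hψw⟩ := exists_continuous_extension hR (hw.mono hB)
    obtain ⟨y, hy, hyc, hys⟩ := hS ψ ((ball c R).indicator (src β g Ω w)) hψ
      (fun x hx => by
        rw [hψw x hx, abs_of_nonneg (hw0 x (hB hx))]
        exact (hwm x (hB hx)).trans ((le_abs_self _).trans (hS₀ x hx)))
      ((h.measurable hw).indicator measurableSet_ball)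
      (fun x => by
        by_cases hx : x ∈ ball c R
        · rw [indicator_of_mem hx]; exact hk x hx
        · rw [indicator_of_notMem hx, abs_zero]; exact hK0)
    exact ⟨fun x hx => (hk x hx).trans (by linarith), y, hy, hyc, fun x hx => by
      rw [hys x hx, hψw x (sphere_subset_closedBall hx)]⟩
  by_cases hS0 : 0 ≤ S
  · exact ⟨S, K₀ + 1, hS0, by linarith, hSw⟩
  · refine ⟨0, K₀ + 1, le_rfl, by linarith, fun w hw hw0 hwm => ?_⟩
    obtain ⟨-, y, hy, -⟩ := hSw w hw hw0 hwm
    exact absurd ((abs_nonneg _).trans (hy.le c (mem_ball_self hR))) hS0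

section Alternation

variable {β : Eu N → ℝ → ℝ} {m : Eu N → ℝ}

/-- Weak subsolutions of `-Δ_p b = 0`. -/
def WeakSub (p : ℝ) (U : Set (Eu N)) (b : Eu N → ℝ) : Prop :=
  ContDiffOn ℝ 1 b U ∧ ∀ φ, LipTest U φ → (∀ x, 0 ≤ φ x) →
    ∫ x, ⟪flux p 0 (∇ b x), ∇ φ x⟫ ≤ 0

/-- Continuous functions between the subsolutions below `m` and `m` which do not increase when
they are replaced in a ball by the solution with the same boundary values. -/
structure Super (p : ℝ) (β : Eu N → ℝ → ℝ) (g : Eu N → ℝ) (Ω : Set (Eu N)) (m w : Eu N → ℝ) :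
    Prop where
  cont : ContinuousOn w Ω
  nonneg : ∀ x ∈ Ω, 0 ≤ w x
  le : ∀ x ∈ Ω, w x ≤ m x
  sub_le : ∀ b, WeakSub p Ω b → (∀ x ∈ Ω, b x ≤ m x) → ∀ x ∈ Ω, b x ≤ w x
  lift_le : ∀ c R, 0 < R → closedBall c R ⊆ Ω → ∀ y, ContinuousOn y (closedBall c R) →
    ContDiffOn ℝ 1 y (ball c R) → WeakEq p (ball c R) y (src β g Ω w) →
    (∀ x ∈ sphere c R, y x = w x) → ∀ x ∈ ball c R, y x ≤ w x

lemma frontier_inter_subset_spheres (hx : x ∈ frontier (ball a r ∩ ball c R)) :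
    x ∈ closedBall a r ∧ x ∈ closedBall c R ∧ (x ∈ sphere a r ∨ x ∈ sphere c R) := by
  have h1 : x ∈ closedBall a r := closure_ball_subset_closedBall
    (closure_mono inter_subset_left hx.1)
  have h2 : x ∈ closedBall c R := closure_ball_subset_closedBall
    (closure_mono inter_subset_right hx.1)
  refine ⟨h1, h2, ?_⟩
  have h3 : x ∉ ball a r ∩ ball c R := fun h =>
    hx.2 (by rwa [(isOpen_ball.inter isOpen_ball).interior_eq])
  by_cases h4 : x ∈ ball a r
  · exact Or.inr (le_antisymm h2 (not_lt.1 fun h => h3 ⟨h4, h⟩))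
  · exact Or.inl (le_antisymm h1 (not_lt.1 h4))

open Classical in
lemma continuousOn_glue (hR : 0 < R) {y : Eu N → ℝ} (hw : ContinuousOn w Ω)
    (hy : ContinuousOn y (closedBall c R)) (hs : ∀ x ∈ sphere c R, y x = w x) :
    ContinuousOn ((ball c R).piecewise y w) Ω := by
  refine ContinuousOn.piecewise (fun x hx => hs x ?_) (hy.mono fun x hx => ?_)
    (hw.mono inter_subset_left)
  · rw [frontier_ball c hR.ne'] at hx; exact hx.2
  · rw [closure_ball c hR.ne'] at hx; exact hx.2

lemma Super.exists_step (hN : 0 < N) (hp : 1 < p) (h : SrcData Ω β g)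
    (hw : Super p β g Ω m w) (hR : 0 < R) (hB : closedBall c R ⊆ Ω)
    {y : Eu N → ℝ} (hy : RSol p 0 S K (ball c R) y ((ball c R).indicator (src β g Ω w)))
    (hyc : ContinuousOn y (closedBall c R)) (hys : ∀ x ∈ sphere c R, y x = w x)
    (hm : ContinuousOn m Ω) :
    ∃ w', Super p β g Ω m w' ∧ (∀ x ∈ Ω, w' x ≤ w x) ∧
      RSol p 0 S K (ball c R) w' ((ball c R).indicator (src β g Ω w)) := by
  classical
  have hye : WeakEq p (ball c R) y (src β g Ω w) :=
    WeakEq.congr isOpen_ball hy.eqn (fun _ _ => rfl) fun x hx => (indicator_of_mem hx _).symm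
  have hyw : ∀ x ∈ closedBall c R, y x ≤ w x := fun x hx => by
    by_cases hxb : x ∈ ball c R
    · exact hw.lift_le c R hR hB y hyc hy.cd hye hys x hxb
    · exact (hys x (le_antisymm hx (not_lt.1 hxb))).le
  obtain ⟨w', hw'⟩ : ∃ w', w' = (ball c R).piecewise y w := ⟨_, rfl⟩
  have hin : ∀ x ∈ ball c R, w' x = y x := fun x hx => by rw [hw']; exact piecewise_eq_of_mem _ _ _ hx
  have hout : ∀ x ∉ ball c R, w' x = w x := fun x hx => by
    rw [hw']; exact piecewise_eq_of_notMem _ _ _ hx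
  have hcl : ∀ x ∈ closedBall c R, w' x = y x := fun x hx => by
    by_cases hxb : x ∈ ball c R
    · exact hin x hxb
    · rw [hout x hxb, hys x (le_antisymm hx (not_lt.1 hxb))]
  have hle : ∀ x, w' x ≤ w x := fun x => by
    by_cases hx : x ∈ ball c R
    · rw [hin x hx]; exact hyw x (ball_subset_closedBall hx)
    · exact (hout x hx).le
  have hcont : ContinuousOn w' Ω := by rw [hw']; exact continuousOn_glue hR hw.cont hyc hys
  have hBΩ : ball c R ⊆ Ω := ball_subset_closedBall.trans hB
  have hsub : ∀ b, WeakSub p Ω b → (∀ x ∈ Ω, b x ≤ w x) → ∀ x ∈ Ω, b x ≤ w' x := by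
    intro b hb hbw x hx
    by_cases hxb : x ∈ ball c R
    · rw [hin x hxb]
      refine le_of_flux_le hN hp isOpen_ball isBounded_ball
        (hb.1.continuousOn.mono (closure_ball_subset_closedBall.trans hB))
        (hyc.mono closure_ball_subset_closedBall) (hb.1.mono hBΩ) hy.cd (fun φ hφ h0 => ?_)
        (fun z hz => ?_) x hxb
      · rw [hye φ hφ]
        refine (hb.2 φ (hφ.mono hBΩ) h0).trans (integral_nonneg fun z => ?_)
        by_cases hz : z ∈ tsupport φ
        · have hzΩ := hBΩ (hφ.2.2 hz)
          exact mul_nonneg (h.src_nonneg hzΩ (hw.nonneg z hzΩ)) (h0 z)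
        · simp only [image_eq_zero_of_notMem_tsupport hz, mul_zero, Pi.zero_apply, le_refl]
      · have hzs := frontier_ball_subset_sphere hz
        rw [hys z hzs]; exact hbw z (hB (sphere_subset_closedBall hzs))
    · rw [hout x hxb]; exact hbw x hx
  have hzero : WeakSub p Ω fun _ => (0 : ℝ) :=
    ⟨contDiffOn_const, fun φ _ _ => by
      have e : ∀ x : Eu N, ∇ (fun _ : Eu N => (0 : ℝ)) x = 0 := fun x => by simp [gradient]
      simp only [e, flux, smul_zero, inner_zero_left, integral_zero, le_refl]⟩
  have hnn : ∀ x ∈ Ω, 0 ≤ w' x := hsub _ hzero hw.nonneg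
  have hlem : ∀ x ∈ Ω, w' x ≤ m x := fun x hx => (hle x).trans (hw.le x hx)
  refine ⟨w', ⟨hcont, hnn, hlem, fun b hb hbm => hsub b hb (hw.sub_le b hb hbm), ?_⟩,
    fun x _ => hle x, hy.congr isOpen_ball hin⟩
  intro a r hr hA v hvc hv1 hve hvs
  have hAΩ : ball a r ⊆ Ω := ball_subset_closedBall.trans hA
  have hvw : ∀ x ∈ closedBall a r, v x ≤ w x := fun x hx => by
    by_cases hxb : x ∈ ball a r
    · obtain ⟨S', K', -, -, hSK⟩ := h.exists_local_solution hN hp hm hr hA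
      obtain ⟨-, z, hz, hzc, hzs⟩ := hSK w hw.cont hw.nonneg hw.le
      have hze : WeakEq p (ball a r) z (src β g Ω w) :=
        WeakEq.congr isOpen_ball hz.eqn (fun _ _ => rfl) fun x hx => (indicator_of_mem hx _).symm
      refine (WeakEq.le hN hp isOpen_ball isBounded_ball (hvc.mono closure_ball_subset_closedBall)
        (hzc.mono closure_ball_subset_closedBall) hv1 hz.cd hve hze (h.measurable hcont)
        (h.measurable hw.cont) ((h.locBdd hcont).mono hAΩ) ((h.locBdd hw.cont).mono hAΩ)
        (fun x hx => h.src_le (hAΩ hx) (hle x) le_rfl) (fun x hx => ?_) x hxb).trans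
        (hw.lift_le a r hr hA z hzc hz.cd hze hzs x hxb)
      have hxs := frontier_ball_subset_sphere hx
      rw [hvs x hxs, hzs x hxs]; exact hle x
    · rw [hvs x (le_antisymm hx (not_lt.1 hxb))]; exact hle x
  intro x hx
  by_cases hxb : x ∈ ball c R
  · rw [hin x hxb]
    have hI : ball a r ∩ ball c R ⊆ Ω := inter_subset_left.trans hAΩ
    have c1 : closure (ball a r ∩ ball c R) ⊆ closedBall a r :=
      (closure_mono inter_subset_left).trans closure_ball_subset_closedBall
    have c2 : closure (ball a r ∩ ball c R) ⊆ closedBall c R :=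
      (closure_mono inter_subset_right).trans closure_ball_subset_closedBall
    refine WeakEq.le hN hp (isOpen_ball.inter isOpen_ball) (isBounded_ball.subset inter_subset_left)
      (hvc.mono c1) (hyc.mono c2) (hv1.mono inter_subset_left) (hy.cd.mono inter_subset_right)
      (hve.mono inter_subset_left) (hye.mono inter_subset_right) (h.measurable hcont)
      (h.measurable hw.cont) ((h.locBdd hcont).mono hI) ((h.locBdd hw.cont).mono hI)
      (fun z hz => h.src_le (hI hz) (hle z) le_rfl) (fun z hz => ?_) x ⟨hx, hxb⟩
    obtain ⟨h1, h2, h3 | h3⟩ := frontier_inter_subset_spheres hz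
    · rw [hvs z h3, hcl z h2]
    · rw [hys z h3]; exact hvw z h1
  · rw [hout x hxb]; exact hvw x (ball_subset_closedBall hx)

lemma exists_ball_cover (hΩ : IsOpen Ω) (hne : Ω.Nonempty) :
    ∃ (c : ℕ → Eu N) (R : ℕ → ℝ), (∀ i, 0 < R i ∧ closedBall (c i) (R i) ⊆ Ω) ∧
      ∀ x ∈ Ω, ∃ i, x ∈ ball (c i) (R i) := by
  have h1 : ∀ x : Eu N, ∃ r : ℝ, x ∈ Ω → 0 < r ∧ closedBall x r ⊆ Ω := fun x => by
    by_cases hx : x ∈ Ω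
    · obtain ⟨r, hr, hrΩ⟩ := nhds_basis_closedBall.mem_iff.1 (hΩ.mem_nhds hx)
      exact ⟨r, fun _ => ⟨hr, hrΩ⟩⟩
    · exact ⟨0, fun h => absurd h hx⟩
  choose r hr using h1
  obtain ⟨t, htΩ, htc, ht⟩ := TopologicalSpace.countable_cover_nhdsWithin (s := Ω)
    (f := fun x => ball x (r x))
    fun x hx => mem_nhdsWithin_of_mem_nhds (ball_mem_nhds x (hr x hx).1)
  have htne : t.Nonempty := by
    obtain ⟨x, hx⟩ := hne
    obtain ⟨i, hi, -⟩ := mem_iUnion₂.1 (ht hx)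
    exact ⟨i, hi⟩
  obtain ⟨c, rfl⟩ := htc.exists_eq_range htne
  refine ⟨c, fun i => r (c i), fun i => hr (c i) (htΩ (mem_range_self i)), fun x hx => ?_⟩
  obtain ⟨_, ⟨i, rfl⟩, hi⟩ := mem_iUnion₂.1 (ht hx)
  exact ⟨i, hi⟩

/-- Existence of a solution between the subsolutions below `m` and `m`. -/
theorem Super.exists_solution (hN : 0 < N) (hp : 1 < p) (h : SrcData Ω β g) (hne : Ω.Nonempty)
    (hm : Super p β g Ω m m) :
    ∃ w, ContDiffOn ℝ 1 w Ω ∧ WeakEq p Ω w (src β g Ω w) ∧ (∀ x ∈ Ω, 0 ≤ w x) ∧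
      (∀ x ∈ Ω, w x ≤ m x) ∧
      ∀ b, WeakSub p Ω b → (∀ x ∈ Ω, b x ≤ m x) → ∀ x ∈ Ω, b x ≤ w x := by
  obtain ⟨c, R, hcR, hcov⟩ := exists_ball_cover h.isOpen hne
  choose S K hS hK hSK using fun i =>
    h.exists_local_solution hN hp hm.cont (hcR i).1 (hcR i).2
  have hstep : ∀ (w : {w // Super p β g Ω m w}) (i : ℕ), ∃ w' : {w // Super p β g Ω m w},
      (∀ x ∈ Ω, w'.1 x ≤ w.1 x) ∧ RSol p 0 (S i) (K i) (ball (c i) (R i)) w'.1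
        ((ball (c i) (R i)).indicator (src β g Ω w.1)) := fun w i => by
    obtain ⟨-, y, hy, hyc, hys⟩ := hSK i w.1 w.2.cont w.2.nonneg w.2.le
    obtain ⟨w', h1, h2, h3⟩ := w.2.exists_step hN hp h (hcR i).1 (hcR i).2 hy hyc hys hm.cont
    exact ⟨⟨w', h1⟩, h2, h3⟩
  choose step hstep1 hstep2 using hstep
  obtain ⟨W, hW⟩ : ∃ W : ℕ → {w // Super p β g Ω m w}, ∀ n, W (n + 1) = step (W n) n.unpair.1 :=
    ⟨fun n => Nat.rec ⟨m, hm⟩ (fun n w => step w n.unpair.1) n, fun n => rfl⟩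
  have hanti : ∀ x ∈ Ω, Antitone fun n => (W n).1 x := fun x hx => antitone_nat_of_succ_le fun n => by
    rw [hW]; exact hstep1 _ _ x hx
  obtain ⟨ω, hω⟩ : ∃ ω : Eu N → ℝ, ω = fun x => ⨅ n, (W n).1 x := ⟨_, rfl⟩
  have hlim : ∀ x ∈ Ω, Tendsto (fun n => (W n).1 x) atTop (nhds (ω x)) := fun x hx => by
    rw [hω]
    exact tendsto_atTop_ciInf (hanti x hx) ⟨0, by rintro _ ⟨n, rfl⟩; exact (W n).2.nonneg x hx⟩
  have hsrc : ∀ x, Tendsto (fun n => src β g Ω (W n).1 x) atTop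
      (nhds (src β g Ω ω x)) := fun x => by
    by_cases hx : x ∈ Ω
    · simp only [src_apply hx]
      refine Tendsto.add_const _ ?_
      have h1 : ContinuousAt (fun q : Eu N × ℝ => β q.1 q.2) (x, ω x) :=
        h.cont.continuousAt ((h.isOpen.prod isOpen_univ).mem_nhds ⟨hx, mem_univ _⟩)
      exact h1.tendsto.comp (tendsto_const_nhds.prodMk_nhds (hlim x hx))
    · simp only [src, indicator_of_notMem hx]; exact tendsto_const_nhds
  have hsm : Measurable (src β g Ω ω) :=
    measurable_of_tendsto_metrizable (fun n => h.measurable (W n).2.cont) (tendsto_pi_nhds.2 hsrc)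
  have hball : ∀ i, RSol p 0 (S i) (K i) (ball (c i) (R i)) ω
      ((ball (c i) (R i)).indicator (src β g Ω ω)) := fun i => by
    have hBΩ : ball (c i) (R i) ⊆ Ω := ball_subset_closedBall.trans (hcR i).2
    have hmono : StrictMono fun j => Nat.pair i j := fun a b hab => Nat.pair_lt_pair_right i hab
    have hsrcK : ∀ n, ∀ x ∈ ball (c i) (R i), |src β g Ω (W n).1 x| ≤ K i := fun n =>
      (hSK i _ (W n).2.cont (W n).2.nonneg (W n).2.le).1
    have hsol : ∀ j, RSol p 0 (S i) (K i) (ball (c i) (R i)) (W (Nat.pair i j + 1)).1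
        ((ball (c i) (R i)).indicator (src β g Ω (W (Nat.pair i j)).1)) := fun j => by
      rw [hW, Nat.unpair_pair]; exact hstep2 _ i
    obtain ⟨θ, hθ, y, hy, hyl⟩ := exists_subseq_rSol hp (hS i) (hK i) isOpen_ball
      (fun _ => le_rfl) tendsto_const_nhds hsol (hsm.indicator measurableSet_ball)
      (fun x hx => by
        rw [indicator_of_mem hx]
        exact le_of_tendsto' (hsrc x).abs fun n => hsrcK n x hx)
      (fun φ hφ => by
        obtain ⟨D, hD⟩ := hφ.2.1.exists_bound_of_continuous hφ.1.continuous
        refine tendsto_integral_of_dominated_convergence (fun x => K i * |φ x|)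
          (fun j => ((hsol j).meas.mul hφ.1.continuous.measurable).aestronglyMeasurable)
          ((hφ.1.integrable_of_hasCompactSupport hφ.2.1).abs.const_mul _)
          (fun j => .of_forall fun x => ?_)
          (.of_forall fun x => ?_)
        · by_cases hx : x ∈ ball (c i) (R i)
          · rw [norm_mul, norm_eq_abs, norm_eq_abs]
            gcongr
            exact (hsol j).bdd x hx
          · rw [indicator_of_notMem hx, zero_mul, norm_zero]
            exact mul_nonneg (hK i) (abs_nonneg _)
        · refine Tendsto.mul_const _ ?_
          by_cases hx : x ∈ ball (c i) (R i)
          · simp only [indicator_of_mem hx]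
            exact (hsrc x).comp hmono.tendsto_atTop
          · simp only [indicator_of_notMem hx]; exact tendsto_const_nhds)
    refine hy.congr isOpen_ball fun x hx => ?_
    refine tendsto_nhds_unique ?_ (hyl x hx)
    exact (hlim x (hBΩ hx)).comp
      ((tendsto_add_atTop_nat 1).comp (hmono.tendsto_atTop.comp hθ.tendsto_atTop))
  have hcd : ContDiffOn ℝ 1 ω Ω := fun x hx => by
    obtain ⟨i, hi⟩ := hcov x hx
    exact ((hball i).cd.contDiffAt (isOpen_ball.mem_nhds hi)).contDiffWithinAt
  refine ⟨ω, hcd, ?_, fun x hx => ge_of_tendsto' (hlim x hx) fun n => (W n).2.nonneg x hx,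
    fun x hx => le_of_tendsto' (hlim x hx) fun n => (W n).2.le x hx,
    fun b hb hbm x hx => ge_of_tendsto' (hlim x hx) fun n => (W n).2.sub_le b hb hbm x hx⟩
  refine WeakEq.of_forall_exists_ball hp h.isOpen hcd hsm (h.locBdd hcd.continuousOn) fun x hx => ?_
  obtain ⟨i, hi⟩ := hcov x hx
  exact ⟨_, isOpen_ball, hi, ball_subset_closedBall.trans (hcR i).2,
    WeakEq.congr isOpen_ball (hball i).eqn (fun _ _ => rfl) fun x hx => (indicator_of_mem hx _).symm⟩

end Alternation

section Barrier

open scoped ContDiff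

lemma hasGradientAt_norm_sub_sq (y x : Eu N) :
    HasGradientAt (fun x => ‖x - y‖ ^ 2) ((2 : ℝ) • (x - y)) x := by
  rw [hasGradientAt_iff_hasFDerivAt]
  refine (((hasFDerivAt_id x).sub_const y).norm_sq).congr_fderiv ?_
  ext v
  simp

lemma hasGradientAt_norm_sub_sq_rpow (h : x ≠ y) (q : ℝ) :
    HasGradientAt (fun x => (‖x - y‖ ^ 2) ^ q) ((2 * q * (‖x - y‖ ^ 2) ^ (q - 1)) • (x - y)) x:= by
  have h0 : ‖x - y‖ ^ 2 ≠ 0 := by simpa [sub_eq_zero] using h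
  have h1 := HasGradientAt.comp_hasDerivAt (f := fun t : ℝ => t ^ q)
    (hasDerivAt_rpow_const (p := q) (Or.inl h0)) (hasGradientAt_norm_sub_sq y x)
  convert h1 using 1
  rw [smul_smul]
  ring_nf

lemma contDiffAt_norm_sub_sq_rpow (h : x ≠ y) (q : ℝ) :
    ContDiffAt ℝ 1 (fun x : Eu N => (‖x - y‖ ^ 2) ^ q) x := by
  have h0 : ‖x - y‖ ^ 2 ≠ 0 := by simpa [sub_eq_zero] using h
  exact (((contDiffAt_id.sub contDiffAt_const).norm_sq ℝ).rpow_const_of_ne h0)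

/-- The field `x ↦ |x - y|^{-2θ} (x - y)` has nonpositive divergence away from `y`
when `2 θ ≥ N`. -/
lemma integral_inner_radial_nonneg (hU : IsOpen U) (hy : y ∉ U) {θ : ℝ}
    (hθ : (N : ℝ) ≤ 2 * θ) (hφ : LipTest U φ) (h0 : ∀ x, 0 ≤ φ x) :
    0 ≤ ∫ x, ⟪(‖x - y‖ ^ 2) ^ (-θ) • (x - y), ∇ φ x⟫ := by
  obtain ⟨χ, hχ, hχc, hχU, -, V, hV, hKV, hχ1⟩ := exists_cutoff hφ.2.1.isCompact hU hφ.2.2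
  have hχ' : ContDiff ℝ 1 χ := hχ.of_le (by norm_cast)
  obtain ⟨e, he⟩ : ∃ e, e = EuclideanSpace.basisFun (Fin N) ℝ := ⟨_, rfl⟩
  obtain ⟨G, hG⟩ : ∃ G : Fin N → Eu N → ℝ,
    G = fun i x => χ x * ((‖x - y‖ ^ 2) ^ (-θ) * ⟪e i, x - y⟫) := ⟨_, rfl⟩
  have hG1 : ∀ i, ContDiff ℝ 1 (G i) := by
    intro i
    rw [contDiff_iff_contDiffAt]
    intro x
    by_cases hx : x ∈ tsupport χ
    · have hxy : x ≠ y := fun h => hy (h ▸ hχU hx)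
      rw [hG]
      exact hχ'.contDiffAt.mul ((contDiffAt_norm_sub_sq_rpow hxy _).mul
        (contDiffAt_const.inner ℝ (contDiffAt_id.sub contDiffAt_const)))
    · have h1 : G i =ᶠ[nhds x] fun _ => 0 := by
        filter_upwards [notMem_tsupport_iff_eventuallyEq.1 hx] with z hz
        simp [hG, hz]
      exact contDiffAt_const.congr_of_eventuallyEq h1
  have hGc : ∀ i, HasCompactSupport (G i) := fun i => by rw [hG]; exact hχc.mul_right
  have hGL : ∀ i, IsLip (G i) := fun i => isLip_of_contDiff (hG1 i) (hGc i)
  have hgrad : ∀ i, ∀ x ∈ V, x ∈ U → ⟪e i, ∇ (G i) x⟫ =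
      (‖x - y‖ ^ 2) ^ (-θ) - 2 * θ * (‖x - y‖ ^ 2) ^ (-θ - 1) * ⟪e i, x - y⟫ ^ 2 := by
    intro i x hx hxU
    have hxy : x ≠ y := fun h => hy (h ▸ hxU)
    have h1 : G i =ᶠ[nhds x] fun x => (‖x - y‖ ^ 2) ^ (-θ) * (⟪e i, x⟫ - ⟪e i, y⟫) := by
      filter_upwards [hV.mem_nhds hx] with z hz
      simp [hG, hχ1 z hz, inner_sub_right]
    have h2 : HasGradientAt (fun x => ⟪e i, x⟫ - ⟪e i, y⟫) (e i) x := by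
      have := hasGradientAt_inner (e i) x
      rw [hasGradientAt_iff_hasFDerivAt] at *
      exact this.sub_const _
    rw [h1.gradient_eq, ((hasGradientAt_norm_sub_sq_rpow hxy (-θ)).mul' h2).gradient,
      inner_add_right, inner_smul_right, inner_smul_right, inner_smul_right,
      real_inner_self_eq_norm_sq, ← inner_sub_right, e.orthonormal.1 i]
    ring
  have hint1 : ∀ i, Integrable fun x => G i x * ⟪e i, ∇ φ x⟫ := by
    intro i
    obtain ⟨C, hC⟩ := hφ.2.1.isCompact.exists_bound_of_continuousOn (hGL i).continuous.continuousOn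
    have := hφ.integrable_inner_of_bdd (F := fun x => G i x • e i) (C := C)
      ((hGL i).continuous.measurable.smul_const _) (fun x hx => by
        rw [norm_smul, e.orthonormal.1 i, mul_one]; exact hC x hx)
    simpa only [real_inner_smul_left] using this
  have hint2 : ∀ i, Integrable fun x => ⟪e i, ∇ (G i) x⟫ * φ x := by
    intro i
    obtain ⟨D, -, hD⟩ := (hGL i).exists_norm_gradient_le
    refine hφ.integrable_mul_of_bdd (C := D) (measurable_const.inner (measurable_gradient _))
      fun x _ => ?_
    refine (abs_real_inner_le_norm _ _).trans ?_
    rw [e.orthonormal.1 i, one_mul]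
    exact hD x
  have hL : ∀ x, ⟪(‖x - y‖ ^ 2) ^ (-θ) • (x - y), ∇ φ x⟫ =
      ∑ i, G i x * ⟪e i, ∇ φ x⟫ := by
    intro x
    by_cases hx : x ∈ tsupport φ
    · rw [real_inner_smul_left, ← e.sum_inner_mul_inner (x - y) (∇ φ x), Finset.mul_sum]
      refine Finset.sum_congr rfl fun i _ => ?_
      rw [hG, real_inner_comm]
      simp only [hχ1 x (hKV hx)]
      ring
    · simp only [gradient_eq_zero_of_notMem_tsupport hx, inner_zero_right, mul_zero,
        Finset.sum_const_zero]
  simp only [hL]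
  rw [integral_finsetSum _ fun i _ => hint1 i]
  simp only [integral_mul_inner_gradient (hGL _) hφ.1 hφ.2.1]
  rw [Finset.sum_neg_distrib, ← integral_finsetSum _ fun i _ => hint2 i, ← integral_neg]
  refine integral_nonneg fun x => ?_
  by_cases hx : x ∈ tsupport φ
  · have hxU := hφ.2.2 hx
    have hxy : x ≠ y := fun h => hy (h ▸ hxU)
    have hpos : 0 < ‖x - y‖ ^ 2 := pow_pos (norm_pos_iff.2 (sub_ne_zero.2 hxy)) 2
    simp only [hgrad _ x (hKV hx) hxU, ← Finset.sum_mul, Finset.sum_sub_distrib, Finset.sum_const,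
      Finset.card_univ, Fintype.card_fin, nsmul_eq_mul, ← Finset.mul_sum]
    have h1 : ∑ i, ⟪e i, x - y⟫ ^ 2 = ‖x - y‖ ^ 2 := by
      rw [← real_inner_self_eq_norm_sq, ← e.sum_inner_mul_inner (x - y) (x - y)]
      refine Finset.sum_congr rfl fun i _ => ?_
      rw [real_inner_comm (e i) (x - y), sq]
    have h2 : (‖x - y‖ ^ 2) ^ (-θ - 1) * ‖x - y‖ ^ 2 = (‖x - y‖ ^ 2) ^ (-θ) := by
      rw [rpow_sub_one hpos.ne', div_mul_cancel₀ _ hpos.ne']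
    rw [h1, mul_assoc (2 * θ), h2, ← sub_mul]
    have h3 := rpow_nonneg hpos.le (-θ)
    have h4 : ((N : ℝ) - 2 * θ) * (‖x - y‖ ^ 2) ^ (-θ) ≤ 0 :=
      mul_nonpos_of_nonpos_of_nonneg (by linarith) h3
    simp only [Pi.zero_apply]
    nlinarith [mul_nonneg (neg_nonneg.2 h4) (h0 x)]
  · simp [image_eq_zero_of_notMem_tsupport hx]

lemma weakSub_radial (hU : IsOpen U) (hy : y ∉ U) {k : ℝ} (hA : 0 < A) (hk : 0 < k)
    (hkN : (N : ℝ) ≤ 2 * (k * (p - 1) + p / 2)) (a : ℝ) :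
    WeakSub p U fun x => a + A * (‖x - y‖ ^ 2) ^ (-k) := by
  have hne : ∀ x ∈ U, x ≠ y := fun x hx h => hy (h ▸ hx)
  refine ⟨fun x hx => (contDiffAt_const.add (contDiffAt_const.mul
    (contDiffAt_norm_sub_sq_rpow (hne x hx) _))).contDiffWithinAt, fun φ hφ h0 => ?_⟩
  obtain ⟨θ, hθ⟩ : ∃ θ, θ = k * (p - 1) + p / 2 := ⟨_, rfl⟩
  obtain ⟨K, hK⟩ : ∃ K : ℝ, K = ((2 * k * A) ^ 2) ^ ((p - 2) / 2) * (2 * k * A) := ⟨_, rfl⟩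
  have hK0 : 0 < K := by rw [hK]; positivity
  have hL : ∀ x, ⟪flux p 0 (∇ (fun x => a + A * (‖x - y‖ ^ 2) ^ (-k)) x), ∇ φ x⟫ =
      -K * ⟪(‖x - y‖ ^ 2) ^ (-θ) • (x - y), ∇ φ x⟫ := by
    intro x
    by_cases hx : x ∈ tsupport φ
    · have hxy := hne x (hφ.2.2 hx)
      have hpos : 0 < ‖x - y‖ ^ 2 := pow_pos (norm_pos_iff.2 (sub_ne_zero.2 hxy)) 2
      have h1 : HasGradientAt (fun x => a + A * (‖x - y‖ ^ 2) ^ (-k))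
          ((-(2 * k * A) * (‖x - y‖ ^ 2) ^ (-k - 1)) • (x - y)) x := by
        have h2 := hasGradientAt_norm_sub_sq_rpow hxy (-k)
        rw [hasGradientAt_iff_hasFDerivAt] at *
        refine ((h2.const_mul A).const_add a).congr_fderiv ?_
        ext v
        simp
        ring
      rw [h1.gradient, ← real_inner_smul_left]
      congr 1
      obtain ⟨t, ht⟩ : ∃ t, t = ‖x - y‖ ^ 2 := ⟨_, rfl⟩
      rw [flux, norm_smul, mul_pow, norm_eq_abs, sq_abs, ← ht, zero_add, smul_smul, smul_smul]
      rw [← ht] at hpos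
      congr 1
      have h3 : (-(2 * k * A) * t ^ (-k - 1)) ^ 2 * t = (2 * k * A) ^ 2 * t ^ (-2 * k - 1) := by
        have : t ^ (-2 * k - 1) = (t ^ (-k - 1)) ^ 2 * t := by
          rw [← rpow_natCast, ← rpow_mul hpos.le, ← rpow_add_one hpos.ne']
          congr 1; push_cast; ring
        rw [this]; ring
      have h4 : t ^ (-θ) = (t ^ (-2 * k - 1)) ^ ((p - 2) / 2) * t ^ (-k - 1) := by
        rw [← rpow_mul hpos.le, ← rpow_add hpos, hθ]
        congr 1; ring
      rw [h3, mul_rpow (by positivity) (by positivity), h4, hK]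
      ring
    · simp only [gradient_eq_zero_of_notMem_tsupport hx, inner_zero_right, mul_zero]
  simp only [hL, integral_const_mul]
  have := integral_inner_radial_nonneg hU hy (hθ ▸ hkN) hφ h0
  nlinarith

/-- Uniform exterior sphere condition at a boundary point. -/
lemma HasSmoothBoundary.exists_exterior_sphere (h : HasSmoothBoundary Ω) (ho : IsOpen Ω)
    (hb : Bornology.IsBounded Ω) (hz : z ∈ frontier Ω) :
    ∃ y, y ≠ z ∧ ∀ x ∈ closure Ω, ‖z - y‖ ^ 2 + ‖x - z‖ ^ 2 / 2 ≤ ‖x - y‖ ^ 2 := by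
  obtain ⟨f, hf, hΩ, hd⟩ := h
  have hcl : ∀ x ∈ closure Ω, f x ≤ 0 := by
    have : closure Ω ⊆ f ⁻¹' Iic 0 := closure_minimal
      (fun x hx => by rw [hΩ] at hx; exact (show f x < 0 from hx).le) (isClosed_Iic.preimage hf.continuous)
    exact fun x hx => this hx
  have hfz : f z = 0 := by
    refine le_antisymm (hcl z hz.1) (not_lt.1 fun h => hz.2 ?_)
    rw [ho.interior_eq, hΩ]
    exact h
  obtain ⟨χ, hχ, hχc, -, -, V, hV, hKV, hχ1⟩ :=
    exists_cutoff hb.isCompact_closure isOpen_univ (subset_univ _)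
  obtain ⟨C, hC, hT⟩ := exists_taylor_bound (ψ := fun x => χ x * f x)
    ((hχ.mul hf).of_le (by norm_cast)) hχc.mul_right
  have hgr : ∇ (fun x => χ x * f x) z = ∇ f z := by
    refine EventuallyEq.gradient_eq ?_
    filter_upwards [hV.mem_nhds (hKV hz.1)] with x hx
    rw [hχ1 x hx, one_mul]
  obtain ⟨G, hG⟩ : ∃ G, G = ∇ f z := ⟨_, rfl⟩
  have hG0 : G ≠ 0 := by
    rw [hG, gradient]
    simpa using hd z hz
  obtain ⟨t, ht⟩ : ∃ t, t = 1 / (4 * (C + 1)) := ⟨_, rfl⟩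
  have ht0 : 0 < t := by rw [ht]; positivity
  have htC : t * C ≤ 1 / 4 := by
    rw [ht, div_mul_eq_mul_div, div_le_div_iff₀ (by positivity) (by positivity)]
    linarith
  refine ⟨z + t • G, by simpa [ht0.ne'] using hG0, fun x hx => ?_⟩
  have h1 := hT z x
  simp only [hgr, hχ1 x (hKV hx), hχ1 z (hKV hz.1), hfz, ← hG, one_mul, sub_zero] at h1
  have h2 : ⟪G, x - z⟫ ≤ C * ‖x - z‖ ^ 2 := by
    have := (abs_le.1 h1).1
    have := hcl x hx
    linarith
  have h3 : ‖x - (z + t • G)‖ ^ 2 = ‖x - z‖ ^ 2 - 2 * t * ⟪G, x - z⟫ + t ^ 2 * ‖G‖ ^ 2 := by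
    rw [← sub_sub, norm_sub_sq_real, inner_smul_right, norm_smul, mul_pow, norm_eq_abs, sq_abs,
      real_inner_comm]
    ring
  have h4 : ‖z - (z + t • G)‖ ^ 2 = t ^ 2 * ‖G‖ ^ 2 := by
    rw [sub_add_cancel_left, norm_neg, norm_smul, mul_pow, norm_eq_abs, sq_abs]
  rw [h3, h4]
  have h5 := mul_le_mul_of_nonneg_left h2 ht0.le
  have h6 := mul_le_mul_of_nonneg_right htC (sq_nonneg ‖x - z‖)
  nlinarith

lemma exists_barrier (hp : 1 < p) (h : HasSmoothBoundary Ω) (ho : IsOpen Ω)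
    (hb : Bornology.IsBounded Ω) {m : Eu N → ℝ} (hm : ContinuousOn m (closure Ω))
    (hm0 : ∀ x ∈ Ω, 0 ≤ m x) (hz : z ∈ frontier Ω) (hδ : 0 < δ) :
    ∃ b, WeakSub p Ω b ∧ (∀ x ∈ Ω, b x ≤ m x) ∧ ContinuousAt b z ∧ m z - δ < b z := by
  obtain ⟨y, hyz, hy⟩ := h.exists_exterior_sphere ho hb hz
  obtain ⟨k, hk⟩ : ∃ k, k = N / (p - 1) + 1 := ⟨_, rfl⟩
  have hp1 : 0 < p - 1 := by linarith
  have hk0 : 0 < k := by rw [hk]; positivity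
  have hkN : (N : ℝ) ≤ 2 * (k * (p - 1) + p / 2) := by
    rw [hk, add_mul, div_mul_cancel₀ _ hp1.ne']
    have : (0 : ℝ) ≤ N := Nat.cast_nonneg N
    linarith
  have hr : 0 < ‖z - y‖ ^ 2 := pow_pos (norm_pos_iff.2 (sub_ne_zero.2 hyz.symm)) 2
  have hyU : y ∉ Ω := fun hyΩ => by
    have := hy y (subset_closure hyΩ)
    rw [sub_self, norm_zero] at this
    nlinarith [sq_nonneg ‖y - z‖]
  obtain ⟨s, hs, hsm⟩ := Metric.continuousWithinAt_iff.1 (hm z hz.1) (δ / 2) (by positivity)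
  obtain ⟨η, hη⟩ : ∃ η, η = (‖z - y‖ ^ 2) ^ (-k) - (‖z - y‖ ^ 2 + s ^ 2 / 2) ^ (-k) := ⟨_, rfl⟩
  have hη0 : 0 < η := by
    rw [hη, sub_pos]
    exact rpow_lt_rpow_of_neg hr (by nlinarith) (by linarith)
  obtain ⟨A, hA⟩ : ∃ A, A = |m z| / η + 1 := ⟨_, rfl⟩
  have hA0 : 0 < A := by rw [hA]; positivity
  have hAη : |m z| ≤ A * η := by
    rw [hA, add_mul, div_mul_cancel₀ _ hη0.ne']
    linarith
  refine ⟨fun x => (m z - δ / 2 - A * (‖z - y‖ ^ 2) ^ (-k)) + A * (‖x - y‖ ^ 2) ^ (-k),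
    weakSub_radial ho hyU hA0 hk0 hkN _, fun x hx => ?_, ?_, by linarith⟩
  · have h1 := hy x (subset_closure hx)
    by_cases hxs : dist x z < s
    · have h2 := hsm (subset_closure hx) hxs
      rw [dist_eq] at h2
      have h3 : (‖x - y‖ ^ 2) ^ (-k) ≤ (‖z - y‖ ^ 2) ^ (-k) :=
        rpow_le_rpow_of_nonpos hr (by nlinarith [sq_nonneg ‖x - z‖]) (by linarith)
      have h4 := mul_le_mul_of_nonneg_left h3 hA0.le
      linarith [(abs_lt.1 h2).1]
    · have h2 : s ^ 2 ≤ ‖x - z‖ ^ 2 := by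
        rw [← dist_eq_norm]
        exact pow_le_pow_left₀ hs.le (not_lt.1 hxs) 2
      have h3 : (‖x - y‖ ^ 2) ^ (-k) ≤ (‖z - y‖ ^ 2 + s ^ 2 / 2) ^ (-k) :=
        rpow_le_rpow_of_nonpos (by positivity) (by linarith) (by linarith)
      have h4 := mul_le_mul_of_nonneg_left h3 hA0.le
      have h5 : A * η = A * (‖z - y‖ ^ 2) ^ (-k) - A * (‖z - y‖ ^ 2 + s ^ 2 / 2) ^ (-k) := by
        rw [hη]; ring
      have := le_abs_self (m z)
      have := hm0 x hx
      linarith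
  · exact continuousAt_const.add (continuousAt_const.mul
      (contDiffAt_norm_sub_sq_rpow hyz.symm (-k)).continuousAt)

end Barrier

section Comparison

open scoped ContDiff Topology

variable {β : Eu N → ℝ → ℝ} {bd : Eu N → ℝ}

lemma setIntegral_flux (p : ℝ) (w : Eu N → ℝ) (hφ : tsupport φ ⊆ Ω) :
    ∫ x in Ω, ‖∇ w x‖ ^ (p - 2) * ⟪∇ w x, ∇ φ x⟫ =
      ∫ x, ⟪flux p 0 (∇ w x), ∇ φ x⟫ := by
  simp only [inner_flux_zero]
  refine setIntegral_eq_integral_of_forall_compl_eq_zero fun x hx => ?_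
  rw [gradient_eq_zero_of_notMem_tsupport fun h => hx (hφ h), inner_zero_right, mul_zero]

lemma setIntegral_src (hΩ : IsOpen Ω) (w : Eu N → ℝ) (φ : Eu N → ℝ) :
    ∫ x in Ω, (β x (w x) + g x) * φ x = ∫ x, src β g Ω w x * φ x := by
  rw [← integral_indicator hΩ.measurableSet]
  refine integral_congr_ae (.of_forall fun x => ?_)
  simp only [src]
  rw [← indicator_mul_left]

lemma SolClass.weakEq (hp : 1 < p) (h : SrcData Ω β g)
    (hw : SolClass p Ω (fun x t => β x t + g x) bd w) : WeakEq p Ω w (src β g Ω w) := by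
  have hc := hw.1.mono subset_closure
  refine WeakEq.of_contDiff hp h.isOpen hw.2.1 (h.measurable hc) (h.locBdd hc) fun φ hφ hL => ?_
  rw [← setIntegral_flux p w hL.2.2, ← setIntegral_src h.isOpen]
  exact hw.2.2.2.2.1 φ ⟨hφ, hL.2⟩

lemma WeakEq.isWeakSolution (hΩ : IsOpen Ω) (h : WeakEq p Ω w (src β g Ω w)) :
    IsWeakSolution p Ω w fun x => β x (w x) + g x := fun φ hφ => by
  rw [setIntegral_flux p w hφ.2.2, setIntegral_src hΩ]
  exact h φ ⟨isLip_of_contDiff (hφ.1.of_le (by norm_cast)) hφ.2.1, hφ.2⟩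

lemma super_min (hN : 0 < N) (hp : 1 < p) (hf : SrcData Ω β f) (hg : SrcData Ω β g)
    (hgf : ∀ x ∈ Ω, g x ≤ f x) (hu : ContDiffOn ℝ 1 u Ω) (hv : ContDiffOn ℝ 1 v Ω)
    (hue : WeakEq p Ω u (src β f Ω u)) (hve : WeakEq p Ω v (src β g Ω v))
    (hu0 : ∀ x ∈ Ω, 0 ≤ u x) (hv0 : ∀ x ∈ Ω, 0 ≤ v x) :
    Super p β g Ω (fun x => min (u x) (v x)) (fun x => min (u x) (v x)) := by
  have hm : ContinuousOn (fun x => min (u x) (v x)) Ω := ContinuousOn.inf hu.continuousOn hv.continuousOn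
  refine ⟨hm, fun x hx => le_min (hu0 x hx) (hv0 x hx), fun x _ => le_rfl, fun b _ h => h,
    fun c R hR hB y hy hy1 hye hys x hx => ?_⟩
  have hBo : ball c R ⊆ Ω := ball_subset_closedBall.trans hB
  have key : ∀ {F s : Eu N → ℝ}, SrcData Ω β F → (∀ x ∈ Ω, g x ≤ F x) → ContDiffOn ℝ 1 s Ω →
      WeakEq p Ω s (src β F Ω s) → (∀ x ∈ Ω, min (u x) (v x) ≤ s x) → y x ≤ s x := by
    intro F s hF hgF hs hse hms
    refine WeakEq.le hN hp isOpen_ball isBounded_ball (by rwa [closure_ball c hR.ne'])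
      (hs.continuousOn.mono ((closure_ball c hR.ne').trans_subset hB)) hy1 (hs.mono hBo) hye
      (hse.mono hBo) (hg.measurable hm) (hF.measurable hs.continuousOn) ((hg.locBdd hm).mono hBo)
      ((hF.locBdd hs.continuousOn).mono hBo)
      (fun x hx => hg.src_le (hBo hx) (hms x (hBo hx)) (hgF x (hBo hx))) (fun x hx => ?_) x hx
    rw [frontier_ball c hR.ne'] at hx
    rw [hys x hx]
    exact hms x (hB (sphere_subset_closedBall hx))
  exact le_min (key hf hgf hu hue fun x _ => min_le_left _ _)
    (key hg (fun x _ => le_rfl) hv hve fun x _ => min_le_right _ _)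

lemma exists_solClass_le (hN : 0 < N) (hp : 1 < p) (hΩ : Ω.Nonempty)
    (hb : Bornology.IsBounded Ω) (hs : HasSmoothBoundary Ω) (hf : SrcData Ω β f)
    (hg : SrcData Ω β g) (hgf : ∀ x ∈ Ω, g x ≤ f x) {f' g' : Eu N → ℝ}
    (hgf' : ∀ x ∈ frontier Ω, g' x ≤ f' x) (hu : SolClass p Ω (fun x t => β x t + f x) f' u)
    (hv : SolClass p Ω (fun x t => β x t + g x) g' v) :
    ∃ w, SolClass p Ω (fun x t => β x t + g x) g' w ∧ ∀ x ∈ Ω, w x ≤ u x := by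
  have ho := hg.isOpen
  obtain ⟨huc, hu1, hu0, -, -, hub⟩ := id hu
  obtain ⟨hvc, hv1, hv0, ⟨M, hM⟩, -, hvb⟩ := id hv
  obtain ⟨w, hw1, hwe, hw0, hwm, hwb⟩ := (super_min hN hp hf hg hgf hu1 hv1 (hu.weakEq hp hf)
    (hv.weakEq hp hg) (fun x hx => hu0 x (subset_closure hx))
    fun x hx => hv0 x (subset_closure hx)).exists_solution hN hp hg hΩ
  obtain ⟨W, hW⟩ : ∃ W : Eu N → ℝ, (∀ x ∈ Ω, W x = w x) ∧ ∀ x ∉ Ω, W x = v x := by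
    classical
    exact ⟨fun x => if x ∈ Ω then w x else v x, fun x hx => if_pos hx, fun x hx => if_neg hx⟩
  obtain ⟨hWw, hWv⟩ := hW
  have hWle : ∀ x ∈ closure Ω, 0 ≤ W x ∧ W x ≤ v x := by
    intro x hx
    by_cases h : x ∈ Ω
    · rw [hWw x h]
      exact ⟨hw0 x h, (hwm x h).trans (min_le_right _ _)⟩
    · rw [hWv x h]
      exact ⟨hv0 x hx, le_rfl⟩
  have hfr : ∀ x ∈ frontier Ω, x ∉ Ω := fun x hx h => hx.2 (by rwa [ho.interior_eq])
  have hcont : ContinuousOn W (closure Ω) := by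
    intro z hz
    by_cases h : z ∈ Ω
    · refine ((hw1.continuousOn.continuousAt (ho.mem_nhds h)).congr ?_).continuousWithinAt
      filter_upwards [ho.mem_nhds h] with x hx
      exact (hWw x hx).symm
    · have hzf : z ∈ frontier Ω := ⟨hz, by rwa [ho.interior_eq]⟩
      have hmz : min (u z) (v z) = v z :=
        min_eq_right (by rw [hub z hzf, hvb z hzf]; exact hgf' z hzf)
      refine tendsto_order.2 ⟨fun a ha => ?_, fun a ha => ?_⟩
      · rw [hWv z h] at ha
        obtain ⟨b, hb1, hb2, hb3, hb4⟩ := exists_barrier hp hs ho hb (ContinuousOn.inf huc hvc)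
          (fun x hx => le_min (hu0 x (subset_closure hx)) (hv0 x (subset_closure hx))) hzf
          (sub_pos.2 ha)
        simp only [hmz] at hb4
        filter_upwards [self_mem_nhdsWithin, (hvc z hz).eventually_const_lt ha,
          hb3.continuousWithinAt.eventually_const_lt (show a < b z by linarith)] with x hx hx1 hx2
        by_cases hxΩ : x ∈ Ω
        · rw [hWw x hxΩ]
          exact hx2.trans_le (hwb b hb1 hb2 x hxΩ)
        · rwa [hWv x hxΩ]
      · rw [hWv z h] at ha
        filter_upwards [self_mem_nhdsWithin, (hvc z hz).eventually_lt_const ha] with x hx hx1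
        exact (hWle x hx).2.trans_lt hx1
  refine ⟨W, ⟨hcont, hw1.congr hWw, fun x hx => (hWle x hx).1, ⟨M, fun x hx => ?_⟩, ?_,
    fun x hx => by rw [hWv x (hfr x hx), hvb x hx]⟩, fun x hx => ?_⟩
  · rw [abs_of_nonneg (hWle x hx).1]
    exact (hWle x hx).2.trans ((le_abs_self _).trans (hM x hx))
  · refine WeakEq.isWeakSolution ho (hwe.congr ho hWw fun x hx => ?_)
    rw [src_apply hx, src_apply hx, hWw x hx]
  · rw [hWw x hx]
    exact (hwm x hx).trans (min_le_left _ _)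

lemma not_isWeakSolution_of_subsingleton [Subsingleton (Eu N)] (hΩ : Ω.Nonempty)
    (hk : ∀ x ∈ Ω, 0 < k x) : ¬ IsWeakSolution p Ω w k := by
  intro h
  obtain ⟨a, ha⟩ := hΩ
  have hΩ : Ω = univ := Subsingleton.eq_univ_of_nonempty ⟨a, ha⟩
  have h1 := h (fun _ => 1) ⟨contDiff_const, HasCompactSupport.of_compactSpace _, by simp [hΩ]⟩
  have h2 : ∀ x, ‖∇ w x‖ ^ (p - 2) * ⟪∇ w x, ∇ (fun _ => (1 : ℝ)) x⟫ = 0 :=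
    fun x => by rw [Subsingleton.elim (∇ (fun _ => (1 : ℝ)) x) 0, inner_zero_right, mul_zero]
  have h3 : ∀ x, k x * 1 = k a := fun x => by rw [Subsingleton.elim x a, mul_one]
  simp only [h2, h3, hΩ, Measure.restrict_univ, integral_zero, integral_const, smul_eq_mul] at h1
  have h4 : 0 < volume.real (univ : Set (Eu N)) :=
    ENNReal.toReal_pos (isOpen_univ.measure_pos volume ⟨a, mem_univ a⟩).ne'
      isCompact_univ.measure_lt_top.ne
  exact (mul_pos h4 (hk a ha)).ne h1

end Comparison

end

/-- Weak comparison principle for the `p`-Laplacian with a nondecreasing nonlinearity and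
inhomogeneous Dirichlet data (Theorem 3.1). -/
theorem weak_comparison_principle
    (N : ℕ) (p : ℝ) (hp : 1 < p) (Ω : Set (EuclideanSpace ℝ (Fin N)))
    (hΩo : IsOpen Ω) (hΩconn : IsConnected Ω) (hΩbdd : Bornology.IsBounded Ω)
    (hΩsm : HasSmoothBoundary Ω)
    (β : EuclideanSpace ℝ (Fin N) → ℝ → ℝ)
    (hβcont : ContinuousOn (fun q : EuclideanSpace ℝ (Fin N) × ℝ => β q.1 q.2)
      (Ω ×ˢ (Set.univ : Set ℝ)))
    (hβlip : ∀ u₀ : ℝ, u₀ ≠ 0 → ∃ ε > 0, ∃ L : ℝ, ∀ x ∈ Ω,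
      ∀ u ∈ Metric.ball u₀ ε, ∀ v ∈ Metric.ball u₀ ε, |β x u - β x v| ≤ L * |u - v|)
    (hβmono : ∀ x ∈ Ω, Monotone (β x))
    (hβ0 : ∀ x ∈ Ω, 0 ≤ β x 0)
    (hexuniq : ∀ h h' : EuclideanSpace ℝ (Fin N) → ℝ,
      Measurable h → (∃ M, ∀ x ∈ Ω, |h x| ≤ M) → (∀ x ∈ Ω, 0 ≤ h x) →
      ContinuousOn h' (frontier Ω) → (∀ x ∈ frontier Ω, 0 ≤ h' x) →
      ∃ w, SolClass p Ω (fun x t => β x t + h x) h' w ∧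
        ∀ w', SolClass p Ω (fun x t => β x t + h x) h' w' → ∀ x ∈ closure Ω, w' x = w x)
    (f g f' g' : EuclideanSpace ℝ (Fin N) → ℝ)
    (hfm : Measurable f) (hfbdd : ∃ M, ∀ x ∈ Ω, |f x| ≤ M)
    (hgm : Measurable g) (hgbdd : ∃ M, ∀ x ∈ Ω, |g x| ≤ M)
    (hgf : ∀ x ∈ Ω, 0 ≤ g x ∧ g x ≤ f x)
    (hf' : ContinuousOn f' (frontier Ω)) (hg' : ContinuousOn g' (frontier Ω))
    (hg'f' : ∀ x ∈ frontier Ω, 0 ≤ g' x ∧ g' x ≤ f' x)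
    (u v : EuclideanSpace ℝ (Fin N) → ℝ)
    (hu : SolClass p Ω (fun x t => β x t + f x) f' u)
    (hv : SolClass p Ω (fun x t => β x t + g x) g' v) :
    ∀ x ∈ Ω, v x ≤ u x := by
  rcases Nat.eq_zero_or_pos N with rfl | hN
  · obtain ⟨w, hw, -⟩ := hexuniq (fun _ => 1) (fun _ => 0) measurable_const ⟨1, by simp⟩ (by simp)
      continuousOn_const (by simp)
    refine absurd hw.2.2.2.2.1 (not_isWeakSolution_of_subsingleton hΩconn.nonempty fun x hx => ?_)
    have := (hβ0 x hx).trans (hβmono x hx (hw.2.2.1 x (subset_closure hx)))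
    linarith
  · have hsf : SrcData Ω β f :=
      ⟨hΩo, hβcont, hβmono, hβ0, hfm, fun x hx => (hgf x hx).1.trans (hgf x hx).2, hfbdd⟩
    have hsg : SrcData Ω β g :=
      ⟨hΩo, hβcont, hβmono, hβ0, hgm, fun x hx => (hgf x hx).1, hgbdd⟩
    obtain ⟨w, hw, hwu⟩ := exists_solClass_le hN hp hΩconn.nonempty hΩbdd hΩsm hsf hsg
      (fun x hx => (hgf x hx).2) (fun x hx => (hg'f' x hx).2) hu hv
    obtain ⟨w₀, -, hw₀⟩ := hexuniq g g' hgm hgbdd (fun x hx => (hgf x hx).1) hg'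
      fun x hx => (hg'f' x hx).1
    intro x hx
    rw [hw₀ v hv x (subset_closure hx), ← hw₀ w hw x (subset_closure hx)]
    exact hwu x hx

end
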